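/- Let K be a field of characteristic zero that is finitely generated over ℚ, let R ⊆ K be a finitely generated subring, let L/K be a finite Galois extension with Galois group 𝒢 = Gal(L/K), and fix a conjugacy class 𝒞 of 𝒢. Then there exists an infinite set Π of prime numbers such that for every p ∈ Π there is a field embedding ι_p : K → ℚ_p with the following properties: (1) ι_p(R) ⊆ ℤ_p; (2) if v denotes the discrete valuation of K obtained by pulling back the p-adic valuation of ℚ_p along ι_p, then ι_p(K) is dense in ℚ_p (so the completion K_v equals ℚ_p), every extension w of v to L is unramified over v, and the Frobenius automorphism of the extension of completions L_w/K_v, viewed as an element of Gal(L/K) via the decomposition group at w, belongs to 𝒞. -/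

import Mathlib

/-- The ring of `p`-adic integers `ℤ_p` considered as a valuation subring of `ℚ_p`. -/
noncomputable def padicValuationSubring (p : ℕ) [Fact p.Prime] : ValuationSubring ℚ_[p] where
  toSubring := PadicInt.subring p
  mem_or_inv_mem' := by
    intro x
    rcases le_or_gt ‖x‖ 1 with h | h
    · exact Or.inl h
    · refine Or.inr ?_
      show ‖x⁻¹‖ ≤ 1
      rw [norm_inv]
      exact inv_le_one_of_one_le₀ h.le

variable {K L : Type*} [Field K] [Field L] [Algebra K L]

/-- If `w` is a valuation subring of `L` lying over the valuation subring `v` of `K`, this is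
the induced ring homomorphism `v →+* w`. -/
def ValuationSubring.extensionHom (v : ValuationSubring K) (w : ValuationSubring L)
    (h : w.comap (algebraMap K L) = v) : v →+* w where
  toFun x := ⟨algebraMap K L x, by
    have hx : (x : K) ∈ w.comap (algebraMap K L) := by rw [h]; exact x.2
    exact ValuationSubring.mem_comap.mp hx⟩
  map_one' := by ext; simp
  map_mul' x y := by ext; simp
  map_zero' := by ext; simp
  map_add' x y := by ext; simp

instance ValuationSubring.isLocalHom_extensionHom (v : ValuationSubring K)
    (w : ValuationSubring L) (h : w.comap (algebraMap K L) = v) :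
    IsLocalHom (ValuationSubring.extensionHom v w h) := by
  subst h
  constructor
  intro x hx
  rcases hx with ⟨u, hu⟩
  have hval : ((u : w) : L) = algebraMap K L x := congrArg Subtype.val hu
  have hx0 : (x : K) ≠ 0 := by
    intro h0
    apply u.ne_zero
    have : ((u : w) : L) = 0 := by rw [hval, h0, map_zero]
    exact Subtype.ext this
  have hmul : ((u⁻¹ : wˣ) : w) * (u : w) = 1 := u.inv_mul
  have hmulL : (((u⁻¹ : wˣ) : w) : L) * algebraMap K L x = 1 := by
    rw [← hval]
    exact_mod_cast congrArg Subtype.val hmul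
  have hinvL : (((u⁻¹ : wˣ) : w) : L) = algebraMap K L ((x : K)⁻¹) := by
    rw [map_inv₀]
    exact eq_inv_of_mul_eq_one_left hmulL
  have hmem : (x : K)⁻¹ ∈ w.comap (algebraMap K L) :=
    ValuationSubring.mem_comap.mpr (by rw [← hinvL]; exact ((u⁻¹ : wˣ) : w).2)
  refine IsUnit.of_mul_eq_one ⟨(x : K)⁻¹, hmem⟩ (Subtype.ext ?_)
  simp [mul_inv_cancel₀ hx0]

/-- The extension `L_w / K_v` of completions is unramified: the value group is unchanged and
the residue field extension is separable. -/
def ValuationSubring.IsUnramifiedExtension (v : ValuationSubring K) (w : ValuationSubring L)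
    (h : w.comap (algebraMap K L) = v) : Prop :=
  (∀ x : L, x ≠ 0 → ∃ y : K, y ≠ 0 ∧ w.valuation x = w.valuation (algebraMap K L y)) ∧
  (letI := (IsLocalRing.ResidueField.map (ValuationSubring.extensionHom v w h)).toAlgebra
   Algebra.IsSeparable (IsLocalRing.ResidueField ↥v) (IsLocalRing.ResidueField ↥w))

/-- `σ` is the Frobenius automorphism of `L_w/K_v`: it belongs to the decomposition group of `w`
and induces `x ↦ x^q` on the residue field of `w`, where `q` is the cardinality of the residue
field of `v`. -/
def ValuationSubring.IsFrobeniusAt (v : ValuationSubring K) (w : ValuationSubring L)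
    (σ : L ≃ₐ[K] L) : Prop :=
  (∀ x : L, x ∈ w ↔ σ x ∈ w) ∧
  (∀ x : L, x ∈ w →
    w.valuation (σ x - x ^ Nat.card (IsLocalRing.ResidueField ↥v)) < 1)

section

open NumberField NumberField.InfinitePlace NumberField.mixedEmbedding NumberField.Units
  NumberField.Units.dirichletUnitTheorem Module Filter Topology

/-- The tent function supported on `[-1, 1]`. -/
noncomputable def tent (x : ℝ) : ℝ := max 0 (1 - |x|)

lemma tent_nonneg (x : ℝ) : 0 ≤ tent x := le_max_left _ _

lemma tent_le_one (x : ℝ) : tent x ≤ 1 := by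
  unfold tent; exact max_le zero_le_one (by linarith [abs_nonneg x])

lemma abs_tent_sub_tent_le (x y : ℝ) : |tent x - tent y| ≤ |x - y| := by
  unfold tent
  have h := abs_max_sub_max_le_abs (1 - |x|) (1 - |y|) 0
  rw [max_comm 0, max_comm 0]
  refine h.trans ?_
  rw [abs_sub_comm x y]
  have h2 := abs_abs_sub_abs_le y x
  rwa [show 1 - |x| - (1 - |y|) = |y| - |x| by ring]

lemma abs_lt_one_of_tent_ne_zero {x : ℝ} (h : tent x ≠ 0) : |x| < 1 := by
  by_contra! hx
  exact h (max_eq_left (by linarith))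

lemma tent_add_intCast_eq_zero (x : ℝ) (k : ℤ) (hk : k ∉ ({-⌊x⌋, -⌊x⌋ - 1} : Finset ℤ)) :
    tent (x + k) = 0 := by
  by_contra h
  have := abs_lt_one_of_tent_ne_zero h
  rw [abs_lt] at this
  have h1 := Int.floor_le x
  have h2 := Int.lt_floor_add_one x
  simp only [Finset.mem_insert, Finset.mem_singleton, not_or] at hk
  have h3 : -⌊x⌋ - 2 < k := by
    have : ((-⌊x⌋ - 2 : ℤ) : ℝ) < k := by push_cast; linarith
    exact_mod_cast this
  have h4 : k < -⌊x⌋ + 1 := by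
    have : (k : ℝ) < ((-⌊x⌋ + 1 : ℤ) : ℝ) := by push_cast; linarith
    exact_mod_cast this
  omega

lemma sum_tent_add_intCast (x : ℝ) :
    ∑ k ∈ ({-⌊x⌋, -⌊x⌋ - 1} : Finset ℤ), tent (x + k) = 1 := by
  have h1 := Int.floor_le x
  have h2 := Int.lt_floor_add_one x
  rw [Finset.sum_pair (by omega)]
  unfold tent
  push_cast
  rw [abs_of_nonneg (by linarith : 0 ≤ x + -(⌊x⌋ : ℝ)),
    abs_of_nonpos (by linarith : x + (-(⌊x⌋ : ℝ) - 1) ≤ 0),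
    max_eq_right (by linarith), max_eq_right (by linarith)]
  ring

lemma abs_prod_sub_prod_le_sum {ι : Type*} (s : Finset ι) (a b : ι → ℝ)
    (ha : ∀ i ∈ s, |a i| ≤ 1) (hb : ∀ i ∈ s, |b i| ≤ 1) :
    |∏ i ∈ s, a i - ∏ i ∈ s, b i| ≤ ∑ i ∈ s, |a i - b i| := by
  classical
  induction s using Finset.induction_on with
  | empty => simp
  | insert i s hi ih =>
    rw [Finset.prod_insert hi, Finset.prod_insert hi, Finset.sum_insert hi]
    have ih' := ih (fun j hj => ha j (Finset.mem_insert_of_mem hj))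
      (fun j hj => hb j (Finset.mem_insert_of_mem hj))
    have h1 : |∏ i ∈ s, a i| ≤ 1 := by
      rw [Finset.abs_prod]
      exact Finset.prod_le_one (fun _ _ => abs_nonneg _)
        (fun j hj => ha j (Finset.mem_insert_of_mem hj))
    have h2 := hb i (Finset.mem_insert_self _ _)
    calc |a i * ∏ i ∈ s, a i - b i * ∏ i ∈ s, b i|
        = |(a i - b i) * ∏ i ∈ s, a i + b i * (∏ i ∈ s, a i - ∏ i ∈ s, b i)| := by ring_nf
      _ ≤ |a i - b i| * |∏ i ∈ s, a i| + |b i| * |∏ i ∈ s, a i - ∏ i ∈ s, b i| := by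
        rw [← abs_mul, ← abs_mul]; exact abs_add_le _ _
      _ ≤ |a i - b i| * 1 + 1 * ∑ i ∈ s, |a i - b i| := by gcongr
      _ = _ := by ring

section weight

variable (E : Type*) [Field E] [NumberField E]

open scoped Classical in
/-- Coordinates of the logarithmic embedding with respect to a basis of the unit lattice. -/
noncomputable def unitCoord : logSpace E ≃ₗ[ℝ] (Fin (rank E) → ℝ) :=
  ((basisUnitLattice E).ofZLatticeBasis ℝ (unitLattice E)).equivFun

variable {E}

/-- A partition of unity for the action of the unit group. -/
noncomputable def unitWeight (a : E) : ℝ :=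
  ∏ i, tent (unitCoord E (logMap (mixedEmbedding E a)) i)

lemma unitWeight_nonneg (a : E) : 0 ≤ unitWeight a :=
  Finset.prod_nonneg fun _ _ => tent_nonneg _

lemma unitWeight_le_one (a : E) : unitWeight a ≤ 1 :=
  Finset.prod_le_one (fun _ _ => tent_nonneg _) fun _ _ => tent_le_one _

open scoped Classical in
lemma unitCoord_logEmbedding_fundSystem (i : Fin (rank E)) :
    unitCoord E (logEmbedding E (Additive.ofMul (fundSystem E i))) = Pi.single i 1 := by
  rw [logEmbedding_fundSystem, unitCoord]
  have : ((basisUnitLattice E i : unitLattice E) : logSpace E) =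
      (basisUnitLattice E).ofZLatticeBasis ℝ (unitLattice E) i := by
    simp
  rw [this]
  ext j
  rw [Basis.equivFun_self, Pi.single_apply]
  simp [eq_comm]

lemma unitCoord_logMap_unit (ζ : torsion E) (k : Fin (rank E) → ℤ) (i : Fin (rank E)) :
    unitCoord E (logEmbedding E (Additive.ofMul (ζ.1 * ∏ i, (fundSystem E i) ^ (k i)))) i = k i := by
  rw [ofMul_mul, map_add, (logEmbedding_eq_zero_iff (K := E)).2 ζ.2, zero_add, ofMul_prod, map_sum,
    map_sum, Finset.sum_apply]
  simp_rw [ofMul_zpow, map_zsmul, unitCoord_logEmbedding_fundSystem]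
  simp [Pi.single_apply]

/-- Dirichlet's unit theorem as an equivalence. -/
noncomputable def unitsEquivTorsionProd : torsion E × (Fin (rank E) → ℤ) ≃ (𝓞 E)ˣ :=
  Equiv.ofBijective (fun p => p.1.1 * ∏ i, (fundSystem E i) ^ (p.2 i)) <| by
    constructor
    · intro p q h
      exact (exist_unique_eq_mul_prod E _).unique (y₁ := p) (y₂ := q) rfl h
    · intro u
      obtain ⟨p, hp, -⟩ := exist_unique_eq_mul_prod E u
      exact ⟨p, hp.symm⟩

lemma unitWeight_unit_mul (p : torsion E × (Fin (rank E) → ℤ)) {a : E} (ha : a ≠ 0) :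
    unitWeight (((unitsEquivTorsionProd p : (𝓞 E)ˣ) : E) * a) =
      ∏ i, tent (unitCoord E (logMap (mixedEmbedding E a)) i + p.2 i) := by
  unfold unitWeight
  refine Finset.prod_congr rfl fun i _ => ?_
  congr 1
  have hna : mixedEmbedding.norm (mixedEmbedding E a) ≠ 0 := by simpa using ha
  rw [map_mul, logMap_mul (by rw [norm_unit]; norm_num) hna, logMap_eq_logEmbedding, map_add,
    Pi.add_apply, add_comm]
  congr 1
  exact unitCoord_logMap_unit p.1 p.2 i

lemma hasSum_unitWeight {a : E} (ha : a ≠ 0) :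
    HasSum (fun u : (𝓞 E)ˣ => unitWeight ((u : E) * a)) (torsionOrder E) := by
  classical
  have := Fintype.ofFinite (torsion E)
  rw [← (unitsEquivTorsionProd (E := E)).hasSum_iff]
  set x := fun i => unitCoord E (logMap (mixedEmbedding E a)) i
  let S : Fin (rank E) → Finset ℤ := fun i => {-⌊x i⌋, -⌊x i⌋ - 1}
  have h1 : ∀ p ∉ (Finset.univ : Finset (torsion E)) ×ˢ Fintype.piFinset S,
      ((fun u : (𝓞 E)ˣ => unitWeight ((u : E) * a)) ∘ unitsEquivTorsionProd) p = 0 := by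
    intro p hp
    simp only [Function.comp_apply]
    rw [unitWeight_unit_mul p ha]
    simp only [Finset.mem_product, Finset.mem_univ, Fintype.mem_piFinset, true_and, not_forall] at hp
    obtain ⟨i, hi⟩ := hp
    exact Finset.prod_eq_zero (Finset.mem_univ i) (tent_add_intCast_eq_zero _ _ hi)
  have h2 := hasSum_sum_of_ne_finset_zero (L := SummationFilter.unconditional _) h1
  convert h2 using 1
  rw [Finset.sum_product]
  have : ∀ ζ : torsion E, ∑ y ∈ Fintype.piFinset S,
      ((fun u : (𝓞 E)ˣ => unitWeight ((u : E) * a)) ∘ unitsEquivTorsionProd) (ζ, y) = 1 := by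
    intro ζ
    simp only [Function.comp_apply]
    simp_rw [unitWeight_unit_mul _ ha]
    rw [← Finset.prod_univ_sum S (fun i k => tent (x i + k))]
    exact Finset.prod_eq_one fun i _ => sum_tent_add_intCast _
  rw [Finset.sum_congr rfl fun ζ _ => this ζ]
  simp [torsionOrder]

end weight

end

section

open NumberField NumberField.InfinitePlace NumberField.mixedEmbedding NumberField.Units
  NumberField.Units.dirichletUnitTheorem Module Filter Topology

section estimate

variable (E : Type*) [Field E] [NumberField E]

open scoped Classical in
lemma exists_abs_le_of_abs_unitCoord_le :
    ∃ B : ℝ, 0 ≤ B ∧ ∀ x : logSpace E, (∀ i, |unitCoord E x i| ≤ 1) → ∀ w, |x w| ≤ B := by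
  refine ⟨∑ i, ‖(unitCoord E).symm (Pi.single i 1)‖, by positivity, fun x hx w => ?_⟩
  have h : x = ∑ i, unitCoord E x i • (unitCoord E).symm (Pi.single i 1) := by
    apply (unitCoord E).injective
    rw [map_sum]
    simp_rw [map_smul, LinearEquiv.apply_symm_apply]
    ext j
    simp [Pi.single_apply]
  calc |x w| ≤ ‖x‖ := norm_le_pi_norm x w
    _ = ‖∑ i, unitCoord E x i • (unitCoord E).symm (Pi.single i 1)‖ := by rw [← h]
    _ ≤ ∑ i, ‖unitCoord E x i • (unitCoord E).symm (Pi.single i 1)‖ := norm_sum_le _ _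
    _ ≤ _ := by
      refine Finset.sum_le_sum fun i _ => ?_
      rw [_root_.norm_smul]
      exact mul_le_of_le_one_left (norm_nonneg _) (hx i)

open scoped Classical in
lemma exists_abs_unitCoord_le :
    ∃ B : ℝ, 0 ≤ B ∧ ∀ (x : logSpace E) (δ : ℝ), (∀ w, |x w| ≤ δ) →
      ∀ i, |unitCoord E x i| ≤ B * δ := by
  let f : logSpace E →L[ℝ] (Fin (rank E) → ℝ) :=
    LinearMap.toContinuousLinearMap (unitCoord E).toLinearMap
  refine ⟨‖f‖, norm_nonneg _, fun x δ hx i => ?_⟩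
  rcases isEmpty_or_nonempty {w : InfinitePlace E // w ≠ w₀} with h | h
  · have : x = 0 := Subsingleton.elim _ _
    rw [this, map_zero, Pi.zero_apply]
    have hδ : unitCoord E 0 i = 0 := by simp
    have e : (unitCoord E).symm (Pi.single i 1) = 0 := Subsingleton.elim _ _
    have := congrArg (unitCoord E) e
    rw [LinearEquiv.apply_symm_apply, map_zero] at this
    have := congrFun this i
    simp at this
  · have hδ : 0 ≤ δ := (abs_nonneg _).trans (hx h.some)
    have hx' : ‖x‖ ≤ δ := (pi_norm_le_iff_of_nonneg hδ).2 hx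
    calc |unitCoord E x i| ≤ ‖f x‖ := norm_le_pi_norm (f x) i
      _ ≤ ‖f‖ * ‖x‖ := f.le_opNorm x
      _ ≤ _ := by gcongr

variable {E}

/-- The absolute norm as a real number. -/
noncomputable def realNorm (a : E) : ℝ := mixedEmbedding.norm (mixedEmbedding E a)

lemma realNorm_eq_prod (a : E) : realNorm a = ∏ v : InfinitePlace E, v a ^ mult v := by
  simp [realNorm, mixedEmbedding.norm_apply]

lemma realNorm_nonneg (a : E) : 0 ≤ realNorm a := mixedEmbedding.norm_nonneg _

lemma realNorm_zero : realNorm (0 : E) = 0 := by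
  simp [realNorm]

lemma realNorm_pos {a : E} (ha : a ≠ 0) : 0 < realNorm a :=
  lt_of_le_of_ne (realNorm_nonneg a) (Ne.symm (by simpa [realNorm] using ha))

lemma realNorm_intCast (a : 𝓞 E) : realNorm (a : E) = ((Algebra.norm ℤ a).natAbs : ℝ) := by
  rw [realNorm, norm_eq_norm]
  rw [← Algebra.coe_norm_int]
  simp [Nat.cast_natAbs]

lemma one_le_realNorm {a : 𝓞 E} (ha : a ≠ 0) : 1 ≤ realNorm (a : E) := by
  rw [realNorm_intCast]
  have : (Algebra.norm ℤ a).natAbs ≠ 0 := by simpa [Algebra.norm_eq_zero_iff] using ha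
  exact_mod_cast Nat.one_le_iff_ne_zero.2 this

lemma log_realNorm {a : E} (ha : a ≠ 0) :
    Real.log (realNorm a) = ∑ v : InfinitePlace E, mult v * Real.log (v a) := by
  rw [realNorm_eq_prod, Real.log_prod]
  · simp
  · intro v _
    exact pow_ne_zero _ (by simpa using ha)

lemma sum_mult_cast : ∑ v : InfinitePlace E, (mult v : ℝ) = finrank ℚ E := by
  exact_mod_cast sum_mult_eq (K := E)

variable (E) in
lemma exists_abs_log_sub_le_of_unitWeight_ne_zero :
    ∃ B : ℝ, 0 ≤ B ∧ ∀ a : E, a ≠ 0 → unitWeight a ≠ 0 → ∀ v : InfinitePlace E,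
      |Real.log (v a) - Real.log (realNorm a) * (finrank ℚ E : ℝ)⁻¹| ≤ B := by
  classical
  obtain ⟨B, hB0, hB⟩ := exists_abs_le_of_abs_unitCoord_le E
  have hd : (finrank ℚ E : ℝ) ≠ 0 := by exact_mod_cast finrank_pos.ne'
  refine ⟨(1 + Fintype.card (InfinitePlace E)) * B, by positivity, fun a ha hw v => ?_⟩
  set l := Real.log (realNorm a) * (finrank ℚ E : ℝ)⁻¹ with hl
  have h1 : ∀ v : InfinitePlace E, v ≠ w₀ → |mult v * (Real.log (v a) - l)| ≤ B := by
    intro v hv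
    have := hB (logMap (mixedEmbedding E a)) (fun i => ?_) ⟨v, hv⟩
    · simpa [logMap_apply, hl, realNorm] using this
    · refine (abs_lt_one_of_tent_ne_zero ?_).le
      exact (Finset.prod_ne_zero_iff.1 hw) i (Finset.mem_univ i)
  have hsum : ∑ v : InfinitePlace E, mult v * (Real.log (v a) - l) = 0 := by
    simp_rw [mul_sub]
    rw [Finset.sum_sub_distrib, ← log_realNorm ha, ← Finset.sum_mul, sum_mult_cast, hl]
    field_simp
    ring
  have h2 : ∀ v : InfinitePlace E, |mult v * (Real.log (v a) - l)| ≤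
      (1 + Fintype.card (InfinitePlace E)) * B := by
    intro v
    by_cases hv : v = w₀
    · rw [← Finset.add_sum_erase _ _ (Finset.mem_univ v)] at hsum
      rw [eq_neg_of_add_eq_zero_left hsum, abs_neg]
      refine (Finset.abs_sum_le_sum_abs _ _).trans ?_
      calc _ ≤ ∑ x ∈ Finset.univ.erase v, B := by
            refine Finset.sum_le_sum fun x hx => h1 x ?_
            rw [← hv]; exact Finset.ne_of_mem_erase hx
        _ ≤ ∑ x : InfinitePlace E, B :=
            Finset.sum_le_sum_of_subset_of_nonneg (Finset.subset_univ _) fun _ _ _ => hB0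
        _ ≤ _ := by simp; nlinarith
    · refine (h1 v hv).trans ?_
      have : (0:ℝ) ≤ Fintype.card (InfinitePlace E) := by positivity
      nlinarith
  refine le_trans ?_ (h2 v)
  rw [abs_mul]
  have : (1:ℝ) ≤ |(mult v : ℝ)| := by
    rw [Nat.abs_cast]; exact_mod_cast one_le_mult (w := v)
  exact le_mul_of_one_le_left (abs_nonneg _) this

open scoped Classical in
/-- The sup norm over the infinite places. -/
noncomputable def placeNorm (a : E) : ℝ := ‖mixedEmbedding E a‖

open scoped Classical in
lemma placeNorm_nonneg (a : E) : 0 ≤ placeNorm a :=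
  norm_nonneg (mixedEmbedding E a)

open scoped Classical in
lemma placeNorm_sub_le (a b : E) : placeNorm (a - b) ≤ placeNorm a + placeNorm b := by
  unfold placeNorm; rw [map_sub]; exact norm_sub_le (mixedEmbedding E a) _

open scoped Classical in
open scoped Classical in
lemma placeNorm_sub_comm (a b : E) : placeNorm (a - b) = placeNorm (b - a) := by
  unfold placeNorm; rw [map_sub, map_sub]; exact norm_sub_rev (mixedEmbedding E a) _

lemma place_le_norm (v : InfinitePlace E) (a : E) : v a ≤ placeNorm a := by
  classical
  rw [placeNorm, norm_eq_sup'_normAtPlace]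
  have := Finset.le_sup' (fun w => normAtPlace w (mixedEmbedding E a)) (Finset.mem_univ v)
  simpa only [normAtPlace_apply] using this

lemma placeNorm_le_of_forall_place_le {a : E} {r : ℝ} (h : ∀ v : InfinitePlace E, v a ≤ r) :
    placeNorm a ≤ r := by
  rw [placeNorm, norm_eq_sup'_normAtPlace]
  exact Finset.sup'_le _ _ fun v _ => by simpa using h v

/-- The summand of the partial Hecke series. -/
noncomputable def heckeTerm (s : ℝ) (a : E) : ℝ := realNorm a ^ (-s) * unitWeight a

lemma heckeTerm_zero {s : ℝ} (hs : 0 < s) : heckeTerm s (0 : E) = 0 := by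
  rw [heckeTerm, realNorm_zero, Real.zero_rpow (by linarith), zero_mul]

lemma heckeTerm_nonneg (s : ℝ) (a : E) : 0 ≤ heckeTerm s a :=
  mul_nonneg (Real.rpow_nonneg (realNorm_nonneg _) _) (unitWeight_nonneg _)

lemma heckeTerm_le_one {s : ℝ} (hs : 0 < s) (a : 𝓞 E) : heckeTerm s (a : E) ≤ 1 := by
  by_cases ha : a = 0
  · simp [ha, heckeTerm_zero hs]
  · refine mul_le_one₀ ?_ (unitWeight_nonneg _) (unitWeight_le_one _)
    exact Real.rpow_le_one_of_one_le_of_nonpos (one_le_realNorm ha) (by linarith)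

lemma abs_log_sub_log_le {x y : ℝ} (hx : 0 < x) (h : |y - x| ≤ x / 2) :
    |Real.log y - Real.log x| ≤ 2 * (|y - x| / x) := by
  have hy : 0 < y := by have := abs_le.1 h; linarith
  have h1 := Real.log_le_sub_one_of_pos (div_pos hy hx)
  have h2 := Real.log_le_sub_one_of_pos (div_pos hx hy)
  rw [Real.log_div hy.ne' hx.ne'] at h1
  rw [Real.log_div hx.ne' hy.ne'] at h2
  have e1 : y / x - 1 = (y - x) / x := by field_simp
  have e2 : x / y - 1 = (x - y) / y := by field_simp
  rw [e1] at h1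
  rw [e2] at h2
  have hyx : x / 2 ≤ y := by have := abs_le.1 h; linarith
  have b1 : (y - x) / x ≤ |y - x| / x := by gcongr; exact le_abs_self _
  have b2 : (x - y) / y ≤ 2 * (|y - x| / x) := by
    calc (x - y) / y ≤ |y - x| / y := by gcongr; rw [abs_sub_comm]; exact le_abs_self _
      _ ≤ |y - x| / (x / 2) := by gcongr
      _ = _ := by field_simp
  have b3 : 0 ≤ |y - x| / x := by positivity
  rw [abs_le]; constructor <;> linarith

lemma abs_exp_sub_exp_le {x y : ℝ} (h : |y - x| ≤ 1) :
    |Real.exp y - Real.exp x| ≤ Real.exp x * (2 * |y - x|) := by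
  have : Real.exp y - Real.exp x = Real.exp x * (Real.exp (y - x) - 1) := by
    rw [mul_sub, ← Real.exp_add]; ring_nf
  rw [this, abs_mul, abs_of_pos (Real.exp_pos _)]
  gcongr
  exact Real.abs_exp_sub_one_le h

end estimate

end

section

open NumberField NumberField.InfinitePlace NumberField.mixedEmbedding NumberField.Units
  NumberField.Units.dirichletUnitTheorem Module Filter Topology

section estimate

variable (E : Type*) [Field E] [NumberField E]

lemma exists_abs_unitWeight_sub_le :
    ∃ C : ℝ, 0 ≤ C ∧ ∀ (a b : E) (δ : ℝ), 0 ≤ δ → a ≠ 0 → b ≠ 0 →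
      (∀ v : InfinitePlace E, |Real.log (v b) - Real.log (v a)| ≤ δ) →
        |unitWeight b - unitWeight a| ≤ C * δ := by
  classical
  obtain ⟨B, hB0, hB⟩ := exists_abs_unitCoord_le E
  have hd : (0 : ℝ) < finrank ℚ E := by exact_mod_cast finrank_pos
  refine ⟨rank E * (B * 4), by positivity, fun a b δ hδ0 ha hb hδ => ?_⟩
  have hN : |Real.log (realNorm b) - Real.log (realNorm a)| ≤ finrank ℚ E * δ := by
    rw [log_realNorm ha, log_realNorm hb, ← Finset.sum_sub_distrib, ← sum_mult_cast, Finset.sum_mul]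
    refine (Finset.abs_sum_le_sum_abs _ _).trans (Finset.sum_le_sum fun v _ => ?_)
    rw [← mul_sub, abs_mul, Nat.abs_cast]
    exact mul_le_mul_of_nonneg_left (hδ v) (Nat.cast_nonneg _)
  have hlog : ∀ w, |(logMap (mixedEmbedding E b) - logMap (mixedEmbedding E a)) w| ≤ 4 * δ := by
    intro w
    rw [Pi.sub_apply, logMap_apply, logMap_apply, ← mul_sub, abs_mul, Nat.abs_cast]
    have hm : (mult w.1 : ℝ) ≤ 2 := by
      have : mult w.1 ≤ 2 := by unfold mult; split_ifs <;> norm_num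
      exact_mod_cast this
    have h1 := hδ w.1
    have h2 : |(Real.log (realNorm b) - Real.log (realNorm a)) * (finrank ℚ E : ℝ)⁻¹| ≤ δ := by
      rw [abs_mul, abs_inv, Nat.abs_cast, ← div_eq_mul_inv, div_le_iff₀ hd, mul_comm δ]
      exact hN
    rw [show (4 : ℝ) * δ = 2 * (δ + δ) by ring]
    refine mul_le_mul hm ?_ (abs_nonneg _) (by norm_num)
    refine le_trans (le_of_eq ?_) ((abs_sub _ _).trans (add_le_add h1 h2))
    congr 1
    simp only [normAtPlace_apply, realNorm]
    ring
  unfold unitWeight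
  refine (abs_prod_sub_prod_le_sum _ _ _ ?_ ?_).trans ?_
  · intro i _; rw [abs_of_nonneg (tent_nonneg _)]; exact tent_le_one _
  · intro i _; rw [abs_of_nonneg (tent_nonneg _)]; exact tent_le_one _
  calc _ ≤ ∑ i : Fin (rank E), B * (4 * δ) := by
        refine Finset.sum_le_sum fun i _ => (abs_tent_sub_tent_le _ _).trans ?_
        have := hB _ _ hlog i
        rwa [map_sub] at this
    _ = _ := by simp; ring

lemma exists_abs_heckeTerm_sub_le_of_log {E : Type*} [Field E] [NumberField E] {Cw : ℝ}
    (hCw : ∀ (a b : E) (δ : ℝ), 0 ≤ δ → a ≠ 0 → b ≠ 0 →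
      (∀ v : InfinitePlace E, |Real.log (v b) - Real.log (v a)| ≤ δ) →
        |unitWeight b - unitWeight a| ≤ Cw * δ)
    {a b : E} {δ s : ℝ} (ha : a ≠ 0) (hb : b ≠ 0) (hδ0 : 0 ≤ δ) (hs1 : 1 ≤ s) (hs2 : s ≤ 2)
    (hδ : ∀ v : InfinitePlace E, |Real.log (v b) - Real.log (v a)| ≤ δ)
    (hδ1 : 2 * (finrank ℚ E * δ) ≤ 1) :
    |heckeTerm s b - heckeTerm s a| ≤ realNorm a ^ (-s) * ((4 * finrank ℚ E + Cw) * δ) := by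
  have hN : |Real.log (realNorm b) - Real.log (realNorm a)| ≤ finrank ℚ E * δ := by
    rw [log_realNorm ha, log_realNorm hb, ← Finset.sum_sub_distrib, ← sum_mult_cast, Finset.sum_mul]
    refine (Finset.abs_sum_le_sum_abs _ _).trans (Finset.sum_le_sum fun v _ => ?_)
    rw [← mul_sub, abs_mul, Nat.abs_cast]
    exact mul_le_mul_of_nonneg_left (hδ v) (Nat.cast_nonneg _)
  have hw := hCw a b δ hδ0 ha hb hδ
  have hNs : |Real.log (realNorm b) * (-s) - Real.log (realNorm a) * (-s)| ≤
      2 * (finrank ℚ E * δ) := by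
    rw [← sub_mul, abs_mul, abs_neg, abs_of_nonneg (by linarith : (0 : ℝ) ≤ s), mul_comm]
    exact mul_le_mul hs2 hN (abs_nonneg _) (by norm_num)
  have hpow : |realNorm b ^ (-s) - realNorm a ^ (-s)| ≤
      realNorm a ^ (-s) * (4 * finrank ℚ E * δ) := by
    rw [Real.rpow_def_of_pos (realNorm_pos ha), Real.rpow_def_of_pos (realNorm_pos hb)]
    refine (abs_exp_sub_exp_le (hNs.trans hδ1)).trans ?_
    refine mul_le_mul_of_nonneg_left ?_ (Real.exp_pos _).le
    linarith
  have hpos : 0 ≤ realNorm a ^ (-s) := Real.rpow_nonneg (realNorm_nonneg _) _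
  unfold heckeTerm
  calc |realNorm b ^ (-s) * unitWeight b - realNorm a ^ (-s) * unitWeight a|
      = |(realNorm b ^ (-s) - realNorm a ^ (-s)) * unitWeight b +
          realNorm a ^ (-s) * (unitWeight b - unitWeight a)| := by congr 1; ring
    _ ≤ |realNorm b ^ (-s) - realNorm a ^ (-s)| * unitWeight b +
          realNorm a ^ (-s) * |unitWeight b - unitWeight a| := by
        refine (abs_add_le _ _).trans (le_of_eq ?_)
        rw [abs_mul, abs_mul, abs_of_nonneg (unitWeight_nonneg b), abs_of_nonneg hpos]
    _ ≤ realNorm a ^ (-s) * (4 * finrank ℚ E * δ) * 1 + realNorm a ^ (-s) * (Cw * δ) := by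
        have := unitWeight_nonneg b
        have := unitWeight_le_one b
        gcongr
    _ = _ := by ring

lemma exists_abs_heckeTerm_sub_le_aux (R : ℝ) (hR : 0 ≤ R) :
    ∃ C : ℝ, 0 ≤ C ∧ ∀ (s : ℝ), 1 ≤ s → s ≤ 2 → ∀ a b : 𝓞 E, a ≠ 0 → unitWeight (a : E) ≠ 0 →
      placeNorm ((b : E) - a) ≤ R →
        |heckeTerm s (b : E) - heckeTerm s (a : E)| ≤
          C * ((1 + placeNorm (a : E)) ^ (finrank ℚ E + 1))⁻¹ := by
  obtain ⟨B, hB0, hB⟩ := exists_abs_log_sub_le_of_unitWeight_ne_zero E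
  obtain ⟨Cw, hCw0, hCw⟩ := exists_abs_unitWeight_sub_le E
  set d := finrank ℚ E with hd
  have hdpos : 0 < d := finrank_pos
  have hdR : (0 : ℝ) < d := by exact_mod_cast hdpos
  have hd1 : (1 : ℝ) ≤ d := by exact_mod_cast hdpos
  set c := Real.exp (-B) with hc
  have hcpos : 0 < c := Real.exp_pos _
  set C3 := 1 + Real.exp B with hC3
  have hC3pos : 0 < C3 := by positivity
  set K := 4 * d * R + 1 with hK
  have hKpos : 0 < K := by positivity
  refine ⟨(C3 * K / c) ^ (d + 1) + C3 ^ (d + 1) * ((4 * d + Cw) * (2 * R / c)), by positivity,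
    fun s hs1 hs2 a b ha hw hab => ?_⟩
  have haE : (a : E) ≠ 0 := by exact_mod_cast ha
  set T := Real.exp (Real.log (realNorm (a : E)) * (d : ℝ)⁻¹) with hT
  have hTpos : 0 < T := Real.exp_pos _
  have hT1 : 1 ≤ T := by
    rw [hT]
    refine Real.one_le_exp (mul_nonneg (Real.log_nonneg (one_le_realNorm ha)) (by positivity))
  have hvpos : ∀ v : InfinitePlace E, 0 < v (a : E) := fun v => InfinitePlace.pos_iff.2 haE
  have hlow : ∀ v : InfinitePlace E, c * T ≤ v (a : E) := by
    intro v
    rw [hc, hT, ← Real.exp_add, ← Real.exp_log (hvpos v)]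
    have := abs_le.1 (hB a haE hw v)
    exact Real.exp_le_exp.2 (by linarith)
  have hup : ∀ v : InfinitePlace E, v (a : E) ≤ Real.exp B * T := by
    intro v
    rw [hT, ← Real.exp_add, ← Real.exp_log (hvpos v)]
    have := abs_le.1 (hB a haE hw v)
    exact Real.exp_le_exp.2 (by linarith)
  have hpn : 1 + placeNorm (a : E) ≤ C3 * T := by
    have := placeNorm_le_of_forall_place_le hup
    rw [hC3]; linarith
  have hpn0 := placeNorm_nonneg (a : E)
  have hpow_inv : (T ^ (d + 1))⁻¹ ≤ C3 ^ (d + 1) * ((1 + placeNorm (a : E)) ^ (d + 1))⁻¹ := by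
    rw [← div_eq_mul_inv, le_div_iff₀ (by positivity), inv_mul_le_iff₀ (by positivity),
      mul_comm, ← mul_pow]
    exact pow_le_pow_left₀ (by positivity) hpn _
  by_cases hbig : K ≤ c * T
  · have hclose : ∀ v : InfinitePlace E, |v (b : E) - v (a : E)| ≤ R := by
      intro v
      exact (AbsoluteValue.abs_abv_sub_le_abv_sub v.1 _ _).trans ((place_le_norm v _).trans hab)
    have hcT : 0 < c * T := by positivity
    have hRle : R ≤ d * R := le_mul_of_one_le_left hR hd1
    have hhalf : ∀ v : InfinitePlace E, |v (b : E) - v (a : E)| ≤ v (a : E) / 2 := by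
      intro v
      have := hclose v
      have := hlow v
      linarith
    have hbE : (b : E) ≠ 0 := by
      intro h0
      have v : InfinitePlace E := Classical.arbitrary _
      have := hhalf v
      rw [h0, map_zero, zero_sub, abs_neg, abs_of_pos (hvpos v)] at this
      linarith [hvpos v]
    set δ := 2 * R / (c * T) with hδ
    have hδ0 : 0 ≤ δ := by positivity
    have hlog : ∀ v : InfinitePlace E, |Real.log (v (b : E)) - Real.log (v (a : E))| ≤ δ := by
      intro v
      refine (abs_log_sub_log_le (hvpos v) (hhalf v)).trans ?_
      rw [hδ, mul_div_assoc]
      gcongr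
      · exact hclose v
      · exact hlow v
    have hδ1 : 2 * (d * δ) ≤ 1 := by
      rw [hδ, show 2 * (d * (2 * R / (c * T))) = (4 * d * R) / (c * T) by ring,
        div_le_one hcT]
      linarith
    refine (exists_abs_heckeTerm_sub_le_of_log hCw haE hbE hδ0 hs1 hs2 hlog hδ1).trans ?_
    have hNT : realNorm (a : E) = T ^ d := by
      rw [hT, ← Real.exp_nat_mul, mul_comm, mul_assoc, inv_mul_cancel₀ hdR.ne', mul_one,
        Real.exp_log (realNorm_pos haE)]
    have hNs : realNorm (a : E) ^ (-s) ≤ (T ^ d)⁻¹ := by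
      rw [← hNT, ← Real.rpow_neg_one]
      exact Real.rpow_le_rpow_of_exponent_le (one_le_realNorm ha) (by linarith)
    calc realNorm (a : E) ^ (-s) * ((4 * d + Cw) * δ)
        ≤ (T ^ d)⁻¹ * ((4 * d + Cw) * δ) := by gcongr
      _ = ((4 * d + Cw) * (2 * R / c)) * (T ^ (d + 1))⁻¹ := by
          rw [hδ]; field_simp; ring
      _ ≤ ((4 * d + Cw) * (2 * R / c)) * (C3 ^ (d + 1) * ((1 + placeNorm (a : E)) ^ (d + 1))⁻¹) := by
          gcongr
      _ ≤ _ := by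
          rw [add_mul]
          have : 0 ≤ (C3 * K / c) ^ (d + 1) * ((1 + placeNorm (a : E)) ^ (d + 1))⁻¹ := by positivity
          linarith
  · have h1 : |heckeTerm s (b : E) - heckeTerm s (a : E)| ≤ 1 := by
      have h1 := heckeTerm_nonneg s (a : E)
      have h2 := heckeTerm_nonneg s (b : E)
      have h3 := heckeTerm_le_one (by linarith : 0 < s) a
      have h4 := heckeTerm_le_one (by linarith : 0 < s) b
      rw [abs_le]; constructor <;> linarith
    have h2 : 1 + placeNorm (a : E) ≤ C3 * K / c := by
      refine hpn.trans ?_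
      rw [mul_div_assoc]
      gcongr
      rw [le_div_iff₀ hcpos]; linarith
    calc _ ≤ (1 : ℝ) := h1
      _ ≤ (C3 * K / c) ^ (d + 1) * ((1 + placeNorm (a : E)) ^ (d + 1))⁻¹ := by
          rw [← div_eq_mul_inv, one_le_div (by positivity)]
          exact pow_le_pow_left₀ (by positivity) h2 _
      _ ≤ _ := by
          rw [add_mul]
          have : 0 ≤ C3 ^ (d + 1) * ((4 * d + Cw) * (2 * R / c)) *
            ((1 + placeNorm (a : E)) ^ (d + 1))⁻¹ := by positivity
          linarith

lemma exists_abs_heckeTerm_sub_le (R : ℝ) (hR : 0 ≤ R) :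
    ∃ C : ℝ, 0 ≤ C ∧ ∀ (s : ℝ), 1 ≤ s → s ≤ 2 → ∀ a b : 𝓞 E, placeNorm ((b : E) - a) ≤ R →
        |heckeTerm s (b : E) - heckeTerm s (a : E)| ≤
          C * ((1 + placeNorm (a : E)) ^ (finrank ℚ E + 1))⁻¹ := by
  obtain ⟨C, hC0, hC⟩ := exists_abs_heckeTerm_sub_le_aux E R hR
  refine ⟨C * (1 + R) ^ (finrank ℚ E + 1), by positivity, fun s hs1 hs2 a b hab => ?_⟩
  have hpa := placeNorm_nonneg (a : E)
  have hpb := placeNorm_nonneg (b : E)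
  have key : ∀ a : 𝓞 E, heckeTerm s (a : E) ≠ 0 → a ≠ 0 ∧ unitWeight (a : E) ≠ 0 := by
    intro a ha
    refine ⟨?_, fun h => ha (by rw [heckeTerm, h, mul_zero])⟩
    rintro rfl
    exact ha (by simpa using heckeTerm_zero (E := E) (by linarith : 0 < s))
  by_cases ha : heckeTerm s (a : E) = 0
  · by_cases hb : heckeTerm s (b : E) = 0
    · rw [ha, hb, sub_zero, abs_zero]; positivity
    · obtain ⟨h1, h2⟩ := key b hb
      rw [abs_sub_comm]
      refine (hC s hs1 hs2 b a h1 h2 (by rwa [placeNorm_sub_comm])).trans ?_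
      rw [mul_assoc]
      refine mul_le_mul_of_nonneg_left ?_ hC0
      rw [← div_eq_mul_inv, le_div_iff₀ (by positivity), inv_mul_le_iff₀ (by positivity),
        ← mul_pow]
      refine pow_le_pow_left₀ (by positivity) ?_ _
      have h3 := placeNorm_sub_le (b : E) ((b : E) - a)
      rw [sub_sub_cancel] at h3
      nlinarith
  · obtain ⟨h1, h2⟩ := key a ha
    refine (hC s hs1 hs2 a b h1 h2 hab).trans ?_
    gcongr
    exact le_mul_of_one_le_right hC0 (one_le_pow₀ (by linarith))

end estimate

end

section

open NumberField NumberField.InfinitePlace NumberField.mixedEmbedding NumberField.Units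
  NumberField.Units.dirichletUnitTheorem Module Filter Topology

section series

variable (E : Type*) [Field E] [NumberField E]

open scoped Classical in
lemma summable_placeNorm :
    Summable fun a : 𝓞 E => ((1 + placeNorm (a : E)) ^ (finrank ℚ E + 1))⁻¹ := by
  have h1 : finrank ℤ (mixedEmbedding.integerLattice E) < finrank ℚ E + 1 := by
    rw [ZLattice.rank ℝ, mixedEmbedding.finrank]; exact Nat.lt_succ_self _
  have h2 := ZLattice.summable_norm_pow_inv (mixedEmbedding.integerLattice E) _ h1
  let φ : 𝓞 E → mixedEmbedding.integerLattice E := fun a => ⟨mixedEmbedding E (a : E), a, rfl⟩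
  have hφ : Function.Injective φ := by
    intro a b hab
    have := congrArg Subtype.val hab
    exact RingOfIntegers.ext (mixedEmbedding_injective E this)
  have h3 := h2.comp_injective hφ
  refine Summable.of_norm_bounded_eventually h3 ?_
  filter_upwards [(Set.finite_singleton (0 : 𝓞 E)).compl_mem_cofinite] with a ha
  have ha0 : (a : E) ≠ 0 := by exact_mod_cast ha
  have hpos : 0 < placeNorm (a : E) := by
    have v : InfinitePlace E := Classical.arbitrary _
    exact (InfinitePlace.pos_iff.2 ha0).trans_le (place_le_norm v _)
  have e : ‖φ a‖ = placeNorm (a : E) := rfl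
  rw [Function.comp_apply, e, inv_pow, Real.norm_of_nonneg (by positivity)]
  gcongr
  linarith

variable {E}

/-- The decomposition of the integers into residue classes modulo `m`. -/
noncomputable def residueEquiv {m : ℕ} (hm : m ≠ 0) :
    ((𝓞 E) ⧸ Ideal.span {(m : 𝓞 E)}) × 𝓞 E ≃ 𝓞 E :=
  Equiv.ofBijective (fun p => p.1.out + m * p.2) <| by
    have hm' : (m : 𝓞 E) ≠ 0 := by exact_mod_cast hm
    have hmk : ∀ p : ((𝓞 E) ⧸ Ideal.span {(m : 𝓞 E)}) × 𝓞 E,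
        Ideal.Quotient.mk (Ideal.span {(m : 𝓞 E)}) (p.1.out + m * p.2) = p.1 := by
      intro p
      rw [map_add, map_mul, Ideal.Quotient.eq_zero_iff_mem.2 (Ideal.mem_span_singleton_self _),
        zero_mul, add_zero]
      exact Quotient.out_eq' p.1
    constructor
    · intro p q h
      have h1 : p.1 = q.1 := by rw [← hmk p, ← hmk q]; exact congrArg _ h
      refine Prod.ext h1 ?_
      simp only [h1, add_right_inj] at h
      exact mul_left_cancel₀ hm' h
    · intro a
      have h : a - (Ideal.Quotient.mk (Ideal.span {(m : 𝓞 E)}) a).out ∈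
          Ideal.span {(m : 𝓞 E)} := by
        rw [← Ideal.Quotient.eq_zero_iff_mem, map_sub, sub_eq_zero]
        exact (Quotient.out_eq' (Ideal.Quotient.mk (Ideal.span {(m : 𝓞 E)}) a)).symm
      obtain ⟨b, hb⟩ := Ideal.mem_span_singleton'.1 h
      exact ⟨(_, b), by simp only; rw [mul_comm, hb]; ring⟩

lemma finite_quotient_natCast {m : ℕ} (hm : m ≠ 0) :
    Finite ((𝓞 E) ⧸ Ideal.span {(m : 𝓞 E)}) := by
  have hm' : (m : 𝓞 E) ≠ 0 := by exact_mod_cast hm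
  exact Ideal.finiteQuotientOfFreeOfNeBot _ (by simpa using hm')

/-- The mean value of a function on the integers which is periodic modulo `m`. -/
noncomputable def periodicMean (m : ℕ) (g : 𝓞 E → ℂ) : ℂ :=
  (Nat.card ((𝓞 E) ⧸ Ideal.span {(m : 𝓞 E)}) : ℂ)⁻¹ *
    ∑ᶠ q : (𝓞 E) ⧸ Ideal.span {(m : 𝓞 E)}, g q.out

lemma tendsto_heckeTerm (a : E) :
    Tendsto (fun s => heckeTerm s a) (𝓝 1) (𝓝 (heckeTerm 1 a)) := by
  unfold heckeTerm
  refine Tendsto.mul_const _ ?_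
  have h1 : ContinuousAt (fun x : ℝ => realNorm a ^ x) (-1) :=
    Real.continuousAt_const_rpow' (by norm_num)
  exact h1.tendsto.comp (continuous_neg.tendsto (1 : ℝ))

set_option maxHeartbeats 1000000 in
lemma exists_tendsto_periodic_series
    (hsum : ∀ s : ℝ, 1 < s → Summable fun a : 𝓞 E => heckeTerm s (a : E))
    {m : ℕ} (hm : m ≠ 0) (g : 𝓞 E → ℂ) (hg : ∀ a b, g (a + m * b) = g a) :
    ∃ l, Tendsto (fun s : ℝ => ∑' a : 𝓞 E, g a * heckeTerm s (a : E) -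
      periodicMean m g * ∑' a : 𝓞 E, (heckeTerm s (a : E) : ℂ)) (𝓝[>] 1) (𝓝 l) := by
  classical
  have hfin := finite_quotient_natCast (E := E) hm
  set Q := (𝓞 E) ⧸ Ideal.span {(m : 𝓞 E)} with hQ
  have := Fintype.ofFinite Q
  set M := periodicMean m g with hM
  have hMsum : ∑ q : Q, (g q.out - M) = 0 := by
    rw [Finset.sum_sub_distrib, hM, periodicMean, finsum_eq_sum_of_fintype]
    have : (Fintype.card Q : ℂ) ≠ 0 := by exact_mod_cast Fintype.card_ne_zero
    simp [Nat.card_eq_fintype_card]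
    field_simp
    ring
  -- bound for the representatives
  obtain ⟨R, hR0, hR⟩ : ∃ R : ℝ, 0 ≤ R ∧ ∀ q : Q, placeNorm ((q.out : 𝓞 E) : E) ≤ R := by
    refine ⟨∑ q : Q, placeNorm ((q.out : 𝓞 E) : E),
      Finset.sum_nonneg fun _ _ => placeNorm_nonneg _, fun q => ?_⟩
    exact Finset.single_le_sum (f := fun q : Q => placeNorm ((q.out : 𝓞 E) : E))
      (fun _ _ => placeNorm_nonneg _) (Finset.mem_univ q)
  obtain ⟨C, hC0, hC⟩ := exists_abs_heckeTerm_sub_le E R hR0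
  let D : ℝ → 𝓞 E → ℂ := fun s b => ∑ q : Q, (g q.out - M) *
    ((heckeTerm s ((q.out + m * b : 𝓞 E) : E) - heckeTerm s ((m * b : 𝓞 E) : E) : ℝ) : ℂ)
  let bound : 𝓞 E → ℝ := fun b => (∑ q : Q, ‖g q.out - M‖ * C) *
    ((1 + placeNorm (b : E)) ^ (finrank ℚ E + 1))⁻¹
  have hbound : ∀ s : ℝ, 1 ≤ s → s ≤ 2 → ∀ b, ‖D s b‖ ≤ bound b := by
    intro s hs1 hs2 b
    simp only [D, bound]
    rw [Finset.sum_mul]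
    refine (norm_sum_le _ _).trans (Finset.sum_le_sum fun q _ => ?_)
    rw [norm_mul, mul_assoc]
    refine mul_le_mul_of_nonneg_left ?_ (norm_nonneg _)
    rw [Complex.norm_real, Real.norm_eq_abs]
    refine (hC s hs1 hs2 (m * b) (q.out + m * b) ?_).trans ?_
    · simpa using hR q
    · refine mul_le_mul_of_nonneg_left ?_ hC0
      have h1 : placeNorm (b : E) ≤ placeNorm ((m * b : 𝓞 E) : E) := by
        refine placeNorm_le_of_forall_place_le fun v => le_trans ?_ (place_le_norm v _)
        have : v ((m * b : 𝓞 E) : E) = m * v (b : E) := by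
          push_cast
          rw [map_mul]
          congr 1
          exact InfinitePlace.map_natCast v m
        rw [this]
        refine le_mul_of_one_le_left (by positivity) ?_
        exact_mod_cast Nat.one_le_iff_ne_zero.2 hm
      have := placeNorm_nonneg (b : E)
      gcongr
  refine ⟨∑' b, D 1 b, ?_⟩
  have hlim : Tendsto (fun s => ∑' b, D s b) (𝓝[>] 1) (𝓝 (∑' b, D 1 b)) := by
    refine tendsto_tsum_of_dominated_convergence (bound := bound)
      ((summable_placeNorm E).mul_left _) ?_ ?_
    · intro b
      refine Tendsto.mono_left ?_ nhdsWithin_le_nhds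
      refine tendsto_finsetSum _ fun q _ => Tendsto.const_mul _ ?_
      exact (Complex.continuous_ofReal.tendsto _).comp
        ((tendsto_heckeTerm _).sub (tendsto_heckeTerm _))
    · have : Set.Ioc (1 : ℝ) 2 ∈ 𝓝[>] (1 : ℝ) := Ioc_mem_nhdsGT (by norm_num)
      filter_upwards [this] with s hs b
      exact hbound s hs.1.le hs.2 b
  refine hlim.congr' ?_
  have : Set.Ioc (1 : ℝ) 2 ∈ 𝓝[>] (1 : ℝ) := Ioc_mem_nhdsGT (by norm_num)
  filter_upwards [this] with s hs
  have hf : Summable fun a : 𝓞 E => (heckeTerm s (a : E) : ℂ) :=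
    Complex.ofRealCLM.summable (hsum s hs.1)
  obtain ⟨B, hB⟩ : ∃ B : ℝ, ∀ a, ‖g a‖ ≤ B := by
    refine ⟨∑ q : Q, ‖g q.out‖, fun a => ?_⟩
    obtain ⟨p, rfl⟩ := (residueEquiv (E := E) hm).surjective a
    have : g (residueEquiv hm p) = g p.1.out := hg _ _
    rw [this]
    exact Finset.single_le_sum (f := fun q : Q => ‖g q.out‖)
      (fun _ _ => norm_nonneg _) (Finset.mem_univ p.1)
  have hgf : Summable fun a : 𝓞 E => g a * (heckeTerm s (a : E) : ℂ) := by
    refine Summable.of_norm_bounded (g := fun a : 𝓞 E => B * ‖(heckeTerm s (a : E) : ℂ)‖)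
      (hf.norm.mul_left B) fun a => ?_
    rw [norm_mul]
    exact mul_le_mul_of_nonneg_right (hB a) (norm_nonneg _)
  rw [← tsum_mul_left, ← hgf.tsum_sub (hf.mul_left M)]
  have hs1 : Summable fun a : 𝓞 E => (g a - M) * (heckeTerm s (a : E) : ℂ) := by
    refine (hgf.sub (hf.mul_left M)).congr fun a => ?_
    ring
  have e1 : ∑' a : 𝓞 E, (g a * (heckeTerm s (a : E) : ℂ) - M * heckeTerm s (a : E)) =
      ∑' a : 𝓞 E, (g a - M) * (heckeTerm s (a : E) : ℂ) := by
    refine tsum_congr fun a => ?_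
    ring
  let T : 𝓞 E × Q ≃ 𝓞 E := (Equiv.prodComm (𝓞 E) Q).trans (residueEquiv (E := E) hm)
  have e2 : ∑' a : 𝓞 E, (g a - M) * (heckeTerm s (a : E) : ℂ) =
      ∑' p : 𝓞 E × Q, (g (T p) - M) * (heckeTerm s (T p : E) : ℂ) :=
    (T.tsum_eq (fun a : 𝓞 E => (g a - M) * (heckeTerm s (a : E) : ℂ))).symm
  have hs3 : Summable fun p : 𝓞 E × Q => (g (T p) - M) * (heckeTerm s (T p : E) : ℂ) :=
    T.summable_iff.2 hs1
  rw [e1, e2, hs3.tsum_prod]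
  refine tsum_congr fun b => ?_
  rw [tsum_fintype]
  simp only [D]
  have : ∑ q : Q, (g q.out - M) * (heckeTerm s ((m * b : 𝓞 E) : E) : ℂ) = 0 := by
    rw [← Finset.sum_mul, hMsum, zero_mul]
  rw [← sub_zero (∑ q : Q, (g (T (b, q)) - M) * (heckeTerm s (T (b, q) : E) : ℂ)), ← this,
    ← Finset.sum_sub_distrib]
  refine Finset.sum_congr rfl fun q _ => ?_
  have h2 : T (b, q) = q.out + m * b := rfl
  rw [h2, hg]
  push_cast
  ring

end series

end

section

open NumberField NumberField.InfinitePlace NumberField.mixedEmbedding NumberField.Units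
  NumberField.Units.dirichletUnitTheorem Module Filter Topology

section idealSums

variable (E : Type*) [Field E] [NumberField E]

/-- The number of integral ideals of norm `n`. -/
noncomputable def idealCount (n : ℕ) : ℕ := Nat.card {I : Ideal (𝓞 E) // Ideal.absNorm I = n}

/-- The nonzero ideals of norm `n`. -/
abbrev NonzeroIdeal := {I : Ideal (𝓞 E) // I ≠ ⊥}

variable {E}

lemma absNorm_ne_zero (I : NonzeroIdeal E) : Ideal.absNorm I.1 ≠ 0 := by
  rw [Ne, Ideal.absNorm_eq_zero_iff]; exact I.2

lemma finite_fiber_absNorm (n : ℕ) :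
    Finite {I : NonzeroIdeal E // Ideal.absNorm I.1 = n} := by
  rcases Nat.eq_zero_or_pos n with rfl | hn
  · have : IsEmpty {I : NonzeroIdeal E // Ideal.absNorm I.1 = 0} :=
      ⟨fun I => absNorm_ne_zero I.1 I.2⟩
    infer_instance
  · have h : Finite {I : Ideal (𝓞 E) // Ideal.absNorm I = n} := Ideal.finite_setOfPred_absNorm_eq n
    exact Finite.of_injective
      (fun I : {I : NonzeroIdeal E // Ideal.absNorm I.1 = n} =>
        (⟨I.1.1, I.2⟩ : {I : Ideal (𝓞 E) // Ideal.absNorm I = n}))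
      fun I J h => by
        have h2 : I.1.1 = J.1.1 := congrArg (fun x : {I : Ideal (𝓞 E) // Ideal.absNorm I = n} => x.1) h
        exact Subtype.ext (Subtype.ext h2)

lemma card_fiber_absNorm {n : ℕ} (hn : n ≠ 0) :
    Nat.card {I : NonzeroIdeal E // Ideal.absNorm I.1 = n} = idealCount E n := by
  refine Nat.card_congr
    { toFun := fun I => ⟨I.1.1, I.2⟩
      invFun := fun I => ⟨⟨I.1, ?_⟩, I.2⟩
      left_inv := fun I => rfl
      right_inv := fun I => rfl }
  intro h
  have := I.2
  rw [h, Ideal.absNorm_bot] at this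
  exact hn this.symm

lemma summable_idealCount {s : ℝ} (hs : 1 < s) :
    Summable fun n : ℕ => (idealCount E n : ℝ) * (n : ℝ) ^ (-s) := by
  have hO : (fun n : ℕ ↦ ∑ k ∈ Finset.Icc 1 n, (idealCount E k : ℝ)) =O[atTop]
      fun n ↦ (n : ℝ) ^ (1 : ℝ) := by
    have h := (Ideal.tendsto_norm_le_div_atTop₀ E).comp tendsto_natCast_atTop_atTop
    have h2 := h.isBigO_one ℝ
    have h3 := h2.mul (Asymptotics.isBigO_refl (fun n : ℕ => (n : ℝ)) atTop)
    refine (h3.congr' ?_ ?_)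
    · filter_upwards [eventually_ne_atTop 0] with n hn
      have hn' : (n : ℝ) ≠ 0 := by exact_mod_cast hn
      simp only [Function.comp_apply, Nat.cast_le]
      rw [div_mul_cancel₀ _ hn', ← Nat.cast_sum]
      congr 1
      rw [← add_left_inj 1, ← Ideal.card_norm_le_eq_card_norm_le_add_one,
        show Finset.Icc 1 n = Finset.Ioc 0 n from Finset.Icc_succ_left_eq_Ioc _ _,
        show 1 = idealCount E 0 by simp [idealCount, Ideal.absNorm_eq_zero_iff],
        Finset.sum_Ioc_add_eq_sum_Icc (n.zero_le)]
      simp only [idealCount]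
      rw [← Finset.card_preimage_eq_sum_card_image_eq
        (fun k _ ↦ Ideal.finite_setOfPred_absNorm_eq k)]
      simp [Set.coe_eq_subtype]
    · exact Eventually.of_forall fun n => by simp
  have h := LSeriesSummable_of_sum_norm_bigO_and_nonneg hO (fun n => Nat.cast_nonneg _)
    zero_le_one (s := (s : ℂ)) (by simpa using hs)
  refine (h.norm).of_norm_bounded_eventually ?_
  filter_upwards [(Set.finite_singleton (0 : ℕ)).compl_mem_cofinite] with n hn
  have hn' : n ≠ 0 := hn
  rw [LSeries.norm_term_eq, if_neg hn']
  simp only [Real.norm_eq_abs, Real.rpow_neg (Nat.cast_nonneg n), div_eq_mul_inv, abs_mul, abs_inv,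
    Complex.norm_real, Complex.ofReal_re]
  rw [abs_of_nonneg (Nat.cast_nonneg _), abs_of_nonneg (a := (n : ℝ) ^ s) (by positivity)]

lemma summable_absNorm_rpow {s : ℝ} (hs : 1 < s) :
    Summable fun I : NonzeroIdeal E => (Ideal.absNorm I.1 : ℝ) ^ (-s) := by
  rw [← (Equiv.sigmaFiberEquiv fun I : NonzeroIdeal E => Ideal.absNorm I.1).summable_iff,
    summable_sigma_of_nonneg (fun _ => by simp only [Function.comp_apply]; positivity)]
  refine ⟨fun n => ?_, ?_⟩
  · have := finite_fiber_absNorm (E := E) n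
    exact Summable.of_finite
  · refine (summable_idealCount (E := E) hs).congr fun n => ?_
    have : ∀ I : {I : NonzeroIdeal E // Ideal.absNorm I.1 = n},
      ((fun I : NonzeroIdeal E => (Ideal.absNorm I.1 : ℝ) ^ (-s)) ∘
        (Equiv.sigmaFiberEquiv fun I : NonzeroIdeal E => Ideal.absNorm I.1)) ⟨n, I⟩ =
      (n : ℝ) ^ (-s) := fun I => by
        change (Ideal.absNorm I.1.1 : ℝ) ^ (-s) = _
        rw [I.2]
    rw [tsum_congr this, tsum_const, nsmul_eq_mul]
    rcases eq_or_ne n 0 with rfl | hn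
    · have : ((0 : ℕ) : ℝ) ^ (-s) = 0 := by
        rw [Nat.cast_zero, Real.zero_rpow (by linarith)]
      rw [this, mul_zero, mul_zero]
    · rw [card_fiber_absNorm hn]

lemma tsum_nonzeroIdeal {F : ℕ → ℂ} (h0 : F 0 = 0)
    (hF : Summable fun I : NonzeroIdeal E => F (Ideal.absNorm I.1)) :
    ∑' I : NonzeroIdeal E, F (Ideal.absNorm I.1) = ∑' n : ℕ, idealCount E n * F n := by
  have h1 := (Equiv.sigmaFiberEquiv fun I : NonzeroIdeal E => Ideal.absNorm I.1).tsum_eq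
    fun I : NonzeroIdeal E => F (Ideal.absNorm I.1)
  have h2 := (Equiv.sigmaFiberEquiv fun I : NonzeroIdeal E => Ideal.absNorm I.1).summable_iff.2 hF
  rw [← h1]
  refine (h2.tsum_sigma).trans (tsum_congr fun n => ?_)
  have : ∀ I : {I : NonzeroIdeal E // Ideal.absNorm I.1 = n},
      F (Ideal.absNorm ((Equiv.sigmaFiberEquiv fun I : NonzeroIdeal E =>
        Ideal.absNorm I.1) ⟨n, I⟩).1) = F n := fun I => by
        change F (Ideal.absNorm I.1.1) = _
        rw [I.2]
  refine (tsum_congr this).trans ?_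
  rw [tsum_const, nsmul_eq_mul]
  rcases eq_or_ne n 0 with rfl | hn
  · rw [h0, mul_zero, mul_zero]
  · rw [card_fiber_absNorm hn]

end idealSums

end

section

open NumberField NumberField.InfinitePlace NumberField.mixedEmbedding NumberField.Units
  NumberField.Units.dirichletUnitTheorem Module Filter Topology

section elementSums

variable {E : Type*} [Field E] [NumberField E]

/-- The nonzero ideals whose product with `J` is principal. -/
abbrev ComplementIdeal (J : NonzeroIdeal E) := {I : NonzeroIdeal E // (I.1 * J.1).IsPrincipal}

lemma exists_span_eq_mul (J : NonzeroIdeal E) (I : ComplementIdeal J) :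
    ∃ a : 𝓞 E, Ideal.span {a} = I.1.1 * J.1 := by
  obtain ⟨a, ha⟩ := I.2.principal
  exact ⟨a, ha.symm⟩

/-- A generator of `I * J`. -/
noncomputable def idealGenerator (J : NonzeroIdeal E) (I : ComplementIdeal J) : 𝓞 E :=
  (exists_span_eq_mul J I).choose

lemma span_idealGenerator (J : NonzeroIdeal E) (I : ComplementIdeal J) :
    Ideal.span {idealGenerator J I} = I.1.1 * J.1 :=
  (exists_span_eq_mul J I).choose_spec

lemma idealGenerator_mem (J : NonzeroIdeal E) (I : ComplementIdeal J) :
    idealGenerator J I ∈ J.1 := by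
  have h : idealGenerator J I ∈ I.1.1 * J.1 := by
    rw [← span_idealGenerator]; exact Ideal.mem_span_singleton_self _
  exact (Ideal.mul_le_right : I.1.1 * J.1 ≤ J.1) h

lemma idealGenerator_ne_zero (J : NonzeroIdeal E) (I : ComplementIdeal J) :
    idealGenerator J I ≠ 0 := by
  intro h
  have := span_idealGenerator J I
  rw [h, Ideal.span_singleton_eq_bot.2 rfl] at this
  exact mul_ne_zero I.1.2 J.2 this.symm

/-- The nonzero elements of an ideal. -/
abbrev NonzeroElement (J : NonzeroIdeal E) := {a : 𝓞 E // a ≠ 0 ∧ a ∈ J.1}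

/-- A nonzero element of `J` corresponds to an ideal with generator, up to units. -/
noncomputable def elementEquiv (J : NonzeroIdeal E) :
    ComplementIdeal J × (𝓞 E)ˣ ≃ NonzeroElement J :=
  Equiv.ofBijective (fun p => ⟨p.2 * idealGenerator J p.1,
    mul_ne_zero p.2.ne_zero (idealGenerator_ne_zero J p.1), Ideal.mul_mem_left _ _ (idealGenerator_mem J p.1)⟩) <| by
    have key : ∀ p : ComplementIdeal J × (𝓞 E)ˣ,
        Ideal.span {(p.2 : 𝓞 E) * idealGenerator J p.1} = p.1.1.1 * J.1 := fun p => by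
      rw [← span_idealGenerator, Ideal.span_singleton_mul_left_unit p.2.isUnit]
    constructor
    · intro p q h
      have h1 : (p.2 : 𝓞 E) * idealGenerator J p.1 = q.2 * idealGenerator J q.1 :=
        congrArg Subtype.val h
      have h2 : p.1.1.1 * J.1 = q.1.1.1 * J.1 := by rw [← key, ← key, h1]
      have h3 : p.1 = q.1 := Subtype.ext (Subtype.ext (mul_right_cancel₀ J.2 h2))
      refine Prod.ext h3 ?_
      rw [h3] at h1
      exact Units.ext (mul_right_cancel₀ (idealGenerator_ne_zero J q.1) h1)
    · rintro ⟨a, ha0, haJ⟩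
      obtain ⟨I, hI⟩ := Ideal.dvd_span_singleton.2 haJ
      have hI0 : I ≠ ⊥ := by
        rintro rfl
        rw [Ideal.mul_bot, Ideal.span_singleton_eq_bot] at hI
        exact ha0 hI
      have hp : (I * J.1).IsPrincipal := by
        rw [mul_comm, ← hI]; exact ⟨⟨a, rfl⟩⟩
      let I' : ComplementIdeal J := ⟨⟨I, hI0⟩, hp⟩
      have h : Ideal.span {idealGenerator J I'} = Ideal.span {a} := by
        rw [span_idealGenerator, hI, mul_comm]
      obtain ⟨u, hu⟩ := Ideal.span_singleton_eq_span_singleton.1 h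
      exact ⟨(I', u), Subtype.ext (by simp only; rw [mul_comm, hu])⟩

lemma absNorm_mul_elementEquiv (J : NonzeroIdeal E) (p : ComplementIdeal J × (𝓞 E)ˣ) :
    (Algebra.norm ℤ (elementEquiv J p).1).natAbs = Ideal.absNorm p.1.1.1 * Ideal.absNorm J.1 := by
  rw [← map_mul, ← span_idealGenerator, ← Ideal.absNorm_span_singleton]
  change Ideal.absNorm (Ideal.span {(p.2 : 𝓞 E) * idealGenerator J p.1}) = _
  rw [Ideal.span_singleton_mul_left_unit p.2.isUnit]

lemma natAbs_norm_div (J : NonzeroIdeal E) (p : ComplementIdeal J × (𝓞 E)ˣ) :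
    (Algebra.norm ℤ (elementEquiv J p).1).natAbs / Ideal.absNorm J.1 = Ideal.absNorm p.1.1.1 := by
  rw [absNorm_mul_elementEquiv, Nat.mul_div_cancel _ (Nat.pos_of_ne_zero (absNorm_ne_zero J))]

lemma hasSum_unitWeight_generator (J : NonzeroIdeal E) (I : ComplementIdeal J) :
    HasSum (fun u : (𝓞 E)ˣ => unitWeight ((elementEquiv J (I, u)).1 : E)) (torsionOrder E) := by
  have h := hasSum_unitWeight (E := E) (a := (idealGenerator J I : E))
    (by exact_mod_cast idealGenerator_ne_zero J I)
  refine h.congr_fun fun u => ?_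
  change unitWeight (((u : 𝓞 E) * idealGenerator J I : 𝓞 E) : E) = _
  push_cast
  rfl

lemma summable_nonzeroElement (J : NonzeroIdeal E) {F : ℕ → ℂ}
    (hF : Summable fun I : ComplementIdeal J => ‖F (Ideal.absNorm I.1.1)‖) :
    Summable fun p : ComplementIdeal J × (𝓞 E)ˣ =>
      F (Ideal.absNorm p.1.1.1) * (unitWeight ((elementEquiv J p).1 : E) : ℂ) := by
  have h : Summable fun p : ComplementIdeal J × (𝓞 E)ˣ =>
      ‖F (Ideal.absNorm p.1.1.1)‖ * unitWeight ((elementEquiv J p).1 : E) := by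
    have h0 : (0 : ComplementIdeal J × (𝓞 E)ˣ → ℝ) ≤ fun p =>
        ‖F (Ideal.absNorm p.1.1.1)‖ * unitWeight ((elementEquiv J p).1 : E) :=
      fun p => mul_nonneg (norm_nonneg _) (unitWeight_nonneg _)
    rw [summable_prod_of_nonneg h0]
    have h1 : ∀ I : ComplementIdeal J, HasSum (fun u : (𝓞 E)ˣ => ‖F (Ideal.absNorm I.1.1)‖ *
        unitWeight ((elementEquiv J (I, u)).1 : E))
        (‖F (Ideal.absNorm I.1.1)‖ * torsionOrder E) := fun I =>
      (hasSum_unitWeight_generator J I).mul_left _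
    exact ⟨fun I => (h1 I).summable,
      (hF.mul_right (torsionOrder E : ℝ)).congr fun I => (h1 I).tsum_eq.symm⟩
  refine Summable.of_norm (h.congr fun p => ?_)
  rw [norm_mul, Complex.norm_real, Real.norm_of_nonneg (unitWeight_nonneg _)]

lemma summable_element (J : NonzeroIdeal E) {F : ℕ → ℂ}
    (hF : Summable fun I : ComplementIdeal J => ‖F (Ideal.absNorm I.1.1)‖) :
    Summable fun a : NonzeroElement J =>
      F ((Algebra.norm ℤ a.1).natAbs / Ideal.absNorm J.1) * (unitWeight (a.1 : E) : ℂ) := by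
  rw [← (elementEquiv J).summable_iff]
  refine (summable_nonzeroElement J hF).congr fun p => ?_
  simp only [Function.comp_apply]
  rw [natAbs_norm_div]

lemma tsum_element (J : NonzeroIdeal E) {F : ℕ → ℂ}
    (hF : Summable fun I : ComplementIdeal J => ‖F (Ideal.absNorm I.1.1)‖) :
    ∑' a : NonzeroElement J,
      F ((Algebra.norm ℤ a.1).natAbs / Ideal.absNorm J.1) * (unitWeight (a.1 : E) : ℂ) =
    torsionOrder E * ∑' I : ComplementIdeal J, F (Ideal.absNorm I.1.1) := by
  rw [← (elementEquiv J).tsum_eq]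
  simp only [natAbs_norm_div]
  rw [(summable_nonzeroElement J hF).tsum_prod, ← tsum_mul_left]
  refine tsum_congr fun I => ?_
  have h := Complex.hasSum_ofReal.2 (hasSum_unitWeight_generator J I)
  refine (h.mul_left (F (Ideal.absNorm I.1.1))).tsum_eq.trans ?_
  rw [mul_comm, Complex.ofReal_natCast]

end elementSums

end

section

open NumberField NumberField.InfinitePlace NumberField.mixedEmbedding NumberField.Units
  NumberField.Units.dirichletUnitTheorem Module Filter Topology

lemma pole_or_limit {A Z H T : ℝ → ℂ} {A' κ l : ℂ} (hA : HasDerivAt A A' 1)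
    (hZ : Tendsto (fun s : ℝ => ((s : ℂ) - 1) * Z s) (𝓝[>] 1) (𝓝 κ)) (hκ : κ ≠ 0)
    (hH : Tendsto H (𝓝[>] 1) (𝓝 l)) (hT : ∀ s, 1 < s → T s = A s * Z s + H s) :
    (∃ κ', κ' ≠ 0 ∧ Tendsto (fun s : ℝ => ((s : ℂ) - 1) * T s) (𝓝[>] 1) (𝓝 κ')) ∨
      ∃ l', Tendsto T (𝓝[>] 1) (𝓝 l') := by
  have hs : Tendsto (fun s : ℝ => (s : ℂ) - 1) (𝓝[>] 1) (𝓝 0) := by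
    have : Continuous fun s : ℝ => (s : ℂ) - 1 := by fun_prop
    have h := this.tendsto 1
    simp only [Complex.ofReal_one, sub_self] at h
    exact h.mono_left nhdsWithin_le_nhds
  by_cases h0 : A 1 = 0
  · right
    refine ⟨A' * κ + l, ?_⟩
    have h1 := (hasDerivAt_iff_tendsto_slope.1 hA).mono_left
      (nhdsWithin_mono 1 (fun x (hx : 1 < x) => hx.ne'))
    refine ((h1.mul hZ).add hH).congr' ?_
    filter_upwards [self_mem_nhdsWithin] with s hs
    rw [hT s hs, slope_def_module, h0, sub_zero]
    have h2 : (s : ℂ) - 1 ≠ 0 := by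
      rw [sub_ne_zero]; exact_mod_cast (ne_of_gt hs)
    rw [Complex.real_smul]
    push_cast
    field_simp
  · left
    refine ⟨A 1 * κ, mul_ne_zero h0 hκ, ?_⟩
    have h1 : Tendsto A (𝓝[>] 1) (𝓝 (A 1)) := hA.continuousAt.tendsto.mono_left nhdsWithin_le_nhds
    have h2 := (h1.mul hZ).add (hs.mul hH)
    rw [zero_mul, add_zero] at h2
    refine h2.congr' ?_
    filter_upwards [self_mem_nhdsWithin] with s hs
    rw [hT s hs]
    ring

section dichotomy

variable {E : Type*} [Field E] [NumberField E]

lemma norm_add_mul_modEq (M : ℕ) (a b : 𝓞 E) :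
    Algebra.norm ℤ (a + M * b) ≡ Algebra.norm ℤ a [ZMOD M] := by
  classical
  rw [← ZMod.intCast_eq_intCast_iff, Algebra.norm_eq_matrix_det (RingOfIntegers.basis E),
    Algebra.norm_eq_matrix_det (RingOfIntegers.basis E)]
  change Int.castRingHom (ZMod M) _ = Int.castRingHom (ZMod M) _
  rw [RingHom.map_det, RingHom.map_det, map_add, map_mul, map_natCast, ← nsmul_eq_mul]
  congr 1
  ext i j
  simp only [RingHom.mapMatrix_apply, Matrix.map_apply, Matrix.add_apply, Matrix.smul_apply]
  simp

/-- The function `g(N a / N J)` on the ideal `J`, extended by zero. -/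
noncomputable def twistOn (g : ℤ → ℂ) (J : NonzeroIdeal E) (a : 𝓞 E) : ℂ :=
  open scoped Classical in
  if a ∈ J.1 then g (Algebra.norm ℤ a / (Ideal.absNorm J.1 : ℤ)) else 0

lemma absNorm_dvd_norm {J : NonzeroIdeal E} {a : 𝓞 E} (ha : a ∈ J.1) :
    (Ideal.absNorm J.1 : ℤ) ∣ Algebra.norm ℤ a := by
  rw [Int.natCast_dvd, ← Ideal.absNorm_span_singleton]
  exact Ideal.absNorm_dvd_absNorm_of_le ((Ideal.span_singleton_le_iff_mem _).2 ha)

lemma twistOn_add_mul {g : ℤ → ℂ} {m : ℕ} (hg : ∀ a b, g (a + m * b) = g a)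
    (J : NonzeroIdeal E) (a b : 𝓞 E) :
    twistOn g J (a + (m * Ideal.absNorm J.1 : ℕ) * b) = twistOn g J a := by
  have hmem : ((m * Ideal.absNorm J.1 : ℕ) : 𝓞 E) * b ∈ J.1 := by
    push_cast
    rw [mul_comm (m : 𝓞 E), mul_assoc]
    exact Ideal.mul_mem_right _ _ (Ideal.absNorm_mem J.1)
  have hN : (Ideal.absNorm J.1 : ℤ) ≠ 0 := by exact_mod_cast absNorm_ne_zero J
  by_cases ha : a ∈ J.1
  · rw [twistOn, twistOn, if_pos ha, if_pos (add_mem ha hmem)]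
    obtain ⟨k, hk⟩ := (norm_add_mul_modEq (m * Ideal.absNorm J.1) a b).symm.dvd
    rw [sub_eq_iff_eq_add'.1 hk]
    push_cast
    rw [show (m * (Ideal.absNorm J.1 : ℤ)) * k = (m * k) * (Ideal.absNorm J.1 : ℤ) by ring,
      Int.add_mul_ediv_right _ _ hN, hg]
  · rw [twistOn, twistOn, if_neg ha, if_neg]
    exact fun h => ha ((add_mem_cancel_right hmem).1 h)

lemma twistOn_mul_heckeTerm {g : ℤ → ℂ} (heven : ∀ a, g (-a) = g a) (J : NonzeroIdeal E) (s : ℝ)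
    {a : 𝓞 E} (ha : a ∈ J.1) :
    twistOn g J a * (heckeTerm s (a : E) : ℂ) = (((Ideal.absNorm J.1 : ℝ) ^ (-s) : ℝ) : ℂ) *
      (g ((Algebra.norm ℤ a).natAbs / Ideal.absNorm J.1 : ℕ) *
        ((((Algebra.norm ℤ a).natAbs / Ideal.absNorm J.1 : ℕ) : ℝ) ^ (-s) : ℝ) *
        (unitWeight (a : E) : ℂ)) := by
  obtain ⟨k, hk⟩ := absNorm_dvd_norm ha
  have hN : Ideal.absNorm J.1 ≠ 0 := absNorm_ne_zero J
  have hN' : (Ideal.absNorm J.1 : ℤ) ≠ 0 := by exact_mod_cast hN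
  have h1 : (Algebra.norm ℤ a).natAbs = Ideal.absNorm J.1 * k.natAbs := by
    rw [hk, Int.natAbs_mul, Int.natAbs_natCast]
  have h2 : (Algebra.norm ℤ a).natAbs / Ideal.absNorm J.1 = k.natAbs := by
    rw [h1, Nat.mul_div_cancel_left _ (Nat.pos_of_ne_zero hN)]
  have h3 : g (k.natAbs : ℤ) = g k := by
    rcases Int.natAbs_eq k with h | h
    · rw [← h]
    · conv_rhs => rw [h, heven]
  rw [twistOn, if_pos ha, h2, h3, hk, Int.mul_ediv_cancel_left _ hN', heckeTerm, realNorm_intCast,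
    h1, Nat.cast_mul, Real.mul_rpow (Nat.cast_nonneg _) (Nat.cast_nonneg _)]
  push_cast
  ring

end dichotomy

end

section

open NumberField NumberField.InfinitePlace NumberField.mixedEmbedding NumberField.Units
  NumberField.Units.dirichletUnitTheorem Module Filter Topology

section classSums

variable {E : Type*} [Field E] [NumberField E]

lemma exists_norm_le_of_periodic {m : ℕ} (hm : m ≠ 0) {g : ℤ → ℂ}
    (hg : ∀ a b, g (a + m * b) = g a) : ∃ B : ℝ, 0 ≤ B ∧ ∀ a, ‖g a‖ ≤ B := by
  refine ⟨∑ i ∈ Finset.range m, ‖g i‖, Finset.sum_nonneg fun _ _ => norm_nonneg _, fun a => ?_⟩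
  have hm' : (m : ℤ) ≠ 0 := by exact_mod_cast hm
  have h1 : g a = g ((a % m).toNat : ℕ) := by
    rw [Int.toNat_of_nonneg (Int.emod_nonneg a hm')]
    conv_lhs => rw [← Int.emod_add_mul_ediv a m]
    rw [hg]
  rw [h1]
  refine Finset.single_le_sum (f := fun i : ℕ => ‖g i‖) (fun _ _ => norm_nonneg _) ?_
  rw [Finset.mem_range]
  have := Int.emod_lt_of_pos a (by omega : (0 : ℤ) < m)
  have := Int.emod_nonneg a hm'
  omega

lemma summable_twist_absNorm {m : ℕ} (hm : m ≠ 0) {g : ℤ → ℂ}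
    (hg : ∀ a b, g (a + m * b) = g a) {s : ℝ} (hs : 1 < s) :
    Summable fun I : NonzeroIdeal E =>
      ‖g (Ideal.absNorm I.1 : ℕ) * (((Ideal.absNorm I.1 : ℝ) ^ (-s) : ℝ) : ℂ)‖ := by
  obtain ⟨B, -, hB⟩ := exists_norm_le_of_periodic hm hg
  refine Summable.of_nonneg_of_le (fun _ => norm_nonneg _) (fun I => ?_)
    ((summable_absNorm_rpow (E := E) hs).mul_left B)
  rw [norm_mul, Complex.norm_real, Real.norm_of_nonneg (by positivity)]
  exact mul_le_mul_of_nonneg_right (hB _) (by positivity)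

/-- The function `n ↦ g(n) n^{-s}`. -/
noncomputable def twistTerm (g : ℤ → ℂ) (s : ℝ) (n : ℕ) : ℂ := g n * (((n : ℝ) ^ (-s) : ℝ) : ℂ)

lemma hasSum_twistOn {m : ℕ} (hm : m ≠ 0) {g : ℤ → ℂ}
    (hg : ∀ a b, g (a + m * b) = g a) (heven : ∀ a, g (-a) = g a) (J : NonzeroIdeal E)
    {s : ℝ} (hs : 1 < s) :
    HasSum (fun a : 𝓞 E => twistOn g J a * (heckeTerm s (a : E) : ℂ))
      ((((Ideal.absNorm J.1 : ℝ) ^ (-s) : ℝ) : ℂ) *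
        (torsionOrder E * ∑' I : ComplementIdeal J, twistTerm g s (Ideal.absNorm I.1.1))) := by
  have hF : Summable fun I : ComplementIdeal J => ‖twistTerm g s (Ideal.absNorm I.1.1)‖ :=
    (summable_twist_absNorm (E := E) hm hg hs).subtype _
  have h1 := (summable_element J hF).hasSum
  rw [tsum_element J hF] at h1
  have h2 := h1.mul_left ((((Ideal.absNorm J.1 : ℝ) ^ (-s) : ℝ) : ℂ))
  have hinj : Function.Injective (Subtype.val : NonzeroElement J → 𝓞 E) :=
    Subtype.val_injective
  rw [← hinj.hasSum_iff]
  · refine h2.congr_fun fun a => ?_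
    simp only [Function.comp_apply]
    rw [twistOn_mul_heckeTerm heven J s a.2.2]
    rfl
  · intro a ha
    by_cases h0 : a = 0
    · rw [h0]
      have : heckeTerm s ((0 : 𝓞 E) : E) = 0 := by
        have := heckeTerm_zero (E := E) (s := s) (by linarith)
        simpa using this
      rw [this, Complex.ofReal_zero, mul_zero]
    · have : a ∉ J.1 := fun h => ha ⟨⟨a, h0, h⟩, rfl⟩
      rw [twistOn, if_neg this, zero_mul]

lemma summable_heckeTerm {s : ℝ} (hs : 1 < s) : Summable fun a : 𝓞 E => heckeTerm s (a : E) := by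
  have h := (hasSum_twistOn (E := E) (m := 1) one_ne_zero (g := fun _ => 1) (fun _ _ => rfl)
    (fun _ => rfl) ⟨⊤, by simp⟩ hs).summable
  refine Complex.summable_ofReal.1 (h.congr fun a => ?_)
  rw [twistOn, if_pos (Submodule.mem_top (x := a)), one_mul]

open nonZeroDivisors in
lemma exists_representative (C : ClassGroup (𝓞 E)) :
    ∃ J : NonzeroIdeal E, ∀ I : NonzeroIdeal E, (I.1 * J.1).IsPrincipal ↔
      ClassGroup.mk0 ⟨I.1, mem_nonZeroDivisors_of_ne_zero I.2⟩ = C := by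
  obtain ⟨J, hJ⟩ := ClassGroup.mk0_surjective C⁻¹
  refine ⟨⟨J.1, nonZeroDivisors.ne_zero J.2⟩, fun I => ?_⟩
  have hI := mem_nonZeroDivisors_of_ne_zero I.2
  have h : ClassGroup.mk0 ⟨I.1 * J.1, mul_mem hI J.2⟩ =
      ClassGroup.mk0 ⟨I.1, hI⟩ * ClassGroup.mk0 J := by
    rw [← map_mul]; rfl
  rw [← ClassGroup.mk0_eq_one_iff (mul_mem hI J.2), h, hJ, mul_inv_eq_one]

/-- A nonzero ideal whose class is inverse to `C`. -/
noncomputable def inverseRep (C : ClassGroup (𝓞 E)) : NonzeroIdeal E :=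
  (exists_representative C).choose

/-- The nonzero ideals, sorted by ideal class. -/
noncomputable def classEquiv :
    (Σ C : ClassGroup (𝓞 E), ComplementIdeal (inverseRep C)) ≃ NonzeroIdeal E :=
  (Equiv.sigmaCongrRight fun C => Equiv.subtypeEquivRight
    fun I => (exists_representative C).choose_spec I).trans
  (Equiv.sigmaFiberEquiv fun I : NonzeroIdeal E =>
    ClassGroup.mk0 ⟨I.1, mem_nonZeroDivisors_of_ne_zero I.2⟩)

lemma classEquiv_apply (C : ClassGroup (𝓞 E)) (I : ComplementIdeal (inverseRep C)) :
    classEquiv ⟨C, I⟩ = I.1 := rfl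

lemma tsum_idealCount_eq_sum_class {m : ℕ} (hm : m ≠ 0) {g : ℤ → ℂ}
    (hg : ∀ a b, g (a + m * b) = g a) (heven : ∀ a, g (-a) = g a) {s : ℝ} (hs : 1 < s) :
    ∑' n : ℕ, idealCount E n * twistTerm g s n = ∑ C : ClassGroup (𝓞 E),
      (((Ideal.absNorm (inverseRep C).1 : ℝ) ^ s : ℝ) : ℂ) * (torsionOrder E : ℂ)⁻¹ *
        ∑' a : 𝓞 E, twistOn g (inverseRep C) a * (heckeTerm s (a : E) : ℂ) := by
  have h0 : twistTerm g s 0 = 0 := by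
    rw [twistTerm, Nat.cast_zero (R := ℝ), Real.zero_rpow (by linarith)]; simp
  have hsum : Summable fun I : NonzeroIdeal E => twistTerm g s (Ideal.absNorm I.1) :=
    (summable_twist_absNorm (E := E) hm hg hs).of_norm
  rw [← tsum_nonzeroIdeal h0 hsum, ← (classEquiv (E := E)).tsum_eq]
  have h2 := (classEquiv (E := E)).summable_iff.2 hsum
  refine (h2.tsum_sigma).trans ?_
  rw [tsum_fintype]
  refine Finset.sum_congr rfl fun C _ => ?_
  rw [(hasSum_twistOn hm hg heven (inverseRep C) hs).tsum_eq]
  have hN : (0 : ℝ) < Ideal.absNorm (inverseRep C).1 := by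
    exact_mod_cast Nat.pos_of_ne_zero (absNorm_ne_zero _)
  have h3 : (((Ideal.absNorm (inverseRep C).1 : ℝ) ^ s : ℝ) : ℂ) *
      (((Ideal.absNorm (inverseRep C).1 : ℝ) ^ (-s) : ℝ) : ℂ) = 1 := by
    rw [← Complex.ofReal_mul, ← Real.rpow_add hN]; simp
  have h4 : (torsionOrder E : ℂ) ≠ 0 := by exact_mod_cast (torsionOrder_ne_zero E)
  simp only [classEquiv_apply, Function.comp_apply]
  calc _ = 1 * ((torsionOrder E : ℂ)⁻¹ * torsionOrder E) * _ := by
        rw [inv_mul_cancel₀ h4, one_mul, one_mul]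
    _ = _ := by rw [← h3]; ring

end classSums

end

section

open NumberField NumberField.InfinitePlace NumberField.mixedEmbedding NumberField.Units
  NumberField.Units.dirichletUnitTheorem Module Filter Topology

section finalDichotomy

variable {E : Type*} [Field E] [NumberField E]

/-- The coefficient of the principal part. -/
noncomputable def principalCoeff (E : Type*) [Field E] [NumberField E] (m : ℕ) (g : ℤ → ℂ)
    (s : ℝ) : ℂ :=
  ∑ C : ClassGroup (𝓞 E), (((Ideal.absNorm (inverseRep C).1 : ℝ) ^ s : ℝ) : ℂ) *
    (torsionOrder E : ℂ)⁻¹ *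
    periodicMean (m * Ideal.absNorm (inverseRep C).1) (twistOn g (inverseRep C))

lemma exists_hasDerivAt_principalCoeff (m : ℕ) (g : ℤ → ℂ) :
    ∃ A', HasDerivAt (principalCoeff E m g) A' 1 := by
  have h : ∀ C : ClassGroup (𝓞 E), DifferentiableAt ℝ (fun s : ℝ =>
      (((Ideal.absNorm (inverseRep C).1 : ℝ) ^ s : ℝ) : ℂ) *
    (torsionOrder E : ℂ)⁻¹ *
    periodicMean (m * Ideal.absNorm (inverseRep C).1) (twistOn g (inverseRep C))) 1 := by
    intro C
    have hN : (0 : ℝ) < Ideal.absNorm (inverseRep C).1 := by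
      exact_mod_cast Nat.pos_of_ne_zero (absNorm_ne_zero _)
    have h1 : DifferentiableAt ℝ (fun s : ℝ =>
        (((Ideal.absNorm (inverseRep C).1 : ℝ) ^ s : ℝ) : ℂ)) 1 :=
      ((Real.hasStrictDerivAt_const_rpow hN 1).hasDerivAt.ofReal_comp).differentiableAt
    exact (h1.mul_const _).mul_const _
  have h2 : DifferentiableAt ℝ (principalCoeff E m g) 1 := by
    unfold principalCoeff
    exact DifferentiableAt.fun_sum fun C _ => h C
  exact ⟨_, h2.hasDerivAt⟩

lemma exists_tendsto_remainder {m : ℕ} (hm : m ≠ 0) {g : ℤ → ℂ}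
    (hg : ∀ a b, g (a + m * b) = g a) (heven : ∀ a, g (-a) = g a) :
    ∃ (H : ℝ → ℂ) (l : ℂ), Tendsto H (𝓝[>] 1) (𝓝 l) ∧ ∀ s, 1 < s →
      ∑' n : ℕ, idealCount E n * twistTerm g s n =
        principalCoeff E m g s * ∑' a : 𝓞 E, (heckeTerm s (a : E) : ℂ) + H s := by
  have h1 : ∀ C : ClassGroup (𝓞 E), ∃ l, Tendsto (fun s : ℝ =>
      ∑' a : 𝓞 E, twistOn g (inverseRep C) a * heckeTerm s (a : E) -
      periodicMean (m * Ideal.absNorm (inverseRep C).1) (twistOn g (inverseRep C)) *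
        ∑' a : 𝓞 E, (heckeTerm s (a : E) : ℂ)) (𝓝[>] 1) (𝓝 l) := fun C =>
    exists_tendsto_periodic_series (fun s hs => summable_heckeTerm hs)
      (mul_ne_zero hm (absNorm_ne_zero _)) _ (twistOn_add_mul hg (inverseRep C))
  choose l hl using h1
  have h2 : ∀ C : ClassGroup (𝓞 E), Tendsto (fun s : ℝ =>
      (((Ideal.absNorm (inverseRep C).1 : ℝ) ^ s : ℝ) : ℂ) * (torsionOrder E : ℂ)⁻¹) (𝓝[>] 1)
      (𝓝 ((((Ideal.absNorm (inverseRep C).1 : ℝ) ^ (1 : ℝ) : ℝ) : ℂ) *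
        (torsionOrder E : ℂ)⁻¹)) := by
    intro C
    refine Tendsto.mul_const _ ?_
    have hN : (0 : ℝ) < Ideal.absNorm (inverseRep C).1 := by
      exact_mod_cast Nat.pos_of_ne_zero (absNorm_ne_zero _)
    have h1 : ContinuousAt (fun s : ℝ =>
        (((Ideal.absNorm (inverseRep C).1 : ℝ) ^ s : ℝ) : ℂ)) 1 :=
      ((Real.hasStrictDerivAt_const_rpow hN 1).hasDerivAt.ofReal_comp).continuousAt
    exact h1.tendsto.mono_left nhdsWithin_le_nhds
  refine ⟨_, _, tendsto_finsetSum Finset.univ fun C _ => (h2 C).mul (hl C), fun s hs => ?_⟩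
  rw [tsum_idealCount_eq_sum_class hm hg heven hs, principalCoeff, Finset.sum_mul,
    ← Finset.sum_add_distrib]
  refine Finset.sum_congr rfl fun C _ => ?_
  ring

lemma principalCoeff_one_ne_zero : principalCoeff E 1 (fun _ => 1) 1 ≠ 0 := by
  classical
  have h1 : ∀ C : ClassGroup (𝓞 E), ∃ r : ℝ, 0 < r ∧
      periodicMean (1 * Ideal.absNorm (inverseRep C).1)
        (twistOn (fun _ => 1) (inverseRep C)) = r := by
    intro C
    set J := inverseRep C
    have hm : 1 * Ideal.absNorm J.1 ≠ 0 := mul_ne_zero one_ne_zero (absNorm_ne_zero _)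
    have hfin := finite_quotient_natCast (E := E) hm
    set Q := (𝓞 E) ⧸ Ideal.span {((1 * Ideal.absNorm J.1 : ℕ) : 𝓞 E)} with hQ
    have := Fintype.ofFinite Q
    refine ⟨(Nat.card Q : ℝ)⁻¹ * ∑ q : Q, if q.out ∈ J.1 then 1 else 0, ?_, ?_⟩
    · refine mul_pos ?_ ?_
      · exact inv_pos.2 (by exact_mod_cast Nat.card_pos)
      · refine Finset.sum_pos' (fun _ _ => by split_ifs <;> norm_num)
          ⟨(0 : Q), Finset.mem_univ _, ?_⟩
        have h2 : ((0 : Q).out : 𝓞 E) ∈ Ideal.span {((1 * Ideal.absNorm J.1 : ℕ) : 𝓞 E)} := by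
          rw [← Ideal.Quotient.eq_zero_iff_mem]
          exact Quotient.out_eq' (0 : Q)
        have h3 : ((0 : Q).out : 𝓞 E) ∈ J.1 := by
          refine (Ideal.span_singleton_le_iff_mem _).2 ?_ h2
          rw [one_mul]
          exact Ideal.absNorm_mem _
        rw [if_pos h3]; norm_num
    · rw [periodicMean, finsum_eq_sum_of_fintype, Complex.ofReal_mul, Complex.ofReal_inv,
        Complex.ofReal_natCast, Complex.ofReal_sum]
      congr 1
      refine Finset.sum_congr rfl fun q _ => ?_
      rw [twistOn]
      split_ifs <;> simp
  choose r hr hr' using h1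
  have h2 : principalCoeff E 1 (fun _ => 1) 1 = ((∑ C : ClassGroup (𝓞 E),
      (Ideal.absNorm (inverseRep C).1 : ℝ) ^ (1 : ℝ) * (torsionOrder E : ℝ)⁻¹ * r C : ℝ) : ℂ) := by
    rw [principalCoeff]
    push_cast
    refine Finset.sum_congr rfl fun C _ => ?_
    rw [hr']
  rw [h2]
  have h3 : (0 : ℝ) < ∑ C : ClassGroup (𝓞 E),
      (Ideal.absNorm (inverseRep C).1 : ℝ) ^ (1 : ℝ) * (torsionOrder E : ℝ)⁻¹ * r C := by
    refine Finset.sum_pos (fun C _ => ?_) Finset.univ_nonempty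
    have hN : (0 : ℝ) < Ideal.absNorm (inverseRep C).1 := by
      exact_mod_cast Nat.pos_of_ne_zero (absNorm_ne_zero _)
    have := torsionOrder_pos E
    have := hr C
    positivity
  exact_mod_cast h3.ne'

lemma tendsto_sub_one_mul_idealCount :
    Tendsto (fun s : ℝ => ((s : ℂ) - 1) * ∑' n : ℕ, idealCount E n * twistTerm (fun _ => 1) s n)
      (𝓝[>] 1) (𝓝 (dedekindZeta_residue E)) := by
  refine (tendsto_sub_one_mul_dedekindZeta_nhdsGT E).congr' ?_
  filter_upwards [self_mem_nhdsWithin] with s hs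
  congr 1
  rw [dedekindZeta, LSeries]
  refine tsum_congr fun n => ?_
  have hs0 : (s : ℝ) ≠ 0 := by have : (1 : ℝ) < s := hs; linarith
  rcases eq_or_ne n 0 with rfl | hn
  · rw [LSeries.term_zero, twistTerm, Nat.cast_zero (R := ℝ), Real.zero_rpow (by simpa using hs0)]
    simp
  · rw [LSeries.term_of_ne_zero hn, twistTerm, one_mul, Complex.ofReal_cpow (Nat.cast_nonneg n)]
    push_cast
    rw [Complex.cpow_neg, div_eq_mul_inv]
    rfl

lemma exists_tendsto_hecke :
    ∃ κ : ℂ, κ ≠ 0 ∧ Tendsto (fun s : ℝ => ((s : ℂ) - 1) * ∑' a : 𝓞 E, (heckeTerm s (a : E) : ℂ))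
      (𝓝[>] 1) (𝓝 κ) := by
  obtain ⟨H, l, hH, hT⟩ := exists_tendsto_remainder (E := E) (m := 1) one_ne_zero
    (g := fun _ => 1) (fun _ _ => rfl) (fun _ => rfl)
  obtain ⟨A', hA⟩ := exists_hasDerivAt_principalCoeff (E := E) 1 (fun _ => 1)
  have hA1 : Tendsto (principalCoeff E 1 (fun _ => 1)) (𝓝[>] 1)
      (𝓝 (principalCoeff E 1 (fun _ => 1) 1)) :=
    hA.continuousAt.tendsto.mono_left nhdsWithin_le_nhds
  have hs : Tendsto (fun s : ℝ => (s : ℂ) - 1) (𝓝[>] 1) (𝓝 0) := by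
    have : Continuous fun s : ℝ => (s : ℂ) - 1 := by fun_prop
    have h := this.tendsto 1
    simp only [Complex.ofReal_one, sub_self] at h
    exact h.mono_left nhdsWithin_le_nhds
  have hne := principalCoeff_one_ne_zero (E := E)
  have h := ((tendsto_sub_one_mul_idealCount (E := E)).sub (hs.mul hH)).div hA1 hne
  refine ⟨_, ?_, h.congr' ?_⟩
  · rw [zero_mul, sub_zero]
    exact div_ne_zero (by exact_mod_cast dedekindZeta_residue_ne_zero E) hne
  · filter_upwards [self_mem_nhdsWithin, hA1.eventually_ne hne] with s hs h0
    simp only [Pi.div_apply]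
    rw [hT s hs]
    field_simp
    ring

/-- A Dirichlet series over the ideals, twisted by an even periodic function, has either a simple
pole or a finite limit at `1`. -/
theorem ideal_series_dichotomy {m : ℕ} (hm : m ≠ 0) {g : ℤ → ℂ}
    (hg : ∀ a b, g (a + m * b) = g a) (heven : ∀ a, g (-a) = g a) :
    (∃ κ, κ ≠ 0 ∧ Tendsto (fun s : ℝ => ((s : ℂ) - 1) *
      ∑' n : ℕ, idealCount E n * twistTerm g s n) (𝓝[>] 1) (𝓝 κ)) ∨
    ∃ l, Tendsto (fun s : ℝ => ∑' n : ℕ, idealCount E n * twistTerm g s n) (𝓝[>] 1) (𝓝 l) := by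
  obtain ⟨H, l, hH, hT⟩ := exists_tendsto_remainder (E := E) hm hg heven
  obtain ⟨A', hA⟩ := exists_hasDerivAt_principalCoeff (E := E) m g
  obtain ⟨κ, hκ, hZ⟩ := exists_tendsto_hecke (E := E)
  exact pole_or_limit hA hZ hκ hH hT

end finalDichotomy

end

section

open NumberField Module Filter Topology

section idealCountMultiplicative

variable {E : Type*} [Field E] [NumberField E]

lemma idealCount_one : idealCount E 1 = 1 := by
  have : Unique {I : Ideal (𝓞 E) // Ideal.absNorm I = 1} :=
    { default := ⟨⊤, by simp⟩
      uniq := fun I => Subtype.ext (Ideal.absNorm_eq_one_iff.mp I.2) }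
  exact Nat.card_unique

lemma isCoprime_of_coprime_absNorm {I J : Ideal (𝓞 E)}
    (h : (Ideal.absNorm I).Coprime (Ideal.absNorm J)) : IsCoprime I J := by
  rw [Ideal.isCoprime_iff_exists]
  obtain ⟨a, b, hab⟩ := Nat.isCoprime_iff_coprime.mpr h
  refine ⟨(a : 𝓞 E) * (Ideal.absNorm I : 𝓞 E), I.mul_mem_left _ (Ideal.absNorm_mem I),
    (b : 𝓞 E) * (Ideal.absNorm J : 𝓞 E), J.mul_mem_left _ (Ideal.absNorm_mem J), ?_⟩
  exact_mod_cast congrArg (Int.cast : ℤ → 𝓞 E) hab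

lemma absNorm_dvd_pow_of_natCast_mem {I : Ideal (𝓞 E)} {m : ℕ} (h : (m : 𝓞 E) ∈ I) :
    Ideal.absNorm I ∣ m ^ finrank ℚ E := by
  have h1 := Ideal.absNorm_dvd_absNorm_of_le ((Ideal.span_singleton_le_iff_mem I).mpr h)
  have h2 : Ideal.absNorm (Ideal.span {(m : 𝓞 E)}) = m ^ finrank ℚ E := by
    rw [Ideal.absNorm_span_singleton]
    have : (m : 𝓞 E) = algebraMap ℤ (𝓞 E) m := by simp
    rw [this, Algebra.norm_algebraMap, RingOfIntegers.rank]
    simp [Int.natAbs_pow]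
  rwa [h2] at h1

lemma idealCount_mul {m n : ℕ} (hmn : m.Coprime n) :
    idealCount E (m * n) = idealCount E m * idealCount E n := by
  unfold idealCount
  rw [← Nat.card_prod]
  symm
  let φ : {I : Ideal (𝓞 E) // Ideal.absNorm I = m} × {I : Ideal (𝓞 E) // Ideal.absNorm I = n} →
      {I : Ideal (𝓞 E) // Ideal.absNorm I = m * n} :=
    fun J => ⟨J.1.1 * J.2.1, by rw [map_mul, J.1.2, J.2.2]⟩
  refine Nat.card_eq_of_bijective φ ⟨?_, ?_⟩
  · rintro ⟨⟨J₁, h₁⟩, ⟨J₂, h₂⟩⟩ ⟨⟨J₁', h₁'⟩, ⟨J₂', h₂'⟩⟩ h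
    have h : J₁ * J₂ = J₁' * J₂' := congrArg Subtype.val h
    have c1 : IsCoprime J₁ J₂' := isCoprime_of_coprime_absNorm (by rw [h₁, h₂']; exact hmn)
    have c2 : IsCoprime J₁' J₂ := isCoprime_of_coprime_absNorm (by rw [h₁', h₂]; exact hmn)
    have e1 : J₁ = J₁' := dvd_antisymm (c1.dvd_of_dvd_mul_right (h ▸ Dvd.intro _ rfl))
      (c2.dvd_of_dvd_mul_right (h ▸ Dvd.intro _ rfl))
    have e2 : J₂ = J₂' := dvd_antisymm (c2.symm.dvd_of_dvd_mul_left (h ▸ Dvd.intro_left _ rfl))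
      (c1.symm.dvd_of_dvd_mul_left (h ▸ Dvd.intro_left _ rfl))
    subst e1 e2; rfl
  · rintro ⟨I, hI⟩
    have hmnI : (m : 𝓞 E) * n ∈ I := by
      have := Ideal.absNorm_mem I; rw [hI] at this; exact_mod_cast this
    obtain ⟨a, b, hab⟩ := Nat.isCoprime_iff_coprime.mpr hmn
    have hab' : (a : 𝓞 E) * m + b * n = 1 := by
      exact_mod_cast congrArg (Int.cast : ℤ → 𝓞 E) hab
    set J₁ := I ⊔ Ideal.span {(m : 𝓞 E)} with hJ₁
    set J₂ := I ⊔ Ideal.span {(n : 𝓞 E)} with hJ₂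
    have hm1 : (m : 𝓞 E) ∈ J₁ := Ideal.mem_sup_right (Ideal.mem_span_singleton_self _)
    have hn1 : (n : 𝓞 E) ∈ J₂ := Ideal.mem_sup_right (Ideal.mem_span_singleton_self _)
    have hprod : J₁ * J₂ = I := by
      apply le_antisymm
      · rw [hJ₁, hJ₂, Ideal.sup_mul, Ideal.mul_sup, Ideal.mul_sup,
          Ideal.span_singleton_mul_span_singleton]
        refine sup_le (sup_le Ideal.mul_le_left Ideal.mul_le_left)
          (sup_le Ideal.mul_le_right ?_)
        exact (Ideal.span_singleton_le_iff_mem _).mpr hmnI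
      · intro x hx
        have h1 : m * x ∈ J₁ * J₂ := Ideal.mul_mem_mul hm1 (Ideal.mem_sup_left hx)
        have h2 : x * n ∈ J₁ * J₂ := Ideal.mul_mem_mul (Ideal.mem_sup_left hx) hn1
        have : x = a * (m * x) + b * (x * n) := by linear_combination -x * hab'
        rw [this]
        exact Ideal.add_mem _ (Ideal.mul_mem_left _ _ h1) (Ideal.mul_mem_left _ _ h2)
    have hN : Ideal.absNorm J₁ * Ideal.absNorm J₂ = m * n := by rw [← map_mul, hprod, hI]
    have d1 : Ideal.absNorm J₁ ∣ m := by
      have : (Ideal.absNorm J₁).Coprime n :=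
        (hmn.pow_left _).coprime_dvd_left (absNorm_dvd_pow_of_natCast_mem hm1)
      exact this.dvd_of_dvd_mul_right (hN ▸ Dvd.intro _ rfl)
    have d1' : m ∣ Ideal.absNorm J₁ := by
      have : m.Coprime (Ideal.absNorm J₂) :=
        (hmn.pow_right _).coprime_dvd_right (absNorm_dvd_pow_of_natCast_mem hn1)
      exact this.dvd_of_dvd_mul_right (hN ▸ Dvd.intro _ rfl)
    have d2 : Ideal.absNorm J₂ ∣ n := by
      have : (Ideal.absNorm J₂).Coprime m :=
        (hmn.symm.pow_left _).coprime_dvd_left (absNorm_dvd_pow_of_natCast_mem hn1)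
      exact this.dvd_of_dvd_mul_left (hN ▸ Dvd.intro_left _ rfl)
    have d2' : n ∣ Ideal.absNorm J₂ := by
      have : n.Coprime (Ideal.absNorm J₁) :=
        (hmn.symm.pow_right _).coprime_dvd_right (absNorm_dvd_pow_of_natCast_mem hm1)
      exact this.dvd_of_dvd_mul_left (hN ▸ Dvd.intro_left _ rfl)
    exact ⟨(⟨J₁, Nat.dvd_antisymm d1 d1'⟩, ⟨J₂, Nat.dvd_antisymm d2 d2'⟩), Subtype.ext hprod⟩

lemma natCast_mem_of_dvd_pow {p : ℕ} {P : Ideal (𝓞 E)} (hP : Prime P) {I : Ideal (𝓞 E)} {k : ℕ}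
    (hI : Ideal.absNorm I = p ^ k) (hPI : P ∣ I) : (p : 𝓞 E) ∈ P := by
  have h1 : ((p ^ k : ℕ) : 𝓞 E) ∈ P := by
    rw [← hI]; exact Ideal.le_of_dvd hPI (Ideal.absNorm_mem I)
  have := Ideal.isPrime_of_prime hP
  push_cast at h1
  exact this.mem_of_pow_mem _ h1

lemma idealCount_prime_pow_le {p : ℕ} (hp : p.Prime) (k : ℕ) :
    idealCount E (p ^ k) ≤ (k + 1) ^ finrank ℚ E := by
  classical
  have hp0 : Ideal.span {(p : 𝓞 E)} ≠ 0 := by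
    simp [hp.ne_zero]
  let S : Finset (Ideal (𝓞 E)) :=
    (UniqueFactorizationMonoid.normalizedFactors (Ideal.span {(p : 𝓞 E)})).toFinset
  have hS : ∀ P, P ∈ S ↔ Prime P ∧ (p : 𝓞 E) ∈ P := by
    intro P
    simp only [S, Multiset.mem_toFinset, Ideal.mem_normalizedFactors_iff hp0]
    constructor
    · rintro ⟨h1, h2⟩
      have h3 : (p : 𝓞 E) ∈ P := h2 (Ideal.mem_span_singleton_self _)
      refine ⟨Ideal.prime_of_isPrime ?_ h1, h3⟩
      rintro rfl
      exact hp.ne_zero (by exact_mod_cast (Ideal.mem_bot.mp h3))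
    · rintro ⟨h1, h2⟩
      exact ⟨Ideal.isPrime_of_prime h1, (Ideal.span_singleton_le_iff_mem _).mpr h2⟩
  have hge : ∀ P ∈ S, p ∣ Ideal.absNorm P := by
    intro P hP
    obtain ⟨h1, h2⟩ := (hS P).mp hP
    obtain ⟨j, -, hj⟩ := (Nat.dvd_prime_pow hp).mp (absNorm_dvd_pow_of_natCast_mem h2)
    rcases j with _ | j
    · exfalso
      rw [pow_zero, Ideal.absNorm_eq_one_iff] at hj
      exact (Ideal.isPrime_of_prime h1).ne_top hj
    · rw [hj]; exact dvd_pow_self _ (by omega)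
  have hcard : S.card ≤ finrank ℚ E := by
    have h1 : ∏ P ∈ S, P ∣ Ideal.span {(p : 𝓞 E)} :=
      Finset.prod_primes_dvd _ (fun P hP => ((hS P).mp hP).1)
        (fun P hP => Ideal.dvd_span_singleton.mpr ((hS P).mp hP).2)
    have h2 : ∏ P ∈ S, Ideal.absNorm P ∣ p ^ finrank ℚ E := by
      rw [← map_prod]
      exact absNorm_dvd_pow_of_natCast_mem (Ideal.dvd_span_singleton.mp h1)
    have h3 : p ^ S.card ∣ ∏ P ∈ S, Ideal.absNorm P := by
      rw [← Finset.prod_const]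
      exact Finset.prod_dvd_prod_of_dvd _ _ hge
    exact (Nat.pow_dvd_pow_iff_le_right hp.one_lt).mp (h3.trans h2)
  have hne : ∀ I : {I : Ideal (𝓞 E) // Ideal.absNorm I = p ^ k}, I.1 ≠ 0 := by
    rintro ⟨I, hI⟩ h0
    simp only at h0
    subst h0
    rw [Ideal.zero_eq_bot, Ideal.absNorm_bot] at hI
    exact pow_ne_zero k hp.ne_zero hI.symm
  have hle : ∀ (I : {I : Ideal (𝓞 E) // Ideal.absNorm I = p ^ k}) (P : S),
      (UniqueFactorizationMonoid.normalizedFactors I.1).count P.1 < k + 1 := by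
    intro I P
    have h1 : P.1 ^ (UniqueFactorizationMonoid.normalizedFactors I.1).count P.1 ∣ I.1 := by
      have h := Multiset.prod_dvd_prod_of_le
        (Multiset.le_count_iff_replicate_le.mp
          (le_refl ((UniqueFactorizationMonoid.normalizedFactors I.1).count P.1)))
      rw [Multiset.prod_replicate] at h
      exact h.trans (UniqueFactorizationMonoid.prod_normalizedFactors (hne I)).dvd
    have h2 := map_dvd Ideal.absNorm h1
    rw [map_pow, I.2] at h2
    have h3 := (pow_dvd_pow_of_dvd (hge P.1 P.2) _).trans h2
    exact Nat.lt_succ_of_le ((Nat.pow_dvd_pow_iff_le_right hp.one_lt).mp h3)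
  let ψ : {I : Ideal (𝓞 E) // Ideal.absNorm I = p ^ k} → (S → Fin (k + 1)) :=
    fun I P => ⟨_, hle I P⟩
  have hψ : Function.Injective ψ := by
    intro I J hIJ
    have hc : UniqueFactorizationMonoid.normalizedFactors I.1 =
        UniqueFactorizationMonoid.normalizedFactors J.1 := by
      ext P
      by_cases hP : P ∈ S
      · exact congrArg Fin.val (congrFun hIJ ⟨P, hP⟩)
      · have key : ∀ I : {I : Ideal (𝓞 E) // Ideal.absNorm I = p ^ k},
            (UniqueFactorizationMonoid.normalizedFactors I.1).count P = 0 := by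
          intro I
          rw [Multiset.count_eq_zero]
          intro hmem
          have hpr := UniqueFactorizationMonoid.prime_of_normalized_factor P hmem
          exact hP ((hS P).mpr ⟨hpr, natCast_mem_of_dvd_pow hpr I.2
            (UniqueFactorizationMonoid.dvd_of_mem_normalizedFactors hmem)⟩)
        rw [key I, key J]
    have h1 := UniqueFactorizationMonoid.prod_normalizedFactors (hne I)
    have h2 := UniqueFactorizationMonoid.prod_normalizedFactors (hne J)
    rw [hc] at h1
    exact Subtype.ext (associated_iff_eq.mp (h1.symm.trans h2))
  calc idealCount E (p ^ k) ≤ Nat.card (S → Fin (k + 1)) :=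
        Nat.card_le_card_of_injective ψ hψ
    _ = (k + 1) ^ S.card := by simp
    _ ≤ (k + 1) ^ finrank ℚ E := Nat.pow_le_pow_right (by omega) hcard

end idealCountMultiplicative

end

section

open NumberField Module Filter Topology

section localFactors

/-- The bound `∑ (k + 2) ^ d / 2 ^ k` for local Euler factors. -/
noncomputable def eulerBound (d : ℕ) : ℝ := ∑' k : ℕ, ((k : ℝ) + 2) ^ d * (1 / 2) ^ k

lemma summable_eulerBound (d : ℕ) : Summable fun k : ℕ => ((k : ℝ) + 2) ^ d * (1 / 2 : ℝ) ^ k := by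
  have h := summable_pow_mul_geometric_of_norm_lt_one (R := ℝ) d (r := 1 / 2) (by norm_num)
  have h2 := ((summable_nat_add_iff 2).mpr h).mul_left 4
  refine h2.congr fun k => ?_
  push_cast
  ring

lemma eulerBound_nonneg (d : ℕ) : 0 ≤ eulerBound d := tsum_nonneg fun k => by positivity

variable {d : ℕ} {a : ℕ → ℂ} {y : ℝ}

lemma norm_le_of_local (hy0 : 0 ≤ y) (hy : y ≤ 1 / 2)
    (ha : ∀ k, ‖a k‖ ≤ ((k : ℝ) + 2) ^ d * y ^ (k + 1)) (k : ℕ) :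
    ‖a k‖ ≤ y * (((k : ℝ) + 2) ^ d * (1 / 2) ^ k) := by
  refine (ha k).trans ?_
  have : y ^ k ≤ (1 / 2) ^ k := pow_le_pow_left₀ hy0 hy k
  have h2 : y ^ (k + 1) ≤ y * (1 / 2) ^ k := by
    rw [pow_succ']; exact mul_le_mul_of_nonneg_left this hy0
  calc _ ≤ ((k : ℝ) + 2) ^ d * (y * (1 / 2) ^ k) := by gcongr
    _ = _ := by ring

lemma summable_of_local (hy0 : 0 ≤ y) (hy : y ≤ 1 / 2)
    (ha : ∀ k, ‖a k‖ ≤ ((k : ℝ) + 2) ^ d * y ^ (k + 1)) : Summable a :=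
  Summable.of_norm_bounded ((summable_eulerBound d).mul_left y) (norm_le_of_local hy0 hy ha)

lemma norm_tsum_le_of_local (hy0 : 0 ≤ y) (hy : y ≤ 1 / 2)
    (ha : ∀ k, ‖a k‖ ≤ ((k : ℝ) + 2) ^ d * y ^ (k + 1)) : ‖∑' k, a k‖ ≤ eulerBound d * y := by
  refine tsum_of_norm_bounded ?_ (norm_le_of_local hy0 hy ha)
  rw [mul_comm]
  exact (summable_eulerBound d).hasSum.mul_left y

lemma norm_tsum_sub_le_of_local (hy0 : 0 ≤ y) (hy : y ≤ 1 / 2)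
    (ha : ∀ k, ‖a k‖ ≤ ((k : ℝ) + 2) ^ d * y ^ (k + 1)) :
    ‖∑' k, a k - a 0‖ ≤ 2 * eulerBound d * y ^ 2 := by
  rw [(summable_of_local hy0 hy ha).tsum_eq_zero_add, add_sub_cancel_left]
  have hs := (summable_nat_add_iff 1).mpr (summable_eulerBound d)
  have hle : ∑' k : ℕ, (((k + 1 : ℕ) : ℝ) + 2) ^ d * (1 / 2 : ℝ) ^ (k + 1) ≤ eulerBound d := by
    rw [eulerBound, (summable_eulerBound d).tsum_eq_zero_add]
    simp
  have h1 : ‖∑' k, a (k + 1)‖ ≤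
      2 * y ^ 2 * ∑' k : ℕ, (((k + 1 : ℕ) : ℝ) + 2) ^ d * (1 / 2 : ℝ) ^ (k + 1) := by
    refine tsum_of_norm_bounded (hs.hasSum.mul_left (2 * y ^ 2)) fun k => ?_
    refine (ha (k + 1)).trans ?_
    have : y ^ k ≤ (1 / 2) ^ k := pow_le_pow_left₀ hy0 hy k
    have h2 : y ^ (k + 1 + 1) ≤ y ^ 2 * (1 / 2) ^ k := by
      rw [pow_succ, pow_succ, mul_assoc, mul_comm, ← sq]
      exact mul_le_mul_of_nonneg_left this (sq_nonneg y)
    calc _ ≤ (((k + 1 : ℕ) : ℝ) + 2) ^ d * (y ^ 2 * (1 / 2) ^ k) := by gcongr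
      _ = _ := by ring
  calc _ ≤ _ := h1
    _ ≤ 2 * y ^ 2 * eulerBound d := by gcongr
    _ = _ := by ring

lemma norm_log_one_add_sub_le {z : ℂ} (hz : ‖z‖ ≤ 1 / 2 ∨ 0 ≤ z.re ∧ z.im = 0) :
    ‖Complex.log (1 + z) - z‖ ≤ ‖z‖ ^ 2 := by
  rcases hz with hz | ⟨h1, h2⟩
  · refine (Complex.norm_log_one_add_sub_self_le (by linarith)).trans ?_
    have h3 : (1 - ‖z‖)⁻¹ ≤ 2 := by
      rw [inv_le_comm₀ (by linarith) (by norm_num)]; linarith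
    nlinarith [sq_nonneg ‖z‖]
  · obtain ⟨x, rfl⟩ : ∃ x : ℝ, z = x := ⟨z.re, Complex.ext rfl (by simp [h2])⟩
    simp only [Complex.ofReal_re] at h1
    have h3 : (1 + (x : ℂ)) = ((1 + x : ℝ) : ℂ) := by push_cast; ring
    rw [h3, ← Complex.ofReal_log (by linarith), ← Complex.ofReal_sub, Complex.norm_real,
      Complex.norm_real, Real.norm_eq_abs, Real.norm_eq_abs, sq_abs]
    have hu := Real.log_le_sub_one_of_pos (show 0 < 1 + x by linarith)
    have hl := Real.one_sub_inv_le_log_of_pos (show 0 < 1 + x by linarith)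
    have h4 : x - (1 - (1 + x)⁻¹) ≤ x ^ 2 := by
      have : x - (1 - (1 + x)⁻¹) = x ^ 2 / (1 + x) := by field_simp; ring
      rw [this]
      exact div_le_self (sq_nonneg x) (by linarith)
    rw [abs_le]
    constructor <;> nlinarith

lemma one_add_mem_slitPlane {z : ℂ} (hz : ‖z‖ ≤ 1 / 2 ∨ 0 ≤ z.re ∧ z.im = 0) :
    1 + z ∈ Complex.slitPlane := by
  left
  rcases hz with hz | ⟨h1, h2⟩
  · have := (abs_le.mp ((Complex.abs_re_le_norm z).trans hz)).1
    simp; linarith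
  · simp; linarith

end localFactors

section eulerProduct

variable {E : Type*} [Field E] [NumberField E] {g : ℤ → ℂ}

/-- The general term of the twisted Dedekind series. -/
noncomputable def heckeCoeff (E : Type*) [Field E] [NumberField E] (g : ℤ → ℂ) (s : ℝ) (n : ℕ) : ℂ :=
  idealCount E n * twistTerm g s n

/-- The contribution of the powers of `p`. -/
noncomputable def localSum (E : Type*) [Field E] [NumberField E] (g : ℤ → ℂ) (s : ℝ) (p : ℕ) : ℂ :=
  ∑' k : ℕ, heckeCoeff E g s (p ^ (k + 1))

/-- The sum of the twisted series over primes. -/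
noncomputable def primeSum (E : Type*) [Field E] [NumberField E] (g : ℤ → ℂ) (s : ℝ) : ℂ :=
  ∑' p : Nat.Primes, heckeCoeff E g s p

/-- The logarithm of the twisted series. -/
noncomputable def logSeries (E : Type*) [Field E] [NumberField E] (g : ℤ → ℂ) (s : ℝ) : ℂ :=
  ∑' p : Nat.Primes, Complex.log (1 + localSum E g s p)

lemma heckeCoeff_prime_pow_le (hb : ∀ a, ‖g a‖ ≤ 1) {p : ℕ} (hp : p.Prime) (s : ℝ) (k : ℕ) :
    ‖heckeCoeff E g s (p ^ (k + 1))‖ ≤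
      ((k : ℝ) + 2) ^ finrank ℚ E * ((p : ℝ) ^ (-s)) ^ (k + 1) := by
  unfold heckeCoeff twistTerm
  rw [norm_mul, norm_mul, Complex.norm_natCast, Complex.norm_real]
  have h1 : (idealCount E (p ^ (k + 1)) : ℝ) ≤ ((k : ℝ) + 2) ^ finrank ℚ E := by
    have := idealCount_prime_pow_le (E := E) hp (k + 1)
    have h := (Nat.cast_le (α := ℝ)).mpr this
    push_cast at h
    rw [show (k : ℝ) + 1 + 1 = k + 2 by ring] at h
    exact h
  have h2 : ‖(((p ^ (k + 1) : ℕ) : ℝ) ^ (-s))‖ = ((p : ℝ) ^ (-s)) ^ (k + 1) := by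
    rw [Real.norm_of_nonneg (by positivity)]
    push_cast
    rw [← Real.rpow_natCast, ← Real.rpow_natCast, ← Real.rpow_mul (by positivity),
      ← Real.rpow_mul (by positivity), mul_comm]
  rw [h2]
  gcongr
  exact (mul_le_mul_of_nonneg_right (hb _) (by positivity)).trans (one_mul _).le

lemma prime_rpow_le_half {p : ℕ} (hp : p.Prime) {s : ℝ} (hs : 1 < s) :
    (p : ℝ) ^ (-s) ≤ 1 / 2 := by
  have h2 : (2 : ℝ) ≤ p := by exact_mod_cast hp.two_le
  have h1 : (p : ℝ) ^ (-s) ≤ (p : ℝ) ^ (-1 : ℝ) :=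
    Real.rpow_le_rpow_of_exponent_le (by linarith) (by linarith)
  rw [Real.rpow_neg_one] at h1
  refine h1.trans ?_
  rw [one_div]
  exact inv_anti₀ (by norm_num) h2

/-- The condition on `g` ensuring that the local factors lie in a region where the logarithm is
well behaved. -/
def SmallOrTrivial (E : Type*) [Field E] [NumberField E] (g : ℤ → ℂ) : Prop :=
  (∀ a, g a = 1) ∨ ∀ p : ℕ, p.Prime → (p : ℝ) < 2 * eulerBound (finrank ℚ E) →
    ∀ k : ℕ, g ((p ^ (k + 1) : ℕ) : ℤ) = 0

lemma localSum_region (hb : ∀ a, ‖g a‖ ≤ 1) (hg : SmallOrTrivial E g) {p : ℕ} (hp : p.Prime)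
    {s : ℝ} (hs : 1 < s) :
    ‖localSum E g s p‖ ≤ 1 / 2 ∨ 0 ≤ (localSum E g s p).re ∧ (localSum E g s p).im = 0 := by
  rcases hg with hg | hg
  · right
    have : localSum E g s p = ((∑' k : ℕ, (idealCount E (p ^ (k + 1)) : ℝ) *
        (((p ^ (k + 1) : ℕ) : ℝ) ^ (-s)) : ℝ) : ℂ) := by
      rw [Complex.ofReal_tsum]
      refine tsum_congr fun k => ?_
      simp [heckeCoeff, twistTerm, hg]
    rw [this]
    refine ⟨?_, Complex.ofReal_im _⟩
    rw [Complex.ofReal_re]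
    exact tsum_nonneg fun k => by positivity
  · left
    by_cases hlt : (p : ℝ) < 2 * eulerBound (finrank ℚ E)
    · have : localSum E g s p = 0 := by
        rw [localSum, tsum_congr (g := fun _ => (0 : ℂ)) fun k => by
          simp only [heckeCoeff, twistTerm, hg p hp hlt k, zero_mul, mul_zero], tsum_zero]
      rw [this]; norm_num
    · have hp0 : (0 : ℝ) < p := by exact_mod_cast hp.pos
      refine (norm_tsum_le_of_local (by positivity) (prime_rpow_le_half hp hs)
        (heckeCoeff_prime_pow_le hb hp s)).trans ?_
      have h1 : (p : ℝ) ^ (-s) ≤ (p : ℝ) ^ (-1 : ℝ) :=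
        Real.rpow_le_rpow_of_exponent_le (by exact_mod_cast hp.one_le) (by linarith)
      rw [Real.rpow_neg_one] at h1
      calc _ ≤ eulerBound (finrank ℚ E) * (p : ℝ)⁻¹ :=
            mul_le_mul_of_nonneg_left h1 (eulerBound_nonneg _)
        _ ≤ (p : ℝ) / 2 * (p : ℝ)⁻¹ := by
            gcongr; linarith
        _ = 1 / 2 := by field_simp

lemma summable_primes_rpow {s : ℝ} (hs : 1 < s) :
    Summable fun p : Nat.Primes => ((p : ℕ) : ℝ) ^ (-s) :=
  (Real.summable_nat_rpow.mpr (by linarith)).comp_injective Nat.Primes.coe_nat_injective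

lemma norm_localSum_le (hb : ∀ a, ‖g a‖ ≤ 1) {p : ℕ} (hp : p.Prime) {s : ℝ} (hs : 1 < s) :
    ‖localSum E g s p‖ ≤ eulerBound (finrank ℚ E) * (p : ℝ) ^ (-s) :=
  norm_tsum_le_of_local (by positivity) (prime_rpow_le_half hp hs)
    (heckeCoeff_prime_pow_le hb hp s)

lemma summable_localSum (hb : ∀ a, ‖g a‖ ≤ 1) {s : ℝ} (hs : 1 < s) :
    Summable fun p : Nat.Primes => localSum E g s p :=
  Summable.of_norm_bounded ((summable_primes_rpow hs).mul_left (eulerBound (finrank ℚ E)))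
    fun p => norm_localSum_le hb p.2 hs

lemma summable_heckeCoeff (hb : ∀ a, ‖g a‖ ≤ 1) {s : ℝ} (hs : 1 < s) :
    Summable fun n => ‖heckeCoeff E g s n‖ := by
  refine Summable.of_nonneg_of_le (fun _ => norm_nonneg _) (fun n => ?_)
    (summable_idealCount (E := E) hs)
  unfold heckeCoeff twistTerm
  rw [norm_mul, norm_mul, Complex.norm_natCast, Complex.norm_real,
    Real.norm_of_nonneg (by positivity : (0 : ℝ) ≤ (n : ℝ) ^ (-s))]
  gcongr
  exact (mul_le_mul_of_nonneg_right (hb _) (by positivity)).trans (one_mul _).le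

lemma exp_logSeries (hb : ∀ a, ‖g a‖ ≤ 1) (hg : SmallOrTrivial E g) (hg1 : g 1 = 1)
    (hmul : ∀ m n : ℕ, g ((m * n : ℕ) : ℤ) = g m * g n) {s : ℝ} (hs : 1 < s) :
    Complex.exp (logSeries E g s) = ∑' n, heckeCoeff E g s n := by
  have hprod : HasProd (fun p : Nat.Primes => ∑' e : ℕ, heckeCoeff E g s ((p : ℕ) ^ e))
      (∑' n, heckeCoeff E g s n) := by
    refine EulerProduct.eulerProduct_hasProd ?_ ?_ (summable_heckeCoeff hb hs) ?_
    · simp [heckeCoeff, twistTerm, idealCount_one, hg1]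
    · intro m n hmn
      simp only [heckeCoeff, twistTerm]
      rw [idealCount_mul hmn, hmul]
      push_cast
      rw [Real.mul_rpow (by positivity) (by positivity)]
      push_cast
      ring
    · simp [heckeCoeff, twistTerm, Real.zero_rpow (by linarith : -s ≠ 0)]
  have heq : (fun p : Nat.Primes => ∑' e : ℕ, heckeCoeff E g s ((p : ℕ) ^ e)) =
      fun p : Nat.Primes => 1 + localSum E g s p := by
    funext p
    have hs2 := summable_of_local (by positivity) (prime_rpow_le_half p.2 hs)
        (heckeCoeff_prime_pow_le (E := E) hb p.2 s)
    have hs3 : Summable fun e : ℕ => heckeCoeff E g s ((p : ℕ) ^ e) :=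
      (summable_nat_add_iff (f := fun e : ℕ => heckeCoeff E g s ((p : ℕ) ^ e)) 1).mp hs2
    rw [hs3.tsum_eq_zero_add]
    congr 1
    simp [heckeCoeff, twistTerm, idealCount_one, hg1]
  rw [heq] at hprod
  rw [← hprod.tprod_eq]
  refine Complex.cexp_tsum_eq_tprod (fun p => ?_)
    (Complex.summable_log_one_add_of_summable (summable_localSum hb hs))
  exact Complex.slitPlane_ne_zero (one_add_mem_slitPlane (localSum_region hb hg p.2 hs))

lemma summable_heckeCoeff_primes (hb : ∀ a, ‖g a‖ ≤ 1) {s : ℝ} (hs : 1 < s) :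
    Summable fun p : Nat.Primes => heckeCoeff E g s p :=
  ((summable_heckeCoeff hb hs).comp_injective Nat.Primes.coe_nat_injective).of_norm

lemma norm_logSeries_sub_primeSum_le (hb : ∀ a, ‖g a‖ ≤ 1) (hg : SmallOrTrivial E g) :
    ∃ C : ℝ, ∀ s : ℝ, 1 < s → ‖logSeries E g s - primeSum E g s‖ ≤ C := by
  set K := eulerBound (finrank ℚ E) with hK
  refine ⟨(K ^ 2 + 2 * K) * ∑' p : Nat.Primes, ((p : ℕ) : ℝ) ^ (-2 : ℝ), fun s hs => ?_⟩
  rw [logSeries, primeSum, ← Summable.tsum_sub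
    (Complex.summable_log_one_add_of_summable (summable_localSum hb hs))
    (summable_heckeCoeff_primes hb hs)]
  refine tsum_of_norm_bounded
    ((summable_primes_rpow (by norm_num : (1 : ℝ) < 2)).hasSum.mul_left _) fun p => ?_
  have hp0 : (1 : ℝ) ≤ ((p : ℕ) : ℝ) := by exact_mod_cast p.2.one_le
  have h1 := norm_log_one_add_sub_le (localSum_region (E := E) hb hg p.2 hs)
  have h2 := norm_localSum_le (E := E) hb p.2 hs
  have h3 := norm_tsum_sub_le_of_local (by positivity) (prime_rpow_le_half p.2 hs)
    (heckeCoeff_prime_pow_le (E := E) hb p.2 s)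
  have h3' : ‖localSum E g s p - heckeCoeff E g s p‖ ≤ 2 * K * (((p : ℕ) : ℝ) ^ (-s)) ^ 2 := by
    have h := h3
    rw [zero_add, pow_one] at h
    exact h
  have h4 : (((p : ℕ) : ℝ) ^ (-s)) ^ 2 ≤ ((p : ℕ) : ℝ) ^ (-2 : ℝ) := by
    rw [← Real.rpow_natCast, ← Real.rpow_mul (by positivity)]
    refine Real.rpow_le_rpow_of_exponent_le hp0 ?_
    push_cast; linarith
  have h5 : ‖localSum E g s p‖ ^ 2 ≤ K ^ 2 * (((p : ℕ) : ℝ) ^ (-s)) ^ 2 := by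
    rw [← mul_pow]
    exact pow_le_pow_left₀ (norm_nonneg _) h2 2
  have hK0 : 0 ≤ K := eulerBound_nonneg _
  calc _ = ‖(Complex.log (1 + localSum E g s p) - localSum E g s p) +
        (localSum E g s p - heckeCoeff E g s p)‖ := by congr 1; ring
    _ ≤ _ := norm_add_le _ _
    _ ≤ (K ^ 2 + 2 * K) * (((p : ℕ) : ℝ) ^ (-s)) ^ 2 := by linarith
    _ ≤ _ := by gcongr

lemma continuousOn_localSum (hb : ∀ a, ‖g a‖ ≤ 1) {p : ℕ} (hp : p.Prime) :
    ContinuousOn (fun s => localSum E g s p) (Set.Ioi 1) := by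
  refine continuousOn_tsum (u := fun k : ℕ => ((k : ℝ) + 2) ^ finrank ℚ E * (1 / 2) ^ k)
    (fun k => ?_) (summable_eulerBound _) fun k s hs => ?_
  · unfold heckeCoeff twistTerm
    have hpos : (0 : ℝ) < ((p ^ (k + 1) : ℕ) : ℝ) := by
      exact_mod_cast pow_pos hp.pos _
    refine Continuous.continuousOn (continuous_const.mul (continuous_const.mul ?_))
    exact Complex.continuous_ofReal.comp
      (Real.continuous_const_rpow hpos.ne' |>.comp continuous_neg)
  · have h1 := norm_le_of_local (by positivity) (prime_rpow_le_half hp hs)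
      (heckeCoeff_prime_pow_le (E := E) hb hp s) k
    refine h1.trans ((mul_le_mul_of_nonneg_right (prime_rpow_le_half hp hs)
      (by positivity)).trans ?_)
    have : 0 ≤ ((k : ℝ) + 2) ^ finrank ℚ E * (1 / 2 : ℝ) ^ k := by positivity
    linarith

lemma continuousOn_logSeries (hb : ∀ a, ‖g a‖ ≤ 1) (hg : SmallOrTrivial E g) :
    ContinuousOn (logSeries E g) (Set.Ioi 1) := by
  set K := eulerBound (finrank ℚ E) with hK
  have hK0 : 0 ≤ K := eulerBound_nonneg _
  have key : ∀ s₀ : ℝ, 1 < s₀ → ContinuousOn (logSeries E g) (Set.Ioi s₀) := by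
    intro s₀ hs₀
    refine continuousOn_tsum (u := fun p : Nat.Primes => (K + K ^ 2) * ((p : ℕ) : ℝ) ^ (-s₀))
      (fun p => ?_) ((summable_primes_rpow hs₀).mul_left _) fun p s hs => ?_
    · refine ContinuousOn.clog (continuousOn_const.add
        ((continuousOn_localSum hb p.2).mono (Set.Ioi_subset_Ioi hs₀.le))) fun s hs => ?_
      exact one_add_mem_slitPlane (localSum_region hb hg p.2 (hs₀.trans hs))
    · have hs1 : 1 < s := hs₀.trans hs
      have hp0 : (1 : ℝ) ≤ ((p : ℕ) : ℝ) := by exact_mod_cast p.2.one_le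
      have h1 := norm_log_one_add_sub_le (localSum_region (E := E) hb hg p.2 hs1)
      have h2 := norm_localSum_le (E := E) hb p.2 hs1
      have h4 : ((p : ℕ) : ℝ) ^ (-s) ≤ ((p : ℕ) : ℝ) ^ (-s₀) :=
        Real.rpow_le_rpow_of_exponent_le hp0 (by have : s₀ < s := hs; linarith)
      have h6 := prime_rpow_le_half p.2 hs1
      have h7 : 0 ≤ ((p : ℕ) : ℝ) ^ (-s) := by positivity
      have h5 : ‖localSum E g s p‖ ^ 2 ≤ K ^ 2 * ((p : ℕ) : ℝ) ^ (-s) := by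
        calc _ ≤ (K * ((p : ℕ) : ℝ) ^ (-s)) ^ 2 := pow_le_pow_left₀ (norm_nonneg _) h2 2
          _ = K ^ 2 * (((p : ℕ) : ℝ) ^ (-s)) ^ 2 := by ring
          _ ≤ _ := by gcongr; nlinarith
      calc _ = ‖(Complex.log (1 + localSum E g s p) - localSum E g s p) + localSum E g s p‖ := by
            congr 1; ring
        _ ≤ _ := norm_add_le _ _
        _ ≤ (K + K ^ 2) * ((p : ℕ) : ℝ) ^ (-s) := by linarith
        _ ≤ _ := by gcongr
  intro s hs
  have hs : 1 < s := hs
  have := (key ((1 + s) / 2) (by linarith)).continuousAt (Ioi_mem_nhds (by linarith : (1 + s) / 2 < s))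
  exact this.continuousWithinAt

end eulerProduct

end

section

open Filter Topology Asymptotics

section boundedLogs

lemma tendsto_neg_log_sub_one :
    Tendsto (fun s : ℝ => -Real.log (s - 1)) (𝓝[>] 1) atTop := by
  refine tendsto_neg_atBot_atTop.comp (Real.tendsto_log_nhdsGT_zero.comp ?_)
  refine tendsto_nhdsWithin_iff.mpr ⟨?_, ?_⟩
  · have : Tendsto (fun s : ℝ => s - 1) (𝓝 1) (𝓝 (1 - 1)) := (continuous_sub_right 1).tendsto 1
    rw [sub_self] at this
    exact this.mono_left nhdsWithin_le_nhds
  · filter_upwards [self_mem_nhdsWithin] with s hs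
    have : (1 : ℝ) < s := hs
    exact sub_pos.mpr this

lemma not_isBigO_neg_log_sub_one :
    ¬ (fun s : ℝ => -Real.log (s - 1)) =O[𝓝[>] 1] (fun _ => (1 : ℝ)) := by
  intro h
  obtain ⟨C, hC⟩ := h.bound
  obtain ⟨s, h1, h2⟩ := (hC.and (tendsto_neg_log_sub_one.eventually_gt_atTop C)).exists
  rw [norm_one, mul_one] at h1
  exact absurd (h1.trans_lt h2) (not_lt.mpr (Real.le_norm_self _))

lemma isBigO_one_of_bounds {f : ℝ → ℝ} {l : Filter ℝ} {a b : ℝ} (h : ∀ᶠ s in l, a ≤ f s ∧ f s ≤ b) :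
    f =O[l] (fun _ => (1 : ℝ)) := by
  refine IsBigO.of_bound (max |a| |b|) ?_
  filter_upwards [h] with s hs
  rw [norm_one, mul_one, Real.norm_eq_abs]
  exact abs_le_max_abs_abs hs.1 hs.2

lemma isBigO_re {f : ℝ → ℂ} {l : Filter ℝ} (h : f =O[l] (fun _ => (1 : ℝ))) :
    (fun s => (f s).re) =O[l] (fun _ => (1 : ℝ)) :=
  (IsBigO.of_bound 1 (Eventually.of_forall fun s => by
    rw [one_mul]; exact Complex.abs_re_le_norm _)).trans h

/-- If `exp ∘ G` has a simple pole at `1`, then `Re G` is `-log (s - 1)` up to a bounded error. -/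
lemma re_sub_log_isBigO_of_pole {G : ℝ → ℂ} {κ : ℂ} (hκ : κ ≠ 0)
    (h : Tendsto (fun s : ℝ => ((s : ℂ) - 1) * Complex.exp (G s)) (𝓝[>] 1) (𝓝 κ)) :
    (fun s : ℝ => (G s).re - -Real.log (s - 1)) =O[𝓝[>] 1] (fun _ => (1 : ℝ)) := by
  have h1 : Tendsto (fun s : ℝ => Real.log ‖((s : ℂ) - 1) * Complex.exp (G s)‖) (𝓝[>] 1)
      (𝓝 (Real.log ‖κ‖)) := (h.norm).log (norm_ne_zero_iff.mpr hκ)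
  refine (h1.isBigO_one ℝ).congr' ?_ EventuallyEq.rfl
  filter_upwards [self_mem_nhdsWithin] with s hs
  have hs : (0 : ℝ) < s - 1 := sub_pos.mpr hs
  have h2 : ((s : ℂ) - 1) = ((s - 1 : ℝ) : ℂ) := by push_cast; ring
  rw [norm_mul, h2, Complex.norm_real, Real.norm_of_nonneg hs.le, Complex.norm_exp,
    Real.log_mul hs.ne' (Real.exp_pos _).ne', Real.log_exp]
  ring

lemma eventually_re_le_of_tendsto_exp {G : ℝ → ℂ} {z : ℂ}
    (h : Tendsto (fun s : ℝ => Complex.exp (G s)) (𝓝[>] 1) (𝓝 z)) :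
    ∃ C : ℝ, ∀ᶠ s in 𝓝[>] (1 : ℝ), (G s).re ≤ C := by
  refine ⟨Real.log (‖z‖ + 1), ?_⟩
  filter_upwards [h.norm.eventually_lt_const (lt_add_one ‖z‖)] with s hs
  rw [Complex.norm_exp] at hs
  rw [Real.le_log_iff_exp_le (by positivity)]
  exact hs.le

/-- A continuous logarithm of a function with nonzero limit is bounded. -/
lemma isBigO_one_of_tendsto_exp {G : ℝ → ℂ} (hG : ContinuousOn G (Set.Ioi 1)) {z : ℂ} (hz : z ≠ 0)
    (h : Tendsto (fun s : ℝ => Complex.exp (G s)) (𝓝[>] 1) (𝓝 z)) :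
    G =O[𝓝[>] 1] (fun _ => (1 : ℝ)) := by
  have h1 : Tendsto (fun s => Complex.exp (G s) / z) (𝓝[>] 1) (𝓝 1) := by
    have := h.div_const z
    rwa [div_self hz] at this
  have hball : ∀ᶠ s in 𝓝[>] (1 : ℝ), Complex.exp (G s) / z ∈ Complex.slitPlane :=
    h1.eventually (Complex.isOpen_slitPlane.mem_nhds Complex.one_mem_slitPlane)
  obtain ⟨b, hb1, hb⟩ := mem_nhdsGT_iff_exists_Ioo_subset.mp hball
  have hb1 : (1 : ℝ) < b := hb1
  set H : ℝ → ℂ := fun s => G s - Complex.log (Complex.exp (G s) / z) with hH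
  have hGc : ContinuousOn G (Set.Ioo 1 b) := hG.mono fun s hs => hs.1
  have hHc : ContinuousOn H (Set.Ioo 1 b) := by
    refine hGc.sub (ContinuousOn.clog ?_ fun s hs => hb hs)
    exact (Complex.continuous_exp.comp_continuousOn hGc).div_const z
  have hexp : ∀ s ∈ Set.Ioo 1 b, ∃ n : ℤ, H s = Complex.log z + n * (2 * Real.pi * Complex.I) := by
    intro s hs
    rw [← Complex.exp_eq_exp_iff_exists_int, Complex.exp_log hz, hH]
    simp only
    rw [Complex.exp_sub, Complex.exp_log (Complex.slitPlane_ne_zero (hb hs))]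
    field_simp [Complex.exp_ne_zero]
  set s₀ := (1 + b) / 2 with hs₀
  have hs₀m : s₀ ∈ Set.Ioo 1 b := ⟨by rw [hs₀]; linarith, by rw [hs₀]; linarith⟩
  have hconst : ∀ s ∈ Set.Ioo 1 b, H s = H s₀ := by
    intro s hs
    have hmap : Set.MapsTo (fun s => ((H s - Complex.log z) / (2 * Real.pi * Complex.I)).re)
        (Set.Ioo 1 b) (Set.range ((↑) : ℤ → ℝ)) := by
      intro s hs
      obtain ⟨n, hn⟩ := hexp s hs
      refine ⟨n, ?_⟩
      simp only
      rw [hn, add_sub_cancel_left, mul_div_assoc, div_self Complex.two_pi_I_ne_zero]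
      simp
    have hcont : ContinuousOn (fun s => ((H s - Complex.log z) / (2 * Real.pi * Complex.I)).re)
        (Set.Ioo 1 b) :=
      Complex.continuous_re.comp_continuousOn ((hHc.sub continuousOn_const).div_const _)
    have hd : DiscreteTopology (Set.range ((↑) : ℤ → ℝ)) := by
      have := Int.isClosedEmbedding_coe_real.isEmbedding.toHomeomorph
      exact this.symm.isEmbedding.discreteTopology
    have := isPreconnected_Ioo.constant_of_mapsTo ⟨hd⟩ hcont hmap hs hs₀m
    obtain ⟨n, hn⟩ := hexp s hs
    obtain ⟨n', hn'⟩ := hexp s₀ hs₀m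
    rw [hn, hn', add_sub_cancel_left, add_sub_cancel_left,
      mul_div_cancel_right₀ _ Complex.two_pi_I_ne_zero,
      mul_div_cancel_right₀ _ Complex.two_pi_I_ne_zero] at this
    simp only [Complex.intCast_re, Int.cast_inj] at this
    rw [hn, hn', this]
  have hlog : (fun s => Complex.log (Complex.exp (G s) / z)) =O[𝓝[>] 1] (fun _ => (1 : ℝ)) := by
    have := (h1.clog Complex.one_mem_slitPlane)
    exact this.isBigO_one ℝ
  have := hlog.add (isBigO_const_const (H s₀) (one_ne_zero (α := ℝ)) (𝓝[>] 1))
  refine this.congr' ?_ EventuallyEq.rfl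
  filter_upwards [Ioo_mem_nhdsGT hb1] with s hs
  rw [← hconst s hs, hH]
  ring

end boundedLogs

end

section

open Filter Topology Asymptotics

section characterArgument

variable {m : ℕ} [NeZero m]

open Classical in
lemma sum_even_characters (a : (ZMod m)ˣ) (b : (ZMod m)ˣ) :
    ∑ χ : DirichletCharacter ℂ m with χ (-1) = 1, χ ((a⁻¹ : (ZMod m)ˣ) : ZMod m) * χ (b : ZMod m) =
      (m.totient : ℂ) / 2 * ((if b = a then 1 else 0) + (if b = -a then 1 else 0)) := by
  have key : ∀ χ : DirichletCharacter ℂ m,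
      (if χ (-1) = 1 then χ ((a⁻¹ : (ZMod m)ˣ) : ZMod m) * χ (b : ZMod m) else 0) =
      (1 / 2 : ℂ) * (χ ((a⁻¹ * b : (ZMod m)ˣ) : ZMod m) + χ ((a⁻¹ * -b : (ZMod m)ˣ) : ZMod m)) := by
    intro χ
    have hsq : χ (-1) * χ (-1) = 1 := by rw [← map_mul]; simp
    have h1 : χ ((a⁻¹ * b : (ZMod m)ˣ) : ZMod m) =
        χ ((a⁻¹ : (ZMod m)ˣ) : ZMod m) * χ (b : ZMod m) := by rw [Units.val_mul, map_mul]
    have h2 : χ ((a⁻¹ * -b : (ZMod m)ˣ) : ZMod m) =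
        χ (-1) * (χ ((a⁻¹ : (ZMod m)ˣ) : ZMod m) * χ (b : ZMod m)) := by
      rw [Units.val_mul, Units.val_neg, map_mul, neg_eq_neg_one_mul, map_mul]; ring
    rw [h1, h2]
    rcases mul_self_eq_one_iff.mp hsq with h | h
    · rw [h, if_pos rfl]; ring
    · rw [h, if_neg (by norm_num)]; ring
  rw [Finset.sum_filter, Finset.sum_congr rfl fun χ _ => key χ, ← Finset.mul_sum,
    Finset.sum_add_distrib, DirichletCharacter.sum_characters_eq ℂ,
    DirichletCharacter.sum_characters_eq ℂ]
  have e1 : ((a⁻¹ * b : (ZMod m)ˣ) : ZMod m) = 1 ↔ b = a := by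
    rw [Units.val_eq_one, inv_mul_eq_one, eq_comm]
  have e2 : ((a⁻¹ * -b : (ZMod m)ˣ) : ZMod m) = 1 ↔ b = -a := by
    rw [Units.val_eq_one, inv_mul_eq_one, eq_comm, neg_eq_iff_eq_neg]
  simp only [e1, e2]
  split_ifs <;> ring

/-- The combination of the class functions `T` with coefficients a Dirichlet character. -/
noncomputable def charSum (T : (ZMod m)ˣ → ℝ → ℝ) (χ : DirichletCharacter ℂ m) (s : ℝ) : ℂ :=
  ∑ c : (ZMod m)ˣ, χ (c : ZMod m) * T c s

open Classical in
lemma sum_even_charSum (T : (ZMod m)ˣ → ℝ → ℝ) (ha : (1 : (ZMod m)ˣ) ≠ -1) (a : (ZMod m)ˣ) (s : ℝ) :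
    ∑ χ : DirichletCharacter ℂ m with χ (-1) = 1,
      χ ((a⁻¹ : (ZMod m)ˣ) : ZMod m) * charSum T χ s =
      (m.totient : ℂ) / 2 * ((T a s + T (-a) s : ℝ) : ℂ) := by
  have hne : -a ≠ a := by
    intro h
    apply ha
    have := congrArg (a⁻¹ * ·) h
    simpa using this.symm
  simp only [charSum, Finset.mul_sum]
  rw [Finset.sum_comm]
  have : ∀ c : (ZMod m)ˣ, ∑ χ : DirichletCharacter ℂ m with χ (-1) = 1,
      χ ((a⁻¹ : (ZMod m)ˣ) : ZMod m) * (χ (c : ZMod m) * (T c s : ℂ)) =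
      (m.totient : ℂ) / 2 * ((if c = a then (T c s : ℂ) else 0) +
        (if c = -a then (T c s : ℂ) else 0)) := by
    intro c
    simp only [← mul_assoc]
    rw [← Finset.sum_mul, sum_even_characters]
    split_ifs <;> ring
  rw [Finset.sum_congr rfl fun c _ => this c, ← Finset.mul_sum, Finset.sum_add_distrib]
  simp

variable {T : (ZMod m)ˣ → ℝ → ℝ}

open Classical in
/-- The sums over subgroups of classes are asymptotically equidistributed. -/
def SubgroupEquidistributed (T : (ZMod m)ˣ → ℝ → ℝ) : Prop :=
  ∀ K' : Subgroup (ZMod m)ˣ,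
    (fun s : ℝ => (∑ c, if c ∈ K' then T c s else 0) - (K'.index : ℝ)⁻¹ * -Real.log (s - 1))
      =O[𝓝[>] 1] (fun _ => (1 : ℝ))

lemma sum_sub_log_isBigO (hK : SubgroupEquidistributed T) :
    (fun s : ℝ => (∑ c, T c s) - -Real.log (s - 1)) =O[𝓝[>] 1] (fun _ => (1 : ℝ)) := by
  simpa using hK ⊤

lemma charSum_not_pole (hT : ∀ c s, 1 < s → 0 ≤ T c s) (hK : SubgroupEquidistributed T)
    {χ : DirichletCharacter ℂ m} (hχ : χ ≠ 1) :
    ¬ (fun s : ℝ => (charSum T χ s).re - -Real.log (s - 1)) =O[𝓝[>] 1] (fun _ => (1 : ℝ)) := by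
  classical
  intro hpole
  have h1 := (sum_sub_log_isBigO hK).sub hpole
  have hre : ∀ c : (ZMod m)ˣ, (χ (c : ZMod m)).re ≤ 1 := fun c =>
    (Complex.re_le_norm _).trans (DirichletCharacter.unit_norm_eq_one χ c).le
  have h2 : (fun s : ℝ => ∑ c : (ZMod m)ˣ, (1 - (χ (c : ZMod m)).re) * T c s) =O[𝓝[>] 1]
      (fun _ => (1 : ℝ)) := by
    refine h1.congr_left fun s => ?_
    simp only [charSum, Complex.re_sum, Complex.re_mul_ofReal, sub_mul, one_mul,
      Finset.sum_sub_distrib]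
    ring
  have h3 : ∀ c : (ZMod m)ˣ, χ (c : ZMod m) ≠ 1 → T c =O[𝓝[>] 1] (fun _ => (1 : ℝ)) := by
    intro c hc
    have hlt : 0 < 1 - (χ (c : ZMod m)).re := by
      rcases (hre c).lt_or_eq with h | h
      · linarith
      · exfalso
        apply hc
        have hn := DirichletCharacter.unit_norm_eq_one χ c
        have h4 : (χ (c : ZMod m)).im = 0 := by
          have := Complex.sq_norm (χ (c : ZMod m))
          rw [hn, Complex.normSq_apply, h] at this
          nlinarith
        exact Complex.ext h h4
    have h4 : (fun s => (1 - (χ (c : ZMod m)).re) * T c s) =O[𝓝[>] 1]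
        (fun s : ℝ => ∑ c : (ZMod m)ˣ, (1 - (χ (c : ZMod m)).re) * T c s) := by
      refine IsBigO.of_bound 1 ?_
      filter_upwards [self_mem_nhdsWithin] with s hs
      have hnn : ∀ c : (ZMod m)ˣ, 0 ≤ (1 - (χ (c : ZMod m)).re) * T c s := fun c =>
        mul_nonneg (by linarith [hre c]) (hT c s hs)
      rw [one_mul, Real.norm_of_nonneg (hnn c),
        Real.norm_of_nonneg (Finset.sum_nonneg fun c _ => hnn c)]
      exact Finset.single_le_sum (f := fun c : (ZMod m)ˣ => (1 - (χ (c : ZMod m)).re) * T c s)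
        (fun c _ => hnn c) (Finset.mem_univ c)
    exact (isBigO_const_mul_left_iff hlt.ne').mp (h4.trans h2)
  set K' : Subgroup (ZMod m)ˣ := χ.toUnitHom.ker with hK'
  have hmem : ∀ c : (ZMod m)ˣ, c ∈ K' ↔ χ (c : ZMod m) = 1 := by
    intro c
    rw [hK', MonoidHom.mem_ker, Units.ext_iff, MulChar.coe_toUnitHom, Units.val_one]
  have hidx : 1 < K'.index := by
    apply Subgroup.one_lt_index_of_ne_top
    intro htop
    apply hχ
    ext c
    rw [(hmem c).mp (htop ▸ Subgroup.mem_top c)]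
    simp
  have h5 : (fun s : ℝ => ∑ c, if c ∈ K' then 0 else T c s) =O[𝓝[>] 1] (fun _ => (1 : ℝ)) := by
    have : (∑ c : (ZMod m)ˣ, fun s : ℝ => if c ∈ K' then 0 else T c s) =O[𝓝[>] 1]
        (fun _ => (1 : ℝ)) := by
      refine IsBigO.sum fun c _ => ?_
      by_cases hc : c ∈ K'
      · simp only [hc, if_true]
        exact isBigO_zero _ _
      · simp only [hc, if_false]
        exact h3 c fun h => hc ((hmem c).mpr h)
    refine this.congr_left fun s => ?_
    simp
  have h6 := ((sum_sub_log_isBigO hK).sub (hK K')).sub h5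
  have h7 : (fun s : ℝ => (1 - (K'.index : ℝ)⁻¹) * -Real.log (s - 1)) =O[𝓝[>] 1]
      (fun _ => (1 : ℝ)) := by
    refine h6.neg_left.congr_left fun s => ?_
    have : ∑ c, T c s = (∑ c, if c ∈ K' then T c s else 0) + ∑ c, if c ∈ K' then 0 else T c s := by
      rw [← Finset.sum_add_distrib]
      refine Finset.sum_congr rfl fun c _ => ?_
      split_ifs <;> simp
    rw [this]; ring
  have hidx' : (1 : ℝ) < K'.index := by exact_mod_cast hidx
  have h8 : (1 - (K'.index : ℝ)⁻¹) ≠ 0 := by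
    have := inv_lt_one_of_one_lt₀ hidx'
    linarith
  exact not_isBigO_neg_log_sub_one ((isBigO_const_mul_left_iff h8).mp h7)

/-- The analytic input for a character `χ`. -/
def HasLogarithm (T : (ZMod m)ˣ → ℝ → ℝ) (χ : DirichletCharacter ℂ m) : Prop :=
  ∃ G : ℝ → ℂ, ContinuousOn G (Set.Ioi 1) ∧
    (fun s => G s - charSum T χ s) =O[𝓝[>] 1] (fun _ => (1 : ℝ)) ∧
    ((∃ κ : ℂ, κ ≠ 0 ∧
        Tendsto (fun s : ℝ => ((s : ℂ) - 1) * Complex.exp (G s)) (𝓝[>] 1) (𝓝 κ)) ∨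
      ∃ z, Tendsto (fun s : ℝ => Complex.exp (G s)) (𝓝[>] 1) (𝓝 z))

open Classical in
/-- Under the analytic input for all even characters, each pair of opposite classes has a
logarithmically divergent sum. -/
theorem not_isBigO_class (hm : (1 : (ZMod m)ˣ) ≠ -1) (hT : ∀ c s, 1 < s → 0 ≤ T c s)
    (hK : SubgroupEquidistributed T)
    (hχ : ∀ χ : DirichletCharacter ℂ m, χ (-1) = 1 → χ ≠ 1 → HasLogarithm T χ) (a : (ZMod m)ˣ) :
    ¬ (fun s => T a s + T (-a) s) =O[𝓝[>] 1] (fun _ => (1 : ℝ)) := by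
  have hone : (fun s => (charSum T 1 s) - ((-Real.log (s - 1) : ℝ) : ℂ)) =O[𝓝[>] 1]
      (fun _ => (1 : ℝ)) := by
    have := sum_sub_log_isBigO hK
    refine (IsBigO.of_bound 1 (Eventually.of_forall fun s => ?_)).trans this
    have h : charSum T 1 s = ((∑ c, T c s : ℝ) : ℂ) := by
      simp [charSum]
    rw [h, ← Complex.ofReal_sub, Complex.norm_real, one_mul]
  have hcoset : (fun s : ℝ => (m.totient : ℝ) / 2 * (T 1 s + T (-1) s) - -Real.log (s - 1))
      =O[𝓝[>] 1] (fun _ => (1 : ℝ)) := by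
    set K' : Subgroup (ZMod m)ˣ := Subgroup.zpowers (-1) with hK'
    have hmem : ∀ c, c ∈ K' ↔ c = 1 ∨ c = -1 := by
      intro c
      rw [hK', Subgroup.mem_zpowers_iff]
      constructor
      · rintro ⟨k, rfl⟩
        rcases Int.even_or_odd k with hk | hk
        · left; exact hk.neg_one_zpow
        · right; exact hk.neg_one_zpow
      · rintro (rfl | rfl)
        · exact ⟨0, by simp⟩
        · exact ⟨1, by simp⟩
    have hord : Nat.card K' = 2 := by
      rw [hK', Nat.card_zpowers]
      exact orderOf_eq_prime (by simp) hm.symm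
    have hidx : (K'.index : ℝ) = (m.totient : ℝ) / 2 := by
      have h := K'.card_mul_index
      rw [hord, Nat.card_eq_fintype_card, ZMod.card_units_eq_totient] at h
      rw [← h]; push_cast; ring
    have h0 : (K'.index : ℝ) ≠ 0 := by
      exact_mod_cast Subgroup.index_ne_zero_of_finite
    refine ((hK K').const_mul_left (K'.index : ℝ)).congr_left fun s => ?_
    have hsum : (∑ c, if c ∈ K' then T c s else 0) = T 1 s + T (-1) s := by
      simp only [hmem]
      rw [← Finset.sum_filter, Finset.filter_or, Finset.sum_union]
      · simp [Finset.filter_eq']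
      · rw [Finset.disjoint_left]
        intro c h1 h2
        simp only [Finset.mem_filter, Finset.mem_univ, true_and] at h1 h2
        exact hm (h1.symm.trans h2)
    rw [hsum, mul_sub, hidx, ← mul_assoc, mul_inv_cancel₀ (hidx ▸ h0), one_mul]
  choose! G hGc hGb hGe using hχ
  have hlim : ∀ χ : DirichletCharacter ℂ m, χ (-1) = 1 → χ ≠ 1 →
      ∃ z, Tendsto (fun s : ℝ => Complex.exp (G χ s)) (𝓝[>] 1) (𝓝 z) := by
    intro χ h1 h2
    rcases hGe χ h1 h2 with ⟨κ, hκ, h⟩ | h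
    · exfalso
      refine charSum_not_pole hT hK h2 ?_
      refine ((re_sub_log_isBigO_of_pole hκ h).sub (isBigO_re (hGb χ h1 h2))).congr_left
        fun s => ?_
      rw [Complex.sub_re]; ring
    · exact h
  have hup : ∀ χ : DirichletCharacter ℂ m, χ (-1) = 1 → χ ≠ 1 →
      ∃ C : ℝ, ∀ᶠ s in 𝓝[>] (1 : ℝ), (charSum T χ s).re ≤ C := by
    intro χ h1 h2
    obtain ⟨z, hz⟩ := hlim χ h1 h2
    obtain ⟨C, hC⟩ := eventually_re_le_of_tendsto_exp hz
    obtain ⟨C', hC'⟩ := (isBigO_re (hGb χ h1 h2)).bound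
    refine ⟨C + C', ?_⟩
    filter_upwards [hC, hC'] with s hs hs'
    rw [norm_one, mul_one, Complex.sub_re, Real.norm_eq_abs] at hs'
    linarith [(abs_le.mp hs').1]
  set Ev : Finset (DirichletCharacter ℂ m) := {χ | χ (-1) = 1} with hEv
  have hEv1 : ∀ χ, χ ∈ Ev.erase 1 ↔ χ ≠ 1 ∧ χ (-1) = 1 := by
    intro χ; simp [hEv]
  have h1Ev : (1 : DirichletCharacter ℂ m) ∈ Ev := by
    simp only [hEv, Finset.mem_filter, Finset.mem_univ, true_and]
    exact MulChar.one_apply (by simp)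
  have hsumre : (fun s => ∑ χ ∈ Ev.erase 1, (charSum T χ s).re) =O[𝓝[>] 1]
      (fun _ => (1 : ℝ)) := by
    refine (hcoset.sub (isBigO_re hone)).congr_left fun s => ?_
    have h := sum_even_charSum T hm 1 s
    simp only [inv_one, Units.val_one, map_one, one_mul] at h
    rw [← hEv, ← Finset.add_sum_erase _ _ h1Ev] at h
    have h2 := congrArg Complex.re h
    have h3 : (m.totient : ℂ) / 2 = ((m.totient / 2 : ℝ) : ℂ) := by push_cast; rfl
    rw [h3, ← Complex.ofReal_mul, Complex.ofReal_re, Complex.add_re, Complex.re_sum] at h2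
    rw [Complex.sub_re, Complex.ofReal_re]
    linarith
  have hlow : ∀ χ : DirichletCharacter ℂ m, χ (-1) = 1 → χ ≠ 1 →
      (fun s => (charSum T χ s).re) =O[𝓝[>] 1] (fun _ => (1 : ℝ)) := by
    intro χ h1 h2
    choose! C hC using hup
    obtain ⟨D, hD⟩ := hsumre.bound
    have hall : ∀ᶠ s in 𝓝[>] (1 : ℝ), ∀ χ ∈ Ev.erase 1, (charSum T χ s).re ≤ C χ := by
      rw [Filter.eventually_all_finset]
      intro χ hχ
      exact hC χ ((hEv1 χ).mp hχ).2 ((hEv1 χ).mp hχ).1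
    have hχm : χ ∈ Ev.erase 1 := (hEv1 χ).mpr ⟨h2, h1⟩
    refine isBigO_one_of_bounds (a := -D - ∑ ψ ∈ (Ev.erase 1).erase χ, C ψ) (b := C χ) ?_
    filter_upwards [hall, hD] with s hs hs'
    refine ⟨?_, hs χ hχm⟩
    rw [norm_one, mul_one, Real.norm_eq_abs, ← Finset.add_sum_erase _ _ hχm] at hs'
    have h3 : ∑ ψ ∈ (Ev.erase 1).erase χ, (charSum T ψ s).re ≤
        ∑ ψ ∈ (Ev.erase 1).erase χ, C ψ :=
      Finset.sum_le_sum fun ψ hψ => hs ψ (Finset.mem_of_mem_erase hψ)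
    linarith [(abs_le.mp hs').1]
  have hbdd : ∀ χ : DirichletCharacter ℂ m, χ (-1) = 1 → χ ≠ 1 →
      charSum T χ =O[𝓝[>] 1] (fun _ => (1 : ℝ)) := by
    intro χ h1 h2
    obtain ⟨z, hz⟩ := hlim χ h1 h2
    have hGre : (fun s => (G χ s).re) =O[𝓝[>] 1] (fun _ => (1 : ℝ)) := by
      refine ((hlow χ h1 h2).add (isBigO_re (hGb χ h1 h2))).congr_left fun s => ?_
      rw [Complex.sub_re]; ring
    have hz0 : z ≠ 0 := by
      rintro rfl
      obtain ⟨C, hC⟩ := hGre.bound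
      have h3 := hz.norm
      rw [norm_zero] at h3
      obtain ⟨s, h4, h5⟩ := ((h3.eventually_lt_const (Real.exp_pos (-C))).and hC).exists
      rw [Complex.norm_exp, Real.exp_lt_exp] at h4
      rw [norm_one, mul_one, Real.norm_eq_abs] at h5
      linarith [(abs_le.mp h5).1]
    refine ((isBigO_one_of_tendsto_exp (hGc χ h1 h2) hz0 hz).sub (hGb χ h1 h2)).congr_left
      fun s => sub_sub_cancel _ _
  intro hcon
  have h1 : (fun s => ∑ χ ∈ Ev.erase 1, χ ((a⁻¹ : (ZMod m)ˣ) : ZMod m) * charSum T χ s) =O[𝓝[>] 1]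
      (fun _ => (1 : ℝ)) := by
    have : (∑ χ ∈ Ev.erase 1, fun s => χ ((a⁻¹ : (ZMod m)ˣ) : ZMod m) * charSum T χ s) =O[𝓝[>] 1]
        (fun _ => (1 : ℝ)) := IsBigO.sum fun χ hχ =>
      (hbdd χ ((hEv1 χ).mp hχ).2 ((hEv1 χ).mp hχ).1).const_mul_left _
    refine this.congr_left fun s => ?_
    simp
  have h2 := (hcon.const_mul_left ((m.totient : ℝ) / 2)).sub (isBigO_re (hone.add h1))
  refine not_isBigO_neg_log_sub_one (h2.congr_left fun s => ?_)
  have h := sum_even_charSum T hm a s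
  rw [← hEv, ← Finset.add_sum_erase _ _ h1Ev, MulChar.one_apply (Units.isUnit _), one_mul] at h
  have h3 := congrArg Complex.re h
  have h4 : (m.totient : ℂ) / 2 = ((m.totient / 2 : ℝ) : ℂ) := by push_cast; rfl
  rw [h4, ← Complex.ofReal_mul, Complex.ofReal_re, Complex.add_re] at h3
  simp only [Complex.sub_re, Complex.add_re, Complex.ofReal_re]
  linarith

end characterArgument

end

section

open NumberField Module Filter Topology Asymptotics

section weightedPrimeSums

/-- The Dirichlet series over primes with coefficients `u`. -/
noncomputable def primeDirichlet (u : ℕ → ℂ) (s : ℝ) : ℂ :=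
  ∑' p : Nat.Primes, u p * ((((p : ℕ) : ℝ) ^ (-s) : ℝ) : ℂ)

lemma primeDirichlet_isBigO {u : ℕ → ℂ} (hu : {p : ℕ | p.Prime ∧ u p ≠ 0}.Finite) :
    primeDirichlet u =O[𝓝[>] 1] (fun _ => (1 : ℝ)) := by
  have hfin : {p : Nat.Primes | u p ≠ 0}.Finite := by
    refine Set.Finite.of_finite_image (f := fun p : Nat.Primes => (p : ℕ)) (hu.subset ?_)
      Nat.Primes.coe_nat_injective.injOn
    rintro _ ⟨p, hp, rfl⟩
    exact ⟨p.2, hp⟩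
  refine IsBigO.of_bound (∑ p ∈ hfin.toFinset, ‖u p‖) ?_
  filter_upwards [self_mem_nhdsWithin] with s hs
  have hs : (1 : ℝ) < s := hs
  rw [primeDirichlet, tsum_eq_sum (s := hfin.toFinset), norm_one, mul_one]
  · refine (norm_sum_le _ _).trans (Finset.sum_le_sum fun p _ => ?_)
    rw [norm_mul, Complex.norm_real, Real.norm_of_nonneg (by positivity)]
    have := prime_rpow_le_half p.2 hs
    exact mul_le_of_le_one_right (norm_nonneg _) (by linarith)
  · intro p hp
    have : u p = 0 := by simpa using hp
    rw [this, zero_mul]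

lemma summable_primeDirichlet {u : ℕ → ℂ} {B : ℝ} (hu : ∀ p : ℕ, p.Prime → ‖u p‖ ≤ B) {s : ℝ}
    (hs : 1 < s) :
    Summable fun p : Nat.Primes => u p * ((((p : ℕ) : ℝ) ^ (-s) : ℝ) : ℂ) := by
  refine Summable.of_norm_bounded ((summable_primes_rpow hs).mul_left B) fun p => ?_
  rw [norm_mul, Complex.norm_real, Real.norm_of_nonneg (by positivity)]
  exact mul_le_mul_of_nonneg_right (hu p p.2) (by positivity)

lemma primeDirichlet_sub_isBigO {u v : ℕ → ℂ} {B B' : ℝ} (hu : ∀ p : ℕ, p.Prime → ‖u p‖ ≤ B)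
    (hv : ∀ p : ℕ, p.Prime → ‖v p‖ ≤ B') (h : {p : ℕ | p.Prime ∧ u p ≠ v p}.Finite) :
    (fun s => primeDirichlet u s - primeDirichlet v s) =O[𝓝[>] 1] (fun _ => (1 : ℝ)) := by
  have h1 : primeDirichlet (fun p => u p - v p) =O[𝓝[>] 1] (fun _ => (1 : ℝ)) := by
    refine primeDirichlet_isBigO (h.subset ?_)
    rintro p ⟨h1, h2⟩
    exact ⟨h1, sub_ne_zero.mp h2⟩
  refine h1.congr' ?_ EventuallyEq.rfl
  filter_upwards [self_mem_nhdsWithin] with s hs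
  rw [primeDirichlet, primeDirichlet, primeDirichlet,
    ← (summable_primeDirichlet hu hs).tsum_sub (summable_primeDirichlet hv hs)]
  exact tsum_congr fun p => by ring

end weightedPrimeSums

section equidistribution

variable {E : Type} [Field E] [NumberField E] {m : ℕ} [NeZero m]

open Classical in
/-- The sum over the primes in a residue class. -/
noncomputable def classSum (E : Type) [Field E] [NumberField E] {m : ℕ} (c : (ZMod m)ˣ) (s : ℝ) : ℝ :=
  ∑' p : Nat.Primes, (if ((p : ℕ) : ZMod m) = c then (idealCount E p : ℝ) else 0) *
    ((p : ℕ) : ℝ) ^ (-s)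

lemma idealCount_prime_le {p : ℕ} (hp : p.Prime) :
    (idealCount E p : ℝ) ≤ 2 ^ finrank ℚ E := by
  have := idealCount_prime_pow_le (E := E) hp 1
  rw [pow_one] at this
  exact_mod_cast this

open Classical in
lemma ofReal_classSum (c : (ZMod m)ˣ) (s : ℝ) : (classSum E c s : ℂ) =
    primeDirichlet (fun p => if (p : ZMod m) = c then (idealCount E p : ℂ) else 0) s := by
  rw [classSum, primeDirichlet, Complex.ofReal_tsum]
  refine tsum_congr fun p => ?_
  split_ifs <;> simp

lemma classSum_nonneg (c : (ZMod m)ˣ) (s : ℝ) : 0 ≤ classSum E c s := by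
  classical
  refine tsum_nonneg fun p => mul_nonneg ?_ (by positivity)
  split_ifs <;> simp

open Classical in
lemma sum_mul_classSum (a : (ZMod m)ˣ → ℂ) {s : ℝ} (hs : 1 < s) :
    ∑ c, a c * classSum E c s = primeDirichlet
      (fun p => ∑ c : (ZMod m)ˣ, if (p : ZMod m) = (c : (ZMod m)ˣ) then a c * idealCount E p else 0) s := by
  simp only [ofReal_classSum, primeDirichlet]
  have hsum : ∀ c ∈ (Finset.univ : Finset (ZMod m)ˣ), Summable fun p : Nat.Primes =>
      a c * ((if ((p : ℕ) : ZMod m) = c then (idealCount E p : ℂ) else 0) *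
        ((((p : ℕ) : ℝ) ^ (-s) : ℝ) : ℂ)) := by
    intro c _
    refine (summable_primeDirichlet (u := fun p => if (p : ZMod m) = c then
      (idealCount E p : ℂ) else 0) (B := 2 ^ finrank ℚ E) (fun p hp => ?_) hs).mul_left (a c)
    split_ifs
    · rw [Complex.norm_natCast]; exact idealCount_prime_le hp
    · rw [norm_zero]; positivity
  simp only [← tsum_mul_left]
  rw [← Summable.tsum_finsetSum hsum]
  refine tsum_congr fun p => ?_
  rw [Finset.sum_mul]
  refine Finset.sum_congr rfl fun c _ => ?_
  split_ifs <;> simp [mul_assoc]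

lemma norm_weight_le (a : (ZMod m)ˣ → ℂ) (ha : ∀ c, ‖a c‖ ≤ 1) {p : ℕ} (hp : p.Prime) :
    ‖∑ c : (ZMod m)ˣ, (open Classical in if (p : ZMod m) = (c : (ZMod m)ˣ) then a c * idealCount E p else 0)‖ ≤
      2 ^ finrank ℚ E := by
  classical
  by_cases h : ∃ c : (ZMod m)ˣ, (p : ZMod m) = c
  · obtain ⟨c, hc⟩ := h
    rw [Finset.sum_eq_single c]
    · rw [if_pos hc, norm_mul, Complex.norm_natCast]
      exact (mul_le_of_le_one_left (Nat.cast_nonneg _) (ha c)).trans (idealCount_prime_le hp)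
    · intro b _ hb
      rw [if_neg fun h => hb (Units.ext (h.symm.trans hc))]
    · simp
  · rw [Finset.sum_eq_zero, norm_zero]
    · positivity
    · intro c _
      rw [if_neg fun h' => h ⟨c, h'⟩]

lemma primeSum_eq_primeDirichlet (g : ℤ → ℂ) (s : ℝ) :
    primeSum E g s = primeDirichlet (fun p => idealCount E p * g p) s := by
  rw [primeSum, primeDirichlet]
  exact tsum_congr fun p => by simp [heckeCoeff, twistTerm, mul_assoc]

lemma primeSum_one_sub_log_isBigO :
    (fun s : ℝ => (primeSum E (fun _ => 1) s).re - -Real.log (s - 1)) =O[𝓝[>] 1]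
      (fun _ => (1 : ℝ)) := by
  have hb : ∀ a : ℤ, ‖(fun _ => (1 : ℂ)) a‖ ≤ 1 := fun a => by simp
  have hg : SmallOrTrivial E (fun _ => (1 : ℂ)) := Or.inl fun _ => rfl
  obtain ⟨C, hC⟩ := norm_logSeries_sub_primeSum_le hb hg
  have h1 : (fun s => logSeries E (fun _ => 1) s - primeSum E (fun _ => 1) s) =O[𝓝[>] 1]
      (fun _ => (1 : ℝ)) := by
    refine IsBigO.of_bound C ?_
    filter_upwards [self_mem_nhdsWithin] with s hs
    rw [norm_one, mul_one]; exact hC s hs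
  have h2 : (fun s : ℝ => (logSeries E (fun _ => 1) s).re - -Real.log (s - 1)) =O[𝓝[>] 1]
      (fun _ => (1 : ℝ)) := by
    refine re_sub_log_isBigO_of_pole (κ := (dedekindZeta_residue E : ℂ)) ?_
      ((tendsto_sub_one_mul_idealCount (E := E)).congr' ?_)
    · exact_mod_cast (dedekindZeta_residue_pos E).ne'
    · filter_upwards [self_mem_nhdsWithin] with s hs
      rw [exp_logSeries hb hg rfl (fun _ _ => (one_mul _).symm) hs]
      rfl
  refine (h2.sub (isBigO_re h1)).congr_left fun s => ?_
  rw [Complex.sub_re]; ring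

open Classical in
/-- The hypothesis that splitting over a subgroup of residue classes is governed by a number
field. -/
def HasSubgroupFields (E : Type) [Field E] [NumberField E] (m : ℕ) : Prop :=
  ∀ K' : Subgroup (ZMod m)ˣ, ∃ (M : Type) (_ : Field M) (_ : NumberField M),
    {p : ℕ | p.Prime ∧ idealCount M p ≠
      if (∃ u ∈ K', (p : ZMod m) = (u : (ZMod m)ˣ)) then K'.index * idealCount E p else 0}.Finite

lemma subgroupEquidistributed_classSum (hE : HasSubgroupFields E m) :
    SubgroupEquidistributed (fun c : (ZMod m)ˣ => classSum E c) := by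
  classical
  intro K'
  obtain ⟨M, _, _, hM⟩ := hE K'
  have hidx : (K'.index : ℝ) ≠ 0 := by exact_mod_cast Subgroup.index_ne_zero_of_finite
  have h1 := primeSum_one_sub_log_isBigO (E := M)
  set a : (ZMod m)ˣ → ℂ := fun c => if c ∈ K' then 1 else 0 with ha
  have h2 : (fun s => primeDirichlet (fun p => idealCount M p * 1) s -
      primeDirichlet (fun p => (K'.index : ℂ) *
        ∑ c, if (p : ZMod m) = (c : (ZMod m)ˣ) then a c * idealCount E p else 0) s)
      =O[𝓝[>] 1] (fun _ => (1 : ℝ)) := by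
    refine primeDirichlet_sub_isBigO (B := 2 ^ finrank ℚ M)
      (B' := K'.index * 2 ^ finrank ℚ E) (fun p hp => ?_) (fun p hp => ?_) (hM.subset ?_)
    · rw [mul_one, Complex.norm_natCast]; exact idealCount_prime_le (E := M) hp
    · rw [norm_mul, Complex.norm_natCast]
      gcongr
      refine norm_weight_le a (fun c => ?_) hp
      simp only [ha]; split_ifs <;> simp
    · rintro p ⟨hp, hne⟩
      refine ⟨hp, fun heq => hne ?_⟩
      rw [heq, mul_one]
      by_cases h : ∃ u ∈ K', (p : ZMod m) = (u : (ZMod m)ˣ)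
      · rw [if_pos h]
        obtain ⟨u, hu, hpu⟩ := h
        rw [Finset.sum_eq_single u]
        · rw [if_pos hpu, ha]; simp [hu]
        · intro b _ hb
          rw [if_neg fun h => hb (Units.ext (h.symm.trans hpu))]
        · simp
      · rw [if_neg h, Finset.sum_eq_zero]
        · simp
        · intro c _
          split_ifs with hc
          · have : c ∉ K' := fun hcK => h ⟨c, hcK, hc⟩
            simp [ha, this]
          · rfl
  have h3 := (h1.sub (isBigO_re h2)).const_mul_left (K'.index : ℝ)⁻¹
  refine h3.congr' ?_ EventuallyEq.rfl
  filter_upwards [self_mem_nhdsWithin] with s hs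
  have h4 : primeDirichlet (fun p => (K'.index : ℂ) *
      ∑ c, if (p : ZMod m) = (c : (ZMod m)ˣ) then a c * idealCount E p else 0) s =
      ((K'.index * ∑ c, (if c ∈ K' then classSum E c s else 0) : ℝ) : ℂ) := by
    have h5 := sum_mul_classSum (E := E) a hs
    push_cast
    have h6 : (∑ c : (ZMod m)ˣ, ((if c ∈ K' then classSum E c s else 0 : ℝ) : ℂ)) =
        ∑ c, a c * classSum E c s := by
      refine Finset.sum_congr rfl fun c _ => ?_
      simp only [ha]; split_ifs <;> simp
    rw [h6, h5, primeDirichlet, primeDirichlet, ← tsum_mul_left]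
    exact tsum_congr fun p => by ring
  rw [h4, primeSum_eq_primeDirichlet, Complex.sub_re, Complex.ofReal_re]
  field_simp
  ring

lemma hasLogarithm_classSum {χ : DirichletCharacter ℂ m} (hχ : χ (-1) = 1) :
    HasLogarithm (fun c : (ZMod m)ˣ => classSum E c) χ := by
  classical
  set N : ℕ := m * (⌈2 * eulerBound (finrank ℚ E)⌉₊).factorial with hN
  have hN0 : N ≠ 0 := mul_ne_zero (NeZero.ne m) (Nat.factorial_ne_zero _)
  have : NeZero N := ⟨hN0⟩
  have hmN : m ∣ N := Dvd.intro _ rfl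
  set χ' : DirichletCharacter ℂ N := DirichletCharacter.changeLevel hmN χ with hχ'
  set g : ℤ → ℂ := fun a => χ' (a : ZMod N) with hg
  have hcast : ∀ a : ZMod N, IsUnit a → χ' a = χ (a.cast : ZMod m) := by
    rintro _ ⟨u, rfl⟩
    exact DirichletCharacter.changeLevel_eq_cast_of_dvd χ hmN u
  have hb : ∀ a, ‖g a‖ ≤ 1 := fun a => DirichletCharacter.norm_le_one χ' _
  have hsm : SmallOrTrivial E g := by
    refine Or.inr fun p hp hlt k => ?_
    have hpN : p ∣ N := by
      refine Dvd.dvd.mul_left ((Nat.Prime.dvd_factorial hp).mpr ?_) m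
      have := hlt.trans_le (Nat.le_ceil _)
      exact_mod_cast this.le
    simp only [hg]
    apply MulChar.map_nonunit
    push_cast
    rw [isUnit_pow_iff (by omega), ZMod.isUnit_iff_coprime]
    intro hcop
    exact hp.one_lt.ne' (Nat.Coprime.eq_one_of_dvd hcop hpN)
  have hg1 : g 1 = 1 := by simp [hg]
  have hmul : ∀ a b : ℕ, g ((a * b : ℕ) : ℤ) = g a * g b := by
    intro a b; simp [hg]
  have hper : ∀ a b, g (a + N * b) = g a := by
    intro a b; simp [hg]
  have heven : ∀ a, g (-a) = g a := by
    intro a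
    have h1 : χ' (-1) = 1 := by
      rw [hcast _ (by simp)]
      rw [ZMod.cast_neg hmN, ZMod.cast_one hmN, hχ]
    simp only [hg]
    rw [Int.cast_neg, neg_eq_neg_one_mul, map_mul, h1, one_mul]
  refine ⟨logSeries E g, continuousOn_logSeries hb hsm, ?_, ?_⟩
  · obtain ⟨C, hC⟩ := norm_logSeries_sub_primeSum_le hb hsm
    have h1 : (fun s => logSeries E g s - primeSum E g s) =O[𝓝[>] 1] (fun _ => (1 : ℝ)) := by
      refine IsBigO.of_bound C ?_
      filter_upwards [self_mem_nhdsWithin] with s hs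
      rw [norm_one, mul_one]; exact hC s hs
    have h2 : (fun s => primeDirichlet (fun p => idealCount E p * g p) s -
        primeDirichlet (fun p => ∑ c : (ZMod m)ˣ, if (p : ZMod m) = c then
          χ (c : ZMod m) * idealCount E p else 0) s) =O[𝓝[>] 1] (fun _ => (1 : ℝ)) := by
      refine primeDirichlet_sub_isBigO (B := 2 ^ finrank ℚ E) (B' := 2 ^ finrank ℚ E)
        (fun p hp => ?_) (fun p hp => norm_weight_le (fun c : (ZMod m)ˣ => χ (c : ZMod m))
          (fun c => DirichletCharacter.norm_le_one χ _) hp)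
        ((Set.finite_le_nat N).subset ?_)
      · rw [norm_mul, Complex.norm_natCast]
        exact (mul_le_of_le_one_right (Nat.cast_nonneg _) (hb _)).trans (idealCount_prime_le hp)
      · rintro p ⟨hp, hne⟩
        refine Nat.le_of_dvd (Nat.pos_of_ne_zero hN0) ?_
        by_contra hpN
        have hcopN : p.Coprime N := (Nat.Prime.coprime_iff_not_dvd hp).mpr hpN
        have huN : IsUnit (p : ZMod N) := (ZMod.isUnit_iff_coprime p N).mpr hcopN
        have hum : IsUnit (p : ZMod m) :=
          (ZMod.isUnit_iff_coprime p m).mpr (hcopN.coprime_dvd_right hmN)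
        obtain ⟨u, hu⟩ := hum
        apply hne
        rw [Finset.sum_eq_single u]
        · rw [if_pos hu.symm]
          simp only [hg]
          rw [Int.cast_natCast, hcast _ huN, ZMod.cast_natCast hmN, hu, mul_comm]
        · intro b _ hbu
          rw [if_neg fun h => hbu (Units.ext (h.symm.trans hu.symm))]
        · simp
    refine (h1.add h2).congr' ?_ EventuallyEq.rfl
    filter_upwards [self_mem_nhdsWithin] with s hs
    have h3 : charSum (fun c : (ZMod m)ˣ => classSum E c) χ s = _ :=
      sum_mul_classSum (E := E) (fun c : (ZMod m)ˣ => χ (c : ZMod m)) hs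
    rw [h3, primeSum_eq_primeDirichlet]
    ring
  · have hexp : (fun s : ℝ => ∑' n : ℕ, (idealCount E n : ℂ) * twistTerm g s n) =ᶠ[𝓝[>] 1]
        fun s => Complex.exp (logSeries E g s) := by
      filter_upwards [self_mem_nhdsWithin] with s hs
      rw [exp_logSeries hb hsm hg1 hmul hs]
      rfl
    rcases ideal_series_dichotomy (E := E) hN0 hper heven with ⟨κ, hκ, h⟩ | ⟨z, h⟩
    · refine Or.inl ⟨κ, hκ, h.congr' ?_⟩
      filter_upwards [hexp] with s hs
      rw [hs]
    · exact Or.inr ⟨z, h.congr' hexp⟩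

/-- Primes of degree one in prescribed pairs of residue classes. -/
theorem infinite_primes_of_hasSubgroupFields (hm : (1 : (ZMod m)ˣ) ≠ -1)
    (hE : HasSubgroupFields E m) (a : (ZMod m)ˣ) :
    {p : ℕ | p.Prime ∧ ((p : ZMod m) = a ∨ (p : ZMod m) = -a) ∧ idealCount E p ≠ 0}.Infinite := by
  classical
  intro hfin
  have key : ∀ b : (ZMod m)ˣ, b = a ∨ b = -a →
      (fun s => classSum E b s) =O[𝓝[>] 1] (fun _ => (1 : ℝ)) := by
    intro b hb
    have h : (fun s => (classSum E b s : ℂ)) =O[𝓝[>] 1] (fun _ => (1 : ℝ)) := by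
      simp only [ofReal_classSum]
      refine primeDirichlet_isBigO (hfin.subset ?_)
      rintro p ⟨hp, hne⟩
      simp only [ne_eq, ite_eq_right_iff, not_forall] at hne
      obtain ⟨h1, h2⟩ := hne
      refine ⟨hp, ?_, by exact_mod_cast h2⟩
      rcases hb with rfl | rfl
      · exact Or.inl h1
      · right; rw [h1]; simp
    simpa using isBigO_re h
  exact not_isBigO_class hm (fun c s _ => classSum_nonneg c s)
    (subgroupEquidistributed_classSum hE) (fun χ hχ _ => hasLogarithm_classSum hχ) a
    ((key a (Or.inl rfl)).add (key (-a) (Or.inr rfl)))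

end equidistribution

end

section

section

/-- Two homomorphisms to a field which agree on the invariants of a finite group are conjugate. -/
theorem exists_smul_of_eqOn_fixed {B Ω G : Type*} [CommRing B] [Field Ω] [Group G] [Finite G]
    [MulSemiringAction G B] (f g : B →+* Ω) (hinj : ∀ h : G, (∀ b, f (h • b) = f b) → h = 1)
    (hfix : ∀ b : B, (∀ h : G, h • b = b) → f b = g b) :
    ∃ h : G, ∀ b, g b = f (h • b) := by
  classical
  have := Fintype.ofFinite G
  let F (u : B →+* Ω) (h : G) : B →* Ω := (u.comp (MulSemiringAction.toRingHom G B h) : B →+* Ω)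
  have hF : ∀ u h b, F u h b = u (h • b) := fun _ _ _ => rfl
  let l : (B →* Ω) →₀ Ω := ∑ h : G, Finsupp.single (F f h) 1 - ∑ h : G, Finsupp.single (F g h) 1
  have hl : l = 0 := by
    refine (linearIndependent_iff.mp (linearIndependent_monoidHom B Ω)) l ?_
    simp only [l, map_sub, map_sum, Finsupp.linearCombination_single, one_smul]
    ext b
    simp only [Pi.sub_apply, Finset.sum_apply, hF, ← map_sum, Pi.zero_apply, sub_eq_zero]
    refine hfix _ fun k => ?_
    rw [Finset.smul_sum]
    simp_rw [smul_smul]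
    exact Fintype.sum_equiv (Equiv.mulLeft k) _ _ fun _ => rfl
  have h1 := DFunLike.congr_fun hl (F f 1)
  have h2 : ∑ h : G, (Finsupp.single (F f h) (1 : Ω)) (F f 1) = 1 := by
    rw [Finset.sum_eq_single 1]
    · simp
    · intro h _ hne
      refine Finsupp.single_eq_of_ne fun he => hne (hinj h fun b => ?_)
      have := DFunLike.congr_fun he b
      simp only [hF, one_smul] at this
      exact this.symm
    · simp
  by_contra! hcon
  have h3 : ∑ h : G, (Finsupp.single (F g h) (1 : Ω)) (F f 1) = 0 := by
    refine Finset.sum_eq_zero fun h _ => Finsupp.single_eq_of_ne fun he => ?_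
    obtain ⟨b, hb⟩ := hcon h⁻¹
    refine hb ?_
    have := DFunLike.congr_fun he (h⁻¹ • b)
    simp only [hF, one_smul, smul_inv_smul] at this
    exact this.symm
  simp only [l, Finsupp.coe_sub, Finsupp.coe_finsetSum, Pi.sub_apply, Finset.sum_apply, h2, h3] at h1
  simp at h1

/-- Homomorphisms to an algebraically closed field extend along integral extensions. -/
theorem exists_ringHom_extend {A B Ω : Type*} [CommRing A] [CommRing B] [Algebra A B]
    [Algebra.IsIntegral A B] [FaithfulSMul A B] [Field Ω] [IsAlgClosed Ω] (f : A →+* Ω) :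
    ∃ g : B →+* Ω, ∀ a, g (algebraMap A B a) = f a := by
  have hP : (RingHom.ker f).IsPrime := RingHom.ker_isPrime f
  obtain ⟨Q, hQ, hQP⟩ := Ideal.exists_ideal_over_prime_of_isIntegral (S := B) (RingHom.ker f) ⊥
    (by
      rw [Ideal.comap_bot_of_injective _ (FaithfulSMul.algebraMap_injective A B)]
      exact bot_le)
  have hLO : Q.LiesOver (RingHom.ker f) := ⟨hQP.2.symm⟩
  let _ : Algebra (A ⧸ RingHom.ker f) Ω := (RingHom.kerLift f).toAlgebra
  have : FaithfulSMul (A ⧸ RingHom.ker f) Ω :=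
    (faithfulSMul_iff_algebraMap_injective _ _).mpr (RingHom.kerLift_injective f)
  have : Q.IsPrime := hQP.1
  have : Algebra.IsAlgebraic (A ⧸ RingHom.ker f) (B ⧸ Q) := Algebra.IsIntegral.isAlgebraic
  have : IsDomain (B ⧸ Q) := Ideal.Quotient.isDomain Q
  have : IsDomain (A ⧸ RingHom.ker f) := Ideal.Quotient.isDomain _
  have : FaithfulSMul (A ⧸ RingHom.ker f) (B ⧸ Q) :=
    Ideal.Quotient.instFaithfulSMul Q _
  have := FaithfulSMul.to_isTorsionFree (A ⧸ RingHom.ker f) (B ⧸ Q)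
  have := FaithfulSMul.to_isTorsionFree (A ⧸ RingHom.ker f) Ω
  let φ : B ⧸ Q →ₐ[A ⧸ RingHom.ker f] Ω := IsAlgClosed.lift
  refine ⟨(φ : B ⧸ Q →+* Ω).comp (Ideal.Quotient.mk Q), fun a => ?_⟩
  have := φ.commutes (Ideal.Quotient.mk _ a)
  exact this
end

end

section

open NumberField

section

/-- Ideals of prime norm `p` correspond to homomorphisms to `ZMod p`. -/
theorem idealCount_prime_eq_card_ringHom (E : Type*) [Field E] [NumberField E] (p : ℕ)
    [hp : Fact p.Prime] : idealCount E p = Nat.card (𝓞 E →+* ZMod p) := by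
  unfold idealCount
  symm
  refine Nat.card_congr (Equiv.ofBijective (fun u => ⟨RingHom.ker u, ?_⟩) ⟨?_, ?_⟩)
  · rw [Ideal.absNorm_apply, Submodule.cardQuot_apply]
    rw [Nat.card_congr (RingHom.quotientKerEquivOfSurjective
      (ZMod.ringHom_surjective u)).toEquiv, Nat.card_zmod]
  · intro u v h
    exact ZMod.ringHom_eq_of_ker_eq u v (congrArg Subtype.val h)
  · rintro ⟨I, hI⟩
    rw [Ideal.absNorm_apply, Submodule.cardQuot_apply] at hI
    have : Finite (𝓞 E ⧸ I) := Nat.finite_of_card_ne_zero (by rw [hI]; exact hp.out.ne_zero)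
    have := Fintype.ofFinite (𝓞 E ⧸ I)
    rw [Nat.card_eq_fintype_card] at hI
    refine ⟨((ZMod.ringEquivOfPrime _ hp.out hI).symm : _ →+* ZMod p).comp (Ideal.Quotient.mk I), ?_⟩
    ext x
    simp [RingHom.mem_ker, Ideal.Quotient.eq_zero_iff_mem]

variable {N : Type*} [Field N] [NumberField N]

theorem exists_int_of_fixed [IsGalois ℚ N] (b : 𝓞 N) (hb : ∀ g : N ≃ₐ[ℚ] N, g • b = b) :
    ∃ n : ℤ, b = n := by
  have h : (b : N) ∈ Set.range (algebraMap ℚ N) := by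
    rw [IsGalois.mem_range_algebraMap_iff_fixed]
    intro g
    exact congrArg (fun x : 𝓞 N => (x : N)) (hb g)
  obtain ⟨q, hq⟩ := h
  have hi : IsIntegral ℤ q := by
    rw [← isIntegral_algebraMap_iff (algebraMap ℚ N).injective, hq]
    exact b.isIntegral_coe
  obtain ⟨n, rfl⟩ := IsIntegrallyClosed.isIntegral_iff.mp hi
  exact ⟨n, RingOfIntegers.ext (by rw [← hq]; simp)⟩

theorem exists_of_fixed (H : Subgroup (N ≃ₐ[ℚ] N)) (b : 𝓞 N) (hb : ∀ g : H, g • b = b) :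
    ∃ e : 𝓞 (IntermediateField.fixedField H), algebraMap _ (𝓞 N) e = b := by
  have h : (b : N) ∈ IntermediateField.fixedField H := by
    rw [IntermediateField.mem_fixedField_iff]
    intro g hg
    exact congrArg (fun x : 𝓞 N => (x : N)) (hb ⟨g, hg⟩)
  have hi : IsIntegral ℤ (⟨b, h⟩ : IntermediateField.fixedField H) := by
    rw [← isIntegral_algebraMap_iff (algebraMap (IntermediateField.fixedField H) N).injective]
    exact b.isIntegral_coe
  exact ⟨⟨_, hi⟩, RingOfIntegers.ext rfl⟩

theorem smul_algebraMap_fixedField (H : Subgroup (N ≃ₐ[ℚ] N)) {h : N ≃ₐ[ℚ] N} (hh : h ∈ H)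
    (e : 𝓞 (IntermediateField.fixedField H)) :
    h • algebraMap _ (𝓞 N) e = algebraMap _ (𝓞 N) e := by
  refine RingOfIntegers.ext ?_
  exact (e : IntermediateField.fixedField H).2 ⟨h, hh⟩

variable [IsGalois ℚ N] {Ω : Type*} [Field Ω] [IsAlgClosed Ω]

/-- Degree one primes of a fixed field counted by double coset data. -/
theorem idealCount_fixedField_mul_card {p : ℕ} [hp : Fact p.Prime] [CharP Ω p] (f : 𝓞 N →+* Ω)
    (hinj : ∀ g : N ≃ₐ[ℚ] N, (∀ b, f (g • b) = f b) → g = 1) {φ : N ≃ₐ[ℚ] N}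
    (hφ : ∀ b, f b ^ p = f (φ • b)) (H : Subgroup (N ≃ₐ[ℚ] N)) :
    idealCount (IntermediateField.fixedField H) p * Nat.card H =
      Nat.card {x : N ≃ₐ[ℚ] N // x⁻¹ * φ * x ∈ H} := by
  rw [idealCount_prime_eq_card_ringHom, ← Nat.card_prod]
  set E := IntermediateField.fixedField H with hE
  let ι : ZMod p →+* Ω := ZMod.castHom (dvd_refl p) Ω
  have hι : Function.Injective ι := ι.injective
  have hinj' : ∀ x y : N ≃ₐ[ℚ] N, (∀ b, f (x • b) = f (y • b)) → x = y := by
    intro x y h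
    have := hinj (x * y⁻¹) fun b => by rw [mul_smul, h, smul_inv_smul]
    exact mul_inv_eq_one.mp this
  have hex : ∀ u : 𝓞 E →+* ZMod p, ∃ x : N ≃ₐ[ℚ] N, ∀ e,
      ι (u e) = f (x • algebraMap (𝓞 E) (𝓞 N) e) := by
    intro u
    obtain ⟨g, hg⟩ := exists_ringHom_extend (B := 𝓞 N) (ι.comp u)
    obtain ⟨x, hx⟩ := exists_smul_of_eqOn_fixed (G := N ≃ₐ[ℚ] N) f g hinj fun b hb => by
      obtain ⟨n, rfl⟩ := exists_int_of_fixed b hb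
      simp
    exact ⟨x, fun e => by rw [← hx, hg]; rfl⟩
  have hsame : ∀ x y : N ≃ₐ[ℚ] N, (∀ e, f (x • algebraMap (𝓞 E) (𝓞 N) e) =
      f (y • algebraMap (𝓞 E) (𝓞 N) e)) → x⁻¹ * y ∈ H := by
    intro x y hxy
    obtain ⟨h, hh⟩ := exists_smul_of_eqOn_fixed (G := H)
      (f.comp (MulSemiringAction.toRingHom _ (𝓞 N) x))
      (f.comp (MulSemiringAction.toRingHom _ (𝓞 N) y)) (fun h h1 => by
        have : x * (h : N ≃ₐ[ℚ] N) = x := hinj' _ _ fun b => by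
          rw [mul_smul]; exact h1 b
        exact Subtype.ext (mul_eq_left.mp this)) (fun b hb => by
        obtain ⟨e, rfl⟩ := exists_of_fixed H b hb
        exact hxy e)
    have : y = x * h := hinj' _ _ fun b => by
      rw [mul_smul]; exact hh b
    rw [this]; simp
  choose x hx using hex
  have hfr : ∀ u, (x u)⁻¹ * φ * x u ∈ H := by
    intro u
    rw [mul_assoc]
    refine hsame _ _ fun e => ?_
    rw [mul_smul, ← hφ, ← hx, ← map_pow, ZMod.pow_card]
  refine Nat.card_congr (Equiv.ofBijective (fun q => ⟨x q.1 * (q.2 : N ≃ₐ[ℚ] N), ?_⟩) ⟨?_, ?_⟩)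
  · have := H.mul_mem (H.mul_mem (H.inv_mem q.2.2) (hfr q.1)) q.2.2
    simpa [mul_assoc] using this
  · rintro ⟨u, h⟩ ⟨v, k⟩ huv
    have huv : x u * (h : N ≃ₐ[ℚ] N) = x v * (k : N ≃ₐ[ℚ] N) := congrArg Subtype.val huv
    have h1 : u = v := by
      ext e
      refine hι ?_
      have h2 : ∀ (y : N ≃ₐ[ℚ] N) (k : H),
          y • algebraMap (𝓞 E) (𝓞 N) e = (y * (k : N ≃ₐ[ℚ] N)) • algebraMap (𝓞 E) (𝓞 N) e :=
        fun y k => by rw [mul_smul, smul_algebraMap_fixedField H k.2]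
      rw [hx, hx, h2 (x u) h, huv, ← h2]
    subst h1
    exact Prod.ext rfl (Subtype.ext (mul_left_cancel huv))
  · rintro ⟨y, hy⟩
    have hpow : ∀ e, f (y • algebraMap (𝓞 E) (𝓞 N) e) ^ p = f (y • algebraMap (𝓞 E) (𝓞 N) e) := by
      intro e
      rw [hφ, ← mul_smul, show φ * y = y * (y⁻¹ * φ * y) by group, mul_smul,
        smul_algebraMap_fixedField H hy]
    have hmem : ∀ e, ∃ z, ι z = f (y • algebraMap (𝓞 E) (𝓞 N) e) := by
      intro e
      have := (Subfield.mem_bot_iff_pow_eq_self Ω p).mpr (hpow e)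
      rwa [← ZMod.fieldRange_castHom_eq_bot p] at this
    choose u0 hu0 using hmem
    let u : 𝓞 E →+* ZMod p :=
      { toFun := u0
        map_one' := hι (by simp [hu0])
        map_zero' := hι (by simp [hu0])
        map_add' := fun a b => hι (by simp [hu0])
        map_mul' := fun a b => hι (by simp [hu0]) }
    have hk : (x u)⁻¹ * y ∈ H := hsame _ _ fun e => by rw [← hx, ← hu0]; rfl
    exact ⟨⟨u, ⟨_, hk⟩⟩, Subtype.ext (by simp)⟩
end

end

section

open NumberField

section
variable (N : Type*) [Field N] [NumberField N] [IsGalois ℚ N]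

theorem exists_smul_ne {N : Type*} [Field N] [NumberField N] {g : N ≃ₐ[ℚ] N} (hg : g ≠ 1) :
    ∃ b : 𝓞 N, g • b ≠ b := by
  by_contra! h
  refine hg (AlgEquiv.ext fun x => ?_)
  obtain ⟨a, b, hb, rfl⟩ := IsFractionRing.div_surjective (A := 𝓞 N) x
  have h' : ∀ b : 𝓞 N, g (algebraMap (𝓞 N) N b) = algebraMap (𝓞 N) N b := fun b =>
    congrArg (fun x : 𝓞 N => (x : N)) (h b)
  rw [map_div₀, h', h']; rfl

/-- Away from finitely many primes, a Galois number field has Frobenius elements. -/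
theorem exists_frobenius : ∃ c : ℕ, c ≠ 0 ∧ ∀ p : ℕ, p.Prime → ¬ p ∣ c →
    ∀ (Ω : Type) [Field Ω] [IsAlgClosed Ω] [CharP Ω p], ∃ f : 𝓞 N →+* Ω,
      (∀ g : N ≃ₐ[ℚ] N, (∀ b, f (g • b) = f b) → g = 1) ∧
      ∃ φ : N ≃ₐ[ℚ] N, ∀ b, f b ^ p = f (φ • b) := by
  classical
  have hb : ∀ g : N ≃ₐ[ℚ] N, ∃ b : 𝓞 N, g ≠ 1 → g • b ≠ b := fun g => by
    by_cases hg : g = 1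
    · exact ⟨0, fun h => absurd hg h⟩
    · exact (exists_smul_ne hg).imp fun b hb _ => hb
  choose b hb using hb
  let D : 𝓞 N := ∏ g ∈ Finset.univ.erase (1 : N ≃ₐ[ℚ] N), (g • b g - b g)
  have hD : D ≠ 0 := Finset.prod_ne_zero_iff.mpr fun g hg =>
    sub_ne_zero.mpr (hb g (Finset.ne_of_mem_erase hg))
  refine ⟨Ideal.absNorm (Ideal.span {D}), ?_, ?_⟩
  · rw [Ne, Ideal.absNorm_eq_zero_iff, Ideal.span_singleton_eq_bot]
    exact hD
  intro p hp hpc Ω _ _ _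
  have : Fact p.Prime := ⟨hp⟩
  obtain ⟨f, -⟩ := exists_ringHom_extend (A := ℤ) (B := 𝓞 N) (Int.castRingHom Ω)
  have hinj : ∀ g : N ≃ₐ[ℚ] N, (∀ b, f (g • b) = f b) → g = 1 := by
    intro g hg
    by_contra hne
    refine hpc ((CharP.cast_eq_zero_iff Ω p _).mp ?_)
    obtain ⟨e, he⟩ := Ideal.mem_span_singleton.mp (Ideal.absNorm_mem (Ideal.span {D}))
    have : f D = 0 := by
      rw [map_prod]
      exact Finset.prod_eq_zero (Finset.mem_erase.mpr ⟨hne, Finset.mem_univ g⟩) (by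
        rw [map_sub, hg, sub_self])
    rw [← map_natCast f, he, map_mul, this, zero_mul]
  refine ⟨f, hinj, ?_⟩
  exact exists_smul_of_eqOn_fixed (G := N ≃ₐ[ℚ] N) f ((frobenius Ω p).comp f) hinj fun b hb => by
    obtain ⟨n, rfl⟩ := exists_int_of_fixed b hb
    simp

variable {N}

theorem cast_eq_autToPow {m : ℕ} [NeZero m] {ζ : N} (hζ : IsPrimitiveRoot ζ m) {p : ℕ}
    [Fact p.Prime]
    (hpm : ¬ p ∣ m) {Ω : Type} [Field Ω] [CharP Ω p] (f : 𝓞 N →+* Ω) {φ : N ≃ₐ[ℚ] N}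
    (hφ : ∀ b, f b ^ p = f (φ • b)) : (p : ZMod m) = (hζ.autToPow ℚ φ : ZMod m) := by
  let z : 𝓞 N := hζ.toInteger
  have hz : IsPrimitiveRoot z m := hζ.toInteger_isPrimitiveRoot
  have hm : NeZero (m : Ω) := ⟨fun h => hpm ((CharP.cast_eq_zero_iff Ω p _).mp h)⟩
  have hroot : IsPrimitiveRoot (f z) m := by
    rw [← Polynomial.isRoot_cyclotomic_iff, ← Polynomial.map_cyclotomic m f]
    exact (hz.isRoot_cyclotomic (Nat.pos_of_neZero m)).map
  have h1 : φ • z = z ^ (hζ.autToPow ℚ φ : ZMod m).val := by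
    refine RingOfIntegers.ext ?_
    have := hζ.autToPow_spec ℚ φ
    exact this.symm.trans (map_pow (algebraMap (𝓞 N) N) z _).symm
  have h2 : f z ^ p = f z ^ (hζ.autToPow ℚ φ : ZMod m).val := by rw [hφ, h1, map_pow]
  have h3 : p ≡ (hζ.autToPow ℚ φ : ZMod m).val [MOD m] := by
    have hu := pow_eq_pow_iff_modEq (x := (hroot.isUnit (NeZero.ne m)).unit)
      (n := p) (m := (hζ.autToPow ℚ φ : ZMod m).val)
    rw [← (IsPrimitiveRoot.isUnit_unit (NeZero.ne m) hroot).eq_orderOf] at hu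
    exact hu.mp (Units.ext (by simpa using h2))
  rw [(ZMod.natCast_eq_natCast_iff _ _ _).mpr h3]
  simp

theorem card_inf_comap_mul_index {G G' : Type*} [Group G] [Group G'] (κ : G →* G')
    (H : Subgroup G) (hH : H.map κ = ⊤) (K : Subgroup G') :
    Nat.card (K.comap κ ⊓ H : Subgroup G) * K.index = Nat.card H := by
  have h : ((K.comap κ ⊓ H).subgroupOf H).index = K.index := by
    rw [← Subgroup.relIndex, Subgroup.inf_relIndex_right, Subgroup.relIndex_comap, hH,
      Subgroup.relIndex_top_right]
  rw [← h, ← Subgroup.card_mul_index ((K.comap κ ⊓ H).subgroupOf H)]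
  congr 1
  exact (Nat.card_congr (Subgroup.subgroupOfEquivOfLe inf_le_right).toEquiv).symm

theorem hasSubgroupFields_fixedField {N : Type} [Field N] [NumberField N] [IsGalois ℚ N]
    {m : ℕ} [NeZero m] {ζ : N} (hζ : IsPrimitiveRoot ζ m)
    (H : Subgroup (N ≃ₐ[ℚ] N)) (hH : H.map (hζ.autToPow ℚ) = ⊤) :
    HasSubgroupFields (IntermediateField.fixedField H) m := by
  classical
  intro K'
  let κ := hζ.autToPow ℚ
  obtain ⟨c, hc0, hc⟩ := exists_frobenius N
  refine ⟨IntermediateField.fixedField (K'.comap κ ⊓ H), inferInstance, inferInstance, ?_⟩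
  refine (Set.finite_Iic (c * m)).subset ?_
  rintro p ⟨hp, hne⟩
  by_contra hlt
  have hcm : c * m < p := not_le.mp hlt
  have hpc : ¬ p ∣ c := fun h => by
    have := Nat.le_of_dvd (Nat.pos_of_ne_zero hc0) h
    nlinarith [Nat.pos_of_neZero m]
  have hpm : ¬ p ∣ m := fun h => by
    have := Nat.le_of_dvd (Nat.pos_of_neZero m) h
    nlinarith [Nat.pos_of_ne_zero hc0]
  have : Fact p.Prime := ⟨hp⟩
  obtain ⟨f, hinj, φ, hφ⟩ := hc p hp hpc (AlgebraicClosure (ZMod p))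
  have h1 := idealCount_fixedField_mul_card f hinj hφ H
  have h2 := idealCount_fixedField_mul_card f hinj hφ (K'.comap κ ⊓ H)
  have h3 : (p : ZMod m) = (κ φ : ZMod m) := cast_eq_autToPow hζ hpm f hφ
  have hconj : ∀ x, κ (x⁻¹ * φ * x) = κ φ := fun x => by
    rw [map_mul, map_mul, map_inv, mul_comm, mul_inv_cancel_left]
  have hcard := card_inf_comap_mul_index κ H hH K'
  have hcond : (∃ u ∈ K', (p : ZMod m) = (u : (ZMod m)ˣ)) ↔ κ φ ∈ K' := by
    constructor
    · rintro ⟨u, hu, h⟩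
      rw [h3] at h
      rwa [Units.ext h]
    · intro h
      exact ⟨_, h, h3⟩
  apply hne
  refine Nat.eq_of_mul_eq_mul_right (Nat.card_pos (α := (K'.comap κ ⊓ H : Subgroup _))) ?_
  rw [h2]
  by_cases hk : κ φ ∈ K'
  · rw [if_pos (hcond.mpr hk)]
    calc _ = Nat.card {x : N ≃ₐ[ℚ] N // x⁻¹ * φ * x ∈ H} := by
          refine Nat.card_congr (Equiv.subtypeEquivRight fun x => ?_)
          rw [Subgroup.mem_inf, Subgroup.mem_comap, hconj]
          exact and_iff_right hk
      _ = _ := by rw [← h1, ← hcard]; ring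
  · rw [if_neg (mt hcond.mp hk), zero_mul]
    have : IsEmpty {x : N ≃ₐ[ℚ] N // x⁻¹ * φ * x ∈ K'.comap κ ⊓ H} := ⟨fun x => hk (by
      have := x.2
      rw [Subgroup.mem_inf, Subgroup.mem_comap, hconj] at this
      exact this.1)⟩
    exact Nat.card_of_isEmpty

/-- Chebotarev for an element of cyclic type with respect to a cyclotomic subfield. -/
theorem infinite_primes_frobenius {N : Type} [Field N] [NumberField N] [IsGalois ℚ N]
    {m : ℕ} [NeZero m] (hm : (1 : (ZMod m)ˣ) ≠ -1) {ζ : N} (hζ : IsPrimitiveRoot ζ m)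
    (τ : N ≃ₐ[ℚ] N) (hτ : ∀ u, u ∈ Subgroup.zpowers (hζ.autToPow ℚ τ)) :
    {p : ℕ | p.Prime ∧ ∀ (Ω : Type) [Field Ω] [IsAlgClosed Ω] [CharP Ω p],
      ∃ f : 𝓞 N →+* Ω, ∃ k : ℤ, (hζ.autToPow ℚ (τ ^ k) = hζ.autToPow ℚ τ ∨
        hζ.autToPow ℚ (τ ^ k) = - hζ.autToPow ℚ τ) ∧
        ∀ b, f b ^ p = f ((τ ^ k) • b)}.Infinite := by
  let κ := hζ.autToPow ℚ
  have hH : (Subgroup.zpowers τ).map κ = ⊤ := by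
    rw [MonoidHom.map_zpowers]
    exact eq_top_iff.mpr fun u _ => hτ u
  have hinf := infinite_primes_of_hasSubgroupFields hm
    (hasSubgroupFields_fixedField hζ (Subgroup.zpowers τ) hH) (κ τ)
  obtain ⟨c, hc0, hc⟩ := exists_frobenius N
  refine (hinf.sdiff (Set.finite_Iic (c * m))).mono ?_
  rintro p ⟨⟨hp, hpa, hE⟩, hlt⟩
  have hcm : c * m < p := not_le.mp hlt
  have hpc : ¬ p ∣ c := fun h => by
    have := Nat.le_of_dvd (Nat.pos_of_ne_zero hc0) h
    nlinarith [Nat.pos_of_neZero m]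
  have hpm : ¬ p ∣ m := fun h => by
    have := Nat.le_of_dvd (Nat.pos_of_neZero m) h
    nlinarith [Nat.pos_of_ne_zero hc0]
  have : Fact p.Prime := ⟨hp⟩
  refine ⟨hp, fun Ω _ _ _ => ?_⟩
  obtain ⟨f, hinj, φ, hφ⟩ := hc p hp hpc Ω
  have h1 := idealCount_fixedField_mul_card f hinj hφ (Subgroup.zpowers τ)
  have h3 : (p : ZMod m) = (κ φ : ZMod m) := cast_eq_autToPow hζ hpm f hφ
  have hne : Nat.card {x : N ≃ₐ[ℚ] N // x⁻¹ * φ * x ∈ Subgroup.zpowers τ} ≠ 0 := by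
    rw [← h1]
    exact mul_ne_zero hE Nat.card_pos.ne'
  obtain ⟨⟨x, hx⟩⟩ := (Nat.card_ne_zero.mp hne).1
  obtain ⟨k, hk⟩ := Subgroup.mem_zpowers_iff.mp hx
  refine ⟨f.comp (MulSemiringAction.toRingHom _ (𝓞 N) x), k, ?_, fun b => ?_⟩
  · have hconj : κ (x⁻¹ * φ * x) = κ φ := by
      rw [map_mul, map_mul, map_inv, mul_comm, mul_inv_cancel_left]
    rw [hk]
    change κ _ = _ ∨ κ _ = _
    rw [hconj]
    rw [h3] at hpa
    exact hpa.imp (fun h => Units.ext h) fun h => Units.ext (by simpa using h)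
  · change f (x • b) ^ p = f (x • (τ ^ k) • b)
    rw [hk, hφ, smul_smul, smul_smul]
    congr 2
    group
end

end

section

open NumberField

section
variable {N P : Type*} [Field N] [NumberField N] [IsGalois ℚ N] [Field P] [NumberField P]
  [Algebra N P] {ℓ : ℕ}

/-- A cyclotomic extension of prime conductor prime to the discriminant is Galois over `ℚ`, with
group the full product. -/
theorem exists_aut_cyclotomicExtension [hl : Fact ℓ.Prime] [IsCyclotomicExtension {ℓ} N P]
    (hdisc : ¬ (ℓ : ℤ) ∣ discr N) {ζ : P} (hζ : IsPrimitiveRoot ζ ℓ) :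
    IsGalois ℚ P ∧ ∀ (σ : N ≃ₐ[ℚ] N) (c : (ZMod ℓ)ˣ), ∃ τ : P ≃ₐ[ℚ] P,
      (∀ x, τ (algebraMap N P x) = algebraMap N P (σ x)) ∧ hζ.autToPow ℚ τ = c := by
  classical
  let i : N →ₐ[ℚ] P := IsScalarTower.toAlgHom ℚ N P
  let A : IntermediateField ℚ P := i.fieldRange
  let C : IntermediateField ℚ P := IntermediateField.adjoin ℚ {ζ}
  let e : N ≃ₐ[ℚ] A := AlgEquiv.ofInjectiveField i
  have hA : IsGalois ℚ A := IsGalois.of_algEquiv e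
  have hC' : IsCyclotomicExtension {ℓ} ℚ C :=
    hζ.intermediateField_adjoin_isCyclotomicExtension ℚ
  have hC : IsGalois ℚ C := IsCyclotomicExtension.isGalois {ℓ} ℚ C
  have hgen : ∀ F : IntermediateField ℚ P, A ≤ F → ζ ∈ F → F = ⊤ := by
    intro F hAF hζF
    rw [eq_top_iff]
    intro x hx'
    clear hx'
    have hx : x ∈ Algebra.adjoin N {ζ} := by
      rw [IsCyclotomicExtension.adjoin_primitive_root_eq_top hζ]; trivial
    induction hx using Algebra.adjoin_induction with
    | mem x hx => rw [Set.mem_singleton_iff.mp hx]; exact hζF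
    | algebraMap r => exact hAF ⟨r, rfl⟩
    | add x y _ _ hx hy => exact F.add_mem hx hy
    | mul x y _ _ hx hy => exact F.mul_mem hx hy
  have htop : A ⊔ C = ⊤ :=
    hgen _ le_sup_left (le_sup_right (a := A) (IntermediateField.mem_adjoin_simple_self ℚ ζ))
  have hG : IsGalois ℚ P := by
    have hA' : @Normal ℚ A _ _ A.algebra' := hA.to_normal
    have hC'' : @Normal ℚ C _ _ C.algebra' := hC.to_normal
    have h1 : @Normal ℚ (A ⊔ C : IntermediateField ℚ P) _ _ (A ⊔ C).algebra' :=
      @IntermediateField.normal_sup ℚ P _ _ _ A C hA' hC''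
    rw [htop] at h1
    have : Normal ℚ P := @Normal.of_algEquiv ℚ _ _ _ _ _ _ _ h1 IntermediateField.topEquiv
    exact { }
  refine ⟨hG, ?_⟩
  have hdisj : A.LinearDisjoint C := by
    refine linearDisjoint_of_isGalois_isCoprime_discr P A C ?_
    rw [← discr_eq_discr_of_algEquiv N e, IsCyclotomicExtension.Rat.discr_prime ℓ C]
    have h1 : IsCoprime (discr N) (ℓ : ℤ) :=
      ((Nat.prime_iff_prime_int.mp hl.out).coprime_iff_not_dvd.mpr hdisc).symm
    refine IsCoprime.mul_right ?_ h1.pow_right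
    exact (IsCoprime.neg_right isCoprime_one_right).pow_right
  have hrank : Module.finrank ℚ P = Module.finrank ℚ N * (ℓ - 1) := by
    have h1 := hdisj.finrank_sup
    rw [htop, IntermediateField.finrank_top', ← e.toLinearEquiv.finrank_eq,
      IsCyclotomicExtension.finrank (n := ℓ) C
        (Polynomial.cyclotomic.irreducible_rat hl.out.pos), Nat.totient_prime hl.out] at h1
    exact h1
  let Φ : (P ≃ₐ[ℚ] P) →* (N ≃ₐ[ℚ] N) × (ZMod ℓ)ˣ :=
    (AlgEquiv.restrictNormalHom N).prod (hζ.autToPow ℚ)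
  have hΦ1 : ∀ τ x, τ (algebraMap N P x) = algebraMap N P ((Φ τ).1 x) := fun τ x =>
    (AlgEquiv.restrictNormal_commutes τ N x).symm
  have hinj : Function.Injective Φ := by
    rw [injective_iff_map_eq_one]
    intro τ hτ
    have hF := hgen (IntermediateField.fixedField (Subgroup.zpowers τ)) (by
      rintro _ ⟨x, rfl⟩
      rw [IntermediateField.mem_fixedField_iff]
      intro g hg
      have : Φ g = 1 := by
        obtain ⟨k, rfl⟩ := Subgroup.mem_zpowers_iff.mp hg
        rw [map_zpow, hτ, one_zpow]
      refine (hΦ1 g x).trans ?_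
      rw [this]; rfl) (by
      rw [IntermediateField.mem_fixedField_iff]
      intro g hg
      have : Φ g = 1 := by
        obtain ⟨k, rfl⟩ := Subgroup.mem_zpowers_iff.mp hg
        rw [map_zpow, hτ, one_zpow]
      have h2 : hζ.autToPow ℚ g = 1 := congrArg Prod.snd this
      have := hζ.autToPow_spec ℚ g
      rw [h2, Units.val_one, ZMod.val_one, pow_one] at this
      exact this.symm)
    ext x
    have hx : x ∈ IntermediateField.fixedField (Subgroup.zpowers τ) := by rw [hF]; trivial
    exact (IntermediateField.mem_fixedField_iff _ _).mp hx τ (Subgroup.mem_zpowers τ)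
  have hbij : Function.Bijective Φ := by
    rw [Nat.bijective_iff_injective_and_card]
    refine ⟨hinj, ?_⟩
    rw [Nat.card_prod, IsGalois.card_aut_eq_finrank, IsGalois.card_aut_eq_finrank,
      Nat.card_eq_fintype_card, ZMod.card_units, hrank]
  intro σ c
  obtain ⟨τ, hτ⟩ := hbij.2 (σ, c)
  refine ⟨τ, fun x => ?_, congrArg Prod.snd hτ⟩
  rw [hΦ1, hτ]
end

/-- **Chebotarev's theorem** (existence form) for Galois number fields. -/
theorem infinite_primes_frobenius_eq {N : Type} [Field N] [NumberField N] [IsGalois ℚ N]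
    (σ : N ≃ₐ[ℚ] N) :
    {p : ℕ | p.Prime ∧ ∀ (Ω : Type) [Field Ω] [IsAlgClosed Ω] [CharP Ω p],
      ∃ f : 𝓞 N →+* Ω, ∀ b, f b ^ p = f (σ • b)}.Infinite := by
  obtain ⟨ℓ, hℓ, hlt, hmod⟩ := Nat.exists_prime_gt_modEq_one (k := 2 * orderOf σ)
    (max 3 (discr N).natAbs) (mul_ne_zero two_ne_zero (orderOf_pos σ).ne')
  have : Fact ℓ.Prime := ⟨hℓ⟩
  have h3 : 3 < ℓ := lt_of_le_of_lt (le_max_left _ _) hlt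
  have hdisc : ¬ (ℓ : ℤ) ∣ discr N := by
    intro h
    have h1 := Nat.le_of_dvd (Int.natAbs_pos.mpr (discr_ne_zero N)) (Int.natCast_dvd.mp h)
    have := lt_of_le_of_lt (le_max_right _ _) hlt
    omega
  let P := CyclotomicField ℓ N
  let ζ : P := IsCyclotomicExtension.zeta ℓ N P
  have hζ : IsPrimitiveRoot ζ ℓ := IsCyclotomicExtension.zeta_spec ℓ N P
  obtain ⟨hG, hlift⟩ := exists_aut_cyclotomicExtension hdisc hζ
  obtain ⟨c, hc⟩ := IsCyclic.exists_generator (α := (ZMod ℓ)ˣ)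
  obtain ⟨τ, hτ, hτc⟩ := hlift σ c
  have hm : (1 : (ZMod ℓ)ˣ) ≠ -1 := by
    intro h
    have h1 : ((1 : (ZMod ℓ)ˣ) : ZMod ℓ) = ((-1 : (ZMod ℓ)ˣ) : ZMod ℓ) := congrArg _ h
    have : Fact (2 < ℓ) := ⟨by omega⟩
    rw [Units.val_neg, Units.val_one] at h1
    exact ZMod.neg_one_ne_one h1.symm
  refine (infinite_primes_frobenius hm hζ τ (by rw [hτc]; exact hc)).mono ?_
  rintro p ⟨hp, h⟩
  refine ⟨hp, fun Ω _ _ _ => ?_⟩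
  obtain ⟨f, k, hk, hf⟩ := h Ω
  have hsq : hζ.autToPow ℚ (τ ^ k) ^ 2 = hζ.autToPow ℚ τ ^ 2 := by
    rcases hk with h | h <;> rw [h]
    rw [neg_sq]
  have hk2 : σ ^ k = σ := by
    rw [map_zpow, hτc] at hsq
    have h1 : c ^ (2 * (k - 1)) = 1 := by
      rw [mul_sub, zpow_sub, mul_comm 2 k, zpow_mul, mul_one]
      rw [zpow_ofNat, zpow_ofNat, hsq, mul_inv_cancel]
    have h2 : orderOf c = ℓ - 1 := by
      rw [orderOf_eq_card_of_forall_mem_zpowers hc, Nat.card_eq_fintype_card, ZMod.card_units]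
    have h3 := orderOf_dvd_iff_zpow_eq_one.mpr h1
    have h4 : 2 * orderOf σ ∣ ℓ - 1 := (Nat.modEq_iff_dvd' (by omega)).mp hmod.symm
    rw [h2] at h3
    have h5 : ((2 * orderOf σ : ℕ) : ℤ) ∣ 2 * (k - 1) := (Int.natCast_dvd_natCast.mpr h4).trans h3
    push_cast at h5
    have h6 : (orderOf σ : ℤ) ∣ k - 1 := Int.dvd_of_mul_dvd_mul_left two_ne_zero h5
    have h7 := orderOf_dvd_iff_zpow_eq_one.mp h6
    rwa [zpow_sub, zpow_one, mul_inv_eq_one] at h7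
  have hτk : ∀ x, (τ ^ k) (algebraMap N P x) = algebraMap N P ((σ ^ k) x) := by
    have h1 : AlgEquiv.restrictNormalHom N τ = σ := AlgEquiv.ext fun x =>
      (algebraMap N P).injective ((AlgEquiv.restrictNormal_commutes τ N x).trans (hτ x))
    intro x
    rw [← h1, ← map_zpow]
    exact (AlgEquiv.restrictNormal_commutes (τ ^ k) N x).symm
  refine ⟨f.comp (algebraMap (𝓞 N) (𝓞 P)), fun b => ?_⟩
  have hb : (τ ^ k) • algebraMap (𝓞 N) (𝓞 P) b = algebraMap (𝓞 N) (𝓞 P) (σ • b) := by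
    refine RingOfIntegers.ext ?_
    refine (hτk b).trans ?_
    rw [hk2]
    rfl
  change f _ ^ p = f _
  rw [hf, hb]

end

section

open NumberField

theorem exists_galois_extension (F L : Type) [Field F] [CharZero F] [Field L] [Algebra F L]
    [FiniteDimensional F L] : ∃ (N : Type) (_ : Field N) (_ : Algebra F N) (_ : Algebra L N)
      (_ : IsScalarTower F L N), FiniteDimensional F N ∧ IsGalois F N :=
  ⟨IntermediateField.normalClosure F L (AlgebraicClosure L), inferInstance, inferInstance,
    inferInstance, inferInstance, inferInstance, { }⟩

theorem exists_galois_numberField (L : Type) [Field L] [NumberField L] :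
    ∃ (N : Type) (_ : Field N) (_ : NumberField N) (_ : Algebra L N), IsGalois ℚ N := by
  obtain ⟨N, hF, a, hLN, hT, hfd, hG⟩ := exists_galois_extension ℚ L
  have h0 : CharZero N := charZero_of_injective_algebraMap (algebraMap ℚ N).injective
  obtain rfl : a = DivisionRing.toRatAlgebra := Subsingleton.elim _ _
  exact ⟨N, hF, { to_finiteDimensional := hfd }, hLN, hG⟩

/-- The localization of a domain at the kernel of a homomorphism to a field, inside the fraction
field. -/
theorem exists_subring_localization {A K Ω : Type*} [CommRing A] [IsDomain A] [Field K]
    [Algebra A K] [IsFractionRing A K] [Field Ω] (f : A →+* Ω) :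
    ∃ (B : Subring K) (ψ : B →+* Ω), (∀ a b, f b ≠ 0 → algebraMap A K a / algebraMap A K b ∈ B) ∧
      ∀ x : B, ∃ a b, f b ≠ 0 ∧ (x : K) = algebraMap A K a / algebraMap A K b ∧
        ψ x = f a / f b := by
  let S : Submonoid A :=
    { carrier := {b | f b ≠ 0}
      one_mem' := by simp
      mul_mem' := fun {a b} ha hb => by
        simp only [Set.mem_ofPred_eq, map_mul] at *
        exact mul_ne_zero ha hb }
  have hS : S ≤ nonZeroDivisors A := fun b (hb : f b ≠ 0) =>
    mem_nonZeroDivisors_of_ne_zero fun h => hb (by rw [h, map_zero])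
  let B := Localization.subalgebra.ofField K S hS
  have hloc : IsLocalization S B := Localization.subalgebra.isLocalization_ofField K S hS
  have hunit : ∀ y : S, IsUnit (f y) := fun y => isUnit_iff_ne_zero.mpr y.2
  have hcoe : ∀ (a : A) (b : S), ((IsLocalization.mk' B a b : B) : K) =
      algebraMap A K a / algebraMap A K b := by
    intro a b
    have hb : algebraMap A K b ≠ 0 :=
      IsFractionRing.to_map_ne_zero_of_mem_nonZeroDivisors (hS b.2)
    rw [eq_div_iff hb]
    have := congrArg (fun x : B => (x : K)) (IsLocalization.mk'_spec B a b)
    exact this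
  refine ⟨B.toSubring, IsLocalization.lift (S := B) hunit, fun a b hb => ?_, fun x => ?_⟩
  · rw [← hcoe a ⟨b, hb⟩]
    exact Subtype.coe_prop _
  · obtain ⟨a, b, hab⟩ := IsLocalization.exists_mk'_eq S (⟨x.1, x.2⟩ : B)
    refine ⟨a, b, b.2, ?_, ?_⟩
    · rw [← hcoe, hab]
    · rw [eq_div_iff b.2]
      have h1 := congrArg (IsLocalization.lift (S := B) hunit) (IsLocalization.mk'_spec B a b)
      rw [map_mul, IsLocalization.lift_eq, IsLocalization.lift_eq, hab] at h1
      exact h1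

/-- There is a homomorphism on a `σ`-stable subring containing `T` to every algebraically closed
field of characteristic `p` which turns `σ` into the Frobenius. -/
def HasFrobeniusPlace {L : Type*} [Field L] (σ : L ≃+* L) (T : Set L) (p : ℕ) : Prop :=
  ∀ (Ω : Type) [Field Ω] [IsAlgClosed Ω] [CharP Ω p], ∃ B : Subring L, T ⊆ B ∧
    ∃ (hσ : ∀ x ∈ B, σ x ∈ B) (ψ : B →+* Ω), ∀ x : B, ψ ⟨σ x, hσ x x.2⟩ = ψ x ^ p

theorem infinite_hasFrobeniusPlace_of_isGalois {N : Type} [Field N] [NumberField N] [IsGalois ℚ N]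
    (σ : N ≃ₐ[ℚ] N) {T : Set N} (hT : T.Finite) :
    {p : ℕ | p.Prime ∧ HasFrobeniusPlace (σ : N ≃+* N) T p}.Infinite := by
  have hex : ∀ t : N, ∃ d : ℕ, ∃ a : 𝓞 N, d ≠ 0 ∧ t * d = a := by
    intro t
    obtain ⟨d, hd, h⟩ := exists_integral_multiples ℤ ℚ {t}
    have hi : IsIntegral ℤ (t * d.natAbs) := by
      have := h t (by simp)
      rw [zsmul_eq_mul, mul_comm] at this
      have h2 : ((d.natAbs : ℕ) : N) = ((d.natAbs : ℤ) : N) := by simp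
      rw [h2]
      rcases abs_choice d with h' | h'
      · rwa [Int.natCast_natAbs, h']
      · rw [Int.natCast_natAbs, h', Int.cast_neg, mul_neg]
        exact this.neg
    exact ⟨d.natAbs, ⟨_, hi⟩, Int.natAbs_ne_zero.mpr hd, rfl⟩
  choose d a hd hda using hex
  have hbad : {p : ℕ | ∃ t ∈ T, p ∣ d t}.Finite := by
    have : {p : ℕ | ∃ t ∈ T, p ∣ d t} = ⋃ t ∈ T, {p | p ∣ d t} := by ext; simp
    rw [this]
    refine hT.biUnion fun t _ => ?_
    exact (Set.finite_Iic (d t)).subset fun p hp => Nat.le_of_dvd (Nat.pos_of_ne_zero (hd t)) hp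
  refine ((infinite_primes_frobenius_eq σ).sdiff hbad).mono ?_
  rintro p ⟨⟨hp, h⟩, hpT⟩
  refine ⟨hp, fun Ω _ _ _ => ?_⟩
  obtain ⟨f, hf⟩ := h Ω
  obtain ⟨B, ψ, hB, hψ⟩ := exists_subring_localization (K := N) f
  have hwd : ∀ (x : B) (a b : 𝓞 N), f b ≠ 0 → (x : N) = a / b → ψ x = f a / f b := by
    intro x a b hb hx
    obtain ⟨a', b', hb', hx', hψx⟩ := hψ x
    rw [hψx, div_eq_div_iff hb' hb, ← map_mul, ← map_mul]
    congr 1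
    refine RingOfIntegers.ext ?_
    have h0 : ∀ c : 𝓞 N, f c ≠ 0 → (c : N) ≠ 0 := fun c hc h0 => hc (by
      rw [RingOfIntegers.coe_eq_zero_iff.mp h0, map_zero])
    rw [hx', div_eq_div_iff (h0 _ hb') (h0 _ hb)] at hx
    simpa using hx
  have hfσ : ∀ b, f b ≠ 0 → f (σ • b) ≠ 0 := fun b hb => by
    have : Nontrivial Ω := inferInstance
    rw [← hf]; exact pow_ne_zero _ hb
  have hσB : ∀ x ∈ B, ∀ a b : 𝓞 N, x = a / b →
      σ x = algebraMap (𝓞 N) N (σ • a) / algebraMap (𝓞 N) N (σ • b) := by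
    intro x _ a b hx
    rw [hx, map_div₀]
    rfl
  refine ⟨B, fun t ht => ?_, fun x hx => ?_, ψ, fun x => ?_⟩
  · have h1 : f (d t : 𝓞 N) ≠ 0 := by
      rw [map_natCast, Ne, CharP.cast_eq_zero_iff Ω p]
      exact fun h => hpT ⟨t, ht, h⟩
    have := hB (a t) (d t) h1
    have h2 : ((d t : ℕ) : N) ≠ 0 := Nat.cast_ne_zero.mpr (hd t)
    rw [map_natCast] at this
    rwa [show algebraMap (𝓞 N) N (a t) = t * d t from (hda t).symm, mul_div_cancel_right₀ _ h2]
      at this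
  · obtain ⟨a, b, hb, hx', -⟩ := hψ ⟨x, hx⟩
    have : σ x ∈ B := by
      rw [hσB x hx a b hx']
      exact hB _ _ (hfσ b hb)
    exact this
  · obtain ⟨a, b, hb, hx', h1⟩ := hψ x
    rw [h1, div_pow, hf, hf]
    exact hwd _ _ _ (hfσ b hb) (hσB _ x.2 a b hx')

/-- **Chebotarev's theorem** for automorphisms of number fields. -/
theorem infinite_hasFrobeniusPlace {L : Type} [Field L] [NumberField L] (σ : L ≃+* L) {T : Set L}
    (hT : T.Finite) : {p : ℕ | p.Prime ∧ HasFrobeniusPlace σ T p}.Infinite := by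
  obtain ⟨N, _, _, _, _⟩ := exists_galois_numberField L
  let σ' : L ≃ₐ[ℚ] L := AlgEquiv.ofRingEquiv (f := σ) fun r => by simp
  let τ : N ≃ₐ[ℚ] N := σ'.liftNormal N
  have hτ : ∀ x : L, τ (algebraMap L N x) = algebraMap L N (σ x) := fun x =>
    σ'.liftNormal_commutes N x
  refine (infinite_hasFrobeniusPlace_of_isGalois τ (hT.image (algebraMap L N))).mono ?_
  rintro p ⟨hp, h⟩
  refine ⟨hp, fun Ω _ _ _ => ?_⟩
  obtain ⟨B, hTB, hσ, ψ, hψ⟩ := h Ω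
  have hstab : ∀ x ∈ B.comap (algebraMap L N), σ x ∈ B.comap (algebraMap L N) := fun x hx => by
    rw [Subring.mem_comap, ← hτ]; exact hσ _ hx
  let i : B.comap (algebraMap L N) →+* B :=
    ((algebraMap L N).comp (B.comap (algebraMap L N)).subtype).codRestrict B fun x => x.2
  refine ⟨B.comap (algebraMap L N), fun t ht => hTB ⟨t, ht, rfl⟩, hstab, ψ.comp i, fun x => ?_⟩
  change ψ _ = ψ (i x) ^ p
  rw [← hψ]
  congr 1
  exact Subtype.ext (hτ x).symm

end

section

open Polynomial IsLocalRing

section Frobenius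

variable {K L : Type*} [Field K] [Field L] [Algebra K L] (v : ValuationSubring K) (w : ValuationSubring L)
  (hw : w.comap (algebraMap K L) = v) (b : w)

/-- Evaluation at an element of `w` of polynomials with coefficients in `v`. -/
noncomputable def ValuationSubring.evalAt : v[X] →+* w :=
  eval₂RingHom (ValuationSubring.extensionHom v w hw) b

/-- The residue of the evaluation at an element of `w`. -/
noncomputable def ValuationSubring.resAt : v[X] →+* ResidueField w :=
  (residue w).comp (ValuationSubring.evalAt v w hw b)

namespace ValuationSubring

theorem residue_extensionHom {K L : Type*} [Field K] [Field L] [Algebra K L]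
    {p : ℕ} [Fact p.Prime] (v : ValuationSubring K) (w : ValuationSubring L)
    (hw : w.comap (algebraMap K L) = v) (r : v →+* ZMod p) (hr : ∀ x, r x = 0 → ∃ y, x = p * y)
    [CharP (ResidueField w) p] (x : v) :
    residue w (extensionHom v w hw x) = ZMod.castHom dvd_rfl (ResidueField w) (r x) := by
  obtain ⟨n, hn⟩ := ZMod.natCast_zmod_surjective (r x)
  obtain ⟨y, hy⟩ := hr (x - n) (by rw [map_sub, map_natCast, hn, sub_self])
  have : x = p * y + n := by rw [← hy]; ring
  rw [← hn]
  conv_lhs => rw [this]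
  simp only [map_add, map_mul, map_natCast, CharP.cast_eq_zero, zero_mul, zero_add]

theorem residue_natCast_eq_zero {K L : Type*} [Field K] [Field L] [Algebra K L]
    {p : ℕ} [Fact p.Prime] (v : ValuationSubring K) (w : ValuationSubring L)
    (hw : w.comap (algebraMap K L) = v) (r : v →+* ZMod p) : (p : ResidueField w) = 0 := by
  rw [← map_natCast (residue w), residue_eq_zero_iff, mem_maximalIdeal]
  intro hu
  have h1 : IsUnit (p : v) := by
    have := isLocalHom_extensionHom v w hw
    refine isUnit_of_map_unit (extensionHom v w hw) _ ?_
    rwa [map_natCast]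
  have h2 := h1.map r
  rw [map_natCast, CharP.cast_eq_zero] at h2
  exact not_isUnit_zero h2

theorem charP_residueField {K L : Type*} [Field K] [Field L] [Algebra K L] {p : ℕ} [Fact p.Prime]
    (v : ValuationSubring K) (w : ValuationSubring L) (hw : w.comap (algebraMap K L) = v)
    (r : v →+* ZMod p) : CharP (ResidueField w) p :=
  (CharP.charP_iff_prime_eq_zero (Fact.out : p.Prime)).mpr (residue_natCast_eq_zero v w hw r)

theorem resAt_eq {K L : Type*} [Field K] [Field L] [Algebra K L] {p : ℕ} [Fact p.Prime]
    (v : ValuationSubring K) (w : ValuationSubring L) (hw : w.comap (algebraMap K L) = v)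
    (r : v →+* ZMod p) (hr : ∀ x, r x = 0 → ∃ y, x = p * y) (b : w)
    [CharP (ResidueField w) p] (P : v[X]) :
    resAt v w hw b P =
      (P.map r).eval₂ (ZMod.castHom dvd_rfl (ResidueField w)) (residue w b) := by
  rw [eval₂_map, resAt, evalAt, RingHom.comp_apply, coe_eval₂RingHom, hom_eval₂]
  congr 1
  ext x
  exact residue_extensionHom v w hw r hr x

theorem exists_cofactor {K L : Type*} [Field K] [Field L] [Algebra K L] {p : ℕ} [Fact p.Prime]
    (v : ValuationSubring K) (w : ValuationSubring L) (hw : w.comap (algebraMap K L) = v)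
    (r : v →+* ZMod p) (hr : ∀ x, r x = 0 → ∃ y, x = p * y) (b : w) (h : v[X])
    (hb : evalAt v w hw b h = 0) (hsep : (h.map r).Separable)
    [CharP (ResidueField w) p] : ∃ e : v[X], resAt v w hw b e ≠ 0 ∧
    ∀ P, resAt v w hw b P = 0 → ∃ P', e * P - C (p : v) * P' ∈ Ideal.span {h} := by
  let _ := ZMod.algebra (ResidueField w) p
  have hc : ZMod.castHom dvd_rfl (ResidueField w) = algebraMap (ZMod p) (ResidueField w) := rfl
  have hrs : Function.Surjective (Polynomial.map r) := map_surjective _ (ZMod.ringHom_surjective r)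
  have hh : aeval (residue w b) (h.map r) = 0 := by
    rw [aeval_def, ← hc, ← resAt_eq v w hw r hr, resAt, RingHom.comp_apply, hb, map_zero]
  obtain ⟨e', he'⟩ := minpoly.dvd _ _ hh
  obtain ⟨e, rfl⟩ := hrs e'
  refine ⟨e, ?_, fun P hP => ?_⟩
  · rw [resAt_eq v w hw r hr, hc, ← aeval_def]
    intro h0
    rw [he'] at hsep
    exact (minpoly.not_isUnit (ZMod p) _) (hsep.isCoprime.isUnit_of_dvd' dvd_rfl (minpoly.dvd _ _ h0))
  · rw [resAt_eq v w hw r hr, hc, ← aeval_def] at hP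
    obtain ⟨q', hq⟩ := minpoly.dvd _ _ hP
    obtain ⟨q, rfl⟩ := hrs q'
    have h0 : (e * P - h * q).map r = 0 := by
      simp only [Polynomial.map_sub, Polynomial.map_mul]
      rw [he', hq]; ring
    have h1 : C (p : v) ∣ e * P - h * q := by
      rw [C_dvd_iff_dvd_coeff]
      intro i
      have := congrArg (coeff · i) h0
      simp only [coeff_map, coeff_zero] at this
      obtain ⟨y, hy⟩ := hr _ this
      exact ⟨y, hy⟩
    obtain ⟨P', hP'⟩ := h1
    refine ⟨P', Ideal.mem_span_singleton.mpr ⟨q, ?_⟩⟩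
    linear_combination hP'

theorem exists_root_relation {K L : Type*} [Field K] [Field L] [Algebra K L]
    {p : ℕ} [Fact p.Prime] (v : ValuationSubring K) (w : ValuationSubring L)
    (hw : w.comap (algebraMap K L) = v) (r : v →+* ZMod p) (hr : ∀ x, r x = 0 → ∃ y, x = p * y)
    (b : w) (h : v[X]) (hm : h.Monic) (hb : evalAt v w hw b h = 0)
    [CharP (ResidueField w) p] :
    ∃ u : AlgebraicClosure (ZMod p), aeval u (h.map r) = 0 ∧
      ∀ P : v[X], aeval u (P.map r) = u ^ p → resAt v w hw b P = residue w b ^ p := by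
  let _ := ZMod.algebra (ResidueField w) p
  have hc : ZMod.castHom dvd_rfl (ResidueField w) = algebraMap (ZMod p) (ResidueField w) := rfl
  have hh : aeval (residue w b) (h.map r) = 0 := by
    rw [aeval_def, ← hc, ← resAt_eq v w hw r hr, resAt, RingHom.comp_apply, hb, map_zero]
  have hi : IsIntegral (ZMod p) (residue w b) := ⟨_, hm.map r, hh⟩
  obtain ⟨u, hu⟩ := IsAlgClosed.exists_aeval_eq_zero (AlgebraicClosure (ZMod p))
    (minpoly (ZMod p) (residue w b)) (minpoly.degree_pos hi).ne'
  have hmu := minpoly.eq_of_irreducible_of_monic (minpoly.irreducible hi) hu (minpoly.monic hi)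
  refine ⟨u, ?_, fun P hP => ?_⟩
  · obtain ⟨q, hq⟩ := minpoly.dvd _ _ hh
    rw [hq, map_mul, hu, zero_mul]
  · have h1 : minpoly (ZMod p) u ∣ P.map r - X ^ p := minpoly.dvd _ _ (by simp [hP])
    rw [← hmu] at h1
    have h2 := aeval_eq_zero_of_dvd_aeval_eq_zero h1 (minpoly.aeval _ _)
    rw [resAt_eq v w hw r hr, hc, ← aeval_def]
    simpa [sub_eq_zero] using h2

end ValuationSubring
end Frobenius

end

section

open Polynomial IsLocalRing

section Frobenius

variable {K L : Type*} [Field K] [Field L] [Algebra K L] (v : ValuationSubring K) (w : ValuationSubring L)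
  (hw : w.comap (algebraMap K L) = v) (b : w)

namespace ValuationSubring

theorem exists_pow_mul_eq {K L : Type*} [Field K] [Field L] [Algebra K L] {p : ℕ} [Fact p.Prime]
    (v : ValuationSubring K) (w : ValuationSubring L) (hw : w.comap (algebraMap K L) = v)
    (r : v →+* ZMod p) (hr : ∀ x, r x = 0 → ∃ y, x = p * y) (b : w) (h : v[X])
    (hb : evalAt v w hw b h = 0) (hsep : (h.map r).Separable)
    [CharP (ResidueField w) p] (hp0 : (p : L) ≠ 0) (M : ℕ) :
    ∀ P Q s : v[X], evalAt v w hw b P * evalAt v w hw b Q = (p : w) ^ M * evalAt v w hw b s →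
      resAt v w hw b s ≠ 0 → ∃ n : ℕ, ∃ c d : v[X], resAt v w hw b c ≠ 0 ∧ resAt v w hw b d ≠ 0 ∧
        evalAt v w hw b P * evalAt v w hw b d = (p : w) ^ n * evalAt v w hw b c := by
  have hp0' : (p : w) ≠ 0 := fun h0 => hp0 (by simpa using congrArg Subtype.val h0)
  obtain ⟨e, he, hcof⟩ := exists_cofactor v w hw r hr b h hb hsep
  induction M with
  | zero =>
    intro P Q s hPQ hs
    refine ⟨0, P, 1, ?_, by simp, by simp⟩
    intro h0
    apply hs
    have := congrArg (residue w) hPQ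
    rw [map_mul, pow_zero, one_mul] at this
    change resAt v w hw b P * _ = resAt v w hw b s at this
    rw [← this, h0, zero_mul]
  | succ M ih =>
    intro P Q s hPQ hs
    by_cases h0 : resAt v w hw b P = 0
    · obtain ⟨P', hP'⟩ := hcof P h0
      obtain ⟨q, hq⟩ := Ideal.mem_span_singleton.mp hP'
      have h1 := congrArg (evalAt v w hw b) hq
      simp only [map_sub, map_mul, hb, zero_mul, map_natCast, sub_eq_zero] at h1
      obtain ⟨n, c, d, hc, hd, hcd⟩ := ih P' Q (s * e) (by
        apply mul_left_cancel₀ hp0'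
        rw [map_mul]
        linear_combination evalAt v w hw b e * hPQ - evalAt v w hw b Q * h1) (by
        rw [map_mul]; exact mul_ne_zero hs he)
      refine ⟨n + 1, c, d * e, hc, by rw [map_mul]; exact mul_ne_zero hd he, ?_⟩
      rw [map_mul]
      linear_combination evalAt v w hw b d * h1 + (p : w) * hcd
    · exact ⟨0, P, 1, h0, by simp, by simp⟩

theorem exists_zpow_mul {K L : Type*} [Field K] [Field L] [Algebra K L] {p : ℕ} [Fact p.Prime]
    (v : ValuationSubring K) (w : ValuationSubring L) (hw : w.comap (algebraMap K L) = v)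
    (r : v →+* ZMod p) (hr : ∀ x, r x = 0 → ∃ y, x = p * y) (b : w) (h : v[X])
    (hb : evalAt v w hw b h = 0) (hsep : (h.map r).Separable)
    [CharP (ResidueField w) p] (hp0 : (p : L) ≠ 0)
    (hgen : ∀ x : L, ∃ P : v[X], ∃ n : ℕ, x * p ^ n = evalAt v w hw b P) {x : L} (hx : x ≠ 0) :
    ∃ n : ℤ, ∃ c d : v[X], resAt v w hw b c ≠ 0 ∧ resAt v w hw b d ≠ 0 ∧
      x * evalAt v w hw b d = (p : L) ^ n * evalAt v w hw b c := by
  obtain ⟨P, m, hP⟩ := hgen x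
  obtain ⟨Q, m', hQ⟩ := hgen x⁻¹
  obtain ⟨n, c, d, hc, hd, hcd⟩ := exists_pow_mul_eq v w hw r hr b h hb hsep hp0 (m + m') P Q 1 (by
    apply Subtype.ext
    push_cast
    rw [← hP, ← hQ, map_one, OneMemClass.coe_one]
    field_simp
    ring) (by simp)
  refine ⟨n - m, c, d, hc, hd, ?_⟩
  have := congrArg Subtype.val hcd
  push_cast at this
  rw [← hP] at this
  rw [zpow_sub₀ hp0, zpow_natCast, zpow_natCast]
  field_simp
  linear_combination this

theorem valuation_evalAt {c : v[X]} (hc : resAt v w hw b c ≠ 0) :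
    w.valuation (evalAt v w hw b c) = 1 := by
  rw [← valuation_eq_one_iff]
  by_contra h0
  exact hc (by rw [resAt, RingHom.comp_apply, residue_eq_zero_iff, mem_maximalIdeal]; exact h0)

end ValuationSubring
end Frobenius

end

section

open Polynomial IsLocalRing

section Frobenius

variable {K L : Type*} [Field K] [Field L] [Algebra K L] (v : ValuationSubring K) (w : ValuationSubring L)
  (hw : w.comap (algebraMap K L) = v) (b : w)

namespace ValuationSubring

theorem apply_evalAt (τ : L ≃ₐ[K] L) {P : v[X]} (hP : τ b = evalAt v w hw b P) (Q : v[X]) :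
    τ (evalAt v w hw b Q) = evalAt v w hw b (Q.comp P) := by
  have : ((τ : L →+* L).comp w.subtype).comp (evalAt v w hw b) =
      (w.subtype.comp (evalAt v w hw b)).comp (compRingHom P) := by
    refine ringHom_ext (fun a => ?_) ?_
    · simp [evalAt, extensionHom]
    · simpa [evalAt] using hP
  exact congrArg (fun f => f Q) this

theorem resAt_comp {K L : Type*} [Field K] [Field L] [Algebra K L] {p : ℕ} [Fact p.Prime]
    (v : ValuationSubring K) (w : ValuationSubring L) (hw : w.comap (algebraMap K L) = v)
    (r : v →+* ZMod p) (hr : ∀ x, r x = 0 → ∃ y, x = p * y) (b : w)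
    [CharP (ResidueField w) p] {P : v[X]}
    (hP : resAt v w hw b P = residue w b ^ p) (Q : v[X]) :
    resAt v w hw b (Q.comp P) = resAt v w hw b Q ^ p := by
  have : (resAt v w hw b).comp (compRingHom P) =
      (frobenius (ResidueField w) p).comp (resAt v w hw b) := by
    refine ringHom_ext (fun a => ?_) ?_
    · have : resAt v w hw b (C a) = ZMod.castHom dvd_rfl (ResidueField w) (r a) := by
        rw [← residue_extensionHom v w hw r hr]; simp [resAt, evalAt]
      simp only [RingHom.comp_apply, coe_compRingHom_apply, C_comp, frobenius_def, this, ← map_pow]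
      rw [map_pow, ZMod.pow_card]
    · simp only [RingHom.comp_apply, coe_compRingHom_apply, X_comp, hP, frobenius_def]
      simp [resAt, evalAt]
  exact congrArg (fun f => f Q) this

theorem card_residueField {K : Type*} [Field K] {p : ℕ} [Fact p.Prime] (v : ValuationSubring K)
    (r : v →+* ZMod p) : Nat.card (ResidueField v) = p := by
  have hs : Function.Surjective r := ZMod.ringHom_surjective r
  have hk : RingHom.ker r = maximalIdeal v :=
    eq_maximalIdeal (RingHom.ker_isMaximal_of_surjective r hs)
  have e := (Ideal.quotEquivOfEq hk).symm.trans (RingHom.quotientKerEquivOfSurjective hs)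
  rw [Nat.card_congr (show ResidueField v ≃ ZMod p from e.toEquiv), Nat.card_zmod]

theorem exists_residue_eq {K L : Type*} [Field K] [Field L] [Algebra K L] {p : ℕ} [Fact p.Prime]
    (v : ValuationSubring K) (w : ValuationSubring L) (hw : w.comap (algebraMap K L) = v)
    (r : v →+* ZMod p) (hr : ∀ x, r x = 0 → ∃ y, x = p * y) (b : w) (h : v[X])
    (hb : evalAt v w hw b h = 0) (hsep : (h.map r).Separable)
    [CharP (ResidueField w) p] (hp0 : (p : L) ≠ 0)
    (hgen : ∀ x : L, ∃ P : v[X], ∃ n : ℕ, x * p ^ n = evalAt v w hw b P) (x : w) :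
    ∃ c d : v[X], resAt v w hw b d ≠ 0 ∧ x * evalAt v w hw b d = evalAt v w hw b c := by
  by_cases hx : (x : L) = 0
  · exact ⟨0, 1, by simp, by simp [Subtype.ext_iff, hx]⟩
  obtain ⟨n, c, d, hc, hd, hcd⟩ := exists_zpow_mul v w hw r hr b h hb hsep hp0 hgen hx
  have hn : 0 ≤ n := by
    by_contra hn
    push Not at hn
    have h1 := congrArg w.valuation hcd
    rw [map_mul, map_mul, valuation_evalAt v w hw b hd, valuation_evalAt v w hw b hc, mul_one,
      mul_one, map_zpow₀] at h1
    have h2 : w.valuation x ≤ 1 := (w.valuation_le_one_iff x).mpr x.2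
    have h3 : w.valuation (p : L) < 1 := by
      have := residue_natCast_eq_zero v w hw r
      rw [← map_natCast (residue w), residue_eq_zero_iff] at this
      have := (valuation_lt_one_iff w _).mp this
      simpa using this
    rw [h1] at h2
    have h4 : 0 < w.valuation (p : L) := by simpa [Valuation.pos_iff] using hp0
    exact absurd h2 (not_le.mpr (one_lt_zpow_of_neg₀ h4 h3 hn))
  obtain ⟨m, rfl⟩ := Int.eq_ofNat_of_zero_le hn
  refine ⟨C (p : v) ^ m * c, d, hd, Subtype.ext ?_⟩
  push_cast
  rw [hcd]
  simp

theorem isFrobeniusAt_of_resAt {K L : Type*} [Field K] [Field L] [Algebra K L]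
    {p : ℕ} [Fact p.Prime] (v : ValuationSubring K) (w : ValuationSubring L)
    (hw : w.comap (algebraMap K L) = v) (r : v →+* ZMod p) (hr : ∀ x, r x = 0 → ∃ y, x = p * y)
    (b : w) (h : v[X]) (hb : evalAt v w hw b h = 0) (hsep : (h.map r).Separable)
    [CharP (ResidueField w) p] (hp0 : (p : L) ≠ 0)
    (hgen : ∀ x : L, ∃ P : v[X], ∃ n : ℕ, x * p ^ n = evalAt v w hw b P) (τ : L ≃ₐ[K] L)
    {P : v[X]} (hP : τ b = evalAt v w hw b P) (hP' : resAt v w hw b P = residue w b ^ p) :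
    IsFrobeniusAt v w τ := by
  have hval : ∀ x : L, w.valuation (τ x) = w.valuation x := by
    intro x
    by_cases hx : x = 0
    · simp [hx]
    obtain ⟨n, c, d, hc, hd, hcd⟩ := exists_zpow_mul v w hw r hr b h hb hsep hp0 hgen hx
    have h1 := congrArg w.valuation (congrArg τ hcd)
    have h2 := congrArg w.valuation hcd
    have hc' : w.valuation (evalAt v w hw b (c.comp P)) = 1 :=
      valuation_evalAt v w hw b (by
        rw [resAt_comp v w hw r hr b hP']; exact pow_ne_zero _ hc)
    have hd' : w.valuation (evalAt v w hw b (d.comp P)) = 1 :=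
      valuation_evalAt v w hw b (by
        rw [resAt_comp v w hw r hr b hP']; exact pow_ne_zero _ hd)
    simp only [map_mul, map_zpow₀, map_natCast, apply_evalAt v w hw b τ hP, hc', hd', mul_one] at h1
    simp only [map_mul, map_zpow₀, valuation_evalAt v w hw b hc, valuation_evalAt v w hw b hd,
      mul_one] at h2
    rw [h1, h2]
  have hmem : ∀ x : L, x ∈ w ↔ τ x ∈ w := fun x => by
    rw [← valuation_le_one_iff, ← valuation_le_one_iff, hval]
  refine ⟨hmem, fun x hx => ?_⟩
  obtain ⟨c, d, hd, hcd⟩ := exists_residue_eq v w hw r hr b h hb hsep hp0 hgen ⟨x, hx⟩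
  rw [card_residueField v r]
  suffices hs : residue w (⟨τ x, (hmem x).mp hx⟩ - ⟨x, hx⟩ ^ p) = 0 by
    rw [residue_eq_zero_iff] at hs
    simpa using (valuation_lt_one_iff w _).mp hs
  rw [map_sub, map_pow, sub_eq_zero]
  have h1 : residue w ⟨x, hx⟩ * resAt v w hw b d = resAt v w hw b c := by
    have := congrArg (residue w) hcd
    rwa [map_mul] at this
  have h2 : residue w ⟨τ x, (hmem x).mp hx⟩ * resAt v w hw b (d.comp P) =
      resAt v w hw b (c.comp P) := by
    have : (⟨τ x, (hmem x).mp hx⟩ : w) * evalAt v w hw b (d.comp P) =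
        evalAt v w hw b (c.comp P) := by
      apply Subtype.ext
      push_cast
      rw [← apply_evalAt v w hw b τ hP, ← apply_evalAt v w hw b τ hP, ← map_mul]
      exact congrArg τ (congrArg Subtype.val hcd)
    have := congrArg (residue w) this
    rwa [map_mul] at this
  rw [resAt_comp v w hw r hr b hP', resAt_comp v w hw r hr b hP', ← h1, mul_pow] at h2
  exact mul_right_cancel₀ (pow_ne_zero _ hd) h2

theorem isUnramifiedExtension_of_separable {K L : Type*} [Field K] [Field L] [Algebra K L]
    {p : ℕ} [Fact p.Prime] (v : ValuationSubring K) (w : ValuationSubring L)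
    (hw : w.comap (algebraMap K L) = v) (r : v →+* ZMod p) (hr : ∀ x, r x = 0 → ∃ y, x = p * y)
    (b : w) (h : v[X]) (hm : h.Monic) (hb : evalAt v w hw b h = 0) (hsep : (h.map r).Separable)
    [CharP (ResidueField w) p] (hp0 : (p : L) ≠ 0)
    (hgen : ∀ x : L, ∃ P : v[X], ∃ n : ℕ, x * p ^ n = evalAt v w hw b P) :
    IsUnramifiedExtension v w hw := by
  constructor
  · intro x hx
    obtain ⟨n, c, d, hc, hd, hcd⟩ := exists_zpow_mul v w hw r hr b h hb hsep hp0 hgen hx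
    refine ⟨(p : K) ^ n, ?_, ?_⟩
    · refine zpow_ne_zero _ fun h0 => hp0 ?_
      rw [← map_natCast (algebraMap K L), h0, map_zero]
    · have := congrArg w.valuation hcd
      rw [map_mul, map_mul, valuation_evalAt v w hw b hd, valuation_evalAt v w hw b hc, mul_one,
        mul_one] at this
      rw [this, map_zpow₀ (algebraMap K L), map_natCast]
  · let _ := (ResidueField.map (extensionHom v w hw)).toAlgebra
    have hfin : Finite (ResidueField v) :=
      Nat.finite_of_card_ne_zero (by
        rw [card_residueField v r]; exact (Fact.out : p.Prime).ne_zero)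
    have hbi : IsIntegral (ResidueField v) (residue w b) := by
      refine ⟨h.map (residue v), hm.map _, ?_⟩
      rw [eval₂_map]
      have := congrArg (residue w) hb
      rwa [evalAt, coe_eval₂RingHom, hom_eval₂, map_zero] at this
    have hint : ∀ c : v[X], IsIntegral (ResidueField v) (resAt v w hw b c) := by
      intro c
      have : resAt v w hw b c = aeval (residue w b) (c.map (residue v)) := by
        rw [aeval_def, eval₂_map, resAt, RingHom.comp_apply, evalAt, coe_eval₂RingHom, hom_eval₂]
        rfl
      rw [this]
      exact adjoin_le_integralClosure hbi (aeval_mem_adjoin_singleton _ _)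
    have : Algebra.IsAlgebraic (ResidueField v) (ResidueField w) := by
      refine ⟨fun y => ?_⟩
      obtain ⟨x, rfl⟩ := residue_surjective y
      obtain ⟨c, d, hd, hcd⟩ := exists_residue_eq v w hw r hr b h hb hsep hp0 hgen x
      have h1 : residue w x * resAt v w hw b d = resAt v w hw b c := by
        have := congrArg (residue w) hcd
        rwa [map_mul] at this
      rw [eq_div_of_mul_eq hd h1]
      exact (hint c).isAlgebraic.mul (hint d).isAlgebraic.inv
    exact Algebra.IsAlgebraic.isSeparable_of_perfectField

end ValuationSubring
end Frobenius

end

section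

open Polynomial IsLocalRing

section Frobenius

variable {K : Type*} [Field K] {p : ℕ} [Fact p.Prime] (ι : K →+* ℚ_[p])

/-- The valuation subring of a field embedded in `ℚ_p` obtained by pulling back `ℤ_p`. -/
noncomputable abbrev padicPullback : ValuationSubring K := (padicValuationSubring p).comap ι

/-- The map into `ℤ_p` induced by an embedding of a field into `ℚ_p`. -/
noncomputable def padicIntegerMap : padicPullback ι →+* ℤ_[p] :=
  (ι.comp (padicPullback ι).subtype).codRestrict (PadicInt.subring p) fun x => x.2

theorem coe_padicIntegerMap (x : padicPullback ι) : (padicIntegerMap ι x : ℚ_[p]) = ι x := rfl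

/-- The reduction modulo `p` of the elements of a field embedded in `ℚ_p` that are integral. -/
noncomputable def padicReduction : padicPullback ι →+* ZMod p :=
  PadicInt.toZMod.comp (padicIntegerMap ι)

theorem padicReduction_eq_zero {x : padicPullback ι}
    (hx : padicReduction ι x = 0) : ∃ y, x = p * y := by
  have h1 : padicIntegerMap ι x ∈ RingHom.ker (PadicInt.toZMod (p := p)) := hx
  rw [PadicInt.ker_toZMod, PadicInt.maximalIdeal_eq_span_p, Ideal.mem_span_singleton] at h1
  obtain ⟨z, hz⟩ := h1
  have hz' : ι x = p * (z : ℚ_[p]) := by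
    rw [← coe_padicIntegerMap, hz]
    simp
  have hp : (p : ℚ_[p]) ≠ 0 := by exact_mod_cast (Fact.out : p.Prime).ne_zero
  have hpK : (p : K) ≠ 0 := fun h0 => hp (by rw [← map_natCast ι, h0, map_zero])
  refine ⟨⟨x / p, ?_⟩, ?_⟩
  · change ι (x / p) ∈ PadicInt.subring p
    rw [map_div₀, hz', map_natCast, mul_div_cancel_left₀ _ hp]
    exact z.2
  · apply Subtype.ext
    push_cast
    rw [mul_div_cancel₀ _ hpK]

theorem exists_mul_pow_mem_padicValuationSubring (x : K) :
    ∃ n : ℕ, x * p ^ n ∈ padicPullback ι := by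
  have hp : (p : ℚ_[p]) ≠ 0 := by exact_mod_cast (Fact.out : p.Prime).ne_zero
  by_cases hx : x = 0
  · exact ⟨0, by simp [hx, zero_mem]⟩
  have hx' : 0 < ‖ι x‖ := norm_pos_iff.mpr (by simpa using hx)
  obtain ⟨n, hn⟩ := exists_pow_lt_of_lt_one (inv_pos.mpr hx') (Padic.norm_p_lt_one (p := p))
  refine ⟨n, ?_⟩
  change ‖ι (x * p ^ n)‖ ≤ 1
  rw [map_mul, map_pow, map_natCast, norm_mul, norm_pow]
  calc _ ≤ ‖ι x‖ * ‖ι x‖⁻¹ := by gcongr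
    _ = 1 := mul_inv_cancel₀ hx'.ne'

theorem isUnramified_and_isFrobeniusAt_of_roots {L : Type*} [Field L] [Algebra K L]
    (𝒞 : Set (L ≃ₐ[K] L)) (β : L) (hβ : ∀ x : L, ∃ Q : K[X], x = aeval β Q)
    (h : (padicPullback ι)[X]) (hm : h.Monic)
    (hroot : h.eval₂ ((algebraMap K L).comp (ValuationSubring.subtype _)) β = 0)
    (hsep : (h.map (padicReduction ι)).Separable)
    (hfrob : ∀ u : AlgebraicClosure (ZMod p), aeval u (h.map (padicReduction ι)) = 0 →
      ∃ τ ∈ 𝒞, ∃ P : (padicPullback ι)[X],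
        τ β = P.eval₂ ((algebraMap K L).comp (ValuationSubring.subtype _)) β ∧
        aeval u (P.map (padicReduction ι)) = u ^ p)
    (w : ValuationSubring L) (hw : w.comap (algebraMap K L) = padicPullback ι) :
    ValuationSubring.IsUnramifiedExtension _ w hw ∧
      ∃ σ ∈ 𝒞, ValuationSubring.IsFrobeniusAt (padicPullback ι) w σ := by
  have hr : ∀ x, padicReduction ι x = 0 → ∃ y, x = p * y := fun x => padicReduction_eq_zero ι
  have hp : (p : ℚ_[p]) ≠ 0 := by exact_mod_cast (Fact.out : p.Prime).ne_zero
  have hpL : (p : L) ≠ 0 := fun h0 => hp (by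
    have : (p : K) = 0 := (algebraMap K L).injective (by rw [map_natCast, h0, map_zero])
    rw [← map_natCast ι, this, map_zero])
  have hext : ∀ x : padicPullback ι, ((ValuationSubring.extensionHom (padicPullback ι) w hw x : w) : L) = algebraMap K L x :=
    fun x => rfl
  have hβw : β ∈ w := by
    have : IsIntegral w β := by
      refine ⟨h.map (ValuationSubring.extensionHom (padicPullback ι) w hw), hm.map _, ?_⟩
      rw [eval₂_map]
      exact hroot
    obtain ⟨y, hy⟩ := (IsIntegrallyClosed.isIntegral_iff (R := w) (K := L)).mp this
    rw [← hy]; exact y.2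
  let b : w := ⟨β, hβw⟩
  have hev : ∀ P : (padicPullback ι)[X], (ValuationSubring.evalAt (padicPullback ι) w hw b P : L) =
      P.eval₂ ((algebraMap K L).comp (ValuationSubring.subtype _)) β := by
    intro P
    change w.subtype _ = _
    rw [ValuationSubring.evalAt, coe_eval₂RingHom, hom_eval₂]
    rfl
  have hb : ValuationSubring.evalAt (padicPullback ι) w hw b h = 0 := Subtype.ext (by rw [hev, hroot]; rfl)
  have hch := ValuationSubring.charP_residueField _ w hw (padicReduction ι)
  have hgen : ∀ x : L, ∃ P : (padicPullback ι)[X], ∃ n : ℕ, x * p ^ n = ValuationSubring.evalAt (padicPullback ι) w hw b P := by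
    intro x
    obtain ⟨Q, rfl⟩ := hβ x
    induction Q using Polynomial.induction_on' with
    | add Q Q' h1 h2 =>
      obtain ⟨P, n, hP⟩ := h1
      obtain ⟨P', n', hP'⟩ := h2
      refine ⟨P * p ^ n' + P' * p ^ n, n + n', ?_⟩
      push_cast [map_add, map_mul, map_pow, map_natCast]
      rw [← hP, ← hP', pow_add]
      ring
    | monomial k a =>
      obtain ⟨n, hn⟩ := exists_mul_pow_mem_padicValuationSubring ι a
      refine ⟨monomial k ⟨_, hn⟩, n, ?_⟩
      rw [hev, eval₂_monomial, aeval_monomial]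
      simp only [RingHom.comp_apply, ValuationSubring.subtype_apply, map_mul, map_pow, map_natCast]
      ring
  refine ⟨ValuationSubring.isUnramifiedExtension_of_separable _ w hw (padicReduction ι) hr b h hm hb hsep hpL hgen, ?_⟩
  obtain ⟨u, hu, hP⟩ := ValuationSubring.exists_root_relation _ w hw (padicReduction ι) hr b h hm hb
  obtain ⟨τ, hτ, P, hP1, hP2⟩ := hfrob u hu
  exact ⟨τ, hτ, ValuationSubring.isFrobeniusAt_of_resAt _ w hw (padicReduction ι) hr b h hb hsep hpL hgen τ
    (P := P) (by rw [hev]; exact hP1) (hP P hP2)⟩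

end Frobenius

end

section

open Polynomial

section Padic

variable {p : ℕ} [Fact p.Prime]

theorem countable_adjoin_of_finite {A : Type*} [CommRing A] [Algebra ℚ A] {s : Set A}
    (hs : s.Finite) : Countable (Algebra.adjoin ℚ s) := by
  have : Algebra.FiniteType ℚ (Algebra.adjoin ℚ s) :=
    (Algebra.adjoin ℚ s).fg_iff_finiteType.mp ⟨hs.toFinset, by simp⟩
  obtain ⟨n, f, hf⟩ := Algebra.FiniteType.iff_quotient_mvPolynomial''.mp this
  have : Countable (MvPolynomial (Fin n) ℚ) := by
    rw [← Cardinal.mk_le_aleph0_iff]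
    exact MvPolynomial.cardinalMk_le_max.trans (by simp)
  exact hf.countable

theorem exists_algebraicIndependent_norm_sub_lt {τ : Type*} [Finite τ] (a : τ → ℤ_[p]) :
    ∃ x : τ → ℚ_[p], AlgebraicIndependent ℚ x ∧ ∀ i, ‖x i - a i‖ < 1 := by
  classical
  have := Fintype.ofFinite τ
  suffices H : ∀ s : Finset τ, ∃ x : τ → ℚ_[p], AlgebraicIndepOn ℚ x (s : Set τ) ∧
      ∀ i ∈ s, ‖x i - a i‖ < 1 by
    obtain ⟨x, hx, hxa⟩ := H Finset.univ
    refine ⟨x, ?_, fun i => hxa i (Finset.mem_univ i)⟩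
    rw [Finset.coe_univ] at hx
    exact (algebraicIndependent_equiv (Equiv.Set.univ τ)).mp hx
  intro s
  induction s using Finset.induction_on with
  | empty => exact ⟨fun _ => 0, by
      rw [Finset.coe_empty]
      exact algebraicIndependent_empty_type_iff.mpr (algebraMap ℚ ℚ_[p]).injective, by simp⟩
  | insert j s hj ih =>
    obtain ⟨x, hx, hxa⟩ := ih
    have hc := countable_adjoin_of_finite (s.finite_toSet.image x)
    have hcount := Algebraic.countable (Algebra.adjoin ℚ (x '' s)) ℚ_[p]
    obtain ⟨y, hy, hya⟩ := (hcount.dense_compl ℚ_[p]).exists_dist_lt (a j : ℚ_[p]) one_pos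
    have hcongr : ∀ i ∈ s, Function.update x j y i = x i := fun i hi =>
      Function.update_of_ne (ne_of_mem_of_not_mem hi hj) _ _
    refine ⟨Function.update x j y, ?_, ?_⟩
    · rw [Finset.coe_insert]
      refine AlgebraicIndepOn.insert ?_ ?_
      · have : (fun i : (s : Set τ) => Function.update x j y i) = fun i : (s : Set τ) => x i :=
          funext fun i => hcongr i i.2
        rw [AlgebraicIndepOn, this]
        exact hx
      · rw [Function.update_self, Set.image_congr (g := x) hcongr]
        exact hy
    · intro i hi
      rcases Finset.mem_insert.mp hi with rfl | hi
      · rw [Function.update_self, ← dist_eq_norm, dist_comm]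
        exact hya
      · rw [hcongr i hi]
        exact hxa i hi

theorem AlgebraicIndependent.exists_algHom {k A B τ : Type*} [Field k] [Field A] [Field B]
    [Algebra k A] [Algebra k B] {x : τ → A} {y : τ → B} (hx : AlgebraicIndependent k x)
    (hy : AlgebraicIndependent k y) (htop : IntermediateField.adjoin k (Set.range x) = ⊤) :
    ∃ e : A →ₐ[k] B, ∀ i, e (x i) = y i := by
  refine ⟨(IntermediateField.val _).comp
    ((hy.aevalEquivField.toAlgHom.comp hx.aevalEquivField.symm.toAlgHom).comp
      ((IntermediateField.equivOfEq htop).symm.toAlgHom.comp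
        IntermediateField.topEquiv.symm.toAlgHom)), fun i => ?_⟩
  have h1 : hx.aevalEquivField (algebraMap (MvPolynomial τ k) _ (MvPolynomial.X i)) =
      (IntermediateField.equivOfEq htop).symm (IntermediateField.topEquiv.symm (x i)) := by
    apply Subtype.ext
    rw [AlgebraicIndependent.aevalEquivField_algebraMap_apply_coe, MvPolynomial.aeval_X]
    rfl
  change ((hy.aevalEquivField (hx.aevalEquivField.symm ((IntermediateField.equivOfEq htop).symm
    (IntermediateField.topEquiv.symm (x i)))) : _) : B) = y i
  rw [← h1, AlgEquiv.symm_apply_apply,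
    AlgebraicIndependent.aevalEquivField_algebraMap_apply_coe, MvPolynomial.aeval_X]

/-- Purely transcendental fields embed in `ℚ_p` with prescribed reductions of the variables. -/
theorem exists_padic_embedding_of_algebraicIndependent {F τ : Type*} [Field F] [CharZero F]
    [Finite τ] {x : τ → F} (hx : AlgebraicIndependent ℚ x)
    (htop : IntermediateField.adjoin ℚ (Set.range x) = ⊤) (a : τ → ZMod p) :
    ∃ ι : F →+* ℚ_[p], ∀ i, ∃ h : x i ∈ padicPullback ι, padicReduction ι ⟨x i, h⟩ = a i := by
  choose a' ha' using fun i => ZMod.ringHom_surjective (PadicInt.toZMod (p := p)) (a i)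
  obtain ⟨y, hy, hya⟩ := exists_algebraicIndependent_norm_sub_lt a'
  obtain ⟨e, he⟩ := hx.exists_algHom hy htop
  refine ⟨e, fun i => ?_⟩
  have hmem : x i ∈ padicPullback (e : F →+* ℚ_[p]) := by
    change ‖e (x i)‖ ≤ 1
    rw [he]
    have : y i = (y i - a' i) + a' i := by ring
    rw [this]
    exact (Padic.nonarchimedean _ _).trans (max_le (hya i).le (a' i).norm_le_one)
  refine ⟨hmem, ?_⟩
  rw [← ha', ← sub_eq_zero, padicReduction, RingHom.comp_apply, ← map_sub, ← RingHom.mem_ker,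
    PadicInt.ker_toZMod, PadicInt.maximalIdeal_eq_span_p, Ideal.mem_span_singleton,
    ← PadicInt.norm_lt_one_iff_dvd]
  have := hya i
  rw [← he] at this
  exact this

end Padic

end

section

open Polynomial

section Compatible

variable {p : ℕ} [Fact p.Prime] {K Ω : Type*} [Field K] [Field Ω] [CharP Ω p]

/-- The elements on which the reduction of an embedding into `ℚ_p` is defined and agrees with a
given homomorphism to a field of characteristic `p`. -/
noncomputable def compatibleSubring (ι : K →+* ℚ_[p]) (B : Subring K) (ψ : B →+* Ω) :
    Subring K where
  carrier := {x | ∃ (hB : x ∈ B) (hV : x ∈ padicPullback ι),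
    ZMod.castHom dvd_rfl Ω (padicReduction ι ⟨x, hV⟩) = ψ ⟨x, hB⟩}
  mul_mem' := by
    rintro x y ⟨hx, hx', h⟩ ⟨hy, hy', h'⟩
    refine ⟨mul_mem hx hy, mul_mem hx' hy', ?_⟩
    have := congrArg₂ (· * ·) h h'
    simp only [← map_mul] at this
    exact this
  one_mem' := ⟨one_mem _, one_mem _, (map_one ((ZMod.castHom dvd_rfl Ω).comp (padicReduction ι))).trans
    (map_one ψ).symm⟩
  add_mem' := by
    rintro x y ⟨hx, hx', h⟩ ⟨hy, hy', h'⟩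
    refine ⟨add_mem hx hy, add_mem hx' hy', ?_⟩
    have := congrArg₂ (· + ·) h h'
    simp only [← map_add] at this
    exact this
  zero_mem' := ⟨zero_mem _, zero_mem _,
    (map_zero ((ZMod.castHom dvd_rfl Ω).comp (padicReduction ι))).trans (map_zero ψ).symm⟩
  neg_mem' := by
    rintro x ⟨hx, hx', h⟩
    refine ⟨neg_mem hx, neg_mem hx', ?_⟩
    have := congrArg (- ·) h
    simp only [← map_neg] at this
    exact this

variable {ι : K →+* ℚ_[p]} {B : Subring K} {ψ : B →+* Ω}

theorem padicReduction_eq_zero_of_norm_lt_one {x : padicPullback ι} (h : ‖ι x‖ < 1) :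
    padicReduction ι x = 0 := by
  rw [padicReduction, RingHom.comp_apply, ← RingHom.mem_ker,
    PadicInt.ker_toZMod, PadicInt.maximalIdeal_eq_span_p, Ideal.mem_span_singleton,
    ← PadicInt.norm_lt_one_iff_dvd]
  exact h

theorem inv_mem_compatibleSubring {x : K} (hx : x ∈ compatibleSubring ι B ψ) (hxi : x⁻¹ ∈ B) :
    x⁻¹ ∈ compatibleSubring ι B ψ := by
  by_cases hx0 : x = 0
  · rw [hx0, inv_zero]; exact zero_mem _
  obtain ⟨hB, hV, h⟩ := hx
  have h1 : ψ ⟨x, hB⟩ * ψ ⟨x⁻¹, hxi⟩ = 1 := by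
    rw [← map_mul, ← map_one ψ]
    congr 1
    exact Subtype.ext (mul_inv_cancel₀ hx0)
  have hne : padicReduction ι ⟨x, hV⟩ ≠ 0 := by
    intro h0
    rw [← h, h0, map_zero, zero_mul] at h1
    exact zero_ne_one h1
  have hnorm : ‖ι x‖ = 1 :=
    le_antisymm hV (not_lt.mp fun hlt => hne (padicReduction_eq_zero_of_norm_lt_one hlt))
  have hVi : x⁻¹ ∈ padicPullback ι := by
    change ‖ι x⁻¹‖ ≤ 1
    rw [map_inv₀, norm_inv, hnorm, inv_one]
  refine ⟨hxi, hVi, ?_⟩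
  have h2 : padicReduction ι ⟨x, hV⟩ * padicReduction ι ⟨x⁻¹, hVi⟩ = 1 := by
    rw [← map_mul, ← map_one (padicReduction ι)]
    congr 1
    exact Subtype.ext (mul_inv_cancel₀ hx0)
  have h3 := congrArg (ZMod.castHom dvd_rfl Ω) h2
  rw [map_mul, map_one, h] at h3
  exact mul_left_cancel₀ (left_ne_zero_of_mul_eq_one h1) (h3.trans h1.symm)

theorem exists_forall_mem_compatibleSubring {s : Set K} {x : K} (hx : x ∈ Subfield.closure s) :
    ∃ d : K, ∀ (p : ℕ) [Fact p.Prime] (Ω : Type*) [Field Ω] [CharP Ω p] (ι : K →+* ℚ_[p])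
      (B : Subring K) (ψ : B →+* Ω), s ⊆ compatibleSubring ι B ψ → d ∈ B →
        x ∈ compatibleSubring ι B ψ := by
  obtain ⟨a, ha, d, hd, rfl⟩ := Subfield.mem_closure_iff.mp hx
  refine ⟨d⁻¹, fun p _ Ω _ _ ι B ψ hs hdB => ?_⟩
  rw [div_eq_mul_inv]
  exact mul_mem (Subring.closure_le.mpr hs ha)
    (inv_mem_compatibleSubring (Subring.closure_le.mpr hs hd) hdB)

/-- Extension of an embedding into `ℚ_p` to a simple extension by Hensel's lemma. -/
theorem exists_padic_embedding_extend {E : Type*} [Field E] [Algebra K E] (pb : PowerBasis K E)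
    (ι : K →+* ℚ_[p]) (B : Subring E) (ψ : B →+* Ω)
    (hcoeff : ∀ i, (minpoly K pb.gen).coeff i ∈ compatibleSubring ι (B.comap (algebraMap K E))
      (ψ.comp ((algebraMap K E).restrict (B.comap (algebraMap K E)) B fun _ h => h)))
    (hgen : pb.gen ∈ B) (hfrob : ψ ⟨pb.gen, hgen⟩ ^ p = ψ ⟨pb.gen, hgen⟩)
    (hder : (aeval pb.gen (derivative (minpoly K pb.gen)))⁻¹ ∈ B) :
    ∃ ι' : E →+* ℚ_[p], ι'.comp (algebraMap K E) = ι ∧ pb.gen ∈ compatibleSubring ι' B ψ := by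
  set η := pb.gen with hη
  set m := minpoly K η with hm
  set G := compatibleSubring ι (B.comap (algebraMap K E))
      (ψ.comp ((algebraMap K E).restrict (B.comap (algebraMap K E)) B fun _ h => h)) with hG
  let gV : G →+* padicPullback ι := G.subtype.codRestrict _ fun x => x.2.2.1
  let gB : G →+* B := ((algebraMap K E).comp G.subtype).codRestrict B fun x => x.2.1
  have hcomp : (ZMod.castHom dvd_rfl Ω).comp ((padicReduction ι).comp gV) = ψ.comp gB := by
    ext x
    exact x.2.2.2
  obtain ⟨m1, hm1⟩ : ∃ m1 : G[X], m1.map G.subtype = m :=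
    (mem_lifts m).mp ((lifts_iff_coeff_lifts m).mpr fun i => ⟨⟨_, hcoeff i⟩, rfl⟩)
  obtain ⟨c, hc⟩ : ∃ c : ZMod p, ZMod.castHom dvd_rfl Ω c = ψ ⟨η, hgen⟩ := by
    have := (Subfield.mem_bot_iff_pow_eq_self (F := Ω) (p := p)).mpr hfrob
    exact (bot_le : ⊥ ≤ (ZMod.castHom (dvd_refl p) Ω).fieldRange) this
  obtain ⟨z, hz⟩ := ZMod.ringHom_surjective (PadicInt.toZMod (p := p)) c
  have key : ∀ q : G[X], ZMod.castHom dvd_rfl Ω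
      (PadicInt.toZMod ((q.map ((padicIntegerMap ι).comp gV)).eval z)) =
        ψ (q.eval₂ gB ⟨η, hgen⟩) := by
    intro q
    rw [eval_map, hom_eval₂, hom_eval₂, hom_eval₂, hz, hc, ← hcomp]
    rfl
  have hB : ∀ q : G[X], ((q.eval₂ gB ⟨η, hgen⟩ : B) : E) = aeval η (q.map G.subtype) := by
    intro q
    change B.subtype _ = _
    rw [hom_eval₂, aeval_def, eval₂_map]
    rfl
  have hinj : Function.Injective (ZMod.castHom (dvd_refl p) Ω) := RingHom.injective _
  have h1 : ‖(m1.map ((padicIntegerMap ι).comp gV)).eval z‖ < 1 := by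
    rw [PadicInt.norm_lt_one_iff_dvd, ← Ideal.mem_span_singleton,
      ← PadicInt.maximalIdeal_eq_span_p, ← PadicInt.ker_toZMod, RingHom.mem_ker]
    apply hinj
    rw [key, map_zero, ← map_zero ψ]
    congr 1
    apply Subtype.ext
    rw [hB, hm1, hm, minpoly.aeval]
    rfl
  have h2 : ‖(derivative (m1.map ((padicIntegerMap ι).comp gV))).eval z‖ = 1 := by
    refine le_antisymm (PadicInt.norm_le_one _) (not_lt.mp fun hlt => ?_)
    rw [PadicInt.norm_lt_one_iff_dvd, ← Ideal.mem_span_singleton,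
      ← PadicInt.maximalIdeal_eq_span_p, ← PadicInt.ker_toZMod, RingHom.mem_ker,
      derivative_map] at hlt
    have h0 := key (derivative m1)
    rw [hlt, map_zero] at h0
    have h3 : (derivative m1).eval₂ gB ⟨η, hgen⟩ * ⟨_, hder⟩ = 1 := by
      apply Subtype.ext
      push_cast
      rw [hB, ← derivative_map, hm1]
      refine mul_inv_cancel₀ ?_
      have : CharZero K := RingHom.charZero ι
      exact (minpoly.irreducible (pb.isIntegral_gen)).separable.aeval_derivative_ne_zero
        (minpoly.aeval _ _)
    have := congrArg ψ h3
    rw [map_mul, ← h0, zero_mul, map_one] at this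
    exact zero_ne_one this
  obtain ⟨y, hy0, hyz, -, -⟩ := hensels_lemma (p := p) (R := ℤ_[p])
    (F := m1.map ((padicIntegerMap ι).comp gV)) (a := z) (by
      rw [coe_aeval_eq_eval, h2, one_pow]
      exact h1)
  rw [coe_aeval_eq_eval] at hy0 hyz
  rw [h2] at hyz
  let _ := ι.toAlgebra
  have hroot : aeval (y : ℚ_[p]) m = 0 := by
    rw [← hm1, aeval_def, eval₂_map]
    have := congrArg (algebraMap ℤ_[p] ℚ_[p]) hy0
    rw [eval_map, hom_eval₂, map_zero] at this
    exact this
  let e : E →ₐ[K] ℚ_[p] := pb.lift (y : ℚ_[p]) hroot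
  have he : e η = (y : ℚ_[p]) := pb.lift_gen (y : ℚ_[p]) hroot
  refine ⟨e, e.comp_algebraMap, hgen, ?_, ?_⟩
  · change ‖e η‖ ≤ 1
    rw [he]; exact y.norm_le_one
  · rw [← hc, ← hz]
    congr 1
    rw [padicReduction, RingHom.comp_apply, ← sub_eq_zero, ← map_sub, ← RingHom.mem_ker,
      PadicInt.ker_toZMod, PadicInt.maximalIdeal_eq_span_p, Ideal.mem_span_singleton,
      ← PadicInt.norm_lt_one_iff_dvd]
    convert! hyz
    exact Subtype.ext he

end Compatible

end

section

open Polynomial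

theorem exists_finite_algebraicIndependent_finiteDimensional {k K : Type*} [Field k] [Field K]
    [Algebra k K] {s : Set K} (hs : s.Finite) (htop : IntermediateField.adjoin k s = ⊤) :
    ∃ t : Set K, t.Finite ∧ AlgebraicIndependent k ((↑) : t → K) ∧
      FiniteDimensional (IntermediateField.adjoin k t) K := by
  have : Algebra.IsAlgebraic (Algebra.adjoin k s) K := by
    have h1 : Algebra.IsAlgebraic (IntermediateField.adjoin k s) K := by
      rw [htop]
      refine ⟨fun x => ?_⟩
      exact isAlgebraic_algebraMap (A := K) (⟨x, trivial⟩ : (⊤ : IntermediateField k K))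
    open scoped IntermediateField.algebraAdjoinAdjoin in
    exact (IsFractionRing.comap_isAlgebraic_iff (A := Algebra.adjoin k s)
      (K := IntermediateField.adjoin k s) (C := K)).mpr h1
  obtain ⟨t, hts, ht⟩ := exists_isTranscendenceBasis_subset (R := k) s
  refine ⟨t, hs.subset hts, ht.1, ?_⟩
  have halg : Algebra.IsAlgebraic (IntermediateField.adjoin k t) K := by
    have := ht.isAlgebraic_field
    rwa [Subtype.range_coe] at this
  have h2 : IntermediateField.adjoin (IntermediateField.adjoin k t) s = ⊤ := by
    rw [← IntermediateField.restrictScalars_eq_top_iff (K := k), eq_top_iff, ← htop,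
      IntermediateField.adjoin_le_iff]
    exact IntermediateField.subset_adjoin _ _
  have := hs.to_subtype
  have h3 := IntermediateField.finiteDimensional_adjoin
    (K := IntermediateField.adjoin k t) (S := s) fun x _ => (halg.isAlgebraic x).isIntegral
  rw [h2] at h3
  exact Module.Finite.of_surjective (IntermediateField.topEquiv (F := IntermediateField.adjoin k t) (E := K)).toLinearEquiv.toLinearMap (LinearEquiv.surjective _)

theorem intermediateField_adjoin_eq_top_of_closure_eq_top {k K : Type*} [Field k] [Field K]
    [Algebra k K] {s : Set K} (h : Subfield.closure s = ⊤) :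
    IntermediateField.adjoin k s = ⊤ := by
  rw [eq_top_iff]
  intro x _
  have hx : x ∈ Subfield.closure s := h ▸ Subfield.mem_top x
  exact Subfield.closure_le (t := (IntermediateField.adjoin k s).toSubfield).mpr
    (IntermediateField.subset_adjoin k s) hx

theorem subfield_closure_eq_top_of_adjoin_rat_eq_top {F : Type*} [Field F] [Algebra ℚ F]
    {s : Set F} (h : IntermediateField.adjoin ℚ s = ⊤) : Subfield.closure s = ⊤ := by
  rw [eq_top_iff]
  intro x _
  have hx : x ∈ IntermediateField.adjoin ℚ s := h ▸ IntermediateField.mem_top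
  refine IntermediateField.adjoin_induction (p := fun x _ => x ∈ Subfield.closure s) ℚ ?_ ?_ ?_ ?_ ?_ hx
  · exact fun x hx => Subfield.subset_closure hx
  · intro x
    rw [eq_ratCast]
    exact SubfieldClass.ratCast_mem _ x
  · exact fun x y _ _ => add_mem
  · exact fun x _ => inv_mem
  · exact fun x y _ _ => mul_mem

end

section

open Polynomial

theorem intermediateField_adjoin_range_eq_top {k K : Type*} [Field k] [Field K] [Algebra k K]
    (t : Set K) :
    IntermediateField.adjoin k (Set.range fun i : t =>
      (⟨i, IntermediateField.subset_adjoin k t i.2⟩ : IntermediateField.adjoin k t)) = ⊤ := by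
  apply IntermediateField.lift_injective (IntermediateField.adjoin k t)
  rw [IntermediateField.lift_adjoin, IntermediateField.lift_top]
  congr 1
  ext x
  simpa using fun h => IntermediateField.subset_adjoin k t h

theorem exists_castHom_eq_of_pow_eq_self {p : ℕ} [Fact p.Prime] {Ω : Type*} [Field Ω] [CharP Ω p]
    {x : Ω} (hx : x ^ p = x) : ∃ c : ZMod p, ZMod.castHom dvd_rfl Ω c = x :=
  (bot_le : ⊥ ≤ (ZMod.castHom (dvd_refl p) Ω).fieldRange)
    ((Subfield.mem_bot_iff_pow_eq_self (F := Ω) (p := p)).mpr hx)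

theorem exists_finite_forall_exists_padic_embedding {K : Type*} [Field K] [CharZero K]
    {s : Set K} (hs : s.Finite) (htop : Subfield.closure s = ⊤) {S : Set K} (hS : S.Finite) :
    ∃ T : Set K, T.Finite ∧ ∀ (p : ℕ) [Fact p.Prime] (Ω : Type) [Field Ω] [CharP Ω p]
      (B : Subring K) (ψ : B →+* Ω), T ⊆ B → (∀ x : B, ψ x ^ p = ψ x) →
        ∃ ι : K →+* ℚ_[p], S ⊆ compatibleSubring ι B ψ := by
  obtain ⟨t, htfin, hind, hfd⟩ := exists_finite_algebraicIndependent_finiteDimensional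
    (k := ℚ) hs (intermediateField_adjoin_eq_top_of_closure_eq_top htop)
  let F := IntermediateField.adjoin ℚ t
  let x : t → F := fun i => ⟨i, IntermediateField.subset_adjoin ℚ t i.2⟩
  have hxind : AlgebraicIndependent ℚ x :=
    AlgebraicIndependent.of_comp F.val (by exact hind)
  have hxtop : IntermediateField.adjoin ℚ (Set.range x) = ⊤ :=
    intermediateField_adjoin_range_eq_top t
  have hxcl := subfield_closure_eq_top_of_adjoin_rat_eq_top hxtop
  have hfin : Finite t := htfin
  let pb : PowerBasis F K := Field.powerBasisOfFiniteOfSeparable F K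
  choose d hd using fun c : F => exists_forall_mem_compatibleSubring (s := Set.range x) (x := c)
    (hxcl ▸ Subfield.mem_top c)
  choose q hq using pb.exists_eq_aeval'
  let C : Set F := ↑(minpoly F pb.gen).coeffs ∪ ⋃ y ∈ S, ↑(q y).coeffs
  have hC : C.Finite := (Finset.finite_toSet _).union (hS.biUnion fun y _ => Finset.finite_toSet _)
  refine ⟨t ∪ {pb.gen, (aeval pb.gen (derivative (minpoly F pb.gen)))⁻¹} ∪
    (fun c => algebraMap F K (d c)) '' C,
    (htfin.union ((Set.finite_singleton _).insert _)).union (hC.image _), ?_⟩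
  intro p _ Ω _ _ B ψ hT hψ
  let BF := B.comap (algebraMap F K)
  let ψF : BF →+* Ω := ψ.comp ((algebraMap F K).restrict BF B fun _ h => h)
  have htB : ∀ i : t, (i : K) ∈ B := fun i => hT (Or.inl (Or.inl i.2))
  choose a ha using fun i : t => exists_castHom_eq_of_pow_eq_self (hψ ⟨i, htB i⟩)
  obtain ⟨ι, hι⟩ := exists_padic_embedding_of_algebraicIndependent hxind hxtop a
  have hxc : Set.range x ⊆ compatibleSubring ι BF ψF := by
    rintro _ ⟨i, rfl⟩
    obtain ⟨h, h'⟩ := hι i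
    refine ⟨htB i, h, ?_⟩
    rw [h', ha]
    rfl
  have hCc : ∀ c ∈ C, c ∈ compatibleSubring ι BF ψF := fun c hc =>
    hd c p Ω ι BF ψF hxc (hT (Or.inr ⟨c, hc, rfl⟩))
  have hcoeff : ∀ f : F[X], ↑f.coeffs ⊆ C → ∀ i, f.coeff i ∈ compatibleSubring ι BF ψF := by
    intro f hf i
    by_cases h0 : f.coeff i = 0
    · rw [h0]; exact zero_mem _
    · exact hCc _ (hf (coeff_mem_coeffs h0))
  obtain ⟨ι', hι', hgen⟩ := exists_padic_embedding_extend pb ι B ψ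
    (hcoeff _ Set.subset_union_left) (hT (Or.inl (Or.inr (Or.inl rfl)))) (hψ _)
    (hT (Or.inl (Or.inr (Or.inr rfl))))
  refine ⟨ι', fun y hy => ?_⟩
  have hmap : ∀ c ∈ compatibleSubring ι BF ψF, algebraMap F K c ∈ compatibleSubring ι' B ψ := by
    subst hι'
    rintro c ⟨h1, h2, h3⟩
    exact ⟨h1, h2, h3⟩
  rw [hq y, aeval_eq_sum_range]
  refine sum_mem fun i _ => ?_
  rw [Algebra.smul_def]
  refine mul_mem (hmap _ (hcoeff _ ?_ i)) (pow_mem hgen i)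
  exact fun z hz => Or.inr (Set.mem_biUnion hy hz)

end

section

open Polynomial

theorem exists_padic_embedding_isFrobeniusAt_of_hasFrobeniusPlace {K L : Type} [Field K] [Field L]
    [Algebra K L] [CharZero K] {s : Set K} (hs : s.Finite) (htop : Subfield.closure s = ⊤)
    [FiniteDimensional K L] [IsGalois K L] {S : Set K} (hS : S.Finite) (σ : L ≃ₐ[K] L) :
    ∃ T : Set L, T.Finite ∧ ∀ (p : ℕ) [Fact p.Prime],
      HasFrobeniusPlace (σ : L ≃+* L) T p →
        ∃ ι : K →+* ℚ_[p], (∀ x ∈ S, x ∈ padicPullback ι) ∧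
          ∀ (w : ValuationSubring L) (hw : w.comap (algebraMap K L) = padicPullback ι),
            ValuationSubring.IsUnramifiedExtension (padicPullback ι) w hw ∧
            ∃ τ ∈ (ConjClasses.mk σ).carrier,
              ValuationSubring.IsFrobeniusAt (padicPullback ι) w τ := by
  obtain ⟨β, hβ⟩ := Field.exists_primitive_element K L
  have hβint : IsIntegral K β := Algebra.IsIntegral.isIntegral β
  have hβ' : ∀ x : L, ∃ Q : K[X], x = aeval β Q := by
    intro x
    have hx : x ∈ IntermediateField.adjoin K {β} := hβ ▸ IntermediateField.mem_top
    rw [← IntermediateField.mem_toSubalgebra,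
      IntermediateField.adjoin_simple_toSubalgebra_of_isAlgebraic hβint.isAlgebraic,
      Algebra.adjoin_singleton_eq_range_aeval] at hx
    obtain ⟨Q, hQ⟩ := hx
    exact ⟨Q, hQ.symm⟩
  choose P hP using fun g : L ≃ₐ[K] L => hβ' (g β)
  obtain ⟨u, v, huv⟩ := (minpoly.irreducible hβint).separable
  let Cf : Set K := S ∪ (↑(minpoly K β).coeffs ∪ ↑u.coeffs ∪ ↑v.coeffs ∪ ⋃ g, ↑(P g).coeffs)
  have hC : Cf.Finite := hS.union ((((Finset.finite_toSet _).union (Finset.finite_toSet _)).union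
    (Finset.finite_toSet _)).union (Set.finite_iUnion fun g => Finset.finite_toSet _))
  obtain ⟨T, hT, hTemb⟩ := exists_finite_forall_exists_padic_embedding hs htop hC
  refine ⟨algebraMap K L '' T ∪ Set.range fun g : L ≃ₐ[K] L => g β,
    (hT.image _).union (Set.finite_range _), ?_⟩
  intro p _ hplace
  obtain ⟨B, hTB, hσ, ψ, hψ⟩ := hplace (AlgebraicClosure (ZMod p))
  obtain ⟨ι, hι⟩ := hTemb p (AlgebraicClosure (ZMod p)) (B.comap (algebraMap K L))
    (ψ.comp ((algebraMap K L).restrict (B.comap (algebraMap K L)) B fun _ h => h))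
    (fun x hx => hTB (Or.inl ⟨x, hx, rfl⟩)) (by
      intro x
      refine (hψ _).symm.trans (congrArg ψ (Subtype.ext ?_))
      exact σ.commutes x)
  refine ⟨ι, fun x hx => (hι (Or.inl hx)).2.1, ?_⟩
  have hgB : ∀ g : L ≃ₐ[K] L, g β ∈ B := fun g => hTB (Or.inr ⟨g, rfl⟩)
  set G := compatibleSubring ι (B.comap (algebraMap K L))
    (ψ.comp ((algebraMap K L).restrict (B.comap (algebraMap K L)) B fun _ h => h)) with hG
  let gV : G →+* padicPullback ι := G.subtype.codRestrict _ fun x => x.2.2.1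
  let gB : G →+* B := ((algebraMap K L).comp G.subtype).codRestrict B fun x => x.2.1
  have hcomp : (algebraMap (ZMod p) (AlgebraicClosure (ZMod p))).comp
      ((padicReduction ι).comp gV) = ψ.comp gB := by
    rw [Subsingleton.elim (algebraMap (ZMod p) (AlgebraicClosure (ZMod p)))
      (ZMod.castHom dvd_rfl _)]
    ext x
    exact x.2.2.2
  have hlift : ∀ f : K[X], ↑f.coeffs ⊆ Cf → ∃ f' : G[X], f'.map G.subtype = f := by
    intro f hf
    refine (mem_lifts f).mp ((lifts_iff_coeff_lifts f).mpr fun i => ?_)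
    refine ⟨⟨f.coeff i, ?_⟩, rfl⟩
    by_cases h0 : f.coeff i = 0
    · rw [h0]; exact zero_mem _
    · exact hι (hf (coeff_mem_coeffs h0))
  obtain ⟨h1, hh1⟩ := hlift (minpoly K β) fun x hx => Or.inr (Or.inl (Or.inl (Or.inl hx)))
  obtain ⟨u1, hu1⟩ := hlift u fun x hx => Or.inr (Or.inl (Or.inl (Or.inr hx)))
  obtain ⟨v1, hv1⟩ := hlift v fun x hx => Or.inr (Or.inl (Or.inr hx))
  choose P1 hP1 using fun g => hlift (P g)
    fun x hx => Or.inr (Or.inr (Set.mem_iUnion.mpr ⟨g, hx⟩))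
  have hinj : Function.Injective G.subtype := Subtype.val_injective
  have hmonic : h1.Monic := monic_of_injective hinj (hh1 ▸ minpoly.monic hβint)
  have hsep : h1.Separable := by
    refine ⟨u1, v1, map_injective _ hinj ?_⟩
    rw [Polynomial.map_add, Polynomial.map_mul, Polynomial.map_mul, ← derivative_map, hu1, hv1,
      hh1, huv, Polynomial.map_one]
  have hevL : ∀ (f : G[X]) (x : L), (f.map gV).eval₂ ((algebraMap K L).comp
      (ValuationSubring.subtype _)) x = aeval x (f.map G.subtype) := by
    intro f x
    rw [eval₂_map, aeval_def, eval₂_map]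
    rfl
  have hevB : ∀ (f : G[X]) (x : B), ((f.eval₂ gB x : B) : L) = aeval (x : L) (f.map G.subtype) := by
    intro f x
    change B.subtype _ = _
    rw [hom_eval₂, aeval_def, eval₂_map]
    rfl
  have hevΩ : ∀ (f : G[X]) (x : AlgebraicClosure (ZMod p)),
      aeval x ((f.map gV).map (padicReduction ι)) = f.eval₂ (ψ.comp gB) x := by
    intro f x
    rw [aeval_def, eval₂_map, eval₂_map, RingHom.comp_assoc, hcomp]
  refine isUnramified_and_isFrobeniusAt_of_roots ι _ β hβ' (h1.map gV) (hmonic.map _) ?_ ?_ ?_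
  · rw [hevL, hh1, minpoly.aeval]
  · rw [map_map]
    exact hsep.map
  · intro x hx
    rw [hevΩ] at hx
    let F : B[X] := ∏ g : L ≃ₐ[K] L, (X - C ⟨g β, hgB g⟩)
    have hdvd : h1.map gB ∣ F := by
      rw [← map_dvd_map B.subtype Subtype.val_injective (hmonic.map _), map_map]
      have h2 : h1.map (B.subtype.comp gB) = (minpoly K β).map (algebraMap K L) := by
        rw [← hh1, map_map]
        rfl
      have : Algebra.IsInvariant K L (L ≃ₐ[K] L) := IsGaloisGroup.isInvariant
      obtain ⟨Q, hQ⟩ := (mem_lifts _).mp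
        (Algebra.IsInvariant.charpoly_mem_lifts K L (L ≃ₐ[K] L) β)
      have h3 : F.map B.subtype = MulSemiringAction.charpoly (L ≃ₐ[K] L) β := by
        simp [F, Polynomial.map_prod, MulSemiringAction.charpoly_eq]
      rw [h2, h3, ← hQ]
      refine Polynomial.map_dvd _ (minpoly.dvd K β ?_)
      rw [aeval_def, ← eval_map, hQ, MulSemiringAction.charpoly_eq, eval_prod]
      exact Finset.prod_eq_zero (Finset.mem_univ 1) (by simp)
    obtain ⟨g, hg⟩ : ∃ g : L ≃ₐ[K] L, x = ψ ⟨g β, hgB g⟩ := by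
      have h0 : (F.map ψ).eval x = 0 := by
        obtain ⟨q, hq⟩ := hdvd
        rw [hq, Polynomial.map_mul, eval_mul, map_map, eval_map, hx, zero_mul]
      rw [Polynomial.map_prod, eval_prod, Finset.prod_eq_zero_iff] at h0
      obtain ⟨g, -, hg⟩ := h0
      refine ⟨g, ?_⟩
      simpa [sub_eq_zero] using hg
    refine ⟨g⁻¹ * σ * g, ?_, (P1 (g⁻¹ * σ * g)).map gV, ?_, ?_⟩
    · rw [ConjClasses.mem_carrier_iff_mk_eq, ConjClasses.mk_eq_mk_iff_isConj]
      exact (isConj_iff.mpr ⟨g⁻¹, by simp⟩ : IsConj σ _).symm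
    · rw [hevL, hP1, ← hP]
    · rw [hevΩ, hg, ← hom_eval₂, ← hψ]
      congr 1
      apply Subtype.ext
      rw [hevB, hP1]
      change aeval (g β) _ = _
      rw [aeval_algHom_apply, ← hP]
      simp

end

section

open Polynomial

/-- Jordan's theorem: a transitive action on a finite set with at least two elements has a group
element without fixed points. -/
theorem exists_forall_smul_ne {G X : Type*} [Group G] [Finite G] [MulAction G X] [Finite X]
    [Nontrivial X] [MulAction.IsPretransitive G X] : ∃ g : G, ∀ x : X, g • x ≠ x := by
  classical
  by_contra! h
  have := Fintype.ofFinite G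
  have := Fintype.ofFinite X
  have := Fintype.ofFinite (MulAction.orbitRel.Quotient G X)
  have h1 := MulAction.sum_card_fixedBy_eq_card_orbits_mul_card_group G X
  have h2 : Fintype.card (Quotient (MulAction.orbitRel G X)) ≤ 1 :=
    Fintype.card_le_one_iff_subsingleton.mpr
      ((MulAction.pretransitive_iff_subsingleton_quotient G X).mp inferInstance)
  have h3 : ∑ g : G, 1 < ∑ g : G, Fintype.card (MulAction.fixedBy X g) := by
    refine Finset.sum_lt_sum (fun g _ => ?_) ⟨1, Finset.mem_univ _, ?_⟩
    · obtain ⟨x, hx⟩ := h g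
      exact Fintype.card_pos_iff.mpr ⟨⟨x, hx⟩⟩
    · rw [Fintype.one_lt_card_iff_nontrivial]
      obtain ⟨x, y, hxy⟩ := exists_pair_ne X
      exact ⟨⟨x, one_smul G x⟩, ⟨y, one_smul G y⟩, fun h => hxy (congrArg Subtype.val h)⟩
  rw [h1, Finset.sum_const, smul_eq_mul, mul_one, Finset.card_univ] at h3
  nlinarith

theorem exists_isGalois_splits {k : Type} [Field k] {f : k[X]} (hf : f.Separable) :
    ∃ (L : Type) (_ : Field L) (_ : Algebra k L), FiniteDimensional k L ∧ IsGalois k L ∧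
      (f.map (algebraMap k L)).Splits :=
  ⟨f.SplittingField, inferInstance, inferInstance, inferInstance,
    IsGalois.of_separable_splitting_field hf, SplittingField.splits f⟩

theorem exists_numberField_isGalois_splits {f : ℚ[X]} (hf : f.Separable) :
    ∃ (L : Type) (_ : Field L) (_ : NumberField L), IsGalois ℚ L ∧
      (f.map (algebraMap ℚ L)).Splits := by
  obtain ⟨L, _, hL, h1, h2, h3⟩ := exists_isGalois_splits hf
  have hc : CharZero L := algebraRat.charZero L
  obtain rfl : hL = DivisionRing.toRatAlgebra := Subsingleton.elim _ _
  exact ⟨L, inferInstance, {}, h2, h3⟩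

theorem infinite_setOf_prime_forall_not_dvd_eval {h : ℤ[X]} (hm : h.Monic) (hirr : Irreducible h)
    (hdeg : 2 ≤ h.natDegree) :
    {p : ℕ | p.Prime ∧ ∀ y : ℤ, ¬ (p : ℤ) ∣ h.eval y}.Infinite := by
  classical
  let f : ℚ[X] := h.map (algebraMap ℤ ℚ)
  have hf : Irreducible f := (hm.irreducible_iff_irreducible_map_fraction_map).mp hirr
  have hfm : f.Monic := hm.map _
  have hfd : f.natDegree = h.natDegree := hm.natDegree_map _
  obtain ⟨L, _, _, _, hsplit⟩ := exists_numberField_isGalois_splits hf.separable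
  obtain ⟨x₀, x₁, hx₀, hx₁, hne⟩ : ∃ x₀ x₁ : L, x₀ ∈ f.rootSet L ∧ x₁ ∈ f.rootSet L ∧ x₀ ≠ x₁ := by
    have : Nontrivial (f.rootSet L) := by
      rw [← Fintype.one_lt_card_iff_nontrivial, card_rootSet_eq_natDegree hf.separable hsplit, hfd]
      omega
    obtain ⟨x, y, hxy⟩ := exists_pair_ne (f.rootSet L)
    exact ⟨x, y, x.2, y.2, fun h => hxy (Subtype.ext h)⟩
  have horb : ∀ x ∈ f.rootSet L, x ∈ MulAction.orbit (L ≃ₐ[ℚ] L) x₀ := by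
    intro x hx
    have hmin : f = minpoly ℚ x :=
      minpoly.eq_of_irreducible_of_monic hf (mem_rootSet.mp hx).2 hfm
    obtain ⟨σ, hσ⟩ := minpoly.exists_algEquiv_of_root (K := ℚ) (x := x₀) (y := x)
      (Algebra.IsAlgebraic.isAlgebraic _) (by rw [← hmin]; exact (mem_rootSet.mp hx₀).2)
    exact ⟨σ, hσ⟩
  have : Finite (MulAction.orbit (L ≃ₐ[ℚ] L) x₀) := Set.finite_range _
  have : Nontrivial (MulAction.orbit (L ≃ₐ[ℚ] L) x₀) :=
    ⟨⟨x₀, horb _ hx₀⟩, ⟨x₁, horb _ hx₁⟩, fun h => hne (congrArg Subtype.val h)⟩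
  obtain ⟨σ, hσ⟩ := exists_forall_smul_ne (G := L ≃ₐ[ℚ] L) (X := MulAction.orbit (L ≃ₐ[ℚ] L) x₀)
  let τ : L ≃+* L := AlgEquiv.toRingEquiv σ
  have hσ' : ∀ x ∈ f.rootSet L, τ x ≠ x := fun x hx h => hσ ⟨x, horb x hx⟩ (Subtype.ext h)
  let T : Set L := f.rootSet L ∪ (fun x => (τ x - x)⁻¹) '' f.rootSet L
  have hT : T.Finite := (rootSet_finite f L).union ((rootSet_finite f L).image _)
  refine (infinite_hasFrobeniusPlace τ hT).mono ?_
  rintro p ⟨hp, hplace⟩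
  refine ⟨hp, fun y hy => ?_⟩
  have : Fact p.Prime := ⟨hp⟩
  obtain ⟨B, hTB, hσB, ψ, hψ⟩ := hplace (AlgebraicClosure (ZMod p))
  have h0 : ∀ x : f.rootSet L, ψ ((y : B) - ⟨x, hTB (Or.inl x.2)⟩) ≠ 0 := by
    intro x hx
    have hx1 : ψ ⟨x, hTB (Or.inl x.2)⟩ = (y : AlgebraicClosure (ZMod p)) := by
      rw [map_sub, map_intCast, sub_eq_zero] at hx
      exact hx.symm
    have hx2 := hψ ⟨x, hTB (Or.inl x.2)⟩
    rw [hx1] at hx2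
    have hx3 : ((y : AlgebraicClosure (ZMod p))) ^ p = y := by
      have := ZMod.pow_card (y : ZMod p)
      have := congrArg (algebraMap (ZMod p) (AlgebraicClosure (ZMod p))) this
      rwa [map_pow, map_intCast] at this
    have hx4 : ψ (⟨_, hσB x (hTB (Or.inl x.2))⟩ - ⟨x, hTB (Or.inl x.2)⟩) = 0 := by
      rw [map_sub, hx2, hx3, hx1, sub_self]
    have hx5 : ((⟨_, hσB x (hTB (Or.inl x.2))⟩ - ⟨x, hTB (Or.inl x.2)⟩ : B)) *
        ⟨_, hTB (Or.inr ⟨x, x.2, rfl⟩)⟩ = 1 :=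
      Subtype.ext (mul_inv_cancel₀ (sub_ne_zero.mpr (hσ' x x.2)))
    have hx6 := congrArg ψ hx5
    rw [map_mul, hx4, zero_mul, map_one] at hx6
    exact zero_ne_one hx6
  have hprod : ((h.eval y : ℤ) : B) = ∏ x : f.rootSet L, ((y : B) - ⟨x, hTB (Or.inl x.2)⟩) := by
    apply Subtype.ext
    have hnodup : (f.aroots L).Nodup := nodup_roots hf.separable.map
    have h2 : ((h.eval y : ℤ) : L) = (f.map (algebraMap ℚ L)).eval (y : L) := by
      rw [map_map, eval_map, Subsingleton.elim ((algebraMap ℚ L).comp _) (Int.castRingHom L),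
        eval₂_at_intCast]
      simp
    have h3 : (f.map (algebraMap ℚ L)).roots.map (fun a => (y : L) - a) =
        (f.aroots L).toFinset.val.map (fun a => (y : L) - a) := by
      rw [Multiset.toFinset_val, hnodup.dedup, aroots]
    have h4 : ((∏ x : f.rootSet L, ((y : B) - ⟨x, hTB (Or.inl x.2)⟩) : B) : L) =
        ∏ x : f.rootSet L, ((y : L) - x) := by
      push_cast
      rfl
    rw [h4, ← Finset.prod_subtype (f.aroots L).toFinset (fun x => by
      simp [rootSet]) (fun x => (y : L) - x)]
    change _ = ((f.aroots L).toFinset.val.map (fun a => (y : L) - a)).prod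
    rw [← h3, ← hsplit.eval_eq_prod_roots_of_monic (hfm.map _), ← h2]
    push_cast
    rfl
  have h1 := congrArg ψ hprod
  rw [map_prod, map_intCast] at h1
  have h2 : ((h.eval y : ℤ) : AlgebraicClosure (ZMod p)) = 0 :=
    (CharP.intCast_eq_zero_iff _ p _).mpr hy
  rw [h2] at h1
  exact Finset.prod_ne_zero_iff.mpr (fun x _ => h0 x) h1.symm

end

section

open Polynomial

universe u

section LinearAlgebra

variable {k S : Type*} [Field k] [CommRing S] [Algebra k S] {t : S} {d : ℕ} {b : Fin d → S}

theorem exists_eq_sum_smul_add_pow_mul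
    (h : ∀ x : S, ∃ (w : Fin d → k) (x' : S), x = ∑ j, w j • b j + t * x') (N : ℕ) (x : S) :
    ∃ (w : Fin N → Fin d → k) (x' : S),
      x = ∑ i : Fin N, ∑ j, w i j • (t ^ (i : ℕ) * b j) + t ^ N * x' := by
  induction N with
  | zero => exact ⟨Fin.elim0, x, by simp⟩
  | succ N ih =>
    obtain ⟨w, x', hx⟩ := ih
    obtain ⟨w', x'', hx'⟩ := h x'
    refine ⟨Fin.snoc w w', x'', ?_⟩
    rw [Fin.sum_univ_castSucc, hx, hx']
    simp only [Fin.snoc_castSucc, Fin.snoc_last, Fin.val_castSucc, Fin.val_last, mul_add,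
      Finset.mul_sum, mul_smul_comm, add_assoc]
    ring

theorem exists_linearMap_surjective_of_pow_eq_zero
    (h : ∀ x : S, ∃ (w : Fin d → k) (x' : S), x = ∑ j, w j • b j + t * x') {N : ℕ}
    (ht : t ^ N = 0) : ∃ Φ : (Fin N → Fin d → k) →ₗ[k] S, Function.Surjective Φ := by
  refine ⟨{ toFun := fun w => ∑ i : Fin N, ∑ j, w i j • (t ^ (i : ℕ) * b j)
            map_add' := fun w w' => by simp [add_smul, Finset.sum_add_distrib]
            map_smul' := fun c w => by simp [Finset.smul_sum, mul_smul] }, fun x => ?_⟩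
  obtain ⟨w, x', hx⟩ := exists_eq_sum_smul_add_pow_mul h N x
  exact ⟨w, by simp [hx, ht]⟩

end LinearAlgebra

theorem C_X_dvd_of_map_evalRingHom_zero {R : Type*} [CommRing R] {f : R[X][X]}
    (hf : f.map (evalRingHom 0) = 0) : C X ∣ f := by
  rw [C_dvd_iff_dvd_coeff]
  intro i
  rw [X_dvd_iff, coeff_zero_eq_eval_zero]
  simpa using congrArg (fun f => coeff f i) hf

theorem map_C_map_evalRingHom {R : Type*} [CommRing R] (f : R[X]) (x : R) :
    (f.map C).map (evalRingHom x) = f := by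
  rw [map_map, show (evalRingHom x).comp C = RingHom.id R from RingHom.ext fun x => by simp,
    map_id]

theorem map_C_eq_sum_smul_of_degree_lt {k : Type*} [Field k] {f : k[X]} {d : ℕ}
    (hf : f.degree < d) :
    f.map C = ∑ j : Fin d, f.coeff j • (X : k[X][X]) ^ (j : ℕ) := by
  have h1 : f = ∑ j : Fin d, C (f.coeff j) * X ^ (j : ℕ) := by
    have h2 := sum_fin (fun e a => C a * (X : k[X]) ^ e) (by simp) hf
    rw [h2]
    exact f.as_sum_support_C_mul_X_pow
  conv_lhs => rw [h1]
  rw [Polynomial.map_sum]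
  refine Finset.sum_congr rfl fun j _ => ?_
  rw [Polynomial.map_mul, map_C, Polynomial.map_pow, map_X]
  rw [← algebraMap_smul k[X] (f.coeff j), smul_eq_C_mul, algebraMap_eq]

section Quotient

variable {k S : Type*} [Field k] [CommRing S] [Algebra k S] (mk : k[X][X] →ₐ[k] S)
  {g : k[X][X]} {q r : k[X]} {N : ℕ}

theorem exists_map_eq_map_C_X_mul (hg : g.map (evalRingHom 0) = q * r) (hqr : IsCoprime q r)
    (hgI : mk g = 0) (hqI : mk ((q.map C) ^ N) = 0) :
    ∃ s, mk (q.map C) = mk (C X) * s := by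
  have h1 : IsCoprime (mk (q.map C)) (mk (r.map C)) := by
    obtain ⟨a, b, hab⟩ := hqr
    refine ⟨mk (a.map C), mk (b.map C), ?_⟩
    rw [← map_mul, ← map_mul, ← map_add, ← Polynomial.map_mul, ← Polynomial.map_mul,
      ← Polynomial.map_add, hab, Polynomial.map_one, map_one]
  have h2 := (h1.pow_left (m := N))
  rw [← map_pow, hqI, isCoprime_zero_left] at h2
  obtain ⟨f, hf⟩ := C_X_dvd_of_map_evalRingHom_zero (f := q.map C * r.map C - g) (by
    rw [Polynomial.map_sub, Polynomial.map_mul, map_C_map_evalRingHom, map_C_map_evalRingHom,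
      hg, sub_self])
  have h3 := congrArg mk hf
  rw [map_sub, hgI, sub_zero, map_mul, map_mul] at h3
  obtain ⟨e, he⟩ := h2.exists_right_inv
  exact ⟨mk f * e, by rw [← mul_assoc, ← h3, mul_assoc, he, mul_one]⟩

theorem exists_eq_sum_smul_add_map_C_X_mul (hq : q.Monic) {s : S}
    (hs : mk (q.map C) = mk (C X) * s) (f : k[X][X]) :
    ∃ (w : Fin q.natDegree → k) (x' : S),
      mk f = ∑ j, w j • mk (X ^ (j : ℕ)) + mk (C X) * x' := by
  obtain ⟨f1, hf1⟩ : ∃ f1, f1 = (f.map (evalRingHom 0)) /ₘ q := ⟨_, rfl⟩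
  obtain ⟨f0, hf0⟩ : ∃ f0, f0 = (f.map (evalRingHom 0)) %ₘ q := ⟨_, rfl⟩
  obtain ⟨e, he⟩ := C_X_dvd_of_map_evalRingHom_zero
    (f := f - (q * f1).map C - f0.map C) (by
    rw [Polynomial.map_sub, Polynomial.map_sub, map_C_map_evalRingHom, map_C_map_evalRingHom]
    rw [sub_sub, add_comm, hf0, hf1, modByMonic_add_div, sub_self])
  have hf : f = f0.map C + (q.map C * f1.map C + C X * e) := by
    rw [← he, Polynomial.map_mul]; ring
  refine ⟨fun j => f0.coeff j, s * mk (f1.map C) + mk e, ?_⟩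
  have h0 : f0.degree < q.natDegree := by
    rw [← degree_eq_natDegree hq.ne_zero, hf0]
    exact degree_modByMonic_lt _ hq
  have h1 : mk (f0.map C) = ∑ j : Fin q.natDegree, f0.coeff j • mk (X ^ (j : ℕ)) := by
    rw [map_C_eq_sum_smul_of_degree_lt h0, map_sum]
    simp only [map_smul]
  rw [← h1, hf, map_add, map_add, map_mul, map_mul, hs, mul_add, mul_assoc]

theorem finrank_le_of_isCoprime (hmk : Function.Surjective mk) (hq : q.Monic)
    (hg : g.map (evalRingHom 0) = q * r) (hqr : IsCoprime q r) (hgI : mk g = 0)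
    (htI : mk ((C X : k[X][X]) ^ N) = 0) (hqI : mk ((q.map C) ^ N) = 0) :
    Module.Finite k S ∧ Module.finrank k S ≤ N * q.natDegree := by
  obtain ⟨s, hs⟩ := exists_map_eq_map_C_X_mul mk hg hqr hgI hqI
  obtain ⟨Φ, hΦ⟩ := exists_linearMap_surjective_of_pow_eq_zero (t := mk (C X))
    (b := fun j : Fin q.natDegree => mk (X ^ (j : ℕ))) (fun x => by
      obtain ⟨f, rfl⟩ := hmk x
      exact exists_eq_sum_smul_add_map_C_X_mul mk hq hs f) (N := N) (by rw [← map_pow]; exact htI)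
  refine ⟨Module.Finite.of_surjective Φ hΦ, ?_⟩
  refine (LinearMap.finrank_le_finrank_of_surjective hΦ).trans ?_
  rw [Module.finrank_pi_fintype]
  simp

theorem exists_ne_zero_map_eq_zero_of_finrank_lt {D n : ℕ} [Module.Finite k S]
    (hlt : Module.finrank k S < n * (D + 1)) :
    ∃ H, mk H = 0 ∧ H ≠ 0 ∧ H.degree < n ∧ ∀ j, (H.coeff j).degree < D + 1 := by
  let Ψ : (Fin n → degreeLT k (D + 1)) →ₗ[k] k[X][X] :=
    ∑ j : Fin n, ((monomial (R := k[X]) (j : ℕ)).restrictScalars k ∘ₗ (degreeLT k (D + 1)).subtype ∘ₗ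
      LinearMap.proj j)
  have hΨ : ∀ w, Ψ w = ∑ j : Fin n, monomial (j : ℕ) (w j : k[X]) := by
    intro w
    simp [Ψ]
  have hcoeff : ∀ w (j : Fin n), (Ψ w).coeff j = w j := by
    intro w j
    rw [hΨ, finsetSum_coeff]
    simp only [coeff_monomial, Fin.val_inj]
    simp
  have hfr : Module.finrank k (degreeLT k (D + 1)) = D + 1 := by
    rw [(degreeLTEquiv k (D + 1)).finrank_eq]; simp
  have : Module.Finite k (degreeLT k (D + 1)) := Module.Finite.equiv (degreeLTEquiv k (D + 1)).symm
  have hker : LinearMap.ker (mk.toLinearMap ∘ₗ Ψ) ≠ ⊥ := by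
    apply LinearMap.ker_ne_bot_of_finrank_lt
    rw [Module.finrank_pi_fintype]
    simp only [hfr, Finset.sum_const, Finset.card_univ, Fintype.card_fin, smul_eq_mul]
    omega
  obtain ⟨w, hw, hw0⟩ := (Submodule.ne_bot_iff _).mp hker
  refine ⟨Ψ w, hw, ?_, ?_, ?_⟩
  · intro h0
    refine hw0 (funext fun j => Subtype.ext ?_)
    rw [← hcoeff, h0]; rfl
  · rw [hΨ]
    refine mem_degreeLT.mp (Submodule.sum_mem _ fun j _ => mem_degreeLT.mpr ?_)
    exact (degree_monomial_le _ _).trans_lt (Nat.cast_lt.mpr j.2)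
  · intro j
    by_cases hj : j < n
    · rw [show (Ψ w).coeff j = w ⟨j, hj⟩ from hcoeff w ⟨j, hj⟩]
      exact_mod_cast mem_degreeLT.mp (w ⟨j, hj⟩).2
    · rw [hΨ, finsetSum_coeff, Finset.sum_eq_zero, degree_zero]
      · exact WithBot.bot_lt_coe (D + 1)
      · intro i _
        rw [coeff_monomial, if_neg]
        omega

end Quotient

/-- A nonzero polynomial of small degree in an ideal containing `g` and the `N`-th powers of `t`
and of `q`, where `q` is a factor of `g` modulo `t`. -/
theorem exists_ne_zero_mem_ideal_of_isCoprime {k : Type u} [Field k] (I : Ideal k[X][X])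
    {g : k[X][X]} {q r : k[X]} {N D n : ℕ} (hq : q.Monic)
    (hg : g.map (evalRingHom 0) = q * r) (hqr : IsCoprime q r) (hgI : g ∈ I)
    (htI : (C X : k[X][X]) ^ N ∈ I) (hqI : (q.map C) ^ N ∈ I)
    (hlt : N * q.natDegree < n * (D + 1)) :
    ∃ H ∈ I, H ≠ 0 ∧ H.degree < n ∧ ∀ j, (H.coeff j).degree < D + 1 := by
  obtain ⟨S, _, _, mk, hs, hk⟩ : ∃ (S : Type u) (_ : CommRing S) (_ : Algebra k S)
      (mk : k[X][X] →ₐ[k] S), Function.Surjective mk ∧ ∀ x, mk x = 0 ↔ x ∈ I :=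
    ⟨k[X][X] ⧸ I, inferInstance, inferInstance, Ideal.Quotient.mkₐ k I,
      Ideal.Quotient.mk_surjective, fun x => Ideal.Quotient.eq_zero_iff_mem⟩
  obtain ⟨hfin, hle⟩ := finrank_le_of_isCoprime mk hs hq hg hqr ((hk _).mpr hgI)
    ((hk _).mpr htI) ((hk _).mpr hqI)
  obtain ⟨H, hH, h⟩ := exists_ne_zero_map_eq_zero_of_finrank_lt mk (hle.trans_lt hlt)
  exact ⟨H, (hk _).mp hH, h⟩

end

section

open Polynomial

/-- Bézout identity with a constant right-hand side, for polynomials coprime over the field of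
fractions. -/
theorem exists_mul_add_mul_eq_C_of_isCoprime_map {R F : Type*} [CommRing R] [IsDomain R] [Field F]
    {φ : R →+* F} (hφ : Function.Injective φ) {f g : R[X]}
    (h : IsCoprime (f.map φ) (g.map φ)) :
    ∃ u v r, r ≠ 0 ∧ f * u + g * v = C r := by
  by_cases h0 : f.natDegree ≠ 0 ∨ g.natDegree ≠ 0
  · obtain ⟨u, v, -, -, huv⟩ := exists_mul_add_mul_eq_C_resultant f g le_rfl le_rfl h0
    refine ⟨u, v, _, fun h1 => ?_, huv⟩
    have h2 : resultant (f.map φ) (g.map φ) = 0 := by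
      rw [natDegree_map_eq_of_injective hφ, natDegree_map_eq_of_injective hφ, resultant_map_map,
        h1, map_zero]
    exact (resultant_eq_zero_iff.mp h2).2 h
  · push Not at h0
    rw [eq_C_of_natDegree_eq_zero h0.1, eq_C_of_natDegree_eq_zero h0.2] at h ⊢
    by_cases hf : f.coeff 0 = 0
    · refine ⟨0, 1, g.coeff 0, fun hg => ?_, by simp⟩
      simp only [hf, hg, map_zero, Polynomial.map_zero] at h
      exact not_isCoprime_zero_zero h
    · exact ⟨1, 0, f.coeff 0, hf, by simp⟩

section Bounds

variable {k : Type*} [Field k] [LinearOrder k] [IsStrictOrderedRing k]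

theorem exists_abs_eval_le {f : k[X]} {D : ℕ} (hf : f.degree < D + 1) :
    ∃ c : k, 0 ≤ c ∧ ∀ a : k, 1 ≤ a → |f.eval a| ≤ c * a ^ D := by
  refine ⟨∑ i ∈ Finset.range (D + 1), |f.coeff i|, Finset.sum_nonneg fun i _ => abs_nonneg _,
    fun a ha => ?_⟩
  have hd : f.natDegree < D + 1 := by
    by_cases h : f = 0
    · simp [h]
    · rw [natDegree_lt_iff_degree_lt h]; exact_mod_cast hf
  rw [eval_eq_sum_range' hd, Finset.sum_mul]
  refine (Finset.abs_sum_le_sum_abs _ _).trans (Finset.sum_le_sum fun i hi => ?_)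
  rw [abs_mul, abs_pow, abs_of_nonneg (zero_le_one.trans ha)]
  gcongr
  exact Nat.lt_succ_iff.mp (Finset.mem_range.mp hi)

theorem exists_abs_eval_coeff_le {H : k[X][X]} {D : ℕ} (n : ℕ)
    (hD : ∀ j, (H.coeff j).degree < D + 1) :
    ∃ c : k, 0 ≤ c ∧ ∀ j < n, ∀ a : k, 1 ≤ a → |(H.coeff j).eval a| ≤ c * a ^ D := by
  choose c hc0 hc using fun j => exists_abs_eval_le (hD j)
  refine ⟨∑ j ∈ Finset.range n, c j, Finset.sum_nonneg fun i _ => hc0 i, fun j hj a ha => ?_⟩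
  refine (hc j a ha).trans ?_
  gcongr
  exact Finset.single_le_sum (f := c) (fun i _ => hc0 i) (Finset.mem_range.mpr hj)

theorem evalEval_eq_sum_range {R : Type*} [CommRing R] {H : R[X][X]} {n : ℕ}
    (hn : H.natDegree < n) (a y : R) :
    H.evalEval a y = ∑ j ∈ Finset.range n, (H.coeff j).eval a * y ^ j := by
  rw [evalEval, eval_eq_sum_range' hn, eval_finsetSum]
  simp

theorem exists_abs_root_le {g : k[X][X]} (hg : g.Monic) {e : ℕ}
    (he : ∀ j, (g.coeff j).degree < e + 1) :
    ∃ c : k, 1 ≤ c ∧ ∀ a y : k, 1 ≤ a → g.evalEval a y = 0 → |y| ≤ c * a ^ e := by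
  obtain ⟨c, hc0, hc⟩ := exists_abs_eval_coeff_le g.natDegree he
  refine ⟨1 + g.natDegree * c, by nlinarith [Nat.cast_nonneg (α := k) g.natDegree], ?_⟩
  intro a y ha hy
  have hae : 1 ≤ a ^ e := one_le_pow₀ ha
  have hnc : 0 ≤ g.natDegree * c := by positivity
  by_cases hy1 : |y| ≤ 1
  · nlinarith
  push Not at hy1
  rw [evalEval_eq_sum_range (Nat.lt_succ_self _), Finset.sum_range_succ, coeff_natDegree,
    hg.leadingCoeff, eval_one, one_mul] at hy
  have hn : g.natDegree ≠ 0 := by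
    intro h0
    rw [h0] at hy
    simp at hy
  obtain ⟨m, hm⟩ := Nat.exists_eq_succ_of_ne_zero hn
  have h1 : |y| ^ g.natDegree ≤ ∑ j ∈ Finset.range g.natDegree, c * a ^ e * |y| ^ m := by
    rw [← abs_pow, show y ^ g.natDegree = -∑ j ∈ Finset.range g.natDegree,
      (g.coeff j).eval a * y ^ j by linear_combination hy, abs_neg]
    refine (Finset.abs_sum_le_sum_abs _ _).trans (Finset.sum_le_sum fun j hj => ?_)
    rw [abs_mul, abs_pow]
    have := hc j (Finset.mem_range.mp hj) a ha
    have hjm : j ≤ m := by have := Finset.mem_range.mp hj; omega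
    gcongr
    exact hy1.le
  rw [Finset.sum_const, Finset.card_range, nsmul_eq_mul] at h1
  nth_rw 1 [hm] at h1
  rw [pow_succ, ← mul_assoc, mul_comm] at h1
  have h2 := le_of_mul_le_mul_right h1 (by positivity)
  nlinarith

theorem exists_abs_evalEval_le {g H : k[X][X]} (hg : g.Monic) {e D n : ℕ}
    (he : ∀ j, (g.coeff j).degree < e + 1) (hH : H.natDegree < n)
    (hD : ∀ j, (H.coeff j).degree < D + 1) :
    ∃ c : k, 0 ≤ c ∧ ∀ a y : k, 1 ≤ a → g.evalEval a y = 0 →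
      |H.evalEval a y| ≤ c * a ^ (D + e * (n - 1)) := by
  obtain ⟨c1, hc1, h1⟩ := exists_abs_root_le hg he
  obtain ⟨c2, hc2, h2⟩ := exists_abs_eval_coeff_le n hD
  refine ⟨∑ j ∈ Finset.range n, c2 * c1 ^ (n - 1), by positivity, fun a y ha hy => ?_⟩
  have hae : 1 ≤ a ^ e := one_le_pow₀ ha
  rw [evalEval_eq_sum_range hH, Finset.sum_mul]
  refine (Finset.abs_sum_le_sum_abs _ _).trans (Finset.sum_le_sum fun j hj => ?_)
  rw [Finset.mem_range] at hj
  rw [abs_mul, abs_pow]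
  have h3 : |y| ^ j ≤ (c1 * a ^ e) ^ (n - 1) :=
    (pow_le_pow_left₀ (abs_nonneg _) (h1 a y ha hy) j).trans
      (pow_le_pow_right₀ (by nlinarith) (by omega))
  calc _ ≤ (c2 * a ^ D) * (c1 * a ^ e) ^ (n - 1) := by
        gcongr
        exact h2 j hj a ha
    _ = _ := by rw [mul_pow, ← pow_mul, pow_add]; ring

end Bounds

end

section

open Polynomial

/-- The value of `f` at every integral point `(a, y)` of `g = 0` is, up to a bounded denominator,
divisible by `Q ^ N` for every common divisor `Q` of `a` and `q(y)`. -/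
def DivisibleOnCurve (g : ℤ[X][X]) (q : ℤ[X]) (N : ℕ) (f : ℚ[X][X]) : Prop :=
  ∃ c : ℤ, c ≠ 0 ∧ ∀ a y Q : ℤ, Q ∣ a → Q ∣ q.eval y → g.evalEval a y = 0 →
    ∃ z : ℤ, (c : ℚ) * f.evalEval (a : ℚ) (y : ℚ) = (Q : ℚ) ^ N * z

namespace DivisibleOnCurve

variable {g : ℤ[X][X]} {q : ℤ[X]} {N N' : ℕ} {f f' : ℚ[X][X]}

theorem zero : DivisibleOnCurve g q N 0 :=
  ⟨1, one_ne_zero, fun a y Q _ _ _ => ⟨0, by simp⟩⟩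

theorem add (h : DivisibleOnCurve g q N f) (h' : DivisibleOnCurve g q N f') :
    DivisibleOnCurve g q N (f + f') := by
  obtain ⟨c, hc, h⟩ := h
  obtain ⟨c', hc', h'⟩ := h'
  refine ⟨c * c', mul_ne_zero hc hc', fun a y Q h1 h2 h3 => ?_⟩
  obtain ⟨z, hz⟩ := h a y Q h1 h2 h3
  obtain ⟨z', hz'⟩ := h' a y Q h1 h2 h3
  refine ⟨c' * z + c * z', ?_⟩
  rw [evalEval_add]
  push_cast
  linear_combination (c' : ℚ) * hz + (c : ℚ) * hz'

theorem mul (h : DivisibleOnCurve g q N f) (h' : DivisibleOnCurve g q N' f') :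
    DivisibleOnCurve g q (N + N') (f * f') := by
  obtain ⟨c, hc, h⟩ := h
  obtain ⟨c', hc', h'⟩ := h'
  refine ⟨c * c', mul_ne_zero hc hc', fun a y Q h1 h2 h3 => ?_⟩
  obtain ⟨z, hz⟩ := h a y Q h1 h2 h3
  obtain ⟨z', hz'⟩ := h' a y Q h1 h2 h3
  refine ⟨z * z', ?_⟩
  rw [evalEval_mul]
  push_cast
  rw [pow_add]
  linear_combination (c' : ℚ) * f'.evalEval (a : ℚ) (y : ℚ) * hz + (Q : ℚ) ^ N * z * hz'

theorem C_C (x : ℚ) : DivisibleOnCurve g q 0 (C (C x)) := by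
  refine ⟨x.den, by exact_mod_cast x.den_ne_zero, fun a y Q _ _ _ => ⟨x.num, ?_⟩⟩
  rw [evalEval_C, eval_C, pow_zero, one_mul]
  exact_mod_cast Rat.den_mul_eq_num x

theorem C_X : DivisibleOnCurve g q 1 (C X) := by
  refine ⟨1, one_ne_zero, fun a y Q h _ _ => ?_⟩
  obtain ⟨z, rfl⟩ := h
  exact ⟨z, by simp [evalEval_C]⟩

theorem X' : DivisibleOnCurve g q 0 X :=
  ⟨1, one_ne_zero, fun a y Q _ _ _ => ⟨y, by simp⟩⟩

theorem of_succ (h : DivisibleOnCurve g q (N + 1) f) : DivisibleOnCurve g q N f := by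
  obtain ⟨c, hc, h⟩ := h
  refine ⟨c, hc, fun a y Q h1 h2 h3 => ?_⟩
  obtain ⟨z, hz⟩ := h a y Q h1 h2 h3
  exact ⟨Q * z, by rw [hz, pow_succ]; push_cast; ring⟩

theorem pow (h : DivisibleOnCurve g q 1 f) (N : ℕ) : DivisibleOnCurve g q N (f ^ N) := by
  induction N with
  | zero => simpa using C_C (g := g) (q := q) 1
  | succ N ih => rw [pow_succ]; exact ih.mul h

theorem all (f : ℚ[X][X]) : DivisibleOnCurve g q 0 f := by
  have hC : ∀ f : ℚ[X], DivisibleOnCurve g q 0 (C f) := by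
    intro f
    induction f using Polynomial.induction_on with
    | C a => exact C_C a
    | add f f' h h' => rw [C_add]; exact h.add h'
    | monomial n a h =>
      rw [pow_succ, ← mul_assoc, C_mul]
      exact h.mul C_X.of_succ
  induction f using Polynomial.induction_on with
  | C a => exact hC a
  | add f f' h h' => exact h.add h'
  | monomial n a h =>
    rw [pow_succ, ← mul_assoc]
    exact h.mul X'

theorem self : DivisibleOnCurve g q N (g.map (mapRingHom (Int.castRingHom ℚ))) := by
  refine ⟨1, one_ne_zero, fun a y Q _ _ h => ⟨0, ?_⟩⟩
  have := map_mapRingHom_evalEval (Int.castRingHom ℚ) g a y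
  rw [h] at this
  simp only [eq_intCast] at this
  rw [this]
  simp

theorem map_C : DivisibleOnCurve g q 1 ((q.map (Int.castRingHom ℚ)).map C) := by
  refine ⟨1, one_ne_zero, fun a y Q _ h _ => ?_⟩
  obtain ⟨z, hz⟩ := h
  refine ⟨z, ?_⟩
  rw [evalEval_map_C, eval_intCast_map, Int.cast_id, hz]
  simp

end DivisibleOnCurve

/-- The functions divisible by `Q ^ N` on the curve form an ideal. -/
def divisibleOnCurveIdeal (g : ℤ[X][X]) (q : ℤ[X]) (N : ℕ) : Ideal ℚ[X][X] where
  carrier := {f | DivisibleOnCurve g q N f}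
  add_mem' := DivisibleOnCurve.add
  zero_mem' := DivisibleOnCurve.zero
  smul_mem' f f' h := by
    have := (DivisibleOnCurve.all (g := g) (q := q) f).mul h
    rwa [zero_add] at this

theorem exists_forall_coeff_degree_lt {R : Type*} [CommRing R] (g : R[X][X]) :
    ∃ e : ℕ, ∀ j, (g.coeff j).degree < e + 1 := by
  refine ⟨∑ j ∈ g.support, (g.coeff j).natDegree, fun j => ?_⟩
  by_cases hj : j ∈ g.support
  · refine (degree_le_natDegree).trans_lt ?_
    exact_mod_cast Nat.lt_succ_of_le (Finset.single_le_sum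
      (f := fun j => (g.coeff j).natDegree) (fun _ _ => Nat.zero_le _) hj)
  · rw [notMem_support_iff.mp hj, degree_zero]
    exact WithBot.bot_lt_coe _

theorem exists_forall_evalEval_ne_zero_of_isCoprime {k : Type*} [Field k] {g H : k[X][X]}
    (h : IsCoprime (g.map (algebraMap k[X] (FractionRing k[X])))
      (H.map (algebraMap k[X] (FractionRing k[X])))) :
    ∃ R : k[X], R ≠ 0 ∧ ∀ a y, g.evalEval a y = 0 → H.evalEval a y = 0 → R.eval a = 0 := by
  obtain ⟨u, v, R, hR, huv⟩ := exists_mul_add_mul_eq_C_of_isCoprime_map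
    (IsFractionRing.injective k[X] (FractionRing k[X])) h
  refine ⟨R, hR, fun a y hg hH => ?_⟩
  have := congrArg (evalEval a y) huv
  rw [evalEval_add, evalEval_mul, evalEval_mul, hg, hH, evalEval_C] at this
  simpa using this.symm

end

section

open Polynomial

theorem exists_map_intCast_eq_C_mul (f : ℚ[X]) :
    ∃ (c : ℤ) (f0 : ℤ[X]), c ≠ 0 ∧ f0.map (Int.castRingHom ℚ) = C (c : ℚ) * f := by
  obtain ⟨b, hb, h⟩ := IsLocalization.integerNormalization_spec (nonZeroDivisors ℤ) f
  refine ⟨b, _, nonZeroDivisors.ne_zero hb, h.trans ?_⟩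
  ext i
  simp

theorem irreducible_map_fractionRing_polynomial_rat {g : ℤ[X][X]} (hg : g.Monic)
    (hirr : Irreducible g) :
    Irreducible ((g.map (mapRingHom (Int.castRingHom ℚ))).map
      (algebraMap ℚ[X] (FractionRing ℚ[X]))) := by
  have hinj : Function.Injective ((algebraMap ℚ[X] (FractionRing ℚ[X])).comp
      (mapRingHom (Int.castRingHom ℚ))) :=
    (IsFractionRing.injective ℚ[X] (FractionRing ℚ[X])).comp
      (map_injective _ (RingHom.injective_int _))
  let _ : Algebra ℤ[X] (FractionRing ℚ[X]) := ((algebraMap ℚ[X] (FractionRing ℚ[X])).comp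
      (mapRingHom (Int.castRingHom ℚ))).toAlgebra
  have : FaithfulSMul ℤ[X] (FractionRing ℚ[X]) :=
    (faithfulSMul_iff_algebraMap_injective _ _).mpr hinj
  have : IsFractionRing ℤ[X] (FractionRing ℚ[X]) := by
    refine IsFractionRing.of_field _ _ fun z => ?_
    obtain ⟨x, y, hy, rfl⟩ := IsFractionRing.div_surjective (A := ℚ[X]) z
    obtain ⟨c, x0, hc, hx⟩ := exists_map_intCast_eq_C_mul x
    obtain ⟨c', y0, hc', hy'⟩ := exists_map_intCast_eq_C_mul y
    refine ⟨C c' * x0, C c * y0, ?_⟩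
    have hy0 := nonZeroDivisors.ne_zero hy
    change _ = algebraMap ℚ[X] (FractionRing ℚ[X]) ((C c' * x0).map (Int.castRingHom ℚ)) /
      algebraMap ℚ[X] (FractionRing ℚ[X]) ((C c * y0).map (Int.castRingHom ℚ))
    have hne : ∀ f : ℚ[X], f ≠ 0 → algebraMap ℚ[X] (FractionRing ℚ[X]) f ≠ 0 := fun f hf h =>
      hf ((map_eq_zero_iff _ (IsFractionRing.injective ℚ[X] (FractionRing ℚ[X]))).mp h)
    rw [Polynomial.map_mul, Polynomial.map_mul, hx, hy', map_C, map_C, eq_intCast, eq_intCast,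
      div_eq_div_iff (hne _ hy0) (hne _ (mul_ne_zero (by simpa using hc)
        (mul_ne_zero (by simpa using hc') hy0))), ← map_mul, ← map_mul]
    congr 1
    ring
  have h := (hg.irreducible_iff_irreducible_map_fraction_map
    (K := FractionRing ℚ[X])).mp hirr
  rwa [show algebraMap ℤ[X] (FractionRing ℚ[X]) = (algebraMap ℚ[X] (FractionRing ℚ[X])).comp
      (mapRingHom (Int.castRingHom ℚ)) from rfl, ← map_map] at h

theorem irreducible_isCoprime_map_of_degree_lt {A F : Type*} [CommRing A] [Field F]
    {φ : A →+* F} (hφ : Function.Injective φ) {g H : A[X]}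
    (hirr : Irreducible (g.map φ)) (hH : H ≠ 0) (hdeg : H.degree < g.degree) :
    IsCoprime (g.map φ) (H.map φ) := by
  refine (hirr.coprime_iff_not_dvd).mpr fun hdvd => ?_
  have h0 : H.map φ ≠ 0 := (Polynomial.map_ne_zero_iff hφ).mpr hH
  have := degree_le_of_dvd hdvd h0
  rw [degree_map_eq_of_injective hφ, degree_map_eq_of_injective hφ] at this
  exact absurd this (not_le.mpr hdeg)

theorem exists_forall_ge_evalEval_ne_zero_of_dvd {g : ℤ[X][X]} (hg : g.Monic)
    (hirr : Irreducible g) {q r : ℤ[X]} (hq : q.Monic) (hqr : g.map (evalRingHom 0) = q * r)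
    (hcop : IsCoprime (q.map (Int.castRingHom ℚ)) (r.map (Int.castRingHom ℚ)))
    (hdeg : q.natDegree < g.natDegree) {M : ℤ} (hM : 0 < M) :
    ∃ B : ℤ, ∀ Q ≥ B, ∀ y, Q ∣ q.eval y → g.evalEval (M * Q) y ≠ 0 := by
  obtain ⟨gQ, hgQ⟩ : ∃ gQ, gQ = g.map (mapRingHom (Int.castRingHom ℚ)) := ⟨_, rfl⟩
  have hgQm : gQ.Monic := hgQ ▸ hg.map _
  have hgd : gQ.natDegree = g.natDegree := hgQ ▸ hg.natDegree_map _
  have hev : ∀ a y : ℤ, gQ.evalEval (a : ℚ) (y : ℚ) = (g.evalEval a y : ℤ) := fun a y => by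
    rw [hgQ]
    exact map_mapRingHom_evalEval (Int.castRingHom ℚ) g a y
  obtain ⟨e, he⟩ := exists_forall_coeff_degree_lt gQ
  obtain ⟨n, hn⟩ : ∃ n, n = g.natDegree := ⟨_, rfl⟩
  obtain ⟨D, hD⟩ : ∃ D, D = n ^ 2 * (e + 1) := ⟨_, rfl⟩
  obtain ⟨E, hE⟩ : ∃ E, E = D + e * (n - 1) := ⟨_, rfl⟩
  have hqr' : gQ.map (evalRingHom 0) = q.map (Int.castRingHom ℚ) * r.map (Int.castRingHom ℚ) := by
    rw [← Polynomial.map_mul, ← hqr, hgQ, map_map, map_map]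
    congr 1
    ext <;> simp
  obtain ⟨H, hHI, hH0, hHn, hHD⟩ := exists_ne_zero_mem_ideal_of_isCoprime
    (divisibleOnCurveIdeal g q (E + 1)) (N := E + 1) (D := D) (n := n) (hq.map _) hqr' hcop
    (by rw [hgQ]; exact DivisibleOnCurve.self) (DivisibleOnCurve.C_X.pow _)
    (DivisibleOnCurve.map_C.pow _) (by
      rw [hq.natDegree_map, hE, hD]
      rw [← hn] at hdeg
      obtain ⟨m, rfl⟩ : ∃ m, n = m + 1 := ⟨n - 1, by omega⟩
      have hd : q.natDegree ≤ m := by omega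
      rw [Nat.add_sub_cancel]
      refine (Nat.mul_le_mul_left _ hd).trans_lt ?_
      ring_nf
      nlinarith [Nat.zero_le (m * e), Nat.zero_le (m ^ 2 * e), Nat.zero_le (m ^ 3 * e)])
  obtain ⟨R, hR0, hR⟩ := exists_forall_evalEval_ne_zero_of_isCoprime
    (irreducible_isCoprime_map_of_degree_lt (IsFractionRing.injective ℚ[X] (FractionRing ℚ[X]))
      (hgQ ▸ irreducible_map_fractionRing_polynomial_rat hg hirr) hH0 (by
        rw [degree_eq_natDegree hgQm.ne_zero, hgd, ← hn]; exact hHn))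
  obtain ⟨c, hc, hdiv⟩ := hHI
  obtain ⟨b, hb0, hb⟩ := exists_abs_evalEval_le hgQm he
    ((natDegree_lt_iff_degree_lt hH0).mpr hHn) hHD
  rw [← hE] at hb
  obtain ⟨B1, hB1⟩ := (R.roots.toFinset : Set ℚ).toFinite.bddAbove
  obtain ⟨B, hB⟩ := exists_int_gt (max (max B1 1) (|(c : ℚ)| * (b * (M : ℚ) ^ E)))
  refine ⟨B, fun Q hQ y hy h0 => ?_⟩
  have hQB : ((B : ℤ) : ℚ) ≤ Q := by exact_mod_cast hQ
  have hQ' := hB.trans_le hQB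
  rw [max_lt_iff, max_lt_iff] at hQ'
  obtain ⟨⟨hQ1, hQ2⟩, hQ3⟩ := hQ'
  have hM1 : (1 : ℚ) ≤ M := by exact_mod_cast hM
  have hMQ : (Q : ℚ) ≤ ((M * Q : ℤ) : ℚ) := by push_cast; nlinarith
  have h0' : gQ.evalEval ((M * Q : ℤ) : ℚ) (y : ℚ) = 0 := by rw [hev, h0]; rfl
  obtain ⟨z, hz⟩ := hdiv (M * Q) y Q (dvd_mul_left _ _) hy h0
  have hle := hb _ _ (hQ2.le.trans hMQ) h0'
  have hz0 : z = 0 := by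
    by_contra hz0
    have h1 : (1 : ℚ) ≤ |(z : ℚ)| := by exact_mod_cast Int.one_le_abs hz0
    have h2 : (Q : ℚ) ^ (E + 1) * |(z : ℚ)| ≤ |(c : ℚ)| * (b * ((M * Q : ℤ) : ℚ) ^ E) := by
      have := congrArg abs hz
      rw [abs_mul, abs_mul, abs_pow, abs_of_pos (zero_lt_one.trans hQ2)] at this
      rw [← this]
      gcongr
    have hQE : (0 : ℚ) < (Q : ℚ) ^ E := pow_pos (zero_lt_one.trans hQ2) _
    have h3 : (Q : ℚ) ^ E * Q ≤ (Q : ℚ) ^ E * (|(c : ℚ)| * (b * (M : ℚ) ^ E)) := by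
      calc (Q : ℚ) ^ E * Q = (Q : ℚ) ^ (E + 1) * 1 := by ring
        _ ≤ (Q : ℚ) ^ (E + 1) * |(z : ℚ)| := by
          have := zero_lt_one.trans hQ2
          gcongr
        _ ≤ _ := h2
        _ = _ := by push_cast; ring
    exact absurd (le_of_mul_le_mul_left h3 hQE) (not_le.mpr hQ3)
  rw [hz0, Int.cast_zero, mul_zero] at hz
  have hH : H.evalEval ((M * Q : ℤ) : ℚ) (y : ℚ) = 0 :=
    (mul_eq_zero.mp hz).resolve_left (by exact_mod_cast hc)
  have hroot := hR _ _ h0' hH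
  have := hB1 (a := ((M * Q : ℤ) : ℚ)) (by simpa [hR0] using hroot)
  exact absurd (hMQ.trans this) (not_le.mpr hQ1)

end

section

open Polynomial

/-- Integral roots of specialisations of monic polynomials over `D[t]` come from roots over
`D[t]`, for infinitely many specialisations of `t` to natural numbers. -/
def HilbertSpecialization (D : Type*) [CommRing D] : Prop :=
  ∀ G : Finset D[X][X], (∀ g ∈ G, g.Monic) → ∃ A : Set ℕ, A.Infinite ∧
    ∀ g ∈ G, ∀ a ∈ A, ∀ y : D, g.evalEval (a : D) y = 0 →
      ∃ P : D[X], g.eval P = 0 ∧ P.eval (a : D) = y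

theorem dvd_eval_map_evalRingHom_zero {g : ℤ[X][X]} {a y : ℤ} (h : g.evalEval a y = 0) :
    a ∣ (g.map (evalRingHom 0)).eval y := by
  have h1 := sub_dvd_eval_sub a 0 (g.eval (C y))
  rw [sub_zero, show eval a (eval (C y) g) = 0 from h, zero_sub, dvd_neg] at h1
  rwa [map_evalRingHom_eval]

theorem exists_forall_prime_pow_evalEval_ne_zero {g : ℤ[X][X]} (hg : g.Monic)
    (hirr : Irreducible g) (hdeg : 2 ≤ g.natDegree)
    (hsep : ((g.map (evalRingHom 0)).map (Int.castRingHom ℚ)).Separable) :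
    ∃ M0 ρ : ℤ, 0 < M0 ∧ ρ ≠ 0 ∧ ∀ M : ℤ, 0 < M → M0 ∣ M → ∀ p : ℕ, p.Prime → ¬ (p : ℤ) ∣ ρ →
      ∃ m0 : ℕ, ∀ m ≥ m0, ∀ y, g.evalEval (M * (p : ℤ) ^ m) y ≠ 0 := by
  have hg0 : (g.map (evalRingHom 0)).Monic := hg.map _
  have hd0 : (g.map (evalRingHom 0)).natDegree = g.natDegree := hg.natDegree_map _
  by_cases h0 : Irreducible (g.map (evalRingHom 0))
  · obtain ⟨l, hl, hl'⟩ :=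
      (infinite_setOf_prime_forall_not_dvd_eval hg0 h0 (hd0 ▸ hdeg)).nonempty
    refine ⟨l, 1, by exact_mod_cast hl.pos, one_ne_zero, fun M hM hdvd p hp _ => ⟨0, ?_⟩⟩
    intro m _ y hy
    exact hl' y ((hdvd.mul_right _).trans (dvd_eval_map_evalRingHom_zero hy))
  · have h1 : g.map (evalRingHom 0) ≠ 1 := fun h => by
      rw [h, natDegree_one] at hd0
      omega
    rw [hg0.irreducible_iff_natDegree] at h0
    push Not at h0
    obtain ⟨q, r, hq, hr, hqr, hq0, hr0⟩ := h0 h1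
    have hcop : IsCoprime (q.map (Int.castRingHom ℚ)) (r.map (Int.castRingHom ℚ)) := by
      rw [← hqr, Polynomial.map_mul] at hsep
      exact hsep.isCoprime
    have hdd := hq.natDegree_mul hr
    rw [hqr, hd0] at hdd
    obtain ⟨u, v, ρ, hρ, huv⟩ := exists_mul_add_mul_eq_C_of_isCoprime_map
      (RingHom.injective_int (Int.castRingHom ℚ)) hcop
    refine ⟨1, ρ, one_pos, hρ, fun M hM _ p hp hpρ => ?_⟩
    obtain ⟨B, hB⟩ := exists_forall_ge_evalEval_ne_zero_of_dvd hg hirr hq hqr.symm hcop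
      (by omega) hM
    obtain ⟨B', hB'⟩ := exists_forall_ge_evalEval_ne_zero_of_dvd hg hirr hr
      (by rw [← hqr, mul_comm]) hcop.symm (by omega) hM
    refine ⟨B.natAbs + B'.natAbs, fun m hm y hy => ?_⟩
    have hpm : ((m : ℕ) : ℤ) < (p : ℤ) ^ m := by exact_mod_cast Nat.lt_pow_self hp.one_lt
    have h2 : (p : ℤ) ^ m ∣ q.eval y * r.eval y := by
      rw [← eval_mul, hqr]
      exact (dvd_mul_left _ _).trans (dvd_eval_map_evalRingHom_zero hy)
    have hpp : Prime (p : ℤ) := Nat.prime_iff_prime_int.mp hp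
    by_cases h3 : (p : ℤ) ∣ q.eval y
    · have h4 : ¬ (p : ℤ) ∣ r.eval y := fun h4 => hpρ (by
        have := congrArg (eval y) huv
        rw [eval_add, eval_mul, eval_mul, eval_C] at this
        exact this ▸ dvd_add (h3.mul_right _) (h4.mul_right _))
      exact hB _ (by omega) y
        ((((hpp.coprime_iff_not_dvd).mpr h4).pow_left).dvd_of_dvd_mul_right h2) hy
    · exact hB' _ (by omega) y
        ((((hpp.coprime_iff_not_dvd).mpr h3).pow_left).dvd_of_dvd_mul_left h2) hy

theorem exists_infinite_forall_evalEval_ne_zero_of_separable (G : Finset ℤ[X][X])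
    (hG : ∀ g ∈ G, g.Monic ∧ Irreducible g ∧ 2 ≤ g.natDegree ∧
      ((g.map (evalRingHom 0)).map (Int.castRingHom ℚ)).Separable) :
    ∃ A : Set ℕ, A.Infinite ∧ ∀ g ∈ G, ∀ a ∈ A, ∀ y : ℤ, g.evalEval (a : ℤ) y ≠ 0 := by
  have h := fun g : G => exists_forall_prime_pow_evalEval_ne_zero (hG g g.2).1 (hG g g.2).2.1
    (hG g g.2).2.2.1 (hG g g.2).2.2.2
  choose M0 ρ hM0 hρ h using h
  have hρ0 : ∏ g : G, ρ g ≠ 0 := Finset.prod_ne_zero_iff.mpr fun g _ => hρ g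
  obtain ⟨p, hpge, hp⟩ := Nat.exists_infinite_primes ((∏ g : G, ρ g).natAbs + 1)
  have hpρ : ∀ g, ¬ (p : ℤ) ∣ ρ g := fun g hdvd => by
    have h1 := Int.natAbs_dvd_natAbs.mpr (hdvd.trans (Finset.dvd_prod_of_mem ρ (Finset.mem_univ g)))
    have h2 := Nat.le_of_dvd (Int.natAbs_pos.mpr hρ0) h1
    simp only [Int.natAbs_natCast] at h2
    omega
  have hM : 0 < ∏ g : G, M0 g := Finset.prod_pos fun g _ => hM0 g
  choose m0 hm0 using fun g => h g _ hM (Finset.dvd_prod_of_mem M0 (Finset.mem_univ g)) p hp (hpρ g)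
  obtain ⟨M, hMn⟩ := Int.eq_ofNat_of_zero_le hM.le
  refine ⟨(fun m => M * p ^ m) '' Set.Ici (∑ g : G, m0 g), (Set.Ici_infinite _).image ?_, ?_⟩
  · intro m _ m' _ hmm
    have hM' : 0 < M := by omega
    exact Nat.pow_right_injective hp.two_le (Nat.eq_of_mul_eq_mul_left hM' hmm)
  · rintro g hg _ ⟨m, hm, rfl⟩ y
    have := hm0 ⟨g, hg⟩ m ((Finset.single_le_sum (f := m0) (fun _ _ => Nat.zero_le _)
      (Finset.mem_univ _)).trans hm) y
    rw [hMn] at this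
    exact_mod_cast this

end

section

open Polynomial

theorem exists_forall_separable_map_evalRingHom {g : ℤ[X][X]} (hg : g.Monic)
    (hirr : Irreducible g) (hdeg : 2 ≤ g.natDegree) :
    ∃ R : ℤ[X], R ≠ 0 ∧ ∀ b : ℤ, R.eval b ≠ 0 →
      ((g.map (evalRingHom b)).map (Int.castRingHom ℚ)).Separable := by
  have hinj := IsFractionRing.injective ℤ[X] (FractionRing ℤ[X])
  have h1 := irreducible_isCoprime_map_of_degree_lt hinj (H := derivative g)
    ((hg.irreducible_iff_irreducible_map_fraction_map (K := FractionRing ℤ[X])).mp hirr)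
    (fun h => by
      have := derivative_eq_zero.mp h
      omega)
    (degree_derivative_lt hg.ne_zero)
  obtain ⟨u, v, R, hR, huv⟩ := exists_mul_add_mul_eq_C_of_isCoprime_map hinj h1
  refine ⟨R, hR, fun b hb => ?_⟩
  have h2 := congrArg (Polynomial.map ((Int.castRingHom ℚ).comp (evalRingHom b))) huv
  rw [Polynomial.map_add, Polynomial.map_mul, Polynomial.map_mul, map_C] at h2
  rw [map_map, Polynomial.Separable, derivative_map]
  have h3 : IsUnit (C (((Int.castRingHom ℚ).comp (evalRingHom b)) R)) := by
    rw [isUnit_C]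
    exact IsUnit.mk0 _ (by simpa using hb)
  obtain ⟨w, hw⟩ := h3.exists_right_inv
  refine ⟨w * u.map ((Int.castRingHom ℚ).comp (evalRingHom b)),
    w * v.map ((Int.castRingHom ℚ).comp (evalRingHom b)), ?_⟩
  rw [← hw, ← h2]
  ring

theorem evalEval_map_taylor {R : Type*} [CommRing R] (g : R[X][X]) (b a y : R) :
    (g.map (taylorAlgHom b : R[X] →ₐ[R] R[X]).toRingHom).evalEval a y = g.evalEval (a + b) y := by
  rw [← map_evalRingHom_eval, ← map_evalRingHom_eval, map_map]
  congr 2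
  ext x <;> simp

theorem exists_infinite_forall_evalEval_ne_zero (G : Finset ℤ[X][X])
    (hG : ∀ g ∈ G, g.Monic ∧ Irreducible g ∧ 2 ≤ g.natDegree) :
    ∃ A : Set ℕ, A.Infinite ∧ ∀ g ∈ G, ∀ a ∈ A, ∀ y : ℤ, g.evalEval (a : ℤ) y ≠ 0 := by
  classical
  choose! R hR0 hR using fun g (hg : g ∈ G) => exists_forall_separable_map_evalRingHom (hG g hg).1
    (hG g hg).2.1 (hG g hg).2.2
  have hP : ∏ g ∈ G, R g ≠ 0 := Finset.prod_ne_zero_iff.mpr hR0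
  obtain ⟨b, hb⟩ : ∃ b : ℕ, (∏ g ∈ G, R g).eval (b : ℤ) ≠ 0 := by
    by_contra! h
    exact hP (eq_zero_of_infinite_isRoot _ ((Set.infinite_range_of_injective
      (Nat.cast_injective (R := ℤ))).mono (by rintro _ ⟨b, rfl⟩; exact h b)))
  obtain ⟨A, hA, h⟩ := exists_infinite_forall_evalEval_ne_zero_of_separable
    (G.image fun g => g.map (taylorAlgHom (b : ℤ)).toRingHom) (by
      intro g' hg'
      obtain ⟨g, hg, rfl⟩ := Finset.mem_image.mp hg'
      obtain ⟨h1, h2, h3⟩ := hG g hg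
      refine ⟨h1.map _, ?_, by rwa [h1.natDegree_map], ?_⟩
      · exact (MulEquiv.irreducible_iff (mapEquiv (taylorEquiv (b : ℤ)).toRingEquiv)).mpr h2
      · have : (evalRingHom (0 : ℤ)).comp (taylorAlgHom (b : ℤ)).toRingHom =
            evalRingHom (b : ℤ) := by ext <;> simp
        rw [map_map (f := (taylorAlgHom (b : ℤ)).toRingHom), this]
        refine hR g hg _ fun h0 => hb ?_
        rw [eval_prod]
        exact Finset.prod_eq_zero hg h0)
  refine ⟨(· + b) '' A, hA.image (fun _ _ _ _ h => Nat.add_right_cancel h), ?_⟩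
  rintro g hg _ ⟨a, ha, rfl⟩ y
  have := h _ (Finset.mem_image_of_mem _ hg) a ha y
  rw [evalEval_map_taylor] at this
  exact_mod_cast this

theorem exists_multiset_monic_irreducible_prod_eq {R : Type*} [CommRing R] [IsDomain R] {g : R[X]}
    (hg : g.Monic) :
    ∃ s : Multiset R[X], (∀ f ∈ s, f.Monic ∧ Irreducible f) ∧ s.prod = g := by
  induction hn : g.natDegree using Nat.strong_induction_on generalizing g with
  | _ n ih =>
    by_cases h1 : g = 1
    · exact ⟨0, by simp, by simp [h1]⟩
    by_cases hirr : Irreducible g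
    · exact ⟨{g}, by simp [hg, hirr], by simp⟩
    rw [hg.irreducible_iff_natDegree] at hirr
    push Not at hirr
    obtain ⟨q, r, hq, hr, hqr, hq0, hr0⟩ := hirr h1
    have hd := hq.natDegree_mul hr
    rw [hqr, hn] at hd
    obtain ⟨s, hs, rfl⟩ := ih q.natDegree (by omega) hq rfl
    obtain ⟨s', hs', rfl⟩ := ih r.natDegree (by omega) hr rfl
    refine ⟨s + s', fun f hf => ?_, by rw [Multiset.prod_add, hqr]⟩
    rcases Multiset.mem_add.mp hf with hf | hf
    exacts [hs f hf, hs' f hf]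

theorem hilbertSpecialization_int : HilbertSpecialization ℤ := by
  classical
  intro G hG
  choose! s hs hs' using fun g (hg : g ∈ G) => exists_multiset_monic_irreducible_prod_eq (hG g hg)
  obtain ⟨A, hA, h⟩ := exists_infinite_forall_evalEval_ne_zero
    (G.biUnion fun g => (s g).toFinset.filter fun f => 2 ≤ f.natDegree) (by
      intro f hf
      obtain ⟨g, hg, hf⟩ := Finset.mem_biUnion.mp hf
      obtain ⟨hf, hdeg⟩ := Finset.mem_filter.mp hf
      have := hs g hg f (Multiset.mem_toFinset.mp hf)
      exact ⟨this.1, this.2, hdeg⟩)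
  refine ⟨A, hA, fun g hg a ha y hy => ?_⟩
  rw [← hs' g hg, ← coe_evalEvalRingHom, map_multiset_prod, Multiset.prod_eq_zero_iff] at hy
  obtain ⟨f, hf, hfy⟩ := Multiset.mem_map.mp hy
  have hdvd : f ∣ g := hs' g hg ▸ Multiset.dvd_prod hf
  obtain ⟨hfm, hfi⟩ := hs g hg f hf
  by_cases hdeg : 2 ≤ f.natDegree
  · exact absurd hfy (h f (Finset.mem_biUnion.mpr ⟨g, hg, Finset.mem_filter.mpr
      ⟨Multiset.mem_toFinset.mpr hf, hdeg⟩⟩) a ha y)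
  have h1 : f.natDegree = 1 := by
    have : f.natDegree ≠ 0 := fun h0 => hfi.not_isUnit
      (eq_one_of_monic_natDegree_zero hfm h0 ▸ isUnit_one)
    omega
  rw [hfm.eq_X_add_C h1] at hdvd hfy
  refine ⟨-f.coeff 0, ?_, ?_⟩
  · obtain ⟨e, he⟩ := hdvd
    rw [he, eval_mul]
    simp
  · rw [coe_evalEvalRingHom, evalEval_add, evalEval_X, evalEval_C] at hfy
    rw [eval_neg]
    linear_combination -hfy

end

section

open Polynomial

theorem exists_eq_mul_of_eval_scaleRoots_eq_zero {A : Type*} [CommRing A] [IsDomain A]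
    [IsIntegrallyClosed A] {g : A[X]} (hg : g.Monic) {s z : A} (hs : s ≠ 0)
    (h : (g.scaleRoots s).eval z = 0) : ∃ x, z = s * x ∧ g.eval x = 0 := by
  have hinj := IsFractionRing.injective A (FractionRing A)
  let φ := algebraMap A (FractionRing A)
  have hs' : φ s ≠ 0 := fun h0 => hs ((map_eq_zero_iff φ hinj).mp h0)
  have h1 := scaleRoots_eval₂_mul (p := g) φ (φ z / φ s) s
  rw [mul_div_cancel₀ _ hs', eval₂_at_apply, h, map_zero] at h1
  have h2 := (mul_eq_zero.mp h1.symm).resolve_left (pow_ne_zero _ hs')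
  obtain ⟨x, hx⟩ := IsIntegrallyClosed.isIntegral_iff.mp (⟨g, hg, h2⟩ : IsIntegral A (φ z / φ s))
  refine ⟨x, hinj ?_, hinj ?_⟩
  · change φ z = φ (s * x)
    rw [map_mul, show φ x = φ z / φ s from hx, mul_div_cancel₀ _ hs']
  · rw [map_zero, ← eval₂_at_apply, hx]
    exact h2

theorem exists_lagrange_basis (D : Type*) [CommRing D] [IsDomain D] [CharZero D] (E : ℕ) :
    ∃ (Δ : D) (l : Fin (E + 1) → D[X]), Δ ≠ 0 ∧ (∀ i, (l i).natDegree ≤ E) ∧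
      ∀ i j : Fin (E + 1), (l i).eval ((j : ℕ) : D) = if i = j then Δ else 0 := by
  classical
  obtain ⟨m, hm⟩ : ∃ m : Fin (E + 1) → D[X],
      ∀ i, m i = ∏ j ∈ Finset.univ.erase i, (X - C ((j : ℕ) : D)) := ⟨_, fun _ => rfl⟩
  have hm0 : ∀ i : Fin (E + 1), (m i).eval ((i : ℕ) : D) ≠ 0 := by
    intro i
    rw [hm, eval_prod, Finset.prod_ne_zero_iff]
    intro j hj
    rw [eval_sub, eval_X, eval_C, sub_ne_zero, Nat.cast_injective.ne_iff, ne_eq, Fin.val_inj]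
    exact (Finset.ne_of_mem_erase hj).symm
  refine ⟨∏ i, (m i).eval ((i : ℕ) : D),
    fun i => C (∏ j ∈ Finset.univ.erase i, (m j).eval ((j : ℕ) : D)) * m i,
    Finset.prod_ne_zero_iff.mpr fun i _ => hm0 i, fun i => ?_, fun i j => ?_⟩
  · refine (natDegree_C_mul_le _ _).trans ?_
    rw [hm, natDegree_prod_of_monic _ _ fun j _ => monic_X_sub_C _]
    simp only [natDegree_X_sub_C]
    simp
  · rw [eval_mul, eval_C]
    split_ifs with h
    · subst h
      rw [mul_comm, Finset.mul_prod_erase Finset.univ (fun i => (m i).eval ((i : ℕ) : D))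
        (Finset.mem_univ i)]
    · have h0 : (m i).eval ((j : ℕ) : D) = 0 := by
        rw [hm, eval_prod]
        exact Finset.prod_eq_zero (i := j) (by simpa using Ne.symm h) (by simp)
      rw [h0, mul_zero]

theorem natDegree_eval_C_le {D : Type*} [CommRing D] (f : D[X][X]) (a : D) :
    (f.eval (C a)).natDegree ≤ ∑ i ∈ f.support, (f.coeff i).natDegree := by
  rw [eval_eq_sum, Polynomial.sum]
  refine natDegree_sum_le_of_forall_le _ _ fun i hi => ?_
  rw [← C_pow]
  exact (natDegree_mul_C_le _ _).trans
    (Finset.single_le_sum (f := fun i => (f.coeff i).natDegree) (fun _ _ => Nat.zero_le _) hi)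

theorem exists_natDegree_root_le {D : Type*} [CommRing D] [IsDomain D] {g : D[X][X][X]}
    (hg : g.Monic) :
    ∃ E : ℕ, ∀ (a : D) (y : D[X]), g.evalEval (C a) y = 0 → y.natDegree ≤ E := by
  refine ⟨∑ j ∈ g.support, ∑ i ∈ (g.coeff j).support, ((g.coeff j).coeff i).natDegree,
    fun a y hy => ?_⟩
  obtain ⟨E, hE⟩ : ∃ E, E = ∑ j ∈ g.support, ∑ i ∈ (g.coeff j).support,
    ((g.coeff j).coeff i).natDegree := ⟨_, rfl⟩
  rw [← hE]
  have hcoeff : ∀ j, ((g.coeff j).eval (C a)).natDegree ≤ E := by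
    intro j
    by_cases hj : j ∈ g.support
    · rw [hE]
      exact (natDegree_eval_C_le _ _).trans (Finset.single_le_sum
        (f := fun j => ∑ i ∈ (g.coeff j).support, ((g.coeff j).coeff i).natDegree)
        (fun _ _ => Nat.zero_le _) hj)
    · simp [notMem_support_iff.mp hj]
  rw [evalEval_eq_sum_range (Nat.lt_succ_self _), Finset.sum_range_succ, coeff_natDegree,
    hg.leadingCoeff, eval_one, one_mul] at hy
  by_contra! hlt
  obtain ⟨n, hn⟩ : ∃ n, n = g.natDegree := ⟨_, rfl⟩
  rw [← hn] at hy
  rcases Nat.eq_zero_or_pos n with h0 | h0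
  · rw [h0] at hy
    simp at hy
  have h1 : y ^ n = -∑ j ∈ Finset.range n, (g.coeff j).eval (C a) * y ^ j := by
    linear_combination hy
  have h2 : (y ^ n).natDegree ≤ E + (n - 1) * y.natDegree := by
    rw [h1, natDegree_neg]
    refine natDegree_sum_le_of_forall_le _ _ fun j hj => ?_
    refine natDegree_mul_le.trans (add_le_add (hcoeff j) ?_)
    rw [natDegree_pow]
    exact Nat.mul_le_mul_right _ (by have := Finset.mem_range.mp hj; omega)
  rw [natDegree_pow] at h2
  obtain ⟨m, rfl⟩ : ∃ m, n = m + 1 := ⟨n - 1, by omega⟩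
  rw [Nat.add_sub_cancel] at h2
  nlinarith

end

section

open Polynomial

theorem finite_setOf_eval_natCast_eq_zero {R : Type*} [CommRing R] [IsDomain R] [CharZero R]
    {W : R[X]} (hW : W ≠ 0) : {a : ℕ | W.eval (a : R) = 0}.Finite := by
  classical
  refine Set.Finite.of_finite_image (f := ((↑) : ℕ → R)) ?_ Nat.cast_injective.injOn
  refine (W.roots.toFinset : Set R).toFinite.subset ?_
  rintro _ ⟨a, ha, rfl⟩
  simpa [hW] using ha

theorem eval_map_C_eval {D : Type*} [CommRing D] (P : D[X]) (a : ℕ) :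
    (P.map C).eval (a : D[X]) = C (P.eval (a : D)) := by
  rw [eval_natCast_map]

theorem exists_finite_forall_root_lift {D : Type*} [CommRing D] [IsDomain D] [CharZero D]
    [IsIntegrallyClosed D] {g : D[X][X][X]} (hg : g.Monic) :
    ∃ (G : Finset D[X][X]) (bad : Set ℕ), (∀ h ∈ G, h.Monic) ∧ bad.Finite ∧ ∀ a ∉ bad,
      (∀ h ∈ G, ∀ y : D, h.evalEval (a : D) y = 0 → ∃ P, h.eval P = 0 ∧ P.eval (a : D) = y) →
      ∀ y : D[X], g.evalEval (a : D[X]) y = 0 → ∃ P, g.eval P = 0 ∧ P.eval (a : D[X]) = y := by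
  classical
  obtain ⟨E, hE⟩ := exists_natDegree_root_le hg
  obtain ⟨Δ, l, hΔ, hl, hl'⟩ := exists_lagrange_basis D E
  let h : Fin (E + 1) → D[X][X] := fun c => g.map (mapRingHom (evalRingHom ((c : ℕ) : D)))
  have hh : ∀ c, (h c).Monic := fun c => hg.map _
  let Z : (Fin (E + 1) → D[X]) → D[X][X] := fun P => ∑ c, (P c).map C * C (l c)
  let W : (Fin (E + 1) → D[X]) → D[X][X] := fun P => (g.scaleRoots (C (C Δ))).eval (Z P)
  refine ⟨Finset.univ.image h, ⋃ P ∈ Fintype.piFinset fun c => (h c).roots.toFinset,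
    {a : ℕ | W P ≠ 0 ∧ (W P).eval (a : D[X]) = 0}, ?_, ?_, ?_⟩
  · intro f hf
    obtain ⟨c, -, rfl⟩ := Finset.mem_image.mp hf
    exact hh c
  · refine Set.Finite.biUnion (Finset.finite_toSet _) fun P _ => ?_
    by_cases hW : W P = 0
    · simp [hW]
    · exact (finite_setOf_eval_natCast_eq_zero hW).subset fun a ha => ha.2
  · intro a ha hroot y hy
    have hyc : ∀ c : Fin (E + 1), (h c).evalEval (a : D) (y.eval ((c : ℕ) : D)) = 0 := by
      intro c
      have := map_mapRingHom_evalEval (evalRingHom ((c : ℕ) : D)) g (a : D[X]) y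
      rw [hy, map_zero, map_natCast] at this
      exact this
    choose P hP hPa using fun c => hroot (h c) (Finset.mem_image_of_mem h (Finset.mem_univ c)) _
      (hyc c)
    have hPmem : P ∈ Fintype.piFinset fun c => (h c).roots.toFinset := by
      rw [Fintype.mem_piFinset]
      intro c
      simpa [(hh c).ne_zero] using hP c
    have hZa : (Z P).eval (a : D[X]) = C Δ * y := by
      have h1 : (Z P).eval (a : D[X]) = ∑ c : Fin (E + 1), C (y.eval ((c : ℕ) : D)) * l c := by
        simp only [Z]
        rw [eval_finsetSum]
        refine Finset.sum_congr rfl fun c _ => ?_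
        rw [eval_mul, eval_C, eval_map_C_eval, hPa]
      rw [h1]
      refine eq_of_natDegree_lt_card_of_eval_eq _ _ (f := fun i : Fin (E + 1) => ((i : ℕ) : D))
        (Nat.cast_injective.comp Fin.val_injective) (fun i => ?_) ?_
      · rw [eval_finsetSum, eval_mul, eval_C]
        simp only [eval_mul, eval_C, hl']
        simp [mul_comm]
      · rw [Fintype.card_fin, Nat.lt_succ_iff, max_le_iff]
        refine ⟨natDegree_sum_le_of_forall_le _ _ fun c _ =>
          (natDegree_C_mul_le _ _).trans (hl c), (natDegree_C_mul_le _ _).trans ?_⟩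
        exact hE (a : D) y (by rwa [C_eq_natCast])
    have hWa : (W P).eval (a : D[X]) = 0 := by
      simp only [W]
      rw [← coe_evalRingHom, ← eval₂_at_apply, coe_evalRingHom, hZa, ← eval_map,
        map_scaleRoots _ _ _ (by simp [hg.leadingCoeff]), coe_evalRingHom, eval_C,
        scaleRoots_eval_mul, map_evalRingHom_eval, hy, mul_zero]
    have hW : W P = 0 := by
      by_contra hne
      exact ha (Set.mem_biUnion hPmem ⟨hne, hWa⟩)
    obtain ⟨Y, hZY, hY⟩ := exists_eq_mul_of_eval_scaleRoots_eq_zero hg (by simpa using hΔ) hW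
    refine ⟨Y, hY, ?_⟩
    rw [hZY, eval_mul, eval_C] at hZa
    exact mul_left_cancel₀ (by simpa using hΔ) hZa

theorem HilbertSpecialization.polynomial {D : Type*} [CommRing D] [IsDomain D] [CharZero D]
    [IsIntegrallyClosed D] (hD : HilbertSpecialization D) : HilbertSpecialization D[X] := by
  classical
  intro G hG
  choose! G' bad hG' hbad h using fun g (hg : g ∈ G) => exists_finite_forall_root_lift (hG g hg)
  obtain ⟨A, hA, hA'⟩ := hD (G.biUnion G') (by
    intro f hf
    obtain ⟨g, hg, hf⟩ := Finset.mem_biUnion.mp hf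
    exact hG' g hg f hf)
  refine ⟨A \ ⋃ g ∈ G, bad g, hA.sdiff (Set.Finite.biUnion G.finite_toSet hbad), ?_⟩
  intro g hg a ha y hy
  refine h g hg a (fun hb => ha.2 (Set.mem_biUnion hg hb)) (fun f hf => ?_) y hy
  exact hA' f (Finset.mem_biUnion.mpr ⟨g, hg, hf⟩) a ha.1

end

section

open Polynomial

universe u

theorem Multiset.exists_le_map_eq {α β : Type*} {f : α → β} {s : Multiset α} {t : Multiset β}
    (h : t ≤ s.map f) : ∃ s' ≤ s, s'.map f = t := by
  classical
  induction s using Multiset.induction_on generalizing t with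
  | empty => exact ⟨0, le_rfl, by simpa using (Multiset.le_zero.mp (by simpa using h)).symm⟩
  | cons a s ih =>
    rw [Multiset.map_cons] at h
    by_cases ha : f a ∈ t
    · obtain ⟨t', rfl⟩ := Multiset.exists_cons_of_mem ha
      obtain ⟨s', hs', rfl⟩ := ih ((Multiset.cons_le_cons_iff _).mp h)
      exact ⟨a ::ₘ s', Multiset.cons_le_cons _ hs', by simp⟩
    · obtain ⟨s', hs', rfl⟩ := ih ((Multiset.le_cons_of_notMem ha).mp h)
      exact ⟨s', hs'.trans (Multiset.le_cons_self _ _), rfl⟩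

theorem exists_coeff_notMem_range {F E : Type*} [Field F] [Field E] [Algebra F E] {f : F[X]}
    (hirr : Irreducible f) {p q : E[X]} (hpq : p * q = f.map (algebraMap F E)) (hp : p.natDegree ≠ 0)
    (hq : q.natDegree ≠ 0) : ∃ i, p.coeff i ∉ (algebraMap F E).range := by
  by_contra! h
  obtain ⟨p0, hp0⟩ := (mem_lifts p).mp ((lifts_iff_coeff_lifts p).mpr h)
  have hf0 : f.map (algebraMap F E) ≠ 0 := Polynomial.map_ne_zero hirr.ne_zero
  have hdvd : p0 ∣ f := by
    rw [← map_dvd_map' (algebraMap F E), hp0, ← hpq]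
    exact dvd_mul_right _ _
  have hd := congrArg natDegree hpq
  have hp1 : p ≠ 0 := fun h => by simp [h] at hp
  have hq1 : q ≠ 0 := fun h => by simp [h] at hq
  rw [natDegree_mul hp1 hq1, natDegree_map] at hd
  have hpd : p0.natDegree = p.natDegree := by rw [← hp0, natDegree_map]
  obtain ⟨q0, hq0⟩ := hdvd
  rcases hirr.isUnit_or_isUnit hq0 with h1 | h1
  · have := natDegree_eq_zero_of_isUnit h1
    omega
  · have h2 := natDegree_eq_zero_of_isUnit h1
    have h3 : f.natDegree = p0.natDegree + q0.natDegree := by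
      rw [hq0, natDegree_mul]
      · rintro rfl; exact hirr.ne_zero (by rw [hq0, zero_mul])
      · rintro rfl; exact hirr.ne_zero (by rw [hq0, mul_zero])
    omega

theorem eval_minpoly_ne_zero_of_notMem_range {A F E : Type*} [CommRing A] [IsDomain A]
    [IsIntegrallyClosed A] [Field F] [Algebra A F] [IsFractionRing A F] [Field E] [Algebra F E]
    [Algebra A E] [IsScalarTower A F E] {c : E} (hc : IsIntegral A c)
    (hcF : c ∉ (algebraMap F E).range) (P : A) : (minpoly A c).eval P ≠ 0 := by
  intro h
  have h1 : (minpoly F c).IsRoot (algebraMap A F P) := by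
    rw [minpoly.isIntegrallyClosed_eq_field_fractions' F hc, IsRoot, eval_map, eval₂_at_apply, h,
      map_zero]
  have hcF' : IsIntegral F c := hc.tower_top
  have h2 := degree_eq_one_of_irreducible_of_root (minpoly.irreducible hcF') h1
  exact hcF (minpoly.mem_range_of_degree_eq_one F c h2)

/-- The proper factors of the roots of a monic irreducible polynomial are detected by monic
polynomials without roots. -/
theorem exists_roots_forall_exists_coeff {A : Type u} [CommRing A] [IsDomain A]
    [IsIntegrallyClosed A] {f : A[X]} (hf : f.Monic) (hirr : Irreducible f) :
    ∃ (B : Type u) (_ : CommRing B) (_ : Algebra A B) (_ : Algebra.IsIntegral A B)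
      (_ : FaithfulSMul A B) (s : Multiset B),
      f.map (algebraMap A B) = (s.map fun b => X - C b).prod ∧
      ∀ s' ≤ s, s' ≠ 0 → s' ≠ s → ∃ (i : ℕ) (g : A[X]), g.Monic ∧
        aeval ((s'.map fun b => X - C b).prod.coeff i) g = 0 ∧ ∀ P, g.eval P ≠ 0 := by
  let F := FractionRing A
  let E := AlgebraicClosure F
  let B := integralClosure A E
  have hinj : Function.Injective (algebraMap B E) := Subtype.val_injective
  have hAF : Function.Injective (algebraMap A F) := IsFractionRing.injective A F
  have hAE : Function.Injective (algebraMap A E) := by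
    rw [IsScalarTower.algebraMap_eq A F E]
    exact (algebraMap F E).injective.comp hAF
  have hfE : f.map (algebraMap A E) = (f.map (algebraMap A F)).map (algebraMap F E) := by
    rw [map_map, ← IsScalarTower.algebraMap_eq A F E]
  have hB : FaithfulSMul A B := (faithfulSMul_iff_algebraMap_injective A B).mpr
    (Function.Injective.of_comp (f := algebraMap B E) (by
      rw [← RingHom.coe_comp, ← IsScalarTower.algebraMap_eq A B E]; exact hAE))
  have hroot : ∀ x ∈ (f.map (algebraMap A E)).roots, x ∈ B := fun x hx =>
    ⟨f, hf, by rw [← eval_map]; exact (mem_roots (hf.map _).ne_zero).mp hx⟩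
  obtain ⟨s, hs⟩ : ∃ s : Multiset B, s.map (algebraMap B E) = (f.map (algebraMap A E)).roots := by
    refine ⟨Multiset.pmap (fun x hx => (⟨x, hx⟩ : B)) _ hroot, ?_⟩
    rw [Multiset.map_pmap]
    exact (Multiset.pmap_eq_map _ id _ _).trans (Multiset.map_id _)
  have hprod : ∀ s' : Multiset B, (s'.map fun b => X - C b).prod.map (algebraMap B E) =
      ((s'.map (algebraMap B E)).map fun b => X - C b).prod := by
    intro s'
    rw [Polynomial.map_multiset_prod, Multiset.map_map, Multiset.map_map]
    simp
    rfl
  have hfs : f.map (algebraMap A B) = (s.map fun b => X - C b).prod := by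
    apply map_injective _ hinj
    rw [hprod, hs, map_map, ← IsScalarTower.algebraMap_eq A B E]
    have h1 := IsAlgClosed.splits (f.map (algebraMap A E))
    rw [← h1.eq_prod_roots_of_monic (hf.map _)]
  refine ⟨B, inferInstance, inferInstance, inferInstance, hB, s, hfs, fun s' hs' h0 h1 => ?_⟩
  obtain ⟨s'', hss⟩ := Multiset.le_iff_exists_add.mp hs'
  have h0' : s'' ≠ 0 := by
    rintro rfl
    exact h1 (by rw [hss, add_zero])
  have hdeg : ∀ t : Multiset B, t ≠ 0 →
      ((t.map fun b => X - C b).prod.map (algebraMap B E)).natDegree ≠ 0 := by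
    intro t ht
    rw [hprod, natDegree_multiset_prod_X_sub_C_eq_card, Multiset.card_map]
    simpa using ht
  obtain ⟨i, hi⟩ := exists_coeff_notMem_range (E := E)
    ((hf.irreducible_iff_irreducible_map_fraction_map (K := F)).mp hirr)
    (p := (s'.map fun b => X - C b).prod.map (algebraMap B E))
    (q := (s''.map fun b => X - C b).prod.map (algebraMap B E)) (by
      rw [← Polynomial.map_mul, ← Multiset.prod_add, ← Multiset.map_add, ← hss, ← hfs, map_map,
        ← IsScalarTower.algebraMap_eq A B E, hfE]) (hdeg _ h0) (hdeg _ h0')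
  rw [coeff_map] at hi
  obtain ⟨c, hc⟩ : ∃ c : B, c = (s'.map fun b => X - C b).prod.coeff i := ⟨_, rfl⟩
  rw [← hc] at hi
  have hcI : IsIntegral A (algebraMap B E c) := c.2
  refine ⟨i, minpoly A (algebraMap B E c), minpoly.monic hcI, ?_,
    eval_minpoly_ne_zero_of_notMem_range (F := F) hcI hi⟩
  rw [← hc]
  apply hinj
  rw [map_zero, ← aeval_algebraMap_apply, minpoly.aeval]

end

section

open Polynomial

universe u v

theorem irreducible_map_of_forall_eval_map_ne_zero {A : Type u} {D : Type v} {B : Type*}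
    [CommRing A] [CommRing D] [IsDomain D] [CommRing B] [Algebra A B] [Algebra.IsIntegral A B]
    [FaithfulSMul A B] (φ : A →+* D) {f : A[X]} (hf : f.Monic) (hf1 : f ≠ 1) {s : Multiset B}
    (hs : f.map (algebraMap A B) = (s.map fun b => X - C b).prod)
    (h : ∀ s' ≤ s, s' ≠ 0 → s' ≠ s → ∃ (i : ℕ) (g : A[X]),
      aeval ((s'.map fun b => X - C b).prod.coeff i) g = 0 ∧ ∀ y, (g.map φ).eval y ≠ 0) :
    Irreducible (f.map φ) := by
  let Ω := AlgebraicClosure (FractionRing D)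
  have hDΩ : Function.Injective (algebraMap D Ω) := by
    rw [IsScalarTower.algebraMap_eq D (FractionRing D) Ω]
    exact (algebraMap (FractionRing D) Ω).injective.comp (IsFractionRing.injective D _)
  obtain ⟨φ', hφ'⟩ := exists_ringHom_extend (B := B) ((algebraMap D Ω).comp φ)
  have hcomp : φ'.comp (algebraMap A B) = (algebraMap D Ω).comp φ := RingHom.ext hφ'
  have hprod : ∀ s' : Multiset B, (s'.map fun b => X - C b).prod.map φ' =
      ((s'.map φ').map fun b => X - C b).prod := by
    intro s'
    rw [Polynomial.map_multiset_prod, Multiset.map_map, Multiset.map_map]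
    simp
  have hfm := hf.map φ
  have hfd : (f.map φ).natDegree = f.natDegree := hf.natDegree_map φ
  have hfΩ : (f.map φ).map (algebraMap D Ω) = ((s.map φ').map fun b => X - C b).prod := by
    rw [map_map, ← hcomp, ← map_map, hs, hprod]
  have hf0 : f.map φ ≠ 1 := by
    intro h1
    apply hf1
    apply hf.natDegree_eq_zero.mp
    rw [← hfd, h1, natDegree_one]
  rw [hfm.irreducible_iff_natDegree]
  refine ⟨hf0, fun q r hq hr hqr => ?_⟩
  by_contra! hne
  have hqs : (q.map (algebraMap D Ω)).roots ≤ s.map φ' := by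
    have h1 : (q.map (algebraMap D Ω)).roots ≤ ((f.map φ).map (algebraMap D Ω)).roots := by
      rw [← hqr, Polynomial.map_mul]
      exact roots.le_of_dvd (((hq.map _).mul (hr.map _)).ne_zero) (dvd_mul_right _ _)
    rwa [hfΩ, roots_multiset_prod_X_sub_C] at h1
  obtain ⟨s', hs', hss⟩ := Multiset.exists_le_map_eq hqs
  have hqp : q.map (algebraMap D Ω) = (s'.map fun b => X - C b).prod.map φ' := by
    rw [hprod, hss]
    exact (IsAlgClosed.splits _).eq_prod_roots_of_monic (hq.map _)
  have hcard : s'.card = q.natDegree := by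
    rw [← hq.natDegree_map (algebraMap D Ω), hqp, hprod,
      natDegree_multiset_prod_X_sub_C_eq_card, Multiset.card_map]
  have hcard' : s.card = q.natDegree + r.natDegree := by
    rw [← hq.natDegree_mul hr, hqr, ← hfm.natDegree_map (algebraMap D Ω), hfΩ,
      natDegree_multiset_prod_X_sub_C_eq_card, Multiset.card_map]
  obtain ⟨i, g, hg, hy⟩ := h s' hs' (by rintro rfl; simp at hcard; omega)
    (by rintro rfl; omega)
  apply hy (q.coeff i)
  apply hDΩ
  have hc : algebraMap D Ω (q.coeff i) = φ' ((s'.map fun b => X - C b).prod.coeff i) := by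
    rw [← coeff_map, ← coeff_map, hqp]
  rw [map_zero, eval_map, hom_eval₂, hc, ← hcomp, ← hom_eval₂, ← aeval_def, hg, map_zero]

theorem HilbertSpecialization.exists_irreducible {D : Type u} [CommRing D] [IsDomain D]
    [CharZero D] [IsIntegrallyClosed D] (hD : HilbertSpecialization D) {f : D[X][X]}
    (hf : f.Monic) (hirr : Irreducible f) {r : D[X]} (hr : r ≠ 0) :
    ∃ a : ℕ, Irreducible (f.map (evalRingHom (a : D))) ∧ r.eval (a : D) ≠ 0 := by
  classical
  obtain ⟨B, _, _, _, _, s, hs, h⟩ := exists_roots_forall_exists_coeff hf hirr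
  have h' : ∀ s' : Multiset B, ∃ g : D[X][X], g.Monic ∧ (s' ≤ s → s' ≠ 0 → s' ≠ s →
      (∃ i : ℕ, aeval ((s'.map fun b => X - C b).prod.coeff i) g = 0) ∧ ∀ P, g.eval P ≠ 0) := by
    intro s'
    by_cases hc : s' ≤ s ∧ s' ≠ 0 ∧ s' ≠ s
    · obtain ⟨i, g, hg, h1, h2⟩ := h s' hc.1 hc.2.1 hc.2.2
      exact ⟨g, hg, fun _ _ _ => ⟨⟨i, h1⟩, h2⟩⟩
    · exact ⟨1, monic_one, fun h1 h2 h3 => (hc ⟨h1, h2, h3⟩).elim⟩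
  choose g hgm hg using h'
  obtain ⟨A, hA, hAg⟩ := hD (s.powerset.toFinset.image g) (by
    intro q hq
    obtain ⟨s', -, rfl⟩ := Finset.mem_image.mp hq
    exact hgm s')
  obtain ⟨a, haA, har⟩ := (hA.sdiff (finite_setOf_eval_natCast_eq_zero hr)).nonempty
  refine ⟨a, ?_, har⟩
  refine irreducible_map_of_forall_eval_map_ne_zero (evalRingHom (a : D)) hf
    (fun h1 => hirr.not_isUnit (h1 ▸ isUnit_one)) hs fun s' hs' h0 h1 => ?_
  obtain ⟨⟨i, hi⟩, hP⟩ := hg s' hs' h0 h1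
  refine ⟨i, g s', hi, fun y hy => ?_⟩
  obtain ⟨P, hP0, -⟩ := hAg (g s') (Finset.mem_image_of_mem g (by simpa using hs')) a haA y
    (by rw [← map_evalRingHom_eval]; exact hy)
  exact hP P hP0

end

section

open Polynomial

theorem HasFrobeniusPlace.comap {L L' : Type*} [Field L] [Field L'] {σ : L ≃+* L} {σ' : L' ≃+* L'}
    {B : Subring L} (ψ : B →+* L') (hσ : ∀ x ∈ B, σ x ∈ B)
    (hψ : ∀ x : B, ψ ⟨σ x, hσ x x.2⟩ = σ' (ψ x)) {T : Set L} (hT : T ⊆ B) {p : ℕ}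
    (h : HasFrobeniusPlace σ' (ψ '' {x | (x : L) ∈ T}) p) : HasFrobeniusPlace σ T p := by
  intro Ω _ _ _
  obtain ⟨B', hB', hσ', χ, hχ⟩ := h Ω
  have hmem : ∀ x, x ∈ (B'.comap ψ).map B.subtype ↔ ∃ hx : x ∈ B, ψ ⟨x, hx⟩ ∈ B' := by
    intro x
    constructor
    · rintro ⟨y, hy, rfl⟩
      exact ⟨y.2, hy⟩
    · rintro ⟨hx, h⟩
      exact ⟨⟨x, hx⟩, h, rfl⟩
  refine ⟨(B'.comap ψ).map B.subtype, fun x hx => (hmem x).mpr ⟨hT hx, hB' ⟨⟨x, hT hx⟩, hx, rfl⟩⟩,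
    fun x hx => ?_, ?_⟩
  · obtain ⟨h1, h2⟩ := (hmem x).mp hx
    refine (hmem _).mpr ⟨hσ x h1, ?_⟩
    rw [hψ ⟨x, h1⟩]
    exact hσ' _ h2
  · let χ' : (B'.comap ψ).map B.subtype →+* B' :=
      { toFun := fun x => ⟨ψ ⟨x, ((hmem x).mp x.2).1⟩, ((hmem x).mp x.2).2⟩
        map_zero' := Subtype.ext (map_zero ψ)
        map_one' := Subtype.ext (map_one ψ)
        map_add' := fun x y => Subtype.ext (map_add ψ ⟨x, ((hmem x).mp x.2).1⟩
          ⟨y, ((hmem y).mp y.2).1⟩)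
        map_mul' := fun x y => Subtype.ext (map_mul ψ ⟨x, ((hmem x).mp x.2).1⟩
          ⟨y, ((hmem y).mp y.2).1⟩) }
    refine ⟨χ.comp χ', fun x => ?_⟩
    have h1 := hχ (χ' x)
    rw [RingHom.comp_apply, RingHom.comp_apply, ← h1]
    congr 1
    exact Subtype.ext (hψ ⟨x, ((hmem x).mp x.2).1⟩)

/-- Lifting a place with Frobenius along a specialization. -/
theorem exists_forall_hasFrobeniusPlace_of_specialization {A A₁ L F' L' : Type*} [CommRing A]
    [CommRing A₁] [IsDomain A₁] [Algebra A A₁] [Field L] [Algebra A₁ L] [IsFractionRing A₁ L]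
    [Field F'] [Field L'] [Algebra F' L'] (φ : A →+* F') (π : A₁ →+* L')
    (hπ : ∀ a, π (algebraMap A A₁ a) = algebraMap F' L' (φ a)) {θ : A₁}
    (hθ : Algebra.adjoin A {θ} = ⊤) {f : A[X]} (hf : aeval θ f = 0)
    (hlift : ∀ y : L', aeval y (f.map φ) = 0 → ∃ σ' : L' ≃ₐ[F'] L', σ' (π θ) = y)
    (σ : L ≃+* L) (hσ : ∀ a, σ (algebraMap A₁ L (algebraMap A A₁ a)) =
      algebraMap A₁ L (algebraMap A A₁ a)) {T : Set L} (hT : T.Finite)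
    (hfrac : ∀ x ∈ insert (σ (algebraMap A₁ L θ)) T, ∃ a b, π b ≠ 0 ∧
      x = algebraMap A₁ L a / algebraMap A₁ L b) :
    ∃ (σ' : L' ≃ₐ[F'] L') (T' : Set L'), T'.Finite ∧ ∀ p,
      HasFrobeniusPlace (σ' : L' ≃+* L') T' p → HasFrobeniusPlace σ T p := by
  obtain ⟨B, ψ, hB, hψ⟩ := exists_subring_localization (K := L) π
  have hinj := IsFractionRing.injective A₁ L
  have h0 : ∀ {b}, π b ≠ 0 → algebraMap A₁ L b ≠ 0 := fun {b} hb h =>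
    hb (by rw [hinj (h.trans (map_zero _).symm), map_zero])
  have hψ' : ∀ (a : A₁) (x : B), (x : L) = algebraMap A₁ L a → ψ x = π a := by
    intro a x hx
    obtain ⟨c, b, hb, hcb, h⟩ := hψ x
    rw [h, div_eq_iff hb, ← map_mul]
    congr 1
    apply hinj
    rw [map_mul, ← hx, hcb, div_mul_cancel₀ _ (h0 hb)]
  have hA₁ : ∀ a, algebraMap A₁ L a ∈ B := fun a => by
    simpa using hB a 1 (by simp)
  let j : A₁ →+* B := (algebraMap A₁ L).codRestrict B hA₁
  have hψj : ∀ a, ψ (j a) = π a := fun a => hψ' a _ rfl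
  obtain ⟨a₀, b₀, hb₀, hθ₀⟩ := hfrac _ (Set.mem_insert _ _)
  have hσθ : σ (algebraMap A₁ L θ) ∈ B := by
    rw [hθ₀]; exact hB _ _ hb₀
  obtain ⟨σ', hσ'⟩ := hlift (ψ ⟨_, hσθ⟩) (by
    have h1 : eval₂ (j.comp (algebraMap A A₁)) (⟨_, hσθ⟩ : B) f = 0 := by
      apply B.subtype_injective
      rw [hom_eval₂, map_zero]
      have h2 : B.subtype.comp (j.comp (algebraMap A A₁)) =
          (σ : L →+* L).comp ((algebraMap A₁ L).comp (algebraMap A A₁)) :=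
        RingHom.ext fun a => (hσ a).symm
      have h3 : B.subtype ⟨_, hσθ⟩ = (σ : L →+* L) (algebraMap A₁ L θ) := rfl
      rw [h2, h3, ← hom_eval₂, ← hom_eval₂, ← aeval_def, hf, map_zero, map_zero]
    have h4 := congrArg ψ h1
    rw [hom_eval₂, map_zero] at h4
    rw [aeval_def, eval₂_map, ← h4]
    congr 1
    exact RingHom.ext fun a => ((hψj _).trans (hπ a)).symm)
  have key : ∀ a : A₁, ∃ y : B, y = σ (algebraMap A₁ L a) ∧ ψ y = σ' (π a) := by
    intro a
    have ha : a ∈ Algebra.adjoin A {θ} := hθ ▸ Algebra.mem_top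
    induction ha using Algebra.adjoin_induction with
    | mem x hx =>
      obtain rfl := Set.mem_singleton_iff.mp hx
      exact ⟨⟨_, hσθ⟩, rfl, hσ'.symm⟩
    | algebraMap r =>
      rw [hσ, hπ, AlgEquiv.commutes]
      exact ⟨j _, rfl, by rw [← hπ]; exact hψj _⟩
    | add x y _ _ hx hy =>
      obtain ⟨u, h1, h2⟩ := hx
      obtain ⟨v, h3, h4⟩ := hy
      exact ⟨u + v, by simp [h1, h3], by simp [h2, h4]⟩
    | mul x y _ _ hx hy =>
      obtain ⟨u, h1, h2⟩ := hx
      obtain ⟨v, h3, h4⟩ := hy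
      exact ⟨u * v, by simp [h1, h3], by simp [h2, h4]⟩
  have hinv : ∀ x : B, ψ x ≠ 0 → (x : L)⁻¹ ∈ B := by
    intro x hx
    obtain ⟨a, b, hb, hab, h⟩ := hψ x
    rw [hab, inv_div]
    exact hB _ _ fun ha => hx (by rw [h, ha, zero_div])
  have hstable : ∀ x ∈ B, σ x ∈ B := by
    intro x hx
    obtain ⟨a, b, hb, hab, h⟩ := hψ ⟨x, hx⟩
    obtain ⟨u, hu, ha2⟩ := key a
    obtain ⟨v, hv, hb2⟩ := key b
    change x = _ at hab
    rw [hab, map_div₀, div_eq_mul_inv, ← hu, ← hv]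
    exact B.mul_mem u.2 (hinv v (by rw [hb2]; simpa using hb))
  refine ⟨σ', ψ '' {x | (x : L) ∈ T}, (hT.preimage Subtype.val_injective.injOn).image _, fun p hp =>
    HasFrobeniusPlace.comap (σ' := (σ' : L' ≃+* L')) ψ hstable (fun x => ?_) (fun x hx => ?_) hp⟩
  · obtain ⟨a, b, hb, hab, h⟩ := hψ x
    obtain ⟨u, hu, ha2⟩ := key a
    obtain ⟨v, hv, hb2⟩ := key b
    change _ = σ' (ψ x)
    rw [h, map_div₀, eq_div_iff (by simpa using hb), ← ha2, ← hb2, ← map_mul]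
    congr 1
    apply Subtype.ext
    change σ x * v = u
    rw [hu, hv, ← map_mul, hab, div_mul_cancel₀ _ (h0 hb)]
  · obtain ⟨a, b, hb, rfl⟩ := hfrac x (Set.mem_insert_of_mem _ hx)
    exact hB _ _ hb

end

section

open Polynomial

section FractionField

variable {A F L : Type*} [CommRing A] [IsDomain A] [Field F] [Algebra A F] [IsFractionRing A F]
  [Field L] [Algebra F L] [Algebra A L] [IsScalarTower A F L]

theorem exists_isIntegral_adjoin_eq_top [FiniteDimensional F L] [Algebra.IsSeparable F L] :
    ∃ θ : L, IsIntegral A θ ∧ Algebra.adjoin F {θ} = ⊤ := by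
  obtain ⟨α, hα⟩ := Field.exists_primitive_element F L
  have hinj : Function.Injective (algebraMap A L) := by
    rw [IsScalarTower.algebraMap_eq A F L]
    exact (algebraMap F L).injective.comp (IsFractionRing.injective A F)
  have hα' : IsAlgebraic A α :=
    (IsFractionRing.isAlgebraic_iff A F L).mpr (Algebra.IsAlgebraic.isAlgebraic α)
  obtain ⟨y, hy, hint⟩ := hα'.exists_integral_multiple
  refine ⟨y • α, hint, ?_⟩
  have h1 : Algebra.adjoin F {α} = ⊤ := by
    rw [← IntermediateField.adjoin_simple_toSubalgebra_of_isAlgebraic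
      (Algebra.IsAlgebraic.isAlgebraic α), hα, IntermediateField.top_toSubalgebra]
  rw [eq_top_iff, ← h1, Algebra.adjoin_le_iff, Set.singleton_subset_iff]
  have hy0 : algebraMap A F y ≠ 0 := fun h =>
    hy (IsFractionRing.injective A F (h.trans (map_zero _).symm))
  have h2 : α = (algebraMap A F y)⁻¹ • (y • α) := by
    rw [← algebraMap_smul F y α, smul_smul, inv_mul_cancel₀ hy0, one_smul]
  have h3 := Subalgebra.smul_mem _ (Algebra.self_mem_adjoin_singleton F (y • α))
    (algebraMap A F y)⁻¹
  rwa [← h2] at h3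

theorem exists_mul_algebraMap_mem_adjoin {θ : L} (hθ : Algebra.adjoin F {θ} = ⊤) (x : L) :
    ∃ d : A, d ≠ 0 ∧ x * algebraMap A L d ∈ Algebra.adjoin A {θ} := by
  have hx : x ∈ Algebra.adjoin F {θ} := hθ ▸ Algebra.mem_top
  induction hx using Algebra.adjoin_induction with
  | mem x hx =>
    refine ⟨1, one_ne_zero, ?_⟩
    rw [map_one, mul_one]
    exact Algebra.subset_adjoin hx
  | algebraMap r =>
    obtain ⟨a, b, hb, rfl⟩ := IsFractionRing.div_surjective (A := A) r
    have hb0 := IsFractionRing.to_map_ne_zero_of_mem_nonZeroDivisors (K := F) hb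
    refine ⟨b, nonZeroDivisors.ne_zero hb, ?_⟩
    rw [IsScalarTower.algebraMap_apply A F L, ← map_mul, div_mul_cancel₀ _ hb0,
      ← IsScalarTower.algebraMap_apply A F L]
    exact Subalgebra.algebraMap_mem _ _
  | add x y _ _ hx hy =>
    obtain ⟨d, hd, h1⟩ := hx
    obtain ⟨e, he, h2⟩ := hy
    refine ⟨d * e, mul_ne_zero hd he, ?_⟩
    have h3 : (x + y) * algebraMap A L (d * e) = (x * algebraMap A L d) * algebraMap A L e +
        (y * algebraMap A L e) * algebraMap A L d := by rw [map_mul]; ring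
    rw [h3]
    exact add_mem (mul_mem h1 (Subalgebra.algebraMap_mem _ _))
      (mul_mem h2 (Subalgebra.algebraMap_mem _ _))
  | mul x y _ _ hx hy =>
    obtain ⟨d, hd, h1⟩ := hx
    obtain ⟨e, he, h2⟩ := hy
    refine ⟨d * e, mul_ne_zero hd he, ?_⟩
    have h3 : x * y * algebraMap A L (d * e) = (x * algebraMap A L d) * (y * algebraMap A L e) := by
      rw [map_mul]; ring
    rw [h3]
    exact mul_mem h1 h2

theorem exists_forall_mul_algebraMap_mem_adjoin {θ : L} (hθ : Algebra.adjoin F {θ} = ⊤)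
    {T : Set L} (hT : T.Finite) :
    ∃ d : A, d ≠ 0 ∧ ∀ x ∈ T, x * algebraMap A L d ∈ Algebra.adjoin A {θ} := by
  induction T, hT using Set.Finite.induction_on with
  | empty => exact ⟨1, one_ne_zero, by simp⟩
  | @insert y T _ _ ih =>
    obtain ⟨d, hd, h1⟩ := ih
    obtain ⟨e, he, h2⟩ := exists_mul_algebraMap_mem_adjoin (A := A) hθ y
    refine ⟨d * e, mul_ne_zero hd he, fun x hx => ?_⟩
    rcases Set.mem_insert_iff.mp hx with rfl | hx
    · rw [mul_comm d e, map_mul, ← mul_assoc]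
      exact mul_mem h2 (Subalgebra.algebraMap_mem _ _)
    · rw [map_mul, ← mul_assoc]
      exact mul_mem (h1 x hx) (Subalgebra.algebraMap_mem _ _)

theorem isFractionRing_adjoin_singleton {θ : L} (hθ : Algebra.adjoin F {θ} = ⊤) :
    IsFractionRing (Algebra.adjoin A {θ}) L := by
  have hinj : Function.Injective (algebraMap A L) := by
    rw [IsScalarTower.algebraMap_eq A F L]
    exact (algebraMap F L).injective.comp (IsFractionRing.injective A F)
  have : FaithfulSMul (Algebra.adjoin A {θ}) L :=
    (faithfulSMul_iff_algebraMap_injective _ _).mpr Subtype.val_injective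
  refine IsFractionRing.of_field _ _ fun z => ?_
  obtain ⟨d, hd, h⟩ := exists_mul_algebraMap_mem_adjoin (A := A) hθ z
  refine ⟨⟨_, h⟩, algebraMap A _ d, ?_⟩
  have hd0 : algebraMap A L d ≠ 0 := fun h => hd (hinj (h.trans (map_zero _).symm))
  exact (mul_div_cancel_right₀ z hd0).symm

end FractionField

end

section

open Polynomial

/-- Every automorphism of a finite extension of the fraction field of `D` is, for infinitely many
primes, induced by the Frobenius endomorphism at some place. -/
def FrobeniusDense (D : Type) [CommRing D] : Prop :=
  ∀ (F L : Type) [Field F] [Algebra D F] [IsFractionRing D F] [Field L] [Algebra F L]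
    [FiniteDimensional F L] (σ : L ≃ₐ[F] L) (T : Set L), T.Finite →
    {p : ℕ | p.Prime ∧ HasFrobeniusPlace (σ : L ≃+* L) T p}.Infinite

theorem frobeniusDense_int : FrobeniusDense ℤ := by
  intro F L _ _ _ _ _ _ σ T hT
  have : CharZero F := charZero_of_injective_algebraMap (IsFractionRing.injective ℤ F)
  have : CharZero L := charZero_of_injective_algebraMap (algebraMap F L).injective
  have : FiniteDimensional ℚ F := by
    refine Module.Finite.of_surjective (algebraMap ℚ F).toRatAlgHom.toLinearMap fun x => ?_
    obtain ⟨a, b, hb, rfl⟩ := IsFractionRing.div_surjective (A := ℤ) x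
    exact ⟨a / b, by simp⟩
  have : NumberField L := by
    have := Module.Finite.trans (R := ℚ) F L
    exact { to_charZero := inferInstance, to_finiteDimensional := this }
  exact infinite_hasFrobeniusPlace (σ : L ≃+* L) hT

theorem AdjoinRoot.exists_algEquiv_root_eq {F : Type*} [Field F] {f : F[X]} [Fact (Irreducible f)]
    {y : AdjoinRoot f} (hy : aeval y f = 0) :
    ∃ σ : AdjoinRoot f ≃ₐ[F] AdjoinRoot f, σ (AdjoinRoot.root f) = y := by
  have : FiniteDimensional F (AdjoinRoot f) :=
    (AdjoinRoot.powerBasis (Fact.out : Irreducible f).ne_zero).finite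
  let σ : AdjoinRoot f →ₐ[F] AdjoinRoot f := AdjoinRoot.liftAlgHom f (Algebra.ofId F _) y hy
  exact ⟨AlgEquiv.ofBijective σ (Algebra.IsAlgebraic.algHom_bijective σ),
    AdjoinRoot.liftAlgHom_root f (Algebra.ofId F _) y hy⟩

theorem FrobeniusDense.polynomial {D : Type} [CommRing D] [IsDomain D] [CharZero D]
    [IsIntegrallyClosed D] (hD : HilbertSpecialization D) (hX : FrobeniusDense D) :
    FrobeniusDense D[X] := by
  intro F L _ _ _ _ _ _ σ T hT
  have : CharZero F := charZero_of_injective_algebraMap (IsFractionRing.injective D[X] F)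
  let _ : Algebra D[X] L := ((algebraMap F L).comp (algebraMap D[X] F)).toAlgebra
  have : IsScalarTower D[X] F L := IsScalarTower.of_algebraMap_eq fun _ => rfl
  have : FaithfulSMul D[X] L := (faithfulSMul_iff_algebraMap_injective _ _).mpr
    ((algebraMap F L).injective.comp (IsFractionRing.injective D[X] F))
  obtain ⟨θ, hθ, hθF⟩ := exists_isIntegral_adjoin_eq_top (A := D[X]) (F := F) (L := L)
  have := isFractionRing_adjoin_singleton (A := D[X]) hθF
  obtain ⟨d, hd, hdT⟩ := exists_forall_mul_algebraMap_mem_adjoin (A := D[X]) hθF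
    (hT.insert (σ θ))
  obtain ⟨a, hirr, hda⟩ := hD.exists_irreducible (minpoly.monic hθ) (minpoly.irreducible hθ) hd
  let F' := FractionRing D
  let φ : D[X] →+* F' := (algebraMap D F').comp (evalRingHom (a : D))
  have hirr' : Irreducible ((minpoly D[X] θ).map φ) := by
    rw [← Polynomial.map_map]
    exact (((minpoly.monic hθ).map _).irreducible_iff_irreducible_map_fraction_map).mp hirr
  have : Fact (Irreducible ((minpoly D[X] θ).map φ)) := ⟨hirr'⟩
  let L' := AdjoinRoot ((minpoly D[X] θ).map φ)
  have : FiniteDimensional F' L' := (AdjoinRoot.powerBasis hirr'.ne_zero).finite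
  let π₀ : AdjoinRoot (minpoly D[X] θ) →+* L' :=
    AdjoinRoot.lift ((algebraMap F' L').comp φ) (AdjoinRoot.root _) (by
      rw [← eval₂_map]; exact AdjoinRoot.eval₂_root _)
  let e := minpoly.equivAdjoin hθ
  let π : Algebra.adjoin D[X] {θ} →+* L' := π₀.comp (e.symm : _ →+* _)
  have hπ : ∀ b, π (algebraMap _ _ b) = algebraMap F' L' (φ b) := by
    intro b
    change π₀ (e.symm (algebraMap _ _ b)) = _
    rw [AlgEquiv.commutes]
    exact AdjoinRoot.lift_of _
  let θ₁ : Algebra.adjoin D[X] {θ} := ⟨θ, Algebra.self_mem_adjoin_singleton _ _⟩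
  have hθ₁ : Algebra.adjoin D[X] {θ₁} = ⊤ := by
    rw [← Algebra.adjoin_adjoin_coe_preimage (R := D[X]) (s := {θ})]
    congr 1
    ext x
    exact Subtype.ext_iff
  have hπθ : π θ₁ = AdjoinRoot.root _ := by
    have h1 : e.symm θ₁ = AdjoinRoot.root _ := by
      rw [AlgEquiv.symm_apply_eq]
      simp only [e, minpoly.coe_equivAdjoin, AdjoinRoot.Minpoly.toAdjoin]
      exact (AdjoinRoot.liftAlgHom_root _ _ _ _).symm
    change π₀ (e.symm θ₁) = _
    rw [h1]
    exact AdjoinRoot.lift_root _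
  obtain ⟨σ', T', hT', h⟩ := exists_forall_hasFrobeniusPlace_of_specialization φ π hπ (θ := θ₁)
    hθ₁ (f := minpoly D[X] θ) (by
      apply Subtype.val_injective
      exact (aeval_algebraMap_apply L θ₁ _).symm.trans (minpoly.aeval _ _)) (fun y hy => by rw [hπθ]; exact AdjoinRoot.exists_algEquiv_root_eq hy) (σ : L ≃+* L)
    (fun b => σ.commutes (algebraMap D[X] F b)) hT (fun x hx => by
      refine ⟨⟨_, hdT x hx⟩, algebraMap _ _ d, ?_, ?_⟩
      · rw [hπ, _root_.map_ne_zero]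
        exact fun h => hda (IsFractionRing.injective D F' (h.trans (map_zero _).symm))
      · refine (mul_div_cancel_right₀ x ?_).symm
        exact fun h => hd (FaithfulSMul.algebraMap_injective D[X] L (h.trans (map_zero _).symm)))
  exact (hX F' L' σ' T' hT').mono fun p hp => ⟨hp.1, h p hp.2⟩

end

section

open Polynomial

theorem exists_frobeniusDense_ringEquiv_mvPolynomial (r : ℕ) :
    ∃ (D : Type) (_ : CommRing D), IsDomain D ∧ CharZero D ∧ IsIntegrallyClosed D ∧
      HilbertSpecialization D ∧ FrobeniusDense D ∧ Nonempty (D ≃+* MvPolynomial (Fin r) ℤ) := by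
  induction r with
  | zero =>
    exact ⟨ℤ, inferInstance, inferInstance, inferInstance, inferInstance, hilbertSpecialization_int,
      frobeniusDense_int, ⟨(MvPolynomial.isEmptyRingEquiv ℤ (Fin 0)).symm⟩⟩
  | succ r ih =>
    obtain ⟨D, _, _, _, _, hH, hX, ⟨e⟩⟩ := ih
    refine ⟨D[X], inferInstance, inferInstance, inferInstance, inferInstance, hH.polynomial,
      hX.polynomial hH, ⟨(Polynomial.mapEquiv e).trans ?_⟩⟩
    exact (MvPolynomial.finSuccEquiv ℤ r).symm.toRingEquiv

theorem isFractionRing_of_subfieldClosure_range_eq_top {D F : Type*} [CommRing D] [Field F]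
    [Algebra D F] [FaithfulSMul D F]
    (h : Subfield.closure (Set.range (algebraMap D F)) = ⊤) : IsFractionRing D F := by
  refine IsFractionRing.of_field _ _ fun z => ?_
  obtain ⟨x, hx, y, hy, hxy⟩ := Subfield.mem_closure_iff.mp (h ▸ Subfield.mem_top z)
  rw [← RingHom.coe_range, Subring.closure_eq] at hx hy
  obtain ⟨a, rfl⟩ := hx
  obtain ⟨b, rfl⟩ := hy
  exact ⟨a, b, hxy.symm⟩

theorem infinite_hasFrobeniusPlace_of_fg {K L : Type} [Field K] [Field L] [Algebra K L]
    [CharZero K] {s : Set K} (hs : s.Finite) (htop : Subfield.closure s = ⊤)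
    [FiniteDimensional K L] (σ : L ≃ₐ[K] L) {T : Set L} (hT : T.Finite) :
    {p : ℕ | p.Prime ∧ HasFrobeniusPlace (σ : L ≃+* L) T p}.Infinite := by
  obtain ⟨t, ht, hind, hfin⟩ := exists_finite_algebraicIndependent_finiteDimensional (k := ℚ) hs
    (intermediateField_adjoin_eq_top_of_closure_eq_top htop)
  have := ht.fintype
  obtain ⟨D, _, _, _, _, -, hX, ⟨e⟩⟩ := exists_frobeniusDense_ringEquiv_mvPolynomial (Fintype.card t)
  let F := IntermediateField.adjoin ℚ t
  let y : t → F := fun i => ⟨i, IntermediateField.subset_adjoin ℚ t i.2⟩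
  let e' : D ≃+* MvPolynomial t ℤ :=
    e.trans (MvPolynomial.renameEquiv ℤ (Fintype.equivFin t).symm).toRingEquiv
  let f : D →+* F := ((MvPolynomial.aeval y : MvPolynomial t ℤ →ₐ[ℤ] F) : _ →+* F).comp
    (e' : D →+* MvPolynomial t ℤ)
  have hy : Function.Injective (MvPolynomial.aeval y : MvPolynomial t ℤ →ₐ[ℤ] F) := by
    have h1 : AlgebraicIndependent ℤ ((↑) : t → K) :=
      hind.restrictScalars (RingHom.injective_int (algebraMap ℤ ℚ))
    exact AlgebraicIndependent.of_comp (x := y) (algebraMap F K).toIntAlgHom h1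
  let _ : Algebra D F := f.toAlgebra
  have : FaithfulSMul D F := (faithfulSMul_iff_algebraMap_injective _ _).mpr
    (hy.comp e'.injective)
  have : IsFractionRing D F := by
    apply isFractionRing_of_subfieldClosure_range_eq_top
    rw [eq_top_iff, ← subfield_closure_eq_top_of_adjoin_rat_eq_top
      (intermediateField_adjoin_range_eq_top (k := ℚ) t)]
    apply Subfield.closure_mono
    rintro _ ⟨i, rfl⟩
    refine ⟨e'.symm (MvPolynomial.X i), ?_⟩
    change MvPolynomial.aeval y (e' _) = _
    rw [RingEquiv.apply_symm_apply, MvPolynomial.aeval_X]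
  have : FiniteDimensional F L := FiniteDimensional.trans F K L
  exact hX F L (σ.restrictScalars F) T hT

theorem Padic.denseRange_of_charZero {K : Type*} [Field K] [CharZero K] {p : ℕ} [Fact p.Prime]
    (ι : K →+* ℚ_[p]) : DenseRange ι := by
  refine (Padic.denseRange_ratCast p).mono ?_
  rintro _ ⟨q, rfl⟩
  exact ⟨q, map_ratCast ι q⟩

end

/-- **A generalization of Chebotarev's Density Theorem** (Prasad–Rapinchuk, Proposition 1).
Let `K` be a finitely generated field of characteristic zero, `R ⊆ K` a finitely generated
subring, `L/K` a finite Galois extension and `𝒞` a conjugacy class of `Gal(L/K)`. Then there is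
an infinite set `Π` of primes such that for each `p ∈ Π` there is an embedding `ι : K → ℚ_p`
with `ι(R) ⊆ ℤ_p`, `ι(K)` dense in `ℚ_p` (so that `K_v = ℚ_p` for the pulled-back valuation `v`),
and such that every extension `w` of `v` to `L` is unramified with Frobenius in `𝒞`. -/
theorem chebotarev_finitely_generated_charZero
    {K L : Type} [Field K] [Field L] [Algebra K L] [CharZero K]
    (hKfg : ∃ s : Finset K, Subfield.closure (s : Set K) = ⊤)
    (R : Subring K) (hRfg : ∃ s : Finset K, Subring.closure (s : Set K) = R)
    [FiniteDimensional K L] [IsGalois K L]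
    (𝒞 : ConjClasses (L ≃ₐ[K] L)) :
    ∃ S : Set ℕ, S.Infinite ∧ (∀ p ∈ S, p.Prime) ∧
      ∀ (p : ℕ), p ∈ S → ∀ [Fact p.Prime],
        ∃ ι : K →+* ℚ_[p],
          (∀ x ∈ R, ι x ∈ padicValuationSubring p) ∧
          DenseRange ι ∧
          ∀ (w : ValuationSubring L)
            (hw : w.comap (algebraMap K L) = (padicValuationSubring p).comap ι),
            ValuationSubring.IsUnramifiedExtension ((padicValuationSubring p).comap ι) w hw ∧
            ∃ σ ∈ 𝒞.carrier,
              ValuationSubring.IsFrobeniusAt ((padicValuationSubring p).comap ι) w σ := by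
  obtain ⟨s, hs⟩ := hKfg
  obtain ⟨S, rfl⟩ := hRfg
  obtain ⟨σ, rfl⟩ := ConjClasses.exists_rep 𝒞
  obtain ⟨T, hT, h⟩ := exists_padic_embedding_isFrobeniusAt_of_hasFrobeniusPlace s.finite_toSet hs
    S.finite_toSet σ
  refine ⟨_, infinite_hasFrobeniusPlace_of_fg s.finite_toSet hs σ hT, fun p hp => hp.1,
    fun p hp _ => ?_⟩
  obtain ⟨ι, hι, hw⟩ := h p hp.2
  refine ⟨ι, fun x hx => ?_, Padic.denseRange_of_charZero ι, hw⟩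
  have hle : Subring.closure (S : Set K) ≤ (padicPullback ι).toSubring :=
    Subring.closure_le.mpr hι
  exact hle hx
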